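/- Let m ≥ 1, n ≥ 1, D ≥ 1 be integers and set k♯ := 2^(D·binom(n+m−1, n)). There exists a constant C♯ depending only on m, n, D such that the following holds. Let E ⊆ ℝ^n be an arbitrary set, and for each x ∈ E let K(x) ⊆ ℝ^D be a closed convex set. Suppose that for every subset S ⊆ E with |S| ≤ k♯ there exists F^S ∈ C^{m−1,1}(ℝ^n,ℝ^D) with ‖F^S‖_{C^{m−1,1}(ℝ^n,ℝ^D)} ≤ 1 and F^S(x) ∈ K(x) for all x ∈ S. Then there exists F ∈ C^{m−1,1}(ℝ^n,ℝ^D) with ‖F‖_{C^{m−1,1}(ℝ^n,ℝ^D)} ≤ C♯ and F(x) ∈ K(x) for all x ∈ E. -/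

import Mathlib

open scoped BigOperators Classical

noncomputable section

/-- `En n` is Euclidean space `ℝ^n`. -/
abbrev En (n : ℕ) : Type := EuclideanSpace ℝ (Fin n)

/-- First-order partial derivative `∂_i f` in the `i`-th coordinate direction. -/
noncomputable def pd1 {n : ℕ} (i : Fin n) (f : En n → ℝ) : En n → ℝ :=
  fun x => fderiv ℝ f x (EuclideanSpace.single i 1)

/-- Higher-order partial derivative `∂^α f` for a multi-index `α`. -/
noncomputable def pdalpha {n : ℕ} (α : Fin n → ℕ) (f : En n → ℝ) : En n → ℝ :=
  (List.finRange n).foldr (fun i g => (pd1 i)^[α i] g) f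

/-- First-order partial derivative within a set `s`. -/
noncomputable def pd1W {n : ℕ} (s : Set (En n)) (i : Fin n) (f : En n → ℝ) : En n → ℝ :=
  fun x => fderivWithin ℝ f s x (EuclideanSpace.single i 1)

/-- Higher-order partial derivative `∂^α f` within a set `s`. -/
noncomputable def pdalphaW {n : ℕ} (s : Set (En n)) (α : Fin n → ℕ) (f : En n → ℝ) : En n → ℝ :=
  (List.finRange n).foldr (fun i g => (pd1W s i)^[α i] g) f

/-- `∂^α` of a multivariate polynomial (formal derivative). -/
noncomputable def polyPD {n : ℕ} (α : Fin n → ℕ) (p : MvPolynomial (Fin n) ℝ) :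
    MvPolynomial (Fin n) ℝ :=
  (List.finRange n).foldr (fun i q => (fun r => MvPolynomial.pderiv i r)^[α i] q) p

/-- The value `∂^α p (x)` of the `α`-th derivative of a polynomial at `x`. -/
noncomputable def polyPDval {n : ℕ} (α : Fin n → ℕ) (p : MvPolynomial (Fin n) ℝ) (x : En n) : ℝ :=
  MvPolynomial.eval (fun i => x i) (polyPD α p)

/-- The `(m-1)`-jet (Taylor polynomial of degree `≤ m-1`) of `f` at `x`. -/
noncomputable def jetScalar (m : ℕ) {n : ℕ} (f : En n → ℝ) (x : En n) :
    MvPolynomial (Fin n) ℝ :=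
  ∑ α ∈ (Finset.univ : Finset (Fin n → Fin m)).filter (fun α => (∑ i, (α i : ℕ)) ≤ m - 1),
    MvPolynomial.C (pdalpha (fun i => (α i : ℕ)) f x / ((∏ i, Nat.factorial (α i : ℕ) : ℕ) : ℝ))
      * ∏ i, (MvPolynomial.X i - MvPolynomial.C (x i)) ^ ((α i : ℕ))

/-- The `(m-1)`-jet of `f` at `x`, with derivatives taken within a set `s`. -/
noncomputable def jetScalarW (m : ℕ) {n : ℕ} (s : Set (En n)) (f : En n → ℝ) (x : En n) :
    MvPolynomial (Fin n) ℝ :=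
  ∑ α ∈ (Finset.univ : Finset (Fin n → Fin m)).filter (fun α => (∑ i, (α i : ℕ)) ≤ m - 1),
    MvPolynomial.C (pdalphaW s (fun i => (α i : ℕ)) f x / ((∏ i, Nat.factorial (α i : ℕ) : ℕ) : ℝ))
      * ∏ i, (MvPolynomial.X i - MvPolynomial.C (x i)) ^ ((α i : ℕ))

/-- The vector-valued `(m-1)`-jet `J_x F ∈ 𝒫⃗` of `F : ℝ^n → ℝ^D` at `x`. -/
noncomputable def jetD (m : ℕ) {n D : ℕ} (F : En n → Fin D → ℝ) (x : En n) :
    Fin D → MvPolynomial (Fin n) ℝ :=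
  fun j => jetScalar m (fun y => F y j) x

/-- The vector-valued `(m-1)`-jet of `F` at `x`, derivatives within `s`. -/
noncomputable def jetDW (m : ℕ) {n D : ℕ} (s : Set (En n)) (F : En n → Fin D → ℝ) (x : En n) :
    Fin D → MvPolynomial (Fin n) ℝ :=
  fun j => jetScalarW m s (fun y => F y j) x

/-- Truncation of a polynomial to total degree `≤ k`. -/
noncomputable def truncDeg {n : ℕ} (k : ℕ) (p : MvPolynomial (Fin n) ℝ) :
    MvPolynomial (Fin n) ℝ :=
  ∑ s ∈ p.support.filter (fun s => (s.sum fun _ e => e) ≤ k),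
    MvPolynomial.monomial s (MvPolynomial.coeff s p)

/-- The degree-`k` Taylor truncation of a polynomial at `x` (the jet `J_x p` of order `k`). -/
noncomputable def taylorTrunc {n : ℕ} (k : ℕ) (x : En n) (p : MvPolynomial (Fin n) ℝ) :
    MvPolynomial (Fin n) ℝ :=
  MvPolynomial.bind₁ (fun i => MvPolynomial.X i - MvPolynomial.C (x i))
    (truncDeg k (MvPolynomial.bind₁ (fun i => MvPolynomial.X i + MvPolynomial.C (x i)) p))

/-- The ring multiplication `p ⊙_x q := J_x(pq)` on degree-`k` jets at `x`. -/
noncomputable def odot {n : ℕ} (k : ℕ) (x : En n) (p q : MvPolynomial (Fin n) ℝ) :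
    MvPolynomial (Fin n) ℝ :=
  taylorTrunc k x (p * q)

/-- `(Γ x M)_{x ∈ E, M > 0}` is a shape field with jets of degree `≤ k` and `d` components:
each `Γ x M` is a convex set of `d`-tuples of polynomials of degree `≤ k`, monotone in `M`. -/
def IsShapeField {N : ℕ} (k d : ℕ) (E : Finset (En N))
    (Γ : En N → ℝ → Set (Fin d → MvPolynomial (Fin N) ℝ)) : Prop :=
  (∀ x ∈ E, ∀ M : ℝ, 0 < M → Convex ℝ (Γ x M)) ∧
  (∀ x ∈ E, ∀ M : ℝ, 0 < M → ∀ P ∈ Γ x M, ∀ j, (P j).totalDegree ≤ k) ∧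
  (∀ x ∈ E, ∀ M' M : ℝ, 0 < M' → M' ≤ M → Γ x M' ⊆ Γ x M)

/-- `(C_w, δmax)`-convexity of a shape field with jets of degree `≤ k`. -/
def SFConvex {N : ℕ} (k d : ℕ) (E : Finset (En N))
    (Γ : En N → ℝ → Set (Fin d → MvPolynomial (Fin N) ℝ)) (Cw δmax : ℝ) : Prop :=
  ∀ δ : ℝ, 0 < δ → δ ≤ δmax → ∀ x ∈ E, ∀ M : ℝ, 0 < M →
    ∀ P₁ P₂ : Fin d → MvPolynomial (Fin N) ℝ, P₁ ∈ Γ x M → P₂ ∈ Γ x M →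
    ∀ Q₁ Q₂ : MvPolynomial (Fin N) ℝ, Q₁.totalDegree ≤ k → Q₂.totalDegree ≤ k →
    (∀ α : Fin N → ℕ, (∑ i, α i) ≤ k → ∀ j,
      |polyPDval α (P₁ j - P₂ j) x| ≤ M * δ ^ (k + 1 - ∑ i, α i)) →
    (∀ α : Fin N → ℕ, (∑ i, α i) ≤ k →
      |polyPDval α Q₁ x| ≤ δ ^ (-((∑ i, α i : ℕ) : ℤ)) ∧
      |polyPDval α Q₂ x| ≤ δ ^ (-((∑ i, α i : ℕ) : ℤ))) →
    odot k x Q₁ Q₁ + odot k x Q₂ Q₂ = 1 →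
    (fun j => odot k x (odot k x Q₁ Q₁) (P₁ j) + odot k x (odot k x Q₂ Q₂) (P₂ j))
      ∈ Γ x (Cw * M)

/-- `‖(P^x)_{x ∈ S}‖_{Ẇ^m(S)} ≤ M` : the homogeneous Whitney seminorm bound. -/
def WSemiLE (m : ℕ) {N d : ℕ} (S : Finset (En N))
    (P : En N → Fin d → MvPolynomial (Fin N) ℝ) (M : ℝ) : Prop :=
  ∀ x ∈ S, ∀ y ∈ S, x ≠ y → ∀ α : Fin N → ℕ, (∑ i, α i) ≤ m - 1 → ∀ j,
    |polyPDval α (P x j - P y j) x| ≤ M * dist x y ^ (m - ∑ i, α i)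

/-- The homogeneous Whitney seminorm `‖(P^x)_{x ∈ S}‖_{Ẇ^m(S)}`. -/
noncomputable def WNormHomog (m : ℕ) {N d : ℕ} (S : Finset (En N))
    (P : En N → Fin d → MvPolynomial (Fin N) ℝ) : ℝ :=
  sSup {r : ℝ | ∃ x ∈ S, ∃ y ∈ S, x ≠ y ∧ ∃ α : Fin N → ℕ, (∑ i, α i) ≤ m - 1 ∧ ∃ j : Fin d,
    r = |polyPDval α (P x j - P y j) x| / dist x y ^ (m - ∑ i, α i)}

/-- The lower-order part of the Whitney norm. -/
noncomputable def WNormLow (m : ℕ) {N d : ℕ} (S : Finset (En N))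
    (P : En N → Fin d → MvPolynomial (Fin N) ℝ) : ℝ :=
  sSup {r : ℝ | ∃ x ∈ S, ∃ α : Fin N → ℕ, (∑ i, α i) ≤ m - 1 ∧ ∃ j : Fin d,
    r = |polyPDval α (P x j) x|}

/-- The Whitney norm `‖(P^x)_{x ∈ S}‖_{W^m(S)}`. -/
noncomputable def WNormFull (m : ℕ) {N d : ℕ} (S : Finset (En N))
    (P : En N → Fin d → MvPolynomial (Fin N) ℝ) : ℝ :=
  WNormLow m S P + WNormHomog m S P

/-- `‖F‖_{C^m} ≤ M`: all partials of order `≤ m` of all components bounded by `M`. -/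
def CmLE (m : ℕ) {n D : ℕ} (F : En n → Fin D → ℝ) (M : ℝ) : Prop :=
  ∀ α : Fin n → ℕ, (∑ i, α i) ≤ m → ∀ x : En n, ∀ j, |pdalpha α (fun y => F y j) x| ≤ M

/-- `‖F‖_{Ċ^m} ≤ M`: all partials of order `= m` of all components bounded by `M`. -/
def CmHomogLE (m : ℕ) {n D : ℕ} (F : En n → Fin D → ℝ) (M : ℝ) : Prop :=
  ∀ α : Fin n → ℕ, (∑ i, α i) = m → ∀ x : En n, ∀ j, |pdalpha α (fun y => F y j) x| ≤ M

/-- `‖F‖_{C^{m-1,1}} ≤ M`. -/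
def Cm11LE (m : ℕ) {n D : ℕ} (F : En n → Fin D → ℝ) (M : ℝ) : Prop :=
  (∀ α : Fin n → ℕ, (∑ i, α i) ≤ m - 1 → ∀ x : En n, ∀ j,
    |pdalpha α (fun y => F y j) x| ≤ M) ∧
  (∀ α : Fin n → ℕ, (∑ i, α i) = m - 1 → ∀ j, ∀ x y : En n,
    |pdalpha α (fun z => F z j) x - pdalpha α (fun z => F z j) y| ≤ M * dist x y)

/-- A closed cube in `ℝ^n` with lower corner `a` and side length `δ`. -/
def cube {n : ℕ} (a : En n) (δ : ℝ) : Set (En n) := {y | ∀ i, a i ≤ y i ∧ y i ≤ a i + δ}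

/-- The embedding `ℝ^n → ℝ^{n+D}`, `x ↦ (x, 0)`. -/
noncomputable def embed (n D : ℕ) (x : En n) : En (n + D) :=
  (EuclideanSpace.equiv (Fin (n + D)) ℝ).symm
    (Fin.append (fun i : Fin n => x i) (fun _ : Fin D => (0 : ℝ)))

/-- The projection `ℝ^{n+D} → ℝ^n`, `(x, ξ) ↦ x`. -/
noncomputable def projn (n D : ℕ) (z : En (n + D)) : En n :=
  (EuclideanSpace.equiv (Fin n) ℝ).symm (fun i => z (Fin.castAdd D i))

/-- Restriction of a polynomial on `ℝ^{n+D}` to `ℝ^n × {0}`, as a polynomial on `ℝ^n`. -/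
noncomputable def restrict0 (n D : ℕ) (p : MvPolynomial (Fin (n + D)) ℝ) :
    MvPolynomial (Fin n) ℝ :=
  MvPolynomial.aeval
    (Fin.append (fun i : Fin n => (MvPolynomial.X i : MvPolynomial (Fin n) ℝ))
      (fun _ : Fin D => 0)) p

set_option linter.unusedSimpArgs false

section
namespace FP
open MvPolynomial

abbrev Poly (n : ℕ) := MvPolynomial (Fin n) ℝ

variable {n : ℕ}

/-- weighted l1 norm -/
def Nw (δ : ℝ) (q : Poly n) : ℝ := ∑ β ∈ q.support, |coeff β q| * δ ^ β.degree

lemma Nw_eq_sum (δ : ℝ) (q : Poly n) (s : Finset (Fin n →₀ ℕ)) (h : q.support ⊆ s) :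
    Nw δ q = ∑ β ∈ s, |coeff β q| * δ ^ β.degree := by
  unfold Nw
  apply Finset.sum_subset h
  intro β _ hβ
  rw [notMem_support_iff.mp hβ]; simp

lemma Nw_nonneg {δ : ℝ} (hδ : 0 ≤ δ) (q : Poly n) : 0 ≤ Nw δ q :=
  Finset.sum_nonneg fun β _ => by positivity

@[simp] lemma Nw_zero (δ : ℝ) : Nw δ (0 : Poly n) = 0 := by simp [Nw]

lemma Nw_add_le {δ : ℝ} (hδ : 0 ≤ δ) (p q : Poly n) : Nw δ (p + q) ≤ Nw δ p + Nw δ q := by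
  rw [Nw_eq_sum δ p (p.support ∪ q.support) Finset.subset_union_left,
    Nw_eq_sum δ q (p.support ∪ q.support) Finset.subset_union_right,
    Nw_eq_sum δ (p + q) (p.support ∪ q.support) support_add, ← Finset.sum_add_distrib]
  apply Finset.sum_le_sum
  intro β _
  rw [coeff_add, ← add_mul]
  gcongr
  exact abs_add_le _ _

lemma Nw_smul (δ c : ℝ) (q : Poly n) : Nw δ (c • q) = |c| * Nw δ q := by
  rw [Nw_eq_sum δ (c • q) q.support (support_smul), Nw, Finset.mul_sum]
  refine Finset.sum_congr rfl fun β _ => ?_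
  rw [coeff_smul, smul_eq_mul, abs_mul, mul_assoc]

@[simp] lemma Nw_neg (δ : ℝ) (q : Poly n) : Nw δ (-q) = Nw δ q := by
  have := Nw_smul δ (-1) q
  simpa using this

lemma Nw_C_mul (δ c : ℝ) (q : Poly n) : Nw δ (C c * q) = |c| * Nw δ q := by
  rw [← smul_eq_C_mul, Nw_smul]

lemma Nw_sub_le {δ : ℝ} (hδ : 0 ≤ δ) (p q : Poly n) : Nw δ (p - q) ≤ Nw δ p + Nw δ q := by
  rw [sub_eq_add_neg, ← Nw_neg δ q]; exact Nw_add_le hδ _ _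

lemma Nw_sum_le {δ : ℝ} (hδ : 0 ≤ δ) {ι : Type*} (s : Finset ι) (f : ι → Poly n) :
    Nw δ (∑ i ∈ s, f i) ≤ ∑ i ∈ s, Nw δ (f i) := by
  induction s using Finset.induction_on with
  | empty => simp
  | insert a s ha ih =>
    rw [Finset.sum_insert ha, Finset.sum_insert ha]
    exact (Nw_add_le hδ _ _).trans (by gcongr)

lemma Nw_monomial (δ : ℝ) (β : Fin n →₀ ℕ) (c : ℝ) :
    Nw δ (monomial β c) = |c| * δ ^ β.degree := by
  rw [Nw_eq_sum δ _ {β} support_monomial_subset]; simp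

lemma Nw_C (δ c : ℝ) : Nw δ (C c : Poly n) = |c| := by
  have := Nw_monomial δ (0 : Fin n →₀ ℕ) c
  simpa using this

@[simp] lemma Nw_one (δ : ℝ) : Nw δ (1 : Poly n) = 1 := by
  have := Nw_C (n := n) δ 1
  simpa using this

lemma Nw_X (δ : ℝ) (i : Fin n) : Nw δ (X i : Poly n) = δ := by
  have := Nw_monomial δ (Finsupp.single i 1) 1
  rw [X, this]; simp

lemma Nw_monomial_mul {δ : ℝ} (hδ : 0 ≤ δ) (β : Fin n →₀ ℕ) (c : ℝ) (q : Poly n) :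
    Nw δ (monomial β c * q) ≤ |c| * δ ^ β.degree * Nw δ q := by
  conv_lhs => rw [q.as_sum, Finset.mul_sum]
  refine (Nw_sum_le hδ _ _).trans ?_
  rw [Nw, Finset.mul_sum]
  apply le_of_eq
  refine Finset.sum_congr rfl fun γ _ => ?_
  rw [monomial_mul, Nw_monomial, abs_mul, map_add, pow_add]; ring

lemma Nw_mul_le {δ : ℝ} (hδ : 0 ≤ δ) (p q : Poly n) : Nw δ (p * q) ≤ Nw δ p * Nw δ q := by
  conv_lhs => rw [p.as_sum, Finset.sum_mul]
  refine (Nw_sum_le hδ _ _).trans ?_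
  rw [Nw, Finset.sum_mul]
  exact Finset.sum_le_sum fun β _ => Nw_monomial_mul hδ _ _ _

lemma Nw_pow_le {δ : ℝ} (hδ : 0 ≤ δ) (p : Poly n) (k : ℕ) : Nw δ (p ^ k) ≤ Nw δ p ^ k := by
  induction k with
  | zero => simp
  | succ k ih =>
    rw [pow_succ, pow_succ]
    exact (Nw_mul_le hδ _ _).trans (mul_le_mul_of_nonneg_right ih (Nw_nonneg hδ _))

lemma Nw_prod_le {δ : ℝ} (hδ : 0 ≤ δ) {ι : Type*} (s : Finset ι) (f : ι → Poly n) :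
    Nw δ (∏ i ∈ s, f i) ≤ ∏ i ∈ s, Nw δ (f i) := by
  induction s using Finset.induction_on with
  | empty => simp
  | insert a s ha ih =>
    rw [Finset.prod_insert ha, Finset.prod_insert ha]
    exact (Nw_mul_le hδ _ _).trans (mul_le_mul_of_nonneg_left ih (Nw_nonneg hδ _))

lemma Nw_mono {δ δ' : ℝ} (hδ : 0 ≤ δ) (h : δ ≤ δ') (q : Poly n) : Nw δ q ≤ Nw δ' q := by
  unfold Nw; gcongr

lemma coeff_le_Nw {δ : ℝ} (hδ : 0 ≤ δ) (q : Poly n) (β : Fin n →₀ ℕ) :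
    |coeff β q| * δ ^ β.degree ≤ Nw δ q := by
  by_cases h : β ∈ q.support
  · exact Finset.single_le_sum (f := fun β => |coeff β q| * δ ^ β.degree)
      (fun β _ => by positivity) h
  · rw [notMem_support_iff.mp h]; simpa using Nw_nonneg hδ q

lemma Nw_le_of_coeff {δ δ' C : ℝ} (q q' : Poly n)
    (h : ∀ β, |coeff β q| * δ ^ β.degree ≤ C * (|coeff β q'| * δ' ^ β.degree)) :
    Nw δ q ≤ C * Nw δ' q' := by
  rw [Nw_eq_sum δ q (q.support ∪ q'.support) Finset.subset_union_left,
    Nw_eq_sum δ' q' (q.support ∪ q'.support) Finset.subset_union_right, Finset.mul_sum]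
  exact Finset.sum_le_sum fun β _ => h β

/-- jets: degree < m -/
def Jet (m : ℕ) (q : Poly n) : Prop := ∀ β : Fin n →₀ ℕ, m ≤ β.degree → coeff β q = 0
/-- tails: order ≥ m -/
def Tail (m : ℕ) (q : Poly n) : Prop := ∀ β : Fin n →₀ ℕ, β.degree < m → coeff β q = 0

lemma Jet.scale {m : ℕ} {q : Poly n} (hq : Jet m q) {δ l : ℝ} (hδ : 0 ≤ δ) (hl : 1 ≤ l) :
    Nw (l * δ) q ≤ l ^ (m - 1) * Nw δ q := by
  apply Nw_le_of_coeff
  intro β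
  by_cases h : m ≤ β.degree
  · simp [hq β h]
  · rw [mul_pow]
    have : l ^ β.degree ≤ l ^ (m - 1) := pow_le_pow_right₀ hl (by omega)
    calc _ = l ^ β.degree * (|coeff β q| * δ ^ β.degree) := by ring
      _ ≤ _ := by gcongr

lemma Jet.scale' {m : ℕ} {q : Poly n} (hq : Jet m q) {δ l : ℝ} (hδ : 0 ≤ δ) (hl : 1 ≤ l) :
    Nw (l * δ) q ≤ l ^ m * Nw δ q :=
  (hq.scale hδ hl).trans (mul_le_mul_of_nonneg_right
    (pow_le_pow_right₀ hl (by omega)) (Nw_nonneg hδ _))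

lemma Tail.scale {m : ℕ} {q : Poly n} (hq : Tail m q) {δ l : ℝ} (hδ : 0 ≤ δ) (hl0 : 0 ≤ l)
    (hl : l ≤ 1) : Nw (l * δ) q ≤ l ^ m * Nw δ q := by
  apply Nw_le_of_coeff
  intro β
  by_cases h : β.degree < m
  · simp [hq β h]
  · rw [mul_pow]
    have : l ^ β.degree ≤ l ^ m := pow_le_pow_of_le_one hl0 hl (by omega)
    calc _ = l ^ β.degree * (|coeff β q| * δ ^ β.degree) := by ring
      _ ≤ _ := by gcongr

lemma Nw_aeval_le {δ t : ℝ} (hδ : 0 ≤ δ) (g : Fin n → Poly n)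
    (hg : ∀ i, Nw δ (g i) ≤ t) (p : Poly n) : Nw δ (aeval g p) ≤ Nw t p := by
  rw [aeval_def, eval₂_eq]
  refine (Nw_sum_le hδ _ _).trans ?_
  unfold Nw
  apply Finset.sum_le_sum
  intro β _
  change Nw δ _ ≤ _
  rw [algebraMap_eq, Nw_C_mul]
  gcongr
  refine (Nw_prod_le hδ _ _).trans ?_
  rw [Finsupp.degree_apply, ← Finset.prod_pow_eq_pow_sum]
  apply Finset.prod_le_prod
  · intro i _; exact Nw_nonneg hδ _
  · intro i _
    exact (Nw_pow_le hδ _ _).trans (pow_le_pow_left₀ (Nw_nonneg hδ _) (hg i) _)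

/-- shift: `tau x p = p(· + x)` -/
def tau (x : En n) : Poly n →ₐ[ℝ] Poly n := aeval (fun i => X i + C (x i))

@[simp] lemma tau_X (x : En n) (i : Fin n) : tau x (X i) = X i + C (x i) := by simp [tau]
@[simp] lemma tau_C (x : En n) (c : ℝ) : tau x (C c) = C c := by
  simp [tau]

lemma tau_tau (x y : En n) (p : Poly n) : tau x (tau y p) = tau (x + y) p := by
  have : (tau x).comp (tau y) = tau (x + y) := by
    apply MvPolynomial.algHom_ext
    intro i
    simp [AlgHom.comp_apply]; ring
  exact DFunLike.congr_fun this p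

@[simp] lemma tau_zero (p : Poly n) : tau 0 p = p := by
  have : (tau (0 : En n)) = AlgHom.id ℝ (Poly n) := by
    apply MvPolynomial.algHom_ext
    intro i; simp
  exact DFunLike.congr_fun this p

lemma abs_coord_le (x : En n) (i : Fin n) : |x i| ≤ ‖x‖ := by
  have := PiLp.norm_apply_le x i
  simpa using this

lemma Nw_tau_le {δ : ℝ} (hδ : 0 ≤ δ) (h : En n) (p : Poly n) :
    Nw δ (tau h p) ≤ Nw (δ + ‖h‖) p := by
  apply Nw_aeval_le hδ
  intro i
  refine (Nw_add_le hδ _ _).trans ?_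
  rw [Nw_X, Nw_C]; gcongr; exact abs_coord_le h i

lemma Nw_tau_sub_le {δ : ℝ} (hδ : 0 ≤ δ) (h : En n) (p : Poly n) :
    Nw δ (tau h p - p) ≤ Nw (δ + ‖h‖) p - Nw δ p := by
  have hmul : ∀ (a b : Poly n) (k l : ℕ), Nw δ (tau h a - a) ≤ (δ + ‖h‖) ^ k - δ ^ k →
      Nw δ (tau h b - b) ≤ (δ + ‖h‖) ^ l - δ ^ l → Nw δ a ≤ δ ^ k →
      Nw δ (tau h b) ≤ (δ + ‖h‖) ^ l →
      Nw δ (tau h (a * b) - a * b) ≤ (δ + ‖h‖) ^ (k + l) - δ ^ (k + l) := by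
    intro a b k l h1 h2 h3 h4
    have e : tau h (a * b) - a * b = (tau h a - a) * tau h b + a * (tau h b - b) := by
      rw [map_mul]; ring
    rw [e]
    refine (Nw_add_le hδ _ _).trans ?_
    have h5 := (Nw_mul_le hδ (tau h a - a) (tau h b)).trans
      (mul_le_mul h1 h4 (Nw_nonneg hδ _) ((Nw_nonneg hδ _).trans h1))
    have h6 := (Nw_mul_le hδ a (tau h b - b)).trans
      (mul_le_mul h3 h2 (Nw_nonneg hδ _) (by positivity))
    calc _ ≤ _ := add_le_add h5 h6
      _ = _ := by rw [pow_add, pow_add]; ring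
  have hX : ∀ i : Fin n, Nw δ (tau h (X i : Poly n) - X i) ≤ (δ + ‖h‖) ^ 1 - δ ^ 1 := by
    intro i
    rw [tau_X, add_sub_cancel_left, Nw_C]; simpa using abs_coord_le h i
  have key : ∀ β : Fin n →₀ ℕ, Nw δ (tau h (monomial β 1) - monomial β 1) ≤
      (δ + ‖h‖) ^ β.degree - δ ^ β.degree := by
    intro β
    induction β using Finsupp.induction_linear with
    | zero =>
      have : (monomial 0 1 : Poly n) = C 1 := rfl
      rw [this, tau_C]; simp
    | add a b ha hb =>
      have : (monomial (a + b) 1 : Poly n) = monomial a 1 * monomial b 1 := by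
        rw [monomial_mul]; simp
      rw [this, map_add]
      apply hmul _ _ _ _ ha hb
      · rw [Nw_monomial]; simp
      · refine (Nw_tau_le hδ _ _).trans ?_
        rw [Nw_monomial]; simp
    | single i k =>
      rw [Finsupp.degree_single]
      induction k with
      | zero =>
        have : (monomial (Finsupp.single i 0) 1 : Poly n) = C 1 := by simp
        rw [this, tau_C]; simp
      | succ k ih =>
        have : (monomial (Finsupp.single i (k+1)) 1 : Poly n) =
            monomial (Finsupp.single i k) 1 * X i := by
          rw [X, monomial_mul, Finsupp.single_add]; simp
        rw [this]
        apply hmul _ _ _ _ ih (hX i)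
        · rw [Nw_monomial]; simp
        · refine (Nw_tau_le hδ _ _).trans ?_
          rw [Nw_X]; simp
  have e : tau h p - p = ∑ β ∈ p.support,
      coeff β p • (tau h (monomial β 1) - monomial β 1) := by
    conv_lhs => rw [p.as_sum, map_sum, ← Finset.sum_sub_distrib]
    refine Finset.sum_congr rfl fun β _ => ?_
    rw [smul_sub, ← map_smul, smul_monomial]; simp
  rw [e]
  refine (Nw_sum_le hδ _ _).trans ?_
  unfold Nw
  rw [← Finset.sum_sub_distrib]
  apply Finset.sum_le_sum
  intro β _
  change Nw δ _ ≤ _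
  rw [Nw_smul, ← mul_sub]
  gcongr
  exact key β

/-- coefficients of the shift -/
lemma coeff_tau_monomial (h : En n) (α β : Fin n →₀ ℕ) (hne : ¬ β ≤ α) :
    coeff β (tau h (monomial α 1)) = 0 := by
  have : ∀ p : Poly n, (∀ γ ∈ p.support, γ ≤ α) → True := fun _ _ => trivial
  have key : ∀ α : Fin n →₀ ℕ, ∀ γ ∈ (tau h (monomial α 1)).support, γ ≤ α := by
    intro α
    induction α using Finsupp.induction_linear with
    | zero =>
      have : (monomial 0 1 : Poly n) = C 1 := rfl
      rw [this, tau_C]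
      intro γ hγ
      simp only [mem_support_iff, coeff_C] at hγ
      by_contra h; apply hγ; rw [if_neg]; intro h'; apply h; rw [h']
    | add a b ha hb =>
      have : (monomial (a + b) 1 : Poly n) = monomial a 1 * monomial b 1 := by
        rw [monomial_mul]; simp
      rw [this, map_mul]
      intro γ hγ
      have := support_mul _ _ hγ
      obtain ⟨x, hx, y, hy, rfl⟩ := Finset.mem_add.mp this
      exact add_le_add (ha x hx) (hb y hy)
    | single i k =>
      induction k with
      | zero =>
        intro γ hγ
        have : (monomial (Finsupp.single i 0) 1 : Poly n) = C 1 := by simp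
        rw [this, tau_C] at hγ
        simp only [mem_support_iff, coeff_C] at hγ
        have : γ = 0 := by
          by_contra h; apply hγ; rw [if_neg]; intro h'; apply h; rw [h']
        rw [this]; simp
      | succ k ih =>
        have : (monomial (Finsupp.single i (k+1)) 1 : Poly n) =
            monomial (Finsupp.single i k) 1 * X i := by
          rw [X, monomial_mul, Finsupp.single_add]; simp
        rw [this, map_mul]
        intro γ hγ
        have := support_mul _ _ hγ
        obtain ⟨x, hx, y, hy, rfl⟩ := Finset.mem_add.mp this
        rw [Finsupp.single_add]
        refine add_le_add (ih x hx) ?_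
        rw [tau_X] at hy
        have := support_add hy
        rw [Finset.mem_union] at this
        rcases this with h1 | h1
        · rw [support_X] at h1; simp at h1; rw [h1]
        · simp only [mem_support_iff, coeff_C] at h1
          have : y = 0 := by
            by_contra h; apply h1; rw [if_neg]; intro h'; apply h; rw [h']
          rw [this]; simp
  by_contra h0
  exact hne (key α β (mem_support_iff.mpr h0))

lemma tau_as_sum (h : En n) (p : Poly n) : tau h p = ∑ α ∈ p.support, coeff α p • tau h (monomial α 1) := by
  conv_lhs => rw [p.as_sum, map_sum]
  refine Finset.sum_congr rfl fun β _ => ?_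
  rw [← map_smul, smul_monomial]; simp

/-- if coeffs of p vanish at all α ≥ β then coeff β (tau h p) = 0 -/
lemma coeff_tau_eq_zero (h : En n) (p : Poly n) (β : Fin n →₀ ℕ)
    (hp : ∀ α, β ≤ α → coeff α p = 0) : coeff β (tau h p) = 0 := by
  rw [tau_as_sum, coeff_sum]
  apply Finset.sum_eq_zero
  intro α hα
  rw [coeff_smul]
  by_cases hle : β ≤ α
  · rw [hp α hle]; simp
  · rw [coeff_tau_monomial h α β hle]; simp

lemma Jet.tau {m : ℕ} {q : Poly n} (hq : Jet m q) (x : En n) : Jet m (tau x q) := by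
  intro β hβ
  apply coeff_tau_eq_zero
  intro α hα
  apply hq
  exact hβ.trans (Finsupp.degree_mono hα)

lemma Jet.add {m : ℕ} {p q : Poly n} (hp : Jet m p) (hq : Jet m q) : Jet m (p + q) := by
  intro β hβ; rw [coeff_add, hp β hβ, hq β hβ, add_zero]
lemma Jet.smul {m : ℕ} {p : Poly n} (c : ℝ) (hp : Jet m p) : Jet m (c • p) := by
  intro β hβ; rw [coeff_smul, hp β hβ, smul_zero]
lemma Jet.sub {m : ℕ} {p q : Poly n} (hp : Jet m p) (hq : Jet m q) : Jet m (p - q) := by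
  intro β hβ; rw [coeff_sub, hp β hβ, hq β hβ, sub_zero]
lemma Jet.zero {m : ℕ} : Jet m (0 : Poly n) := by
  intro β _; simp
lemma Jet.of_tau {m : ℕ} {q : Poly n} {x : En n} (hq : Jet m (FP.tau x q)) : Jet m q := by
  have := hq.tau (-x)
  rwa [tau_tau, neg_add_cancel, tau_zero] at this

/-- truncation at 0 -/
def tr0 (m : ℕ) : Poly n →ₗ[ℝ] Poly n := ∑ i ∈ Finset.range m, homogeneousComponent i

lemma coeff_tr0 (m : ℕ) (q : Poly n) (β : Fin n →₀ ℕ) :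
    coeff β (tr0 m q) = if β.degree < m then coeff β q else 0 := by
  simp only [tr0, LinearMap.sum_apply, coeff_sum, coeff_homogeneousComponent]
  simp

/-- truncation at x -/
def tr (m : ℕ) (x : En n) : Poly n →ₗ[ℝ] Poly n :=
  (tau (-x)).toLinearMap ∘ₗ tr0 m ∘ₗ (tau x).toLinearMap

lemma tau_tr (m : ℕ) (x : En n) (q : Poly n) : tau x (tr m x q) = tr0 m (tau x q) := by
  simp [tr, tau_tau]

lemma jet_tr0 (m : ℕ) (q : Poly n) : Jet m (tr0 m q) := by
  intro β hβ; rw [coeff_tr0, if_neg (by omega)]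
lemma jet_tr (m : ℕ) (x : En n) (q : Poly n) : Jet m (tr m x q) :=
  Jet.of_tau (x := x) (by rw [tau_tr]; exact jet_tr0 _ _)

lemma tr_of_jet {m : ℕ} (x : En n) {q : Poly n} (hq : Jet m q) : tr m x q = q := by
  have h : tr0 m (tau x q) = tau x q := by
    ext β
    rw [coeff_tr0]
    split_ifs with h
    · rfl
    · rw [hq.tau x β (by omega)]
  simp only [tr, LinearMap.comp_apply, AlgHom.toLinearMap_apply, h]
  rw [tau_tau]; simp

/-- norm at x scale δ -/
def N (x : En n) (δ : ℝ) (p : Poly n) : ℝ := Nw δ (tau x p)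

section N
variable {x y : En n} {δ : ℝ}

lemma N_nonneg (hδ : 0 ≤ δ) (p : Poly n) : 0 ≤ N x δ p := Nw_nonneg hδ _
@[simp] lemma N_zero : N x δ (0 : Poly n) = 0 := by simp [N]
@[simp] lemma N_one : N x δ (1 : Poly n) = 1 := by simp [N]
lemma N_add_le (hδ : 0 ≤ δ) (p q : Poly n) : N x δ (p + q) ≤ N x δ p + N x δ q := by
  unfold N; rw [map_add]; exact Nw_add_le hδ _ _
lemma N_sub_le (hδ : 0 ≤ δ) (p q : Poly n) : N x δ (p - q) ≤ N x δ p + N x δ q := by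
  unfold N; rw [map_sub]; exact Nw_sub_le hδ _ _
lemma N_smul (c : ℝ) (p : Poly n) : N x δ (c • p) = |c| * N x δ p := by
  unfold N; rw [map_smul, Nw_smul]
@[simp] lemma N_neg (p : Poly n) : N x δ (-p) = N x δ p := by
  unfold N; rw [map_neg, Nw_neg]
lemma N_sub_comm (p q : Poly n) : N x δ (p - q) = N x δ (q - p) := by
  rw [← N_neg, neg_sub]
lemma N_mul_le (hδ : 0 ≤ δ) (p q : Poly n) : N x δ (p * q) ≤ N x δ p * N x δ q := by
  unfold N; rw [map_mul]; exact Nw_mul_le hδ _ _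
lemma N_sum_le (hδ : 0 ≤ δ) {ι : Type*} (s : Finset ι) (f : ι → Poly n) :
    N x δ (∑ i ∈ s, f i) ≤ ∑ i ∈ s, N x δ (f i) := by
  unfold N; rw [map_sum]; exact Nw_sum_le hδ _ _
lemma N_prod_le (hδ : 0 ≤ δ) {ι : Type*} (s : Finset ι) (f : ι → Poly n) :
    N x δ (∏ i ∈ s, f i) ≤ ∏ i ∈ s, N x δ (f i) := by
  unfold N; rw [map_prod]; exact Nw_prod_le hδ _ _
lemma N_mono (hδ : 0 ≤ δ) {δ' : ℝ} (h : δ ≤ δ') (p : Poly n) : N x δ p ≤ N x δ' p :=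
  Nw_mono hδ h _
lemma N_shift (x y : En n) (hδ : 0 ≤ δ) (p : Poly n) : N y δ p ≤ N x (δ + dist x y) p := by
  unfold N
  have : tau y p = tau (y - x) (tau x p) := by rw [tau_tau]; simp
  rw [this, dist_comm, dist_eq_norm]
  exact Nw_tau_le hδ _ _
lemma N_shift_le (hδ : 0 ≤ δ) {δ' : ℝ} (h : δ + dist x y ≤ δ') (p : Poly n) :
    N y δ p ≤ N x δ' p :=
  (N_shift x y hδ p).trans (N_mono (by positivity) h p)
lemma N_jet_scale {m : ℕ} {q : Poly n} (hq : Jet m q) {l : ℝ} (hδ : 0 ≤ δ) (hl : 1 ≤ l) :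
    N x (l * δ) q ≤ l ^ m * N x δ q := (hq.tau x).scale' hδ hl
lemma N_jet_scale1 {m : ℕ} {q : Poly n} (hq : Jet m q) {l : ℝ} (hδ : 0 ≤ δ) (hl : 1 ≤ l) :
    N x (l * δ) q ≤ l ^ (m - 1) * N x δ q := (hq.tau x).scale hδ hl
lemma N_tr_le (hδ : 0 ≤ δ) (m : ℕ) (q : Poly n) : N x δ (tr m x q) ≤ N x δ q := by
  unfold N; rw [tau_tr]
  have := Nw_le_of_coeff (δ := δ) (δ' := δ) (C := 1) (tr0 m (tau x q)) (tau x q) (by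
    intro β; rw [coeff_tr0]; split_ifs
    · simp
    · simp; positivity)
  simpa using this

lemma tail_sub_tr (m : ℕ) (q : Poly n) : Tail m (tau x (q - tr m x q)) := by
  intro β hβ
  rw [map_sub, tau_tr, coeff_sub, coeff_tr0, if_pos hβ, sub_self]

lemma N_sub_tr_le (hδ : 0 ≤ δ) (m : ℕ) (q : Poly n) : N x δ (q - tr m x q) ≤ N x δ q := by
  unfold N; rw [map_sub, tau_tr]
  have := Nw_le_of_coeff (δ := δ) (δ' := δ) (C := 1) (tau x q - tr0 m (tau x q)) (tau x q) (by
    intro β; rw [coeff_sub, coeff_tr0]; split_ifs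
    · simp; positivity
    · simp)
  simpa using this

/-- key truncation difference -/
lemma N_tr_tr_le {ρ : ℝ} (m : ℕ) (q : Poly n) (hρ : dist x y ≤ ρ) (hδ : 0 < δ)
    (h2 : 2 * ρ ≤ δ) : N y ρ (tr m y q - tr m x q) ≤ (2 * ρ / δ) ^ m * N x δ q := by
  have hρ0 : 0 ≤ ρ := dist_nonneg.trans hρ
  have e : tr m y q - tr m x q = tr m y (q - tr m x q) := by
    rw [map_sub, tr_of_jet y (jet_tr m x q)]
  rw [e]
  refine (N_tr_le hρ0 _ _).trans ?_
  refine (N_shift_le (x := x) (δ' := 2 * ρ) hρ0 (by linarith) _).trans ?_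
  have h1 := (tail_sub_tr (x := x) m q).scale hδ.le (l := 2 * ρ / δ) (by positivity)
    ((div_le_one hδ).mpr h2)
  rw [div_mul_cancel₀ _ hδ.ne'] at h1
  refine h1.trans ?_
  gcongr
  exact N_sub_tr_le hδ.le m q

lemma N_tr_tr_le' {ρ : ℝ} (m : ℕ) (q : Poly n) (hρ : dist x y ≤ ρ) (hδ : 0 < δ)
    (h2 : 2 * ρ ≤ δ) : N x ρ (tr m x q - tr m y q) ≤ (2 * ρ / δ) ^ m * N y δ q :=
  N_tr_tr_le m q (by rwa [dist_comm]) hδ h2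

end N
end FP
end

section
namespace FP
open MvPolynomial
variable {n D : ℕ}

/-- vector polynomials -/
abbrev VP (n D : ℕ) := Fin D → Poly n

def NV (x : En n) (δ : ℝ) (P : VP n D) : ℝ := ∑ j, N x δ (P j)
def JetV (m : ℕ) (P : VP n D) : Prop := ∀ j, Jet m (P j)
def trV (m : ℕ) (x : En n) : VP n D →ₗ[ℝ] VP n D :=
  LinearMap.pi fun j => tr m x ∘ₗ LinearMap.proj j
@[simp] lemma trV_apply (m : ℕ) (x : En n) (P : VP n D) (j : Fin D) : trV m x P j = tr m x (P j) := rfl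

/-- value at x -/
def ev1 (x : En n) : Poly n →+* ℝ := (constantCoeff (R := ℝ)).comp (tau x).toRingHom
lemma ev1_apply (x : En n) (p : Poly n) : ev1 x p = coeff 0 (tau x p) := rfl
@[simp] lemma ev1_smul (x : En n) (c : ℝ) (p : Poly n) : ev1 x (c • p) = c * ev1 x p := by
  rw [ev1_apply, map_smul, coeff_smul]; rfl
def ev (x : En n) : VP n D →ₗ[ℝ] (Fin D → ℝ) where
  toFun P j := ev1 x (P j)
  map_add' P Q := by ext j; simp
  map_smul' c P := by ext j; simp
@[simp] lemma ev_apply (x : En n) (P : VP n D) (j : Fin D) : ev x P j = ev1 x (P j) := rfl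
lemma ev_mul (x : En n) (θ : Poly n) (P : VP n D) : ev x (θ • P) = ev1 x θ • ev x P := by
  ext j; simp

lemma ev1_tr {m : ℕ} (hm : 1 ≤ m) (x : En n) (p : Poly n) : ev1 x (tr m x p) = ev1 x p := by
  rw [ev1_apply, tau_tr, coeff_tr0, if_pos (by simp; omega), ev1_apply]
lemma ev_trV {m : ℕ} (hm : 1 ≤ m) (x : En n) (P : VP n D) : ev x (trV m x P) = ev x P := by
  ext j; simp [ev1_tr hm]

lemma ev1_le_N {x : En n} {δ : ℝ} (hδ : 0 ≤ δ) (p : Poly n) : |ev1 x p| ≤ N x δ p := by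
  have := coeff_le_Nw hδ (tau x p) 0
  simpa [ev1_apply, N] using this

section
variable {x y : En n} {δ : ℝ}

lemma NV_nonneg (hδ : 0 ≤ δ) (P : VP n D) : 0 ≤ NV x δ P :=
  Finset.sum_nonneg fun _ _ => N_nonneg hδ _
@[simp] lemma NV_zero : NV x δ (0 : VP n D) = 0 := by simp [NV]
lemma NV_add_le (hδ : 0 ≤ δ) (P Q : VP n D) : NV x δ (P + Q) ≤ NV x δ P + NV x δ Q := by
  unfold NV; rw [← Finset.sum_add_distrib]
  exact Finset.sum_le_sum fun j _ => N_add_le hδ _ _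
lemma NV_smul (c : ℝ) (P : VP n D) : NV x δ (c • P) = |c| * NV x δ P := by
  unfold NV; rw [Finset.mul_sum]
  exact Finset.sum_congr rfl fun j _ => N_smul _ _
@[simp] lemma NV_neg (P : VP n D) : NV x δ (-P) = NV x δ P := by
  unfold NV; simp
lemma NV_sub_le (hδ : 0 ≤ δ) (P Q : VP n D) : NV x δ (P - Q) ≤ NV x δ P + NV x δ Q := by
  rw [sub_eq_add_neg, ← NV_neg Q]; exact NV_add_le hδ _ _
lemma NV_sub_comm (P Q : VP n D) : NV x δ (P - Q) = NV x δ (Q - P) := by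
  rw [← NV_neg, neg_sub]
lemma NV_tri (hδ : 0 ≤ δ) (P Q S : VP n D) : NV x δ (P - S) ≤ NV x δ (P - Q) + NV x δ (Q - S) := by
  have := NV_add_le (x := x) hδ (P - Q) (Q - S)
  simpa using this
lemma NV_mul_le (hδ : 0 ≤ δ) (θ : Poly n) (P : VP n D) :
    NV x δ (θ • P) ≤ N x δ θ * NV x δ P := by
  unfold NV; rw [Finset.mul_sum]
  exact Finset.sum_le_sum fun j _ => N_mul_le hδ _ _
lemma NV_sum_le (hδ : 0 ≤ δ) {ι : Type*} (s : Finset ι) (f : ι → VP n D) :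
    NV x δ (∑ i ∈ s, f i) ≤ ∑ i ∈ s, NV x δ (f i) := by
  induction s using Finset.induction_on with
  | empty => simp
  | insert a s ha ih =>
    rw [Finset.sum_insert ha, Finset.sum_insert ha]
    exact (NV_add_le hδ _ _).trans (by gcongr)
lemma NV_mono (hδ : 0 ≤ δ) {δ' : ℝ} (h : δ ≤ δ') (P : VP n D) : NV x δ P ≤ NV x δ' P :=
  Finset.sum_le_sum fun _ _ => N_mono hδ h _
lemma NV_shift (x y : En n) (hδ : 0 ≤ δ) (P : VP n D) : NV y δ P ≤ NV x (δ + dist x y) P :=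
  Finset.sum_le_sum fun _ _ => N_shift x y hδ _
lemma NV_shift_le (hδ : 0 ≤ δ) {δ' : ℝ} (h : δ + dist x y ≤ δ') (P : VP n D) :
    NV y δ P ≤ NV x δ' P :=
  Finset.sum_le_sum fun _ _ => N_shift_le hδ h _
lemma NV_jet_scale {m : ℕ} {P : VP n D} (hP : JetV m P) {l : ℝ} (hδ : 0 ≤ δ) (hl : 1 ≤ l) :
    NV x (l * δ) P ≤ l ^ m * NV x δ P := by
  unfold NV; rw [Finset.mul_sum]
  exact Finset.sum_le_sum fun j _ => N_jet_scale (hP j) hδ hl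
lemma NV_jet_scale1 {m : ℕ} {P : VP n D} (hP : JetV m P) {l : ℝ} (hδ : 0 ≤ δ) (hl : 1 ≤ l) :
    NV x (l * δ) P ≤ l ^ (m - 1) * NV x δ P := by
  unfold NV; rw [Finset.mul_sum]
  exact Finset.sum_le_sum fun j _ => N_jet_scale1 (hP j) hδ hl
/-- shift and scale for jets -/
lemma NV_jet_shift {m : ℕ} {P : VP n D} (hP : JetV m P) {l δ' : ℝ} (hδ : 0 ≤ δ) (hl : 1 ≤ l)
    (hδ' : 0 ≤ δ') (h : δ' + dist x y ≤ l * δ) :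
    NV y δ' P ≤ l ^ m * NV x δ P :=
  (NV_shift_le hδ' h P).trans (NV_jet_scale hP hδ hl)
lemma NV_trV_le (hδ : 0 ≤ δ) (m : ℕ) (P : VP n D) : NV x δ (trV m x P) ≤ NV x δ P :=
  Finset.sum_le_sum fun _ _ => N_tr_le hδ _ _
lemma NV_tr_tr_le {ρ : ℝ} (m : ℕ) (P : VP n D) (hρ : dist x y ≤ ρ) (hδ : 0 < δ)
    (h2 : 2 * ρ ≤ δ) : NV y ρ (trV m y P - trV m x P) ≤ (2 * ρ / δ) ^ m * NV x δ P := by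
  unfold NV; rw [Finset.mul_sum]
  exact Finset.sum_le_sum fun j _ => N_tr_tr_le m _ hρ hδ h2
lemma ev_le_NV (hδ : 0 ≤ δ) (P : VP n D) (j : Fin D) : |ev x P j| ≤ NV x δ P :=
  (ev1_le_N hδ (P j)).trans (Finset.single_le_sum (f := fun j => N x δ (P j))
    (fun _ _ => N_nonneg hδ _) (Finset.mem_univ j))
end

lemma JetV.add {m : ℕ} {P Q : VP n D} (hp : JetV m P) (hq : JetV m Q) : JetV m (P + Q) :=
  fun j => (hp j).add (hq j)
lemma JetV.sub {m : ℕ} {P Q : VP n D} (hp : JetV m P) (hq : JetV m Q) : JetV m (P - Q) :=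
  fun j => (hp j).sub (hq j)
lemma JetV.smul {m : ℕ} {P : VP n D} (c : ℝ) (hp : JetV m P) : JetV m (c • P) :=
  fun j => (hp j).smul c
lemma JetV.neg {m : ℕ} {P : VP n D} (hp : JetV m P) : JetV m (-P) := by
  have := hp.smul (-1); simpa using this
lemma JetV.zero {m : ℕ} : JetV m (0 : VP n D) := fun _ => Jet.zero
lemma JetV.sum {m : ℕ} {ι : Type*} (s : Finset ι) (f : ι → VP n D) (h : ∀ i ∈ s, JetV m (f i)) :
    JetV m (∑ i ∈ s, f i) := by
  induction s using Finset.induction_on with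
  | empty => simpa using JetV.zero
  | insert a s ha ih =>
    rw [Finset.sum_insert ha]
    exact (h a (by simp)).add (ih fun i hi => h i (by simp [hi]))
lemma jetV_trV (m : ℕ) (x : En n) (P : VP n D) : JetV m (trV m x P) := fun _ => jet_tr _ _ _
lemma trV_of_jet {m : ℕ} (x : En n) {P : VP n D} (h : JetV m P) : trV m x P = P := by
  ext1 j; simp [tr_of_jet x (h j)]

/-- Whitney field condition on a set -/
def Fld (m : ℕ) (S : Set (En n)) (P : En n → VP n D) (M : ℝ) : Prop :=
  (∀ x ∈ S, JetV m (P x)) ∧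
  ∀ x ∈ S, ∀ y ∈ S, NV x (dist x y) (P x - P y) ≤ M * dist x y ^ m

end FP
end

section
namespace FP
open MvPolynomial
variable {n D : ℕ}

lemma coeff_pderiv (i : Fin n) (p : Poly n) (β : Fin n →₀ ℕ) :
    coeff β (pderiv i p) = (β i + 1) * coeff (β + Finsupp.single i 1) p := by
  induction p using MvPolynomial.induction_on' with
  | add p q hp hq => rw [map_add, coeff_add, coeff_add, hp, hq]; ring
  | monomial u a =>
    rw [pderiv_monomial, coeff_monomial, coeff_monomial]
    by_cases h : u = β + Finsupp.single i 1
    · subst h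
      rw [if_pos (by simp), if_pos rfl]; simp; ring
    · rw [if_neg h]
      split_ifs with h2
      · have : u i = 0 := by
          by_contra h3
          apply h
          rw [← h2, tsub_add_cancel_of_le]
          simpa using Nat.one_le_iff_ne_zero.mpr h3
        simp [this]
      · simp

lemma pderiv_tau (i : Fin n) (x : En n) (p : Poly n) : pderiv i (tau x p) = tau x (pderiv i p) := by
  induction p using MvPolynomial.induction_on with
  | C a => simp
  | add p q hp hq => simp [hp, hq]
  | mul_X p k hp =>
    rw [map_mul, Derivation.leibniz, hp, Derivation.leibniz]
    simp only [tau_X, map_add, pderiv_C, add_zero, smul_eq_mul, map_mul]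
    congr 2
    rw [pderiv_X]
    by_cases h : k = i
    · subst h; simp
    · simp [Pi.single_apply, h]

lemma hfd_congr {f g : En n → ℝ} {L L' : En n →L[ℝ] ℝ} {x : En n} (h : HasFDerivAt f L x)
    (h1 : g = f) (h2 : L' = L) : HasFDerivAt g L' x := by rw [h1, h2]; exact h

lemma hasFDerivAt_coeff_tau_aux (p : Poly n) : ∀ (β : Fin n →₀ ℕ) (x : En n),
    HasFDerivAt (fun x => coeff β (tau x p))
      (∑ i, coeff β (tau x (pderiv i p)) • (EuclideanSpace.proj i : En n →L[ℝ] ℝ)) x := by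
  induction p using MvPolynomial.induction_on with
  | C a =>
    intro β x
    simpa using hasFDerivAt_const _ _
  | add p q hp hq =>
    intro β x
    have := (hp β x).add (hq β x)
    refine hfd_congr this ?_ ?_
    · ext y; simp
    · rw [← Finset.sum_add_distrib]
      exact Finset.sum_congr rfl fun i _ => by simp [add_smul]
  | mul_X p k hp =>
    intro β x
    have h1 : HasFDerivAt (fun x => coeff β (tau x p * X k))
        (∑ i, coeff β (tau x (pderiv i p) * X k) • (EuclideanSpace.proj i : En n →L[ℝ] ℝ)) x := by
      simp only [coeff_mul_X']
      split_ifs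
      · exact hp _ x
      · simpa using hasFDerivAt_const _ _
    have h2 : HasFDerivAt (fun x : En n => x k) (EuclideanSpace.proj k : En n →L[ℝ] ℝ) x :=
      (EuclideanSpace.proj k : En n →L[ℝ] ℝ).hasFDerivAt
    have h3 := h1.add ((hp β x).mul h2)
    refine hfd_congr h3 ?_ ?_
    · ext y
      simp only [map_mul, tau_X, mul_add, Pi.add_apply, Pi.mul_apply, coeff_add]
      rw [mul_comm (tau y p) (C _), coeff_C_mul, mul_comm (y k)]
    · have : ∀ i, coeff β (tau x (pderiv i (p * X k))) = coeff β (tau x (pderiv i p) * X k) +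
          x k * coeff β (tau x (pderiv i p)) + if i = k then coeff β (tau x p) else 0 := by
        intro i
        rw [Derivation.leibniz, pderiv_X]
        simp only [smul_eq_mul, map_add, map_mul, tau_X, coeff_add]
        have e1 : coeff β ((X k + C (x k)) * tau x (pderiv i p)) =
          coeff β (tau x (pderiv i p) * X k) + x k * coeff β (tau x (pderiv i p)) := by
          rw [add_mul, coeff_add, coeff_C_mul, mul_comm (X k)]
        rw [e1]
        by_cases h : i = k
        · subst h; simp; ring
        · simp [Pi.single_apply, h, Ne.symm h]
      simp only [this, add_smul, Finset.sum_add_distrib]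
      simp only [ite_smul, zero_smul, Finset.sum_ite_eq', Finset.mem_univ, if_true]
      rw [Finset.smul_sum]
      simp only [smul_smul]
      abel

lemma hasFDerivAt_coeff_tau (p : Poly n) (β : Fin n →₀ ℕ) (x : En n) :
    HasFDerivAt (fun x => coeff β (tau x p))
      (∑ i, ((β i + 1) * coeff (β + Finsupp.single i 1) (tau x p)) •
        (EuclideanSpace.proj i : En n →L[ℝ] ℝ)) x := by
  have := hasFDerivAt_coeff_tau_aux p β x
  simpa only [← pderiv_tau, coeff_pderiv] using this

lemma coeff_top_tau {m : ℕ} {p : Poly n} (hp : Jet m p) (β : Fin n →₀ ℕ) (hβ : m ≤ β.degree + 1)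
    (x y : En n) : coeff β (tau x p) = coeff β (tau y p) := by
  have h : ∀ z : En n, HasFDerivAt (fun x => coeff β (tau x p)) (0 : En n →L[ℝ] ℝ) z := by
    intro z
    have := hasFDerivAt_coeff_tau p β z
    refine hfd_congr this rfl ?_
    symm
    apply Finset.sum_eq_zero
    intro i _
    rw [hp.tau z _ (by rw [map_add, Finsupp.degree_single]; exact hβ)]; simp
  exact is_const_of_fderiv_eq_zero (𝕜 := ℝ) (fun z => (h z).differentiableAt)
    (fun z => (h z).fderiv) x y

/-- list derivative -/
def pdL : List (Fin n) → (En n → ℝ) → (En n → ℝ)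
  | [], f => f
  | i :: l, f => pd1 i (pdL l f)

lemma pdL_append (l l' : List (Fin n)) (f : En n → ℝ) : pdL (l ++ l') f = pdL l (pdL l' f) := by
  induction l with
  | nil => rfl
  | cons a l ih => simp [pdL, ih]

lemma pdL_replicate (k : ℕ) (i : Fin n) (f : En n → ℝ) :
    pdL (List.replicate k i) f = (pd1 i)^[k] f := by
  induction k with
  | zero => rfl
  | succ k ih => rw [List.replicate_succ, pdL, ih, Function.iterate_succ_apply']

def Lw (α : Fin n → ℕ) : List (Fin n) := (List.finRange n).flatMap fun i => List.replicate (α i) i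

lemma pdalpha_eq (α : Fin n → ℕ) (f : En n → ℝ) : pdalpha α f = pdL (Lw α) f := by
  unfold pdalpha Lw
  generalize List.finRange n = l
  induction l with
  | nil => rfl
  | cons a l ih =>
    rw [List.foldr_cons, List.flatMap_cons, pdL_append, pdL_replicate, ih]

lemma count_Lw (α : Fin n → ℕ) (i : Fin n) : (Lw α).count i = α i := by
  unfold Lw
  rw [List.count_flatMap]
  have : (List.count i ∘ fun i => List.replicate (α i) i) = fun k => if k = i then α i else 0 := by
    ext k; simp only [Function.comp, List.count_replicate]
    by_cases h : k = i
    · subst h; simp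
    · simp [h]
  rw [this]
  rw [← List.ofFn_eq_map, List.sum_ofFn]
  simp

lemma contDiff_pd1 {k : ℕ} {f : En n → ℝ} (hf : ContDiff ℝ (k + 1 : ℕ) f) (i : Fin n) :
    ContDiff ℝ k (pd1 i f) := by
  unfold pd1
  have : ContDiff ℝ k (fderiv ℝ f) := hf.fderiv_right (by norm_cast)
  exact this.clm_apply contDiff_const

lemma contDiff_pdL {k : ℕ} (l : List (Fin n)) {f : En n → ℝ} (hf : ContDiff ℝ (k + l.length : ℕ) f) :
    ContDiff ℝ k (pdL l f) := by
  induction l generalizing k with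
  | nil => simpa [pdL] using hf
  | cons a l ih =>
    apply contDiff_pd1
    apply ih
    have e : k + 1 + l.length = k + (a :: l).length := by simp; ring
    rw [e]; exact hf

lemma pd1_comm {f : En n → ℝ} (hf : ContDiff ℝ 2 f) (i j : Fin n) :
    pd1 i (pd1 j f) = pd1 j (pd1 i f) := by
  have h1 : ContDiff ℝ 1 (fderiv ℝ f) := hf.fderiv_right (by norm_num)
  have h2 := h1.differentiable (by norm_num)
  have key : ∀ (v w : En n) x, fderiv ℝ (fun y => fderiv ℝ f y v) x w = fderiv ℝ (fderiv ℝ f) x w v := by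
    intro v w x
    rw [fderiv_clm_apply (h2 x) (by fun_prop)]
    simp
  ext x
  unfold pd1
  rw [key, key]
  have := (hf.contDiffAt (x := x)).isSymmSndFDerivAt (by simp)
  exact this _ _

lemma pdL_perm {l l' : List (Fin n)} (h : l.Perm l') {f : En n → ℝ}
    (hf : ContDiff ℝ (l.length : ℕ) f) : pdL l f = pdL l' f := by
  induction h with
  | nil => rfl
  | cons a h ih =>
    rw [pdL, pdL, ih]
    exact hf.of_le (by simp)
  | swap a b l =>
    simp only [pdL]
    apply pd1_comm
    apply contDiff_pdL (k := 2)
    convert hf using 2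
    simp; ring
  | trans h1 h2 ih1 ih2 =>
    rw [ih1 hf, ih2]
    rwa [← h1.length_eq]

lemma length_Lw (α : Fin n → ℕ) : (Lw α).length = ∑ i, α i := by
  rw [← Multiset.coe_card, ← Multiset.toFinset_sum_count_eq]
  rw [Finset.sum_subset (Finset.subset_univ _)]
  · simp [count_Lw]
  · intro x _ hx; simpa [List.count_eq_zero] using hx

lemma degree_eq (β : Fin n →₀ ℕ) : β.degree = ∑ i, β i := by
  rw [Finsupp.degree_eq_sum]

lemma pdalpha_succ (β : Fin n →₀ ℕ) (i : Fin n) {f : En n → ℝ}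
    (hf : ContDiff ℝ (β.degree + 1 : ℕ) f) :
    pdalpha (⇑(β + Finsupp.single i 1 : Fin n →₀ ℕ)) f = pd1 i (pdalpha (⇑β) f) := by
  rw [pdalpha_eq, pdalpha_eq]
  change _ = pdL (i :: Lw β) f
  symm
  apply pdL_perm
  · rw [List.perm_iff_count]
    intro k
    rw [List.count_cons, count_Lw, count_Lw]
    simp [Finsupp.single_apply]
  · simpa [length_Lw, ← degree_eq] using hf

end FP
end

section
namespace FP
open MvPolynomial
variable {n D : ℕ}

lemma finite_deg (n m : ℕ) : {β : Fin n →₀ ℕ | β.degree < m}.Finite :=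
  (Finsupp.finite_of_degree_le (σ := Fin n) m).subset (fun β (h : β.degree < m) => h.le)
/-- multi-indices of degree < m -/
def Bm (n m : ℕ) : Finset (Fin n →₀ ℕ) := (finite_deg n m).toFinset
@[simp] lemma mem_Bm {m : ℕ} {β : Fin n →₀ ℕ} : β ∈ Bm n m ↔ β.degree < m := by simp [Bm]

lemma Jet.support_sub {m : ℕ} {q : Poly n} (h : Jet m q) : q.support ⊆ Bm n m := by
  intro β hβ
  rw [mem_Bm]
  by_contra h'
  exact (mem_support_iff.mp hβ) (h β (by omega))

lemma Jet.Nw_eq {m : ℕ} {q : Poly n} (h : Jet m q) (δ : ℝ) :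
    Nw δ q = ∑ β ∈ Bm n m, |coeff β q| * δ ^ β.degree := Nw_eq_sum _ _ _ h.support_sub

/-- multi factorial -/
def bf (β : Fin n →₀ ℕ) : ℝ := ∏ i, ((β i).factorial : ℝ)
lemma bf_pos (β : Fin n →₀ ℕ) : 0 < bf β := Finset.prod_pos fun i _ => by positivity
lemma one_le_bf (β : Fin n →₀ ℕ) : 1 ≤ bf β := by
  unfold bf
  have : ∏ i : Fin n, (1 : ℝ) ≤ ∏ i, ((β i).factorial : ℝ) :=
    Finset.prod_le_prod (fun _ _ => by norm_num)
      (fun i _ => by exact_mod_cast Nat.succ_le_of_lt (Nat.factorial_pos _))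
  simpa using this
lemma bf_succ (β : Fin n →₀ ℕ) (i : Fin n) :
    bf (β + Finsupp.single i 1) = bf β * (β i + 1) := by
  unfold bf
  have : ∀ k, (((β + Finsupp.single i 1 : Fin n →₀ ℕ) k).factorial : ℝ) =
      ((β k).factorial : ℝ) * (if k = i then (β i + 1 : ℝ) else 1) := by
    intro k
    by_cases h : k = i
    · subst h; simp [Nat.factorial_succ]; ring
    · simp [h, Ne.symm h]
  rw [Finset.prod_congr rfl fun k _ => this k, Finset.prod_mul_distrib]
  simp

@[simp] lemma bf_zero : bf (0 : Fin n →₀ ℕ) = 1 := by simp [bf]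

/-- scaled coefficient: derivative at x -/
def cb (β : Fin n →₀ ℕ) (x : En n) (p : Poly n) : ℝ := bf β * coeff β (tau x p)

lemma cb_sub (β : Fin n →₀ ℕ) (x : En n) (p q : Poly n) : cb β x (p - q) = cb β x p - cb β x q := by
  simp [cb, mul_sub]

lemma hasFDerivAt_cb (p : Poly n) (β : Fin n →₀ ℕ) (x : En n) :
    HasFDerivAt (fun x => cb β x p)
      (∑ i, (cb (β + Finsupp.single i 1) x p) •
        (EuclideanSpace.proj i : En n →L[ℝ] ℝ)) x := by
  have := (hasFDerivAt_coeff_tau p β x).const_mul (bf β)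
  refine hfd_congr this rfl ?_
  rw [Finset.smul_sum]
  refine Finset.sum_congr rfl fun i _ => ?_
  rw [smul_smul, cb, bf_succ]; congr 1; ring

def jetP (m : ℕ) (f : En n → ℝ) (x : En n) : Poly n :=
  tau (-x) (∑ β ∈ Bm n m, monomial β (pdalpha (⇑β) f x / bf β))

lemma cb_jetP {m : ℕ} (f : En n → ℝ) (x : En n) (β : Fin n →₀ ℕ) (hβ : β.degree < m) :
    cb β x (jetP m f x) = pdalpha (⇑β) f x := by
  rw [cb, jetP, tau_tau, add_neg_cancel, tau_zero, coeff_sum]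
  simp only [coeff_monomial]
  rw [Finset.sum_ite_eq', if_pos (by simpa using hβ)]
  have := bf_pos β
  field_simp

lemma jet_jetP (m : ℕ) (f : En n → ℝ) (x : En n) : Jet m (jetP m f x) := by
  apply Jet.of_tau (x := x)
  rw [jetP, tau_tau, add_neg_cancel, tau_zero]
  intro β hβ
  rw [coeff_sum]
  apply Finset.sum_eq_zero
  intro γ hγ
  rw [coeff_monomial, if_neg]
  rintro rfl
  rw [mem_Bm] at hγ; omega

lemma pdalpha_zero (f : En n → ℝ) : pdalpha (⇑(0 : Fin n →₀ ℕ)) f = f := by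
  unfold pdalpha
  generalize List.finRange n = l
  induction l with
  | nil => rfl
  | cons a l ih => rw [List.foldr_cons, ih]; rfl

lemma fderiv_eq_sum {f : En n → ℝ} {x : En n} :
    fderiv ℝ f x = ∑ i, pd1 i f x • (EuclideanSpace.proj i : En n →L[ℝ] ℝ) := by
  ext v
  conv_lhs => rw [← (EuclideanSpace.basisFun (Fin n) ℝ).sum_repr v]
  simp [pd1, mul_comm]

lemma norm_sum_proj_le {a : Fin n → ℝ} {K : ℝ} (h : ∀ i, |a i| ≤ K) :
    ‖∑ i, a i • (EuclideanSpace.proj i : En n →L[ℝ] ℝ)‖ ≤ n * K := by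
  refine (norm_sum_le _ _).trans ?_
  have : ∀ i ∈ (Finset.univ : Finset (Fin n)), ‖a i • (EuclideanSpace.proj i : En n →L[ℝ] ℝ)‖ ≤ K := by
    intro i _
    rw [norm_smul, Real.norm_eq_abs]
    have h1 : ‖(EuclideanSpace.proj i : En n →L[ℝ] ℝ)‖ ≤ 1 := by
      apply ContinuousLinearMap.opNorm_le_bound _ zero_le_one
      intro v; rw [one_mul]; exact PiLp.norm_apply_le v i
    calc |a i| * _ ≤ |a i| * 1 := by gcongr
      _ ≤ K := by simpa using h i
  refine (Finset.sum_le_card_nsmul _ _ _ this).trans ?_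
  simp

lemma contDiff_pdalpha {k : ℕ} (β : Fin n →₀ ℕ) {f : En n → ℝ}
    (hf : ContDiff ℝ (k + β.degree : ℕ) f) : ContDiff ℝ k (pdalpha (⇑β) f) := by
  rw [pdalpha_eq]
  apply contDiff_pdL
  rw [length_Lw, ← degree_eq]; exact hf

lemma taylor {m : ℕ} {f : En n → ℝ} {M : ℝ} (hf : ContDiff ℝ (m - 1 : ℕ) f)
    (hl : ∀ β : Fin n →₀ ℕ, β.degree + 1 = m → ∀ x y,
      |pdalpha (⇑β) f x - pdalpha (⇑β) f y| ≤ M * dist x y) (y : En n) :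
    ∀ k : ℕ, ∀ β : Fin n →₀ ℕ, β.degree + 1 + k = m → ∀ x,
      |pdalpha (⇑β) f x - cb β x (jetP m f y)| ≤ (n + 1) ^ k * M * dist x y ^ (k + 1) := by
  intro k
  induction k with
  | zero =>
    intro β hβ x
    have h1 : cb β x (jetP m f y) = pdalpha (⇑β) f y := by
      rw [← cb_jetP (m := m) f y β (by omega), cb, cb,
        coeff_top_tau (jet_jetP m f y) β (by omega) x y]
    rw [h1]; simpa using hl β hβ x y
  | succ k ih =>
    intro β hβ x
    have hf' : ContDiff ℝ (β.degree + 1 : ℕ) f := hf.of_le (by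
      rw [Nat.cast_le]; omega)
    have hM : 0 ≤ (n + 1) ^ k * M * dist x y ^ (k + 1) := by
      by_cases hn : Nonempty (Fin n)
      · obtain ⟨i⟩ := hn
        exact (abs_nonneg _).trans (ih (β + Finsupp.single i 1)
          (by rw [map_add, Finsupp.degree_single]; omega) x)
      · have : x = y := by ext i; exact absurd ⟨i⟩ hn
        subst this; simp
    have hc : ContDiff ℝ 1 (pdalpha (⇑β) f) := by
      apply contDiff_pdalpha
      convert hf' using 2; ring
    have hd : ∀ z, HasFDerivAt (fun x => pdalpha (⇑β) f x - cb β x (jetP m f y))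
        (∑ i, (pdalpha (⇑(β + Finsupp.single i 1 : Fin n →₀ ℕ)) f z -
          cb (β + Finsupp.single i 1) z (jetP m f y)) • (EuclideanSpace.proj i : En n →L[ℝ] ℝ)) z := by
      intro z
      have h1 := ((hc.differentiable (by norm_num)) z).hasFDerivAt
      have h2 := h1.sub (hasFDerivAt_cb (jetP m f y) β z)
      refine hfd_congr h2 rfl ?_
      rw [fderiv_eq_sum, ← Finset.sum_sub_distrib]
      refine Finset.sum_congr rfl fun i _ => ?_
      rw [pdalpha_succ β i hf', sub_smul]
    have hmv := (convex_segment (𝕜 := ℝ) y x).norm_image_sub_le_of_norm_hasFDerivWithin_le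
      (C := n * ((n + 1) ^ k * M * dist x y ^ (k + 1)))
      (fun z _ => (hd z).hasFDerivWithinAt) (fun z hz => by
        apply norm_sum_proj_le
        intro i
        refine (ih (β + Finsupp.single i 1)
          (by rw [map_add, Finsupp.degree_single]; omega) z).trans ?_
        have hzd : dist z y ≤ dist x y := by
          obtain ⟨t, ht, rfl⟩ := (segment_eq_image_lineMap ℝ y x) ▸ hz
          rw [dist_lineMap_left, Real.norm_eq_abs, abs_of_nonneg ht.1, dist_comm x y]
          exact mul_le_of_le_one_left dist_nonneg ht.2
        by_cases hxy : dist x y = 0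
        · have : dist z y = 0 := le_antisymm (hxy ▸ hzd) dist_nonneg
          rw [this, hxy]
        · have : 0 < dist x y := lt_of_le_of_ne dist_nonneg (Ne.symm hxy)
          have hM' : 0 ≤ (n + 1) ^ k * M := by
            by_contra h
            push Not at h
            have := mul_neg_of_neg_of_pos h (pow_pos this (k+1))
            linarith
          gcongr)
      (left_mem_segment ℝ y x) (right_mem_segment ℝ y x)
    have h0 : pdalpha (⇑β) f y - cb β y (jetP m f y) = 0 := by
      rw [cb_jetP f y β (by omega), sub_self]
    rw [h0, sub_zero, Real.norm_eq_abs, ← dist_eq_norm] at hmv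
    refine hmv.trans ?_
    calc _ = (n : ℝ) * (((n + 1) ^ k * M * dist x y ^ (k + 1)) * dist x y) := by ring
      _ ≤ (n + 1) * (((n + 1) ^ k * M * dist x y ^ (k + 1)) * dist x y) := by
        gcongr; linarith
      _ = _ := by ring

lemma coeff_le_cb (β : Fin n →₀ ℕ) (x : En n) (p : Poly n) : |coeff β (tau x p)| ≤ |cb β x p| := by
  rw [cb, abs_mul, abs_of_pos (bf_pos β)]
  exact le_mul_of_one_le_left (abs_nonneg _) (one_le_bf β)

lemma N_jetP_le {m : ℕ} {f : En n → ℝ} {M : ℝ}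
    (hb : ∀ β : Fin n →₀ ℕ, β.degree < m → ∀ x, |pdalpha (⇑β) f x| ≤ M) (x : En n) :
    N x 1 (jetP m f x) ≤ (Bm n m).card * M := by
  unfold N
  rw [((jet_jetP m f x).tau x).Nw_eq]
  rw [← nsmul_eq_mul]
  apply Finset.sum_le_card_nsmul
  intro β hβ
  rw [mem_Bm] at hβ
  rw [one_pow, mul_one]
  refine (coeff_le_cb _ _ _).trans ?_
  rw [cb_jetP f x β hβ]; exact hb β hβ x

lemma N_jetP_sub_le {m : ℕ} {f : En n → ℝ} {M : ℝ} (hM : 0 ≤ M) (hf : ContDiff ℝ (m - 1 : ℕ) f)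
    (hl : ∀ β : Fin n →₀ ℕ, β.degree + 1 = m → ∀ x y,
      |pdalpha (⇑β) f x - pdalpha (⇑β) f y| ≤ M * dist x y) (x y : En n) :
    N x (dist x y) (jetP m f x - jetP m f y) ≤ (Bm n m).card * ((n + 1) ^ m * M) * dist x y ^ m := by
  unfold N
  rw [(((jet_jetP m f x).sub (jet_jetP m f y)).tau x).Nw_eq]
  rw [mul_assoc, ← nsmul_eq_mul]
  apply Finset.sum_le_card_nsmul
  intro β hβ
  rw [mem_Bm] at hβ
  have h1 := taylor hf hl y (m - 1 - β.degree) β (by omega) x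
  rw [← cb_jetP (m := m) f x β hβ, ← cb_sub] at h1
  have h2 := (coeff_le_cb _ _ _).trans h1
  calc _ ≤ ((n + 1) ^ (m - 1 - β.degree) * M * dist x y ^ (m - 1 - β.degree + 1)) *
        dist x y ^ β.degree := by gcongr
    _ = ((n + 1) ^ (m - 1 - β.degree) * M) * dist x y ^ m := by
      rw [mul_assoc, ← pow_add]; congr 2; omega
    _ ≤ _ := by
      gcongr
      · linarith [show (0:ℝ) ≤ n from Nat.cast_nonneg n]
      · omega

/-- function to field -/
theorem fun_to_field (m n D : ℕ) (hm : 1 ≤ m) : ∃ C : ℝ, 1 ≤ C ∧ ∀ (F : En n → Fin D → ℝ) (M : ℝ),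
    0 ≤ M → ContDiff ℝ (m - 1 : ℕ) F → Cm11LE m F M →
    ∃ P : En n → VP n D, Fld m Set.univ P (C * M) ∧ (∀ x, NV x 1 (P x) ≤ C * M) ∧
      ∀ x, ev x (P x) = F x := by
  set C1 : ℝ := D * ((Bm n m).card * (n + 1) ^ m) with hC1
  have hn1 : (1 : ℝ) ≤ (n + 1) ^ m := one_le_pow₀ (by linarith [show (0:ℝ) ≤ n from Nat.cast_nonneg n])
  refine ⟨C1 + 1, by have : 0 ≤ C1 := by positivity
                     linarith, ?_⟩
  intro F M hM hF hc
  have hFj : ∀ j, ContDiff ℝ (m - 1 : ℕ) (fun y => F y j) := fun j => contDiff_pi.mp hF j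
  have hb : ∀ j, ∀ β : Fin n →₀ ℕ, β.degree < m → ∀ x, |pdalpha (⇑β) (fun y => F y j) x| ≤ M := by
    intro j β hβ x
    exact hc.1 β (by rw [← degree_eq]; omega) x j
  have hl : ∀ j, ∀ β : Fin n →₀ ℕ, β.degree + 1 = m → ∀ x y,
      |pdalpha (⇑β) (fun y => F y j) x - pdalpha (⇑β) (fun y => F y j) y| ≤ M * dist x y := by
    intro j β hβ x y
    exact hc.2 β (by rw [← degree_eq]; omega) j x y
  refine ⟨fun x j => jetP m (fun y => F y j) x, ⟨fun x _ j => jet_jetP _ _ _, ?_⟩, ?_, ?_⟩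
  · intro x _ y _
    unfold NV
    calc _ ≤ ∑ j : Fin D, (Bm n m).card * ((n + 1) ^ m * M) * dist x y ^ m :=
          Finset.sum_le_sum fun j _ => N_jetP_sub_le hM (hFj j) (hl j) x y
      _ = C1 * M * dist x y ^ m := by simp [hC1]; ring
      _ ≤ _ := by gcongr; linarith
  · intro x
    unfold NV
    calc _ ≤ ∑ j : Fin D, (Bm n m).card * M :=
          Finset.sum_le_sum fun j _ => N_jetP_le (hb j) x
      _ = D * ((Bm n m).card * 1) * M := by simp; ring
      _ ≤ C1 * M := by rw [hC1]; gcongr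
      _ ≤ _ := by gcongr; linarith
  · intro x
    ext j
    have := cb_jetP (m := m) (fun y => F y j) x 0 (by simp; omega)
    rw [pdalpha_zero, cb, bf_zero, one_mul] at this
    exact this

end FP
end

section
namespace FP
open MvPolynomial
variable {n D : ℕ}

section
variable {m : ℕ} {p : En n → Poly n} {M : ℝ}

lemma cb_field_sub_le (hd : ∀ x y, N x (dist x y) (p x - p y) ≤ M * dist x y ^ m)
    (β : Fin n →₀ ℕ) (hβ : β.degree < m) (x y : En n) :
    |cb β x (p x - p y)| ≤ bf β * M * dist x y ^ (m - β.degree) := by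
  rcases eq_or_ne x y with rfl | hxy
  · have : m - β.degree ≠ 0 := by omega
    simp [cb, this]
  · have hd0 : 0 < dist x y := dist_pos.mpr hxy
    have h1 := (coeff_le_Nw hd0.le (tau x (p x - p y)) β).trans (hd x y)
    have h2 : |coeff β (tau x (p x - p y))| ≤ M * dist x y ^ (m - β.degree) := by
      have e : dist x y ^ m = dist x y ^ (m - β.degree) * dist x y ^ β.degree := by
        rw [← pow_add]; congr 1; omega
      rw [e, ← mul_assoc] at h1
      exact le_of_mul_le_mul_right h1 (by positivity)
    rw [cb, abs_mul, abs_of_pos (bf_pos β), mul_assoc]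
    exact mul_le_mul_of_nonneg_left h2 (bf_pos β).le

lemma hasFDerivAt_field (hd : ∀ x y, N x (dist x y) (p x - p y) ≤ M * dist x y ^ m)
    (β : Fin n →₀ ℕ) (hβ : β.degree + 1 < m) (x : En n) :
    HasFDerivAt (fun x => cb β x (p x))
      (∑ i, (cb (β + Finsupp.single i 1) x (p x)) •
        (EuclideanSpace.proj i : En n →L[ℝ] ℝ)) x := by
  have h1 := hasFDerivAt_cb (p x) β x
  have h2 : HasFDerivAt (fun y => cb β y (p y - p x)) (0 : En n →L[ℝ] ℝ) x := by
    apply Asymptotics.IsBigO.hasFDerivAt (n := m - β.degree) _ (by omega)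
    apply Asymptotics.IsBigO.of_bound (bf β * M)
    filter_upwards with y
    rw [norm_pow, norm_norm, ← dist_eq_norm, Real.norm_eq_abs]
    exact cb_field_sub_le hd β (by omega) y x
  refine hfd_congr (h1.add h2) ?_ (by simp)
  ext y
  simp [cb_sub]

lemma contDiff_field (hp : ∀ x, Jet m (p x))
    (hd : ∀ x y, N x (dist x y) (p x - p y) ≤ M * dist x y ^ m) :
    ∀ k : ℕ, ∀ β : Fin n →₀ ℕ, β.degree + 1 + k = m → ContDiff ℝ k (fun x => cb β x (p x)) := by
  intro k
  induction k with
  | zero =>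
    intro β hβ
    rw [Nat.cast_zero, contDiff_zero]
    have hLip : ∀ x y, |cb β x (p x) - cb β y (p y)| ≤ bf β * M * dist x y := by
      intro x y
      have h1 := cb_field_sub_le hd β (by omega) x y
      have e : m - β.degree = 1 := by omega
      rw [e, pow_one, cb_sub] at h1
      have : cb β x (p y) = cb β y (p y) := by
        rw [cb, cb, coeff_top_tau (hp y) β (by omega) x y]
      rwa [this] at h1
    have hL : LipschitzWith (Real.toNNReal (bf β * M)) (fun x => cb β x (p x)) := by
      apply LipschitzWith.of_dist_le_mul
      intro x y
      rw [Real.dist_eq]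
      refine (hLip x y).trans ?_
      gcongr
      exact Real.le_coe_toNNReal _
    exact hL.continuous
  | succ k ih =>
    intro β hβ
    have hD := hasFDerivAt_field hd β (by omega)
    push_cast
    rw [contDiff_succ_iff_hasFDerivAt]
    refine ⟨_, ?_, hD⟩
    apply ContDiff.sum
    intro i _
    have := ih (β + Finsupp.single i 1) (by rw [map_add, Finsupp.degree_single]; omega)
    exact this.fun_smul contDiff_const

lemma pdL_field (hd : ∀ x y, N x (dist x y) (p x - p y) ≤ M * dist x y ^ m) (l : List (Fin n))
    (hl : l.length < m) : ∃ β : Fin n →₀ ℕ, β.degree = l.length ∧ (∀ i, β i = l.count i) ∧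
      pdL l (fun x => cb 0 x (p x)) = fun x => cb β x (p x) := by
  induction l with
  | nil => exact ⟨0, by simp, by simp, rfl⟩
  | cons a l ih =>
    obtain ⟨β, h1, h2, h3⟩ := ih (by simp at hl; omega)
    refine ⟨β + Finsupp.single a 1, by simp [h1], ?_, ?_⟩
    · intro i
      rw [List.count_cons]
      simp [h2, Finsupp.single_apply]
    · rw [pdL, h3]
      ext x
      rw [pd1, (hasFDerivAt_field hd β (by rw [h1]; simpa using hl) x).fderiv]
      simp [Finset.sum_apply, Pi.single_apply]

lemma pdalpha_field (hd : ∀ x y, N x (dist x y) (p x - p y) ≤ M * dist x y ^ m)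
    (α : Fin n → ℕ) (hα : ∑ i, α i < m) :
    ∃ β : Fin n →₀ ℕ, β.degree = ∑ i, α i ∧
      pdalpha α (fun x => cb 0 x (p x)) = fun x => cb β x (p x) := by
  rw [pdalpha_eq]
  obtain ⟨β, h1, _, h3⟩ := pdL_field hd (Lw α) (by rwa [length_Lw])
  exact ⟨β, by rw [h1, length_Lw], h3⟩
end

lemma exists_bf_bound (n m : ℕ) : ∃ B : ℝ, 1 ≤ B ∧ ∀ β : Fin n →₀ ℕ, β.degree < m → bf β ≤ B := by
  refine ⟨1 + ∑ β ∈ Bm n m, bf β, ?_, ?_⟩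
  · have := Finset.sum_nonneg (s := Bm n m) fun β _ => (bf_pos β).le
    linarith
  · intro β hβ
    have := Finset.single_le_sum (f := bf) (fun β _ => (bf_pos β).le) (mem_Bm.mpr hβ)
    linarith

theorem field_to_fun (m n D : ℕ) (hm : 1 ≤ m) : ∃ C : ℝ, 1 ≤ C ∧ ∀ (P : En n → VP n D) (M : ℝ),
    0 ≤ M → Fld m Set.univ P M → (∀ x, NV x 1 (P x) ≤ M) →
    ContDiff ℝ (m - 1 : ℕ) (fun x => ev x (P x)) ∧ Cm11LE m (fun x => ev x (P x)) (C * M) := by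
  obtain ⟨B, hB, hbf⟩ := exists_bf_bound n m
  refine ⟨B, hB, ?_⟩
  intro P M hM hF hb
  have hd : ∀ j, ∀ x y, N x (dist x y) (P x j - P y j) ≤ M * dist x y ^ m := by
    intro j x y
    refine le_trans ?_ (hF.2 x trivial y trivial)
    exact Finset.single_le_sum (f := fun j => N x (dist x y) ((P x - P y) j))
      (fun j _ => N_nonneg dist_nonneg _) (Finset.mem_univ j)
  have hb' : ∀ j x, N x 1 (P x j) ≤ M := by
    intro j x
    refine le_trans ?_ (hb x)
    exact Finset.single_le_sum (f := fun j => N x 1 (P x j))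
      (fun j _ => N_nonneg zero_le_one _) (Finset.mem_univ j)
  have e : ∀ j, (fun x => ev x (P x) j) = fun x => cb 0 x (P x j) := by
    intro j; ext x; simp [cb, ev1_apply]
  refine ⟨?_, ?_, ?_⟩
  · rw [contDiff_pi]
    intro j
    rw [e]
    exact contDiff_field (fun x => hF.1 x trivial j) (hd j) (m - 1) 0 (by simp; omega)
  · intro α hα x j
    obtain ⟨β, h1, h2⟩ := pdalpha_field (hd j) α (by omega)
    rw [e, h2]
    have h3 := (coeff_le_Nw zero_le_one (tau x (P x j)) β).trans (hb' j x)
    rw [one_pow, mul_one] at h3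
    simp only [cb, abs_mul, abs_of_pos (bf_pos β)]
    exact mul_le_mul (hbf β (by omega)) h3 (abs_nonneg _) (by linarith)
  · intro α hα j x y
    obtain ⟨β, h1, h2⟩ := pdalpha_field (hd j) α (by omega)
    rw [e, h2]
    have h3 := cb_field_sub_le (hd j) β (by omega) x y
    have e : m - β.degree = 1 := by omega
    rw [e, pow_one, cb_sub] at h3
    have : cb β x (P y j) = cb β y (P y j) := by
      rw [cb, cb, coeff_top_tau (hF.1 y trivial j) β (by omega) x y]
    rw [this] at h3
    refine h3.trans ?_
    gcongr
    exact hbf β (by omega)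

end FP
end

section
namespace FP
open MvPolynomial
variable {n D : ℕ}

/-- scalar Whitney field at scale s -/
structure SFld (m : ℕ) (s B : ℝ) (θ : En n → Poly n) : Prop where
  jet : ∀ z, Jet m (θ z)
  bd : ∀ z, N z s (θ z) ≤ B
  diff : ∀ z w, N z (dist z w) (θ z - θ w) ≤ B * (dist z w / s) ^ m
  nonneg : ∀ z, 0 ≤ ev1 z (θ z)
  le_one : ∀ z, ev1 z (θ z) ≤ 1

lemma pd1_congr {f g : En n → ℝ} {z : En n} (h : f =ᶠ[nhds z] g) (i : Fin n) :
    pd1 i f =ᶠ[nhds z] pd1 i g := by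
  have := h.fderiv (𝕜 := ℝ)
  filter_upwards [this] with y hy
  simp [pd1, hy]

lemma pdL_congr {f g : En n → ℝ} {z : En n} (h : f =ᶠ[nhds z] g) (l : List (Fin n)) :
    pdL l f =ᶠ[nhds z] pdL l g := by
  induction l with
  | nil => exact h
  | cons a l ih => exact pd1_congr ih a

lemma jetP_congr {m : ℕ} {f g : En n → ℝ} {z : En n} (h : f =ᶠ[nhds z] g) :
    jetP m f z = jetP m g z := by
  unfold jetP
  congr 1
  refine Finset.sum_congr rfl fun β _ => ?_
  rw [pdalpha_eq, pdalpha_eq, (pdL_congr h _).eq_of_nhds]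

lemma pdL_const (c : ℝ) (i : Fin n) (l : List (Fin n)) : pdL (i :: l) (fun _ : En n => c) = 0 := by
  induction l generalizing i with
  | nil => ext x; simp [pdL, pd1]
  | cons a l ih =>
    rw [pdL, ih]
    ext x
    simp only [pd1, Pi.zero_apply]
    have : fderiv ℝ (0 : En n → ℝ) x = 0 := by simp
    rw [this]; rfl

lemma jetP_const {m : ℕ} (hm : 1 ≤ m) (c : ℝ) (z : En n) : jetP m (fun _ => c) z = C c := by
  unfold jetP
  have : ∀ β ∈ Bm n m, β ≠ 0 → monomial β (pdalpha (⇑β) (fun _ : En n => c) z / bf β) = 0 := by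
    intro β _ h0
    rw [pdalpha_eq]
    have hl : Lw (⇑β) ≠ [] := by
      intro h
      have := length_Lw (⇑β)
      rw [h, ← degree_eq] at this
      simp at this
      exact h0 ((Finsupp.degree_eq_zero_iff β).mp this.symm)
    obtain ⟨i, l, hil⟩ := List.exists_cons_of_ne_nil hl
    rw [hil, pdL_const]; simp
  rw [Finset.sum_eq_single 0 this]
  · rw [pdalpha_zero]; simp
  · intro h; simp at h; omega

lemma exists_bump (m n : ℕ) (hm : 1 ≤ m) : ∃ B : ℝ, 1 ≤ B ∧ ∃ φ : En n → Poly n, SFld m 1 B φ ∧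
    (∀ z, ‖z‖ ≤ 1 → φ z = 1) ∧ ∀ z, 2 ≤ ‖z‖ → φ z = 0 := by
  let f : ContDiffBump (0 : En n) := ⟨5/4, 7/4, by norm_num, by norm_num⟩
  have hsm : ∀ k : ℕ, ContDiff ℝ k f := fun k => f.contDiff
  have hcs : ∀ l : List (Fin n), HasCompactSupport (pdL l f) := by
    intro l
    induction l with
    | nil => exact f.hasCompactSupport
    | cons a l ih => exact ih.fderiv_apply (𝕜 := ℝ) _
  have hsm' : ∀ (l : List (Fin n)) (k : ℕ), ContDiff ℝ k (pdL l f) := fun l k =>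
    contDiff_pdL l (hsm _)
  have hb : ∀ l : List (Fin n), ∃ M : ℝ, 0 ≤ M ∧ (∀ x, |pdL l f x| ≤ M) ∧
      ∀ x y, |pdL l f x - pdL l f y| ≤ M * dist x y := by
    intro l
    obtain ⟨M1, h1⟩ := (hcs l).exists_bound_of_continuous (hsm' l 0).continuous
    obtain ⟨K, hK⟩ := (hsm' l 1).lipschitzWith_of_hasCompactSupport (hcs l) (by norm_num)
    refine ⟨max M1 K, le_max_of_le_right K.2, fun x => (h1 x).trans (le_max_left _ _), ?_⟩
    intro x y
    have := hK.dist_le_mul x y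
    rw [Real.dist_eq] at this
    refine this.trans ?_
    gcongr; exact le_max_right _ _
  choose M hM0 hM1 hM2 using hb
  set MM : ℝ := ∑ β ∈ Bm n m, M (Lw (⇑β)) with hMM
  have hMle : ∀ β : Fin n →₀ ℕ, β.degree < m → M (Lw (⇑β)) ≤ MM := by
    intro β hβ
    exact Finset.single_le_sum (f := fun β : Fin n →₀ ℕ => M (Lw (⇑β)))
      (fun β _ => hM0 _) (mem_Bm.mpr hβ)
  have hMM0 : 0 ≤ MM := Finset.sum_nonneg fun β _ => hM0 _
  have hn1 : (1 : ℝ) ≤ (n + 1) ^ m := one_le_pow₀ (by linarith [show (0:ℝ) ≤ n from Nat.cast_nonneg n])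
  have hb1 : ∀ β : Fin n →₀ ℕ, β.degree < m → ∀ x, |pdalpha (⇑β) f x| ≤ MM := by
    intro β hβ x; rw [pdalpha_eq]; exact (hM1 _ x).trans (hMle β hβ)
  have hb2 : ∀ β : Fin n →₀ ℕ, β.degree + 1 = m → ∀ x y,
      |pdalpha (⇑β) f x - pdalpha (⇑β) f y| ≤ MM * dist x y := by
    intro β hβ x y; rw [pdalpha_eq]
    refine (hM2 _ x y).trans ?_
    gcongr; exact hMle β (by omega)
  have hev : ∀ z, ev1 z (jetP m f z) = f z := by
    intro z
    have := cb_jetP (m := m) f z 0 (by simp; omega)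
    rw [pdalpha_zero, cb, bf_zero, one_mul] at this
    exact this
  set C1 : ℝ := (Bm n m).card * ((n + 1) ^ m * MM) with hC1
  have hC1' : 0 ≤ C1 := by positivity
  refine ⟨C1 + 1, by linarith, jetP m f, ⟨fun z => jet_jetP _ _ _, ?_, ?_, ?_, ?_⟩, ?_, ?_⟩
  · intro z
    refine (N_jetP_le hb1 z).trans ?_
    have : ((Bm n m).card : ℝ) * MM ≤ C1 := by
      rw [hC1]; gcongr; exact le_mul_of_one_le_left hMM0 hn1
    linarith
  · intro z w
    refine (N_jetP_sub_le hMM0 (hsm _) hb2 z w).trans ?_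
    rw [div_one]; gcongr; linarith
  · intro z; rw [hev]; exact f.nonneg
  · intro z; rw [hev]; exact f.le_one
  · intro z hz
    have : f =ᶠ[nhds z] fun _ => (1 : ℝ) := by
      have : Metric.ball (0 : En n) (5/4) ∈ nhds z := Metric.isOpen_ball.mem_nhds (by
        rw [mem_ball_zero_iff]; linarith)
      filter_upwards [this] with y hy
      exact f.one_of_mem_closedBall (Metric.ball_subset_closedBall hy)
    rw [jetP_congr this, jetP_const hm]; simp
  · intro z hz
    have : f =ᶠ[nhds z] fun _ => (0 : ℝ) := by
      have : (Metric.closedBall (0 : En n) (7/4))ᶜ ∈ nhds z :=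
        Metric.isClosed_closedBall.isOpen_compl.mem_nhds (by
        rw [Set.mem_compl_iff, mem_closedBall_zero_iff]; linarith)
      filter_upwards [this] with y hy
      apply f.zero_of_le_dist
      rw [Set.mem_compl_iff, Metric.mem_closedBall] at hy
      exact (not_le.mp hy).le
    rw [jetP_congr this, jetP_const hm]; simp

/-- dilation -/
def dil (a : En n) (s : ℝ) : Poly n →ₐ[ℝ] Poly n := aeval (fun i => C (1 / s) * (X i - C (a i)))

lemma tau_dil (a z : En n) {s : ℝ} (hs : s ≠ 0) (p : Poly n) :
    tau z (dil a s p) = dil 0 s (tau (s⁻¹ • (z - a)) p) := by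
  have : (tau z).comp (dil a s) = (dil 0 s).comp (tau (s⁻¹ • (z - a))) := by
    apply MvPolynomial.algHom_ext
    intro i
    simp [AlgHom.comp_apply, dil, ← algebraMap_eq]
    simp [algebraMap_eq]
    ring
  exact DFunLike.congr_fun this p

lemma Nw_dil_le {s δ : ℝ} (hs : 0 < s) (hδ : 0 ≤ δ) (p : Poly n) :
    Nw δ (dil 0 s p) ≤ Nw (δ / s) p := by
  apply Nw_aeval_le hδ
  intro i
  simp only [PiLp.zero_apply, map_zero, sub_zero]
  rw [Nw_C_mul, Nw_X, abs_of_pos (by positivity)]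
  apply le_of_eq; field_simp

lemma N_dil_le {s δ : ℝ} (hs : 0 < s) (hδ : 0 ≤ δ) (a z : En n) (p : Poly n) :
    N z δ (dil a s p) ≤ N (s⁻¹ • (z - a)) (δ / s) p := by
  unfold N
  rw [tau_dil a z hs.ne']
  exact Nw_dil_le hs hδ _

lemma jet_dil {m : ℕ} (a : En n) (s : ℝ) {p : Poly n} (hp : Jet m p) : Jet m (dil a s p) := by
  intro β hβ
  rw [dil, aeval_def, eval₂_eq, coeff_sum]
  apply Finset.sum_eq_zero
  intro γ hγ
  have hγ' := mem_Bm.mp (hp.support_sub hγ)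
  rw [algebraMap_eq, coeff_C_mul]
  have hdeg : (∏ i ∈ γ.support, (C (1 / s) * (X i - C (a i)) : Poly n) ^ γ i).totalDegree ≤ γ.degree := by
    refine (totalDegree_finsetProd _ _).trans ?_
    rw [Finsupp.degree_apply]
    apply Finset.sum_le_sum
    intro i _
    refine (totalDegree_pow _ _).trans ?_
    have : (C (1 / s) * (X i - C (a i)) : Poly n).totalDegree ≤ 1 := by
      refine (totalDegree_mul _ _).trans ?_
      rw [totalDegree_C, zero_add]
      refine (totalDegree_sub _ _).trans ?_
      simp
    nlinarith
  have : coeff β (∏ i ∈ γ.support, (C (1 / s) * (X i - C (a i)) : Poly n) ^ γ i) = 0 := by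
    apply coeff_eq_zero_of_totalDegree_lt
    have : ∑ i ∈ β.support, β i = β.degree := rfl
    omega
  rw [this, mul_zero]

lemma ev1_dil (a z : En n) {s : ℝ} (hs : s ≠ 0) (p : Poly n) :
    ev1 z (dil a s p) = ev1 (s⁻¹ • (z - a)) p := by
  rw [ev1_apply, tau_dil a z hs, ev1_apply]
  generalize tau (s⁻¹ • (z - a)) p = q
  have : ((constantCoeff (R := ℝ) (σ := Fin n))).comp (dil (0 : En n) s).toRingHom = constantCoeff := by
    apply MvPolynomial.ringHom_ext
    · intro r; simp [dil]
    · intro i; simp [dil]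
  exact DFunLike.congr_fun this q

lemma exists_bump_scaled (m n : ℕ) (hm : 1 ≤ m) : ∃ B : ℝ, 1 ≤ B ∧ ∀ (a : En n) (s : ℝ), 0 < s →
    ∃ φ : En n → Poly n, SFld m s B φ ∧
    (∀ z, dist z a ≤ s → φ z = 1) ∧ ∀ z, 2 * s ≤ dist z a → φ z = 0 := by
  obtain ⟨B, hB, φ, hφ, h1, h0⟩ := exists_bump m n hm
  refine ⟨B, hB, fun a s hs => ⟨fun z => dil a s (φ (s⁻¹ • (z - a))), ⟨?_, ?_, ?_, ?_, ?_⟩, ?_, ?_⟩⟩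
  · intro z; exact jet_dil _ _ (hφ.jet _)
  · intro z
    refine (N_dil_le hs hs.le _ _ _).trans ?_
    rw [div_self hs.ne']; exact hφ.bd _
  · intro z w
    rw [← map_sub]
    refine (N_dil_le hs dist_nonneg _ _ _).trans ?_
    have e : dist z w / s = dist (s⁻¹ • (z - a)) (s⁻¹ • (w - a)) := by
      rw [dist_smul₀, dist_sub_right, norm_inv, Real.norm_eq_abs, abs_of_pos hs]; ring
    rw [e]
    simpa using hφ.diff (s⁻¹ • (z - a)) (s⁻¹ • (w - a))
  · intro z; rw [ev1_dil _ _ hs.ne']; exact hφ.nonneg _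
  · intro z; rw [ev1_dil _ _ hs.ne']; exact hφ.le_one _
  · intro z hz
    show dil a s (φ (s⁻¹ • (z - a))) = 1
    rw [h1, map_one]
    rw [norm_smul, norm_inv, Real.norm_eq_abs, abs_of_pos hs, ← dist_eq_norm, inv_mul_le_iff₀ hs]
    linarith
  · intro z hz
    show dil a s (φ (s⁻¹ • (z - a))) = 0
    rw [h0, map_zero]
    rw [norm_smul, norm_inv, Real.norm_eq_abs, abs_of_pos hs, ← dist_eq_norm, le_inv_mul_iff₀ hs]
    linarith

lemma card_sep_le (n : ℕ) (L : ℝ) : ∃ K : ℕ, ∀ (T : Finset (En n)) (z : En n) (t : ℝ), 0 < t →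
    (∀ a ∈ T, dist a z ≤ L * t) → (∀ a ∈ T, ∀ b ∈ T, a ≠ b → t < dist a b) → T.card ≤ K := by
  obtain ⟨s, -, hsf, hs⟩ := Metric.finite_approx_of_totallyBounded
    (isCompact_closedBall (0 : En n) L).totallyBounded (1/2) (by norm_num)
  refine ⟨hsf.toFinset.card, ?_⟩
  intro T z t ht h1 h2
  have key : ∀ a ∈ T, ∃ c ∈ s, dist (t⁻¹ • (a - z)) c < 1/2 := by
    intro a ha
    have : t⁻¹ • (a - z) ∈ Metric.closedBall (0 : En n) L := by
      rw [mem_closedBall_zero_iff, norm_smul, norm_inv, Real.norm_eq_abs, abs_of_pos ht,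
        ← dist_eq_norm, inv_mul_le_iff₀ ht, mul_comm]
      exact h1 a ha
    have := hs this
    simpa using this
  choose! f hf1 hf2 using key
  apply Finset.card_le_card_of_injOn f
  · intro a ha; simpa using hf1 a ha
  · intro a ha b hb hab
    by_contra hne
    have h3 := h2 a ha b hb hne
    have h4 := hf2 a ha
    have h5 := hf2 b hb
    rw [← hab] at h5
    have h6 : dist (t⁻¹ • (a - z)) (t⁻¹ • (b - z)) < 1 :=
      (dist_triangle_right _ _ (f a)).trans_lt (by linarith)
    rw [dist_smul₀, dist_sub_right, norm_inv, Real.norm_eq_abs, abs_of_pos ht,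
      inv_mul_lt_iff₀ ht] at h6
    linarith

end FP
end

section
namespace FP
open MvPolynomial
variable {n D : ℕ}

/-- jets: growth at larger scales -/
lemma NV_jet_up {m : ℕ} {z : En n} {Q : VP n D} (hQ : JetV m Q) {r t c : ℝ} (hr : 0 < r)
    (hrt : r ≤ t) (h : NV z r Q ≤ c * r ^ m) : NV z t Q ≤ c * t ^ m := by
  have h1 : 1 ≤ t / r := by rw [le_div_iff₀ hr]; linarith
  have h2 := NV_jet_scale (x := z) hQ hr.le h1
  rw [div_mul_cancel₀ _ hr.ne'] at h2
  refine h2.trans ?_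
  calc (t / r) ^ m * NV z r Q ≤ (t / r) ^ m * (c * r ^ m) := by gcongr
    _ = c * ((t / r) * r) ^ m := by rw [mul_pow]; ring
    _ = c * t ^ m := by rw [div_mul_cancel₀ _ hr.ne']

lemma pair_glue {m : ℕ} {ι : Type*} (I : Finset ι) {z z' : En n} {s B H : ℝ}
    (hs : 0 < s) (hρ : 4 * dist z z' ≤ s) (hB : 0 ≤ B) (_hH : 0 ≤ H)
    (θ θ' : ι → Poly n) (f f' : ι → VP n D) (P : VP n D) (hP : JetV m P)
    (h1 : ∀ i ∈ I, N z s (θ i) ≤ B) (h2 : ∀ i ∈ I, N z s (θ' i) ≤ B)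
    (h3 : ∀ i ∈ I, N z (dist z z') (θ i - θ' i) ≤ B * (dist z z' / s) ^ m)
    (h4 : ∀ i ∈ I, NV z s (f i - P) ≤ H) (h5 : ∀ i ∈ I, NV z s (f' i - P) ≤ H)
    (h6 : ∀ i ∈ I, NV z (dist z z') (f i - f' i) ≤ H * (dist z z' / s) ^ m)
    (hs1 : ∑ i ∈ I, θ i = 1) (hs2 : ∑ i ∈ I, θ' i = 1) :
    NV z (dist z z') (trV m z (∑ i ∈ I, θ i • f i) - trV m z' (∑ i ∈ I, θ' i • f' i))
      ≤ I.card * (B * H * (2 + 4 ^ m)) * (dist z z' / s) ^ m ∧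
    NV z s (trV m z (∑ i ∈ I, θ i • f i) - P) ≤ I.card * (B * H) := by
  set ρ := dist z z' with hρd
  have hρ0 : 0 ≤ ρ := dist_nonneg
  have hρs : ρ ≤ s := by linarith
  set U : VP n D := ∑ i ∈ I, θ i • (f i - P) with hU
  set V : VP n D := ∑ i ∈ I, θ' i • (f' i - P) with hV
  have eU : ∑ i ∈ I, θ i • f i = P + U := by
    rw [hU]; simp only [smul_sub]; rw [Finset.sum_sub_distrib, ← Finset.sum_smul, hs1, one_smul]; abel
  have eV : ∑ i ∈ I, θ' i • f' i = P + V := by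
    rw [hV]; simp only [smul_sub]; rw [Finset.sum_sub_distrib, ← Finset.sum_smul, hs2, one_smul]; abel
  have bU : NV z s U ≤ I.card * (B * H) := by
    refine (NV_sum_le hs.le _ _).trans ?_
    rw [← nsmul_eq_mul]
    refine Finset.sum_le_card_nsmul _ _ _ fun i hi => ?_
    refine (NV_mul_le hs.le _ _).trans ?_
    exact mul_le_mul (h1 i hi) (h4 i hi) (NV_nonneg hs.le _) hB
  have bV : NV z s V ≤ I.card * (B * H) := by
    refine (NV_sum_le hs.le _ _).trans ?_
    rw [← nsmul_eq_mul]
    refine Finset.sum_le_card_nsmul _ _ _ fun i hi => ?_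
    refine (NV_mul_le hs.le _ _).trans ?_
    exact mul_le_mul (h2 i hi) (h5 i hi) (NV_nonneg hs.le _) hB
  have bUV : NV z ρ (U - V) ≤ I.card * (B * H * 2 * (ρ / s) ^ m) := by
    rw [hU, hV, ← Finset.sum_sub_distrib]
    refine (NV_sum_le hρ0 _ _).trans ?_
    rw [← nsmul_eq_mul]
    refine Finset.sum_le_card_nsmul _ _ _ fun i hi => ?_
    have e : θ i • (f i - P) - θ' i • (f' i - P)
      = (θ i - θ' i) • (f i - P) + θ' i • (f i - f' i) := by
      simp only [sub_smul, smul_sub]; abel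
    rw [e]
    refine (NV_add_le hρ0 _ _).trans ?_
    have a1 := (NV_mul_le (x := z) hρ0 (θ i - θ' i) (f i - P)).trans
      (mul_le_mul (h3 i hi) ((NV_mono hρ0 hρs _).trans (h4 i hi)) (NV_nonneg hρ0 _) (by positivity))
    have a2 := (NV_mul_le (x := z) hρ0 (θ' i) (f i - f' i)).trans
      (mul_le_mul ((N_mono hρ0 hρs _).trans (h2 i hi)) (h6 i hi) (NV_nonneg hρ0 _) hB)
    linarith
  have bT : NV z ρ (trV m z V - trV m z' V) ≤ (4 * ρ / s) ^ m * (I.card * (B * H)) := by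
    have := NV_tr_tr_le (x := z') (y := z) (ρ := ρ) (δ := s / 2) m V (by rw [dist_comm])
      (by positivity) (by linarith)
    refine this.trans ?_
    have e : 2 * ρ / (s / 2) = 4 * ρ / s := by field_simp; ring
    rw [e]
    gcongr
    exact (NV_shift_le (by positivity) (by linarith) _).trans bV
  refine ⟨?_, ?_⟩
  · rw [eU, eV, map_add, map_add, trV_of_jet _ hP, trV_of_jet _ hP]
    have e : P + trV m z U - (P + trV m z' V) = trV m z (U - V) + (trV m z V - trV m z' V) := by
      rw [map_sub]; abel
    rw [e]
    refine (NV_add_le hρ0 _ _).trans ?_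
    have := (NV_trV_le (x := z) hρ0 m (U - V)).trans bUV
    have e4 : (4 * ρ / s) ^ m = 4 ^ m * (ρ / s) ^ m := by rw [mul_div_assoc, mul_pow]
    rw [e4] at bT
    linarith
  · rw [eU, map_add, trV_of_jet _ hP, add_sub_cancel_left]
    exact (NV_trV_le hs.le _ _).trans bU

lemma N_prod_sub_le {ι : Type*} (T : Finset ι) {z : En n} {ρ b ε : ℝ} (hρ : 0 ≤ ρ) (hb : 1 ≤ b)
    (f g : ι → Poly n) (hf : ∀ i ∈ T, N z ρ (f i) ≤ b) (hg : ∀ i ∈ T, N z ρ (g i) ≤ b)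
    (hd : ∀ i ∈ T, N z ρ (f i - g i) ≤ ε) :
    N z ρ (∏ i ∈ T, f i) ≤ b ^ T.card ∧ N z ρ (∏ i ∈ T, g i) ≤ b ^ T.card ∧
    N z ρ (∏ i ∈ T, f i - ∏ i ∈ T, g i) ≤ T.card * b ^ T.card * ε := by
  induction T using Finset.induction_on with
  | empty => simp
  | insert a T ha ih =>
    obtain ⟨i1, i2, i3⟩ := ih (fun i hi => hf i (by simp [hi])) (fun i hi => hg i (by simp [hi]))
      (fun i hi => hd i (by simp [hi]))
    have hb0 : 0 ≤ b := by linarith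
    have hε : 0 ≤ ε := (N_nonneg hρ _).trans (hd a (by simp))
    rw [Finset.prod_insert ha, Finset.prod_insert ha, Finset.card_insert_of_notMem ha, pow_succ]
    have hfa := hf a (by simp)
    have hga := hg a (by simp)
    have hda := hd a (by simp)
    refine ⟨?_, ?_, ?_⟩
    · refine (N_mul_le hρ _ _).trans ?_
      rw [mul_comm (b ^ _)]
      exact mul_le_mul hfa i1 (N_nonneg hρ _) hb0
    · refine (N_mul_le hρ _ _).trans ?_
      rw [mul_comm (b ^ _)]
      exact mul_le_mul hga i2 (N_nonneg hρ _) hb0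
    · have e : f a * ∏ i ∈ T, f i - g a * ∏ i ∈ T, g i
        = (f a - g a) * ∏ i ∈ T, f i + g a * (∏ i ∈ T, f i - ∏ i ∈ T, g i) := by ring
      rw [e]
      refine (N_add_le hρ _ _).trans ?_
      have a1 := (N_mul_le (x := z) hρ (f a - g a) (∏ i ∈ T, f i)).trans
        (mul_le_mul hda i1 (N_nonneg hρ _) hε)
      have a2 := (N_mul_le (x := z) hρ (g a) (∏ i ∈ T, f i - ∏ i ∈ T, g i)).trans
        (mul_le_mul hga i3 (N_nonneg hρ _) hb0)
      have a3 : ε * b ^ T.card ≤ ε * b ^ T.card * b := le_mul_of_one_le_right (by positivity) hb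
      push_cast
      linarith

/-- partition of unity from an ordered product -/
def part {ι : Type*} [LinearOrder ι] (A : Finset ι) (φ : ι → Poly n) (i : ι) : Poly n :=
  φ i * ∏ j ∈ A with j < i, (1 - φ j)

lemma part_sum {ι : Type*} [LinearOrder ι] (A : Finset ι) (φ : ι → Poly n) {i : ι} (hi : i ∈ A)
    (h : φ i = 1) : ∑ i ∈ A, part A φ i = 1 := by
  have := Finset.prod_one_sub_ordered A φ
  have h0 : ∏ i ∈ A, (1 - φ i) = 0 := Finset.prod_eq_zero hi (by rw [h, sub_self])
  rw [h0] at this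
  unfold part
  linear_combination this

lemma part_zero {ι : Type*} [LinearOrder ι] (A : Finset ι) (φ : ι → Poly n) {i : ι} 
    (h : φ i = 0) : part A φ i = 0 := by rw [part, h, zero_mul]

lemma part_nonneg {ι : Type*} [LinearOrder ι] (A : Finset ι) (φ : ι → Poly n) (z : En n)
    (h0 : ∀ i, 0 ≤ ev1 z (φ i)) (h1 : ∀ i, ev1 z (φ i) ≤ 1) (i : ι) : 0 ≤ ev1 z (part A φ i) := by
  rw [part, map_mul, map_prod]
  refine mul_nonneg (h0 i) (Finset.prod_nonneg fun j _ => ?_)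
  rw [map_sub, map_one]; linarith [h1 j]

lemma part_bd {ι : Type*} [LinearOrder ι] (A T : Finset ι) (hT : T ⊆ A) (φ φ' : ι → Poly n)
    {z : En n} {ρ B ε : ℝ} {K : ℕ} (hρ : 0 ≤ ρ) (hB : 1 ≤ B) (hK : T.card ≤ K) (hε : 0 ≤ ε)
    (hz : ∀ i ∈ A, i ∉ T → φ i = 0 ∧ φ' i = 0)
    (h1 : ∀ i ∈ T, N z ρ (φ i) ≤ B) (h2 : ∀ i ∈ T, N z ρ (φ' i) ≤ B)
    (h3 : ∀ i ∈ T, N z ρ (φ i - φ' i) ≤ ε) (i : ι) (hi : i ∈ T) :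
    N z ρ (part A φ i) ≤ (1 + B) ^ (K + 1) ∧ N z ρ (part A φ' i) ≤ (1 + B) ^ (K + 1) ∧
    N z ρ (part A φ i - part A φ' i) ≤ (K + 1) * (1 + B) ^ (K + 1) * ε := by
  set T' := T.filter (· < i)
  have hsub : T' ⊆ A.filter (· < i) := Finset.filter_subset_filter _ hT
  have e1 : part A φ i = φ i * ∏ j ∈ T', (1 - φ j) := by
    rw [part]; congr 1; symm
    apply Finset.prod_subset hsub
    intro j hj hj'
    simp only [T', Finset.mem_filter] at hj hj'
    rw [(hz j hj.1 (fun h => hj' ⟨h, hj.2⟩)).1, sub_zero]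
  have e2 : part A φ' i = φ' i * ∏ j ∈ T', (1 - φ' j) := by
    rw [part]; congr 1; symm
    apply Finset.prod_subset hsub
    intro j hj hj'
    simp only [T', Finset.mem_filter] at hj hj'
    rw [(hz j hj.1 (fun h => hj' ⟨h, hj.2⟩)).2, sub_zero]
  have hT'T : T' ⊆ T := Finset.filter_subset _ _
  have hT'K : T'.card ≤ K := (Finset.card_le_card hT'T).trans hK
  have hb : (1:ℝ) ≤ 1 + B := by linarith
  obtain ⟨p1, p2, p3⟩ := N_prod_sub_le T' (z := z) hρ hb (fun j => 1 - φ j) (fun j => 1 - φ' j)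
    (ε := ε)
    (fun j hj => (N_sub_le hρ _ _).trans (by rw [N_one]; linarith [h1 j (hT'T hj)]))
    (fun j hj => (N_sub_le hρ _ _).trans (by rw [N_one]; linarith [h2 j (hT'T hj)]))
    (fun j hj => by
      have : (1 - φ j - (1 - φ' j)) = φ' j - φ j := by ring
      rw [this, N_sub_comm]; exact h3 j (hT'T hj))
  have hp : (1 + B) ^ T'.card ≤ (1 + B) ^ K := pow_le_pow_right₀ hb hT'K
  have hp0 : 0 ≤ (1 + B) ^ K := by positivity
  have q1 := h1 i hi
  have q2 := h2 i hi
  have q3 := h3 i hi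
  rw [e1, e2, pow_succ]
  refine ⟨?_, ?_, ?_⟩
  · refine (N_mul_le hρ _ _).trans ?_
    rw [mul_comm (_ ^ _)]
    exact mul_le_mul (by linarith) (p1.trans hp) (N_nonneg hρ _) (by linarith)
  · refine (N_mul_le hρ _ _).trans ?_
    rw [mul_comm (_ ^ _)]
    exact mul_le_mul (by linarith) (p2.trans hp) (N_nonneg hρ _) (by linarith)
  · have e : φ i * ∏ j ∈ T', (1 - φ j) - φ' i * ∏ j ∈ T', (1 - φ' j)
        = (φ i - φ' i) * ∏ j ∈ T', (1 - φ j) +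
          φ' i * (∏ j ∈ T', (1 - φ j) - ∏ j ∈ T', (1 - φ' j)) := by ring
    rw [e]
    refine (N_add_le hρ _ _).trans ?_
    have a1 := (N_mul_le (x := z) hρ (φ i - φ' i) (∏ j ∈ T', (1 - φ j))).trans
      (mul_le_mul q3 (p1.trans hp) (N_nonneg hρ _) hε)
    have p4 : (T'.card : ℝ) * (1 + B) ^ T'.card * ε ≤ K * (1 + B) ^ K * ε := by gcongr
    have a2 := (N_mul_le (x := z) hρ (φ' i) (∏ j ∈ T', (1 - φ j) - ∏ j ∈ T', (1 - φ' j))).trans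
      (mul_le_mul (show _ ≤ 1 + B by linarith) (p3.trans p4) (N_nonneg hρ _) (by linarith))
    have a3 : ε * (1 + B) ^ K ≤ ε * (1 + B) ^ K * (1 + B) :=
      le_mul_of_one_le_right (by positivity) hb
    linarith

lemma exists_sep (E' : Finset (En n)) (r : En n → ℝ) {κ : ℝ} (hκ : 0 < κ) (hκ1 : κ ≤ 1 / 8)
    (hr : ∀ x ∈ E', 0 < r x)
    (hrl : ∀ x ∈ E', ∀ y ∈ E', |r x - r y| ≤ dist x y / 2) :
    ∃ A ⊆ E', (∀ a ∈ A, ∀ b ∈ A, a ≠ b → κ * r a < dist a b) ∧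
      ∀ z ∈ E', ∃ a ∈ A, dist z a ≤ 2 * κ * r a := by
  have hne : (E'.powerset.filter fun A => ∀ a ∈ A, ∀ b ∈ A, a ≠ b → κ * r a < dist a b).Nonempty :=
    ⟨∅, by simp⟩
  obtain ⟨A, hA, hmax⟩ := Finset.exists_max_image _ Finset.card hne
  simp only [Finset.mem_filter, Finset.mem_powerset] at hA hmax
  refine ⟨A, hA.1, hA.2, ?_⟩
  intro z hz
  have hrz := hr z hz
  by_cases hzA : z ∈ A
  · refine ⟨z, hzA, ?_⟩
    rw [dist_self]; positivity
  by_contra hcon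
  push Not at hcon
  have hbig : ∀ a ∈ A, κ * r z < dist z a := by
    intro a ha
    have h1 := hcon a ha
    have h2 := (abs_le.mp (hrl z hz a (hA.1 ha))).2
    have h3 := hr a (hA.1 ha)
    have h4 : κ * r z ≤ κ * (r a + dist z a / 2) := by gcongr; linarith
    have h5 : κ * dist z a ≤ dist z a / 8 := by nlinarith [dist_nonneg (x := z) (y := a)]
    have h6 : 0 < κ * r a := by positivity
    linarith
  have := hmax (insert z A) ⟨Finset.insert_subset hz hA.1, ?_⟩
  · rw [Finset.card_insert_of_notMem hzA] at this; omega
  · intro a ha b hb hab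
    rw [Finset.mem_insert] at ha hb
    rcases ha with rfl | ha <;> rcases hb with rfl | hb
    · exact absurd rfl hab
    · exact hbig b hb
    · have h1 := hcon a ha
      have h3 := hr a (hA.1 ha)
      rw [dist_comm]; nlinarith
    · exact hA.2 a ha b hb hab

set_option maxHeartbeats 2000000 in
theorem glue (m n D : ℕ) (hm : 1 ≤ m) (C0 c3 : ℝ) (hC0 : 0 ≤ C0) (hc3 : 0 < c3) (hc31 : c3 ≤ 1) :
    ∃ C' : ℝ, 0 ≤ C' ∧ ∀ (E' : Finset (En n)) (r : En n → ℝ) (P : En n → VP n D)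
      (F : En n → En n → VP n D),
      (∀ x ∈ E', 0 < r x) → (∀ x ∈ E', ∀ y ∈ E', |r x - r y| ≤ dist x y / 2) →
      (∀ x ∈ E', JetV m (P x)) →
      (∀ a ∈ E', Fld m {z | z ∈ E' ∧ dist a z < c3 * r a} (F a) C0) →
      (∀ a ∈ E', ∀ z ∈ E', dist a z < c3 * r a → NV a (r a) (F a z - P a) ≤ C0 * r a ^ m) →
      (∀ x ∈ E', ∀ y ∈ E', NV x (dist x y + r x) (P x - P y) ≤ C0 * (dist x y + r x) ^ m) →
      ∃ G : En n → VP n D, Fld m (↑E') G C' ∧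
        (∀ x ∈ E', NV x (r x) (G x - P x) ≤ C' * r x ^ m) ∧
        ∀ z ∈ E', ∀ Kz : Set (Fin D → ℝ), Convex ℝ Kz →
          (∀ a ∈ E', dist a z < c3 * r a → ev z (F a z) ∈ Kz) → ev z (G z) ∈ Kz := by
  obtain ⟨B, hB, hbump⟩ := exists_bump_scaled m n hm
  obtain ⟨K, hK⟩ := card_sep_le n 20
  set κ : ℝ := c3 / 8 with hκd
  have hκ : 0 < κ := by positivity
  have hκ1 : κ ≤ 1 / 8 := by rw [hκd]; linarith
  set B' : ℝ := (K + 1) * (1 + B) ^ (K + 1) * B with hB'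
  have hB1 : 1 ≤ (1 + B) ^ (K + 1) := one_le_pow₀ (by linarith)
  have hKp : (1:ℝ) ≤ (K + 1) := by linarith [show (0:ℝ) ≤ K from Nat.cast_nonneg K]
  have hB'' : (1 + B) ^ (K + 1) ≤ B' := by
    rw [hB']
    calc (1 + B) ^ (K + 1) = 1 * (1 + B) ^ (K + 1) * 1 := by ring
      _ ≤ _ := by gcongr
  have hB'0 : 0 ≤ B' := by linarith
  set C1 : ℝ := K * (B' * (2 * C0 * 3 ^ m) * (2 + 4 ^ m)) * (2 / κ) ^ m with hC1
  have hC10 : 0 ≤ C1 := by positivity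
  set L : ℝ := 8 / κ + 2 with hL
  have hL0 : 0 < 8 / κ := by positivity
  set C' : ℝ := (2 * C1 + C0) * L ^ m with hC'
  have hLm : 1 ≤ L ^ m := one_le_pow₀ (by linarith)
  have hC1' : C1 ≤ C' := by
    rw [hC']
    calc C1 ≤ (2 * C1 + C0) * 1 := by linarith
      _ ≤ _ := by gcongr
  refine ⟨C', by linarith, ?_⟩
  intro E' r P F hr hrl hP hF hFP hPP
  obtain ⟨A, hAE, hAsep, hAcov⟩ := exists_sep E' r hκ hκ1 hr hrl
  let _ : LinearOrder (En n) := IsWellOrder.linearOrder WellOrderingRel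
  have hbump' : ∀ a : En n, ∃ φ : En n → Poly n, a ∈ A → (SFld m (2 * κ * r a) B φ ∧
    (∀ z, dist z a ≤ 2 * κ * r a → φ z = 1) ∧ ∀ z, 2 * (2 * κ * r a) ≤ dist z a → φ z = 0) := by
    intro a
    by_cases ha : a ∈ A
    · have := hr a (hAE ha)
      obtain ⟨φ, h⟩ := hbump a (2 * κ * r a) (by positivity)
      exact ⟨φ, fun _ => h⟩
    · exact ⟨0, fun h => absurd h ha⟩
  choose φ hφ using hbump'
  set θ : En n → En n → Poly n := fun z => part A (fun a => φ a z) with hθ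
  set G : En n → VP n D := fun z => trV m z (∑ a ∈ A, θ z a • F a z) with hG
  have hθsum : ∀ z ∈ E', ∑ a ∈ A, θ z a = 1 := by
    intro z hz
    obtain ⟨a, ha, h⟩ := hAcov z hz
    exact part_sum A (fun a => φ a z) ha ((hφ a ha).2.1 z h)
  let T : En n → Finset (En n) := fun z => A.filter fun a => dist a z ≤ 5 * κ * r a
  have hTA : ∀ z, T z ⊆ A := fun z => Finset.filter_subset _ _
  have hTr : ∀ z ∈ E', ∀ a ∈ T z, r a ≤ 2 * r z ∧ r z ≤ 2 * r a ∧ 0 < r a := by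
    intro z hz a ha
    have ha' := Finset.mem_filter.mp ha
    have h1 := hr a (hAE ha'.1)
    have h2 := abs_le.mp (hrl a (hAE ha'.1) z hz)
    have h3 := ha'.2
    have h4 : κ * r a ≤ r a / 8 := by nlinarith
    exact ⟨by linarith, by linarith, h1⟩
  have hTcard : ∀ z ∈ E', (T z).card ≤ K := by
    intro z hz
    have hrz := hr z hz
    apply hK (T z) z (κ * r z / 2) (by positivity)
    · intro a ha
      have h1 := hTr z hz a ha
      have ha' := Finset.mem_filter.mp ha
      have : κ * r a ≤ κ * (2 * r z) := by gcongr; exact h1.1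
      linarith [ha'.2]
    · intro a ha b hb hab
      have h1 := hTr z hz a ha
      have := hAsep a (hTA z ha) b (hTA z hb) hab
      have : κ * r z ≤ κ * (2 * r a) := by gcongr; exact h1.2.1
      linarith
  have hTz : ∀ z ∈ E', ∀ z', dist z z' ≤ κ * r z / 8 → ∀ a ∈ A, a ∉ T z → φ a z' = 0 := by
    intro z hz z' hzz a ha haT
    have h1 : 5 * κ * r a < dist a z := by
      by_contra h
      exact haT (Finset.mem_filter.mpr ⟨ha, not_lt.mp h⟩)
    apply (hφ a ha).2.2 z'
    have h2 := abs_le.mp (hrl a (hAE ha) z hz)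
    have h3 := hr a (hAE ha)
    have h4 : dist a z ≤ dist a z' + dist z z' := dist_triangle_right _ _ _
    rw [dist_comm a z'] at h4
    have h5 : κ * r z ≤ κ * (r a + dist a z / 2) := by gcongr; linarith
    have h6 : κ * dist a z ≤ dist a z / 8 := by nlinarith [dist_nonneg (x := a) (y := z)]
    have h7 : 0 < κ * r a := by positivity
    linarith
  -- main near estimate
  have near : ∀ z ∈ E', ∀ z' ∈ E', dist z z' ≤ κ * r z / 8 →
      NV z (dist z z') (G z - G z') ≤ C1 * dist z z' ^ m ∧
      NV z (r z) (G z - P z) ≤ C1 * r z ^ m := by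
    intro z hz z' hz' hzz
    have hrz := hr z hz
    set ρ := dist z z' with hρ
    have hρ0 : 0 ≤ ρ := dist_nonneg
    set s : ℝ := κ * r z / 2 with hs
    have hs0 : 0 < s := by positivity
    have hz0 : dist z z ≤ κ * r z / 8 := by rw [dist_self]; positivity
    have hact : ∀ a ∈ T z, dist a z < c3 * r a ∧ dist a z' < c3 * r a := by
      intro a ha
      have h1 := hTr z hz a ha
      have ha' := (Finset.mem_filter.mp ha).2
      have h8 : c3 * r a = 8 * (κ * r a) := by rw [hκd]; ring
      have h7 : 0 < κ * r a := mul_pos hκ h1.2.2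
      have h5 : κ * r z ≤ κ * (2 * r a) := by gcongr; exact h1.2.1
      have h4 : dist a z' ≤ dist a z + dist z z' := dist_triangle _ _ _
      constructor <;> linarith
    have eG : ∀ w ∈ E', dist z w ≤ κ * r z / 8 → G w = trV m w (∑ a ∈ T z, θ w a • F a w) := by
      intro w hw hd
      rw [hG]; dsimp only; congr 1; symm
      apply Finset.sum_subset (hTA z)
      intro a ha haT
      rw [hθ]; dsimp only
      rw [part_zero A (fun a => φ a w) (i := a) (hTz z hz w hd a ha haT), zero_smul]
    have eS : ∀ w ∈ E', dist z w ≤ κ * r z / 8 → ∑ a ∈ T z, θ w a = 1 := by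
      intro w hw hd
      rw [← hθsum w hw]
      apply Finset.sum_subset (hTA z)
      intro a ha haT
      rw [hθ]; dsimp only
      rw [part_zero A (fun a => φ a w) (i := a) (hTz z hz w hd a ha haT)]
    have hsa : ∀ a ∈ T z, s + ρ ≤ 2 * κ * r a := by
      intro a ha
      have h1 := hTr z hz a ha
      have h5 : κ * r z ≤ κ * (2 * r a) := by gcongr; exact h1.2.1
      linarith
    have hφb : ∀ a ∈ T z, N z s (φ a z) ≤ B := by
      intro a ha
      exact (N_mono hs0.le (by linarith [hsa a ha]) _).trans ((hφ a (hTA z ha)).1.bd z)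
    have hφb' : ∀ a ∈ T z, N z s (φ a z') ≤ B := by
      intro a ha
      exact (N_shift_le hs0.le (by rw [dist_comm]; exact hsa a ha) _).trans
        ((hφ a (hTA z ha)).1.bd z')
    have hφd : ∀ a ∈ T z, N z ρ (φ a z - φ a z') ≤ B * (ρ / s) ^ m := by
      intro a ha
      refine ((hφ a (hTA z ha)).1.diff z z').trans ?_
      have hss : s ≤ 2 * κ * r a := by linarith [hsa a ha]
      refine mul_le_mul_of_nonneg_left (pow_le_pow_left₀ ?_ ?_ m) (by linarith)
      · exact div_nonneg hρ0 (hs0.le.trans hss)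
      · exact div_le_div_of_nonneg_left hρ0 hs0 hss
    have hzero : ∀ a ∈ A, a ∉ T z → φ a z = 0 ∧ φ a z' = 0 := fun a ha haT =>
      ⟨hTz z hz z hz0 a ha haT, hTz z hz z' hzz a ha haT⟩
    have b1 := fun a ha => part_bd A (T z) (hTA z) (fun a => φ a z) (fun a => φ a z') (z := z)
      (ρ := s) (ε := B + B) hs0.le hB (hTcard z hz) (by linarith) hzero hφb hφb'
      (fun a ha => (N_sub_le hs0.le _ _).trans (add_le_add (hφb a ha) (hφb' a ha))) a ha
    have b2 := fun a ha => part_bd A (T z) (hTA z) (fun a => φ a z) (fun a => φ a z') (z := z)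
      (ρ := ρ) (ε := B * (ρ / s) ^ m) hρ0 hB (hTcard z hz) (by positivity) hzero
      (fun a ha => (N_mono hρ0 (by linarith) _).trans (hφb a ha))
      (fun a ha => (N_mono hρ0 (by linarith) _).trans (hφb' a ha)) hφd a ha
    have hFw : ∀ a ∈ T z, ∀ w ∈ E', dist a w < c3 * r a →
        NV z s (F a w - P z) ≤ 2 * C0 * 3 ^ m * r z ^ m := by
      intro a ha w hw hd
      have h1 := hTr z hz a ha
      have haA := hAE (hTA z ha)
      have ha' := (Finset.mem_filter.mp ha).2
      have h5 : κ * r z ≤ κ * (2 * r a) := by gcongr; exact h1.2.1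
      have h6 : κ * r a ≤ 1 / 8 * r a := mul_le_mul_of_nonneg_right hκ1 h1.2.2.le
      have h7 : κ * r z ≤ 1 / 8 * r z := mul_le_mul_of_nonneg_right hκ1 hrz.le
      have h8 : κ * r a ≤ κ * (2 * r z) := by gcongr; exact h1.1
      refine (NV_tri hs0.le _ (P a) _).trans ?_
      have k1 : NV z s (F a w - P a) ≤ C0 * (3 * r z) ^ m := by
        refine (NV_shift_le (x := a) (δ' := r a) hs0.le (by linarith) _).trans ?_
        refine (hFP a haA w hw hd).trans ?_
        refine mul_le_mul_of_nonneg_left (pow_le_pow_left₀ h1.2.2.le ?_ m) hC0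
        linarith
      have k2 : NV z s (P a - P z) ≤ C0 * (3 * r z) ^ m := by
        rw [NV_sub_comm]
        refine (NV_mono hs0.le (by linarith [dist_nonneg (x := z) (y := a)]) _).trans
          ((hPP z hz a haA).trans ?_)
        refine mul_le_mul_of_nonneg_left (pow_le_pow_left₀ ?_ ?_ m) hC0
        · linarith [dist_nonneg (x := z) (y := a)]
        · rw [dist_comm]; linarith
      rw [mul_pow] at k1 k2
      linarith
    have hH0 : 0 ≤ 2 * C0 * 3 ^ m * r z ^ m := by positivity
    obtain ⟨g1, g2⟩ := pair_glue (m := m) (T z) (z := z) (z' := z') (s := s) (B := B')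
      (H := 2 * C0 * 3 ^ m * r z ^ m) hs0 (by linarith) hB'0 hH0
      (θ z) (θ z') (fun a => F a z) (fun a => F a z') (P z) (hP z hz)
      (fun a ha => (b1 a ha).1.trans hB'') (fun a ha => (b1 a ha).2.1.trans hB'')
      (fun a ha => by
        have := (b2 a ha).2.2
        rw [hB']; rw [← mul_assoc] at this; exact this)
      (fun a ha => hFw a ha z hz (hact a ha).1) (fun a ha => hFw a ha z' hz' (hact a ha).2)
      (fun a ha => by
        have haA := hAE (hTA z ha)
        refine ((hF a haA).2 z ⟨hz, (hact a ha).1⟩ z' ⟨hz', (hact a ha).2⟩).trans ?_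
        have : ρ ^ m = s ^ m * (ρ / s) ^ m := by
          rw [← mul_pow, mul_div_cancel₀ _ hs0.ne']
        rw [this, ← mul_assoc]
        refine mul_le_mul_of_nonneg_right ?_ (by positivity)
        have : s ≤ r z := by
          have h7 : κ * r z ≤ 1 / 8 * r z := mul_le_mul_of_nonneg_right hκ1 hrz.le
          rw [hs]; linarith
        have h3m : (1:ℝ) ≤ 3 ^ m := one_le_pow₀ (by norm_num)
        calc C0 * s ^ m ≤ C0 * r z ^ m := by gcongr
          _ = 1 * C0 * 1 * r z ^ m := by ring
          _ ≤ 2 * C0 * 3 ^ m * r z ^ m := by gcongr; norm_num)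
      (eS z hz hz0) (eS z' hz' hzz)
    rw [← eG z hz hz0, ← eG z' hz' hzz] at g1
    rw [← eG z hz hz0] at g2
    have hcK : ((T z).card : ℝ) ≤ K := by exact_mod_cast hTcard z hz
    have hrs : r z = 2 / κ * s := by rw [hs]; field_simp
    constructor
    · refine g1.trans ?_
      have e1 : (ρ / s) ^ m * r z ^ m = (2 / κ) ^ m * ρ ^ m := by
        rw [← mul_pow, ← mul_pow]; congr 1; rw [hrs]; field_simp
      calc ((T z).card : ℝ) * (B' * (2 * C0 * 3 ^ m * r z ^ m) * (2 + 4 ^ m)) * (ρ / s) ^ m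
          ≤ K * (B' * (2 * C0 * 3 ^ m * r z ^ m) * (2 + 4 ^ m)) * (ρ / s) ^ m := by gcongr
        _ = K * (B' * (2 * C0 * 3 ^ m) * (2 + 4 ^ m)) * ((ρ / s) ^ m * r z ^ m) := by ring
        _ = C1 * ρ ^ m := by rw [e1, hC1]; ring
    · have hj : JetV m (G z - P z) := (jetV_trV _ _ _).sub (hP z hz)
      have h2k : 1 ≤ 2 / κ := by rw [le_div_iff₀ hκ]; linarith
      have := NV_jet_scale (x := z) hj hs0.le h2k
      rw [← hrs] at this
      refine this.trans ?_
      have h4m : (1:ℝ) ≤ 2 + 4 ^ m := by linarith [show (0:ℝ) ≤ 4 ^ m by positivity]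
      calc (2 / κ) ^ m * NV z s (G z - P z)
          ≤ (2 / κ) ^ m * ((T z).card * (B' * (2 * C0 * 3 ^ m * r z ^ m))) := by gcongr
        _ ≤ (2 / κ) ^ m * (K * (B' * (2 * C0 * 3 ^ m * r z ^ m) * (2 + 4 ^ m))) := by
            refine mul_le_mul_of_nonneg_left (mul_le_mul hcK ?_ (by positivity) (by positivity))
              (by positivity)
            exact le_mul_of_one_le_right (by positivity) h4m
        _ = C1 * r z ^ m := by rw [hC1]; ring
  have hGP : ∀ z ∈ E', NV z (r z) (G z - P z) ≤ C1 * r z ^ m := fun z hz =>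
    (near z hz z hz (by rw [dist_self]; have := hr z hz; positivity)).2
  refine ⟨G, ⟨fun x _ => jetV_trV _ _ _, ?_⟩, ?_, ?_⟩
  · intro x hx y hy
    rw [Finset.mem_coe] at hx hy
    by_cases hd : dist x y ≤ κ * r x / 8
    · refine (near x hx y hy hd).1.trans ?_
      gcongr
    · push Not at hd
      set ρ := dist x y with hρ
      have hrx := hr x hx
      have hry := hr y hy
      have hρ0 : 0 < ρ := lt_trans (by positivity) hd
      have h1 : r x ≤ 8 / κ * ρ := by
        rw [div_mul_eq_mul_div, le_div_iff₀ hκ]; linarith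
      have h2 := abs_le.mp (hrl x hx y hy)
      have hLρ : L * ρ = 8 / κ * ρ + 2 * ρ := by rw [hL]; ring
      have hρ8 : 0 < 8 / κ * ρ := by positivity
      have k1 : NV x ρ (G x - P x) ≤ C1 * (L * ρ) ^ m :=
        (NV_mono hρ0.le (by linarith) _).trans
          (NV_jet_up ((jetV_trV _ _ _).sub (hP x hx)) hrx (by linarith) (hGP x hx))
      have k2 : NV x ρ (P x - P y) ≤ C0 * (L * ρ) ^ m := by
        refine (NV_mono hρ0.le (by linarith) _).trans ((hPP x hx y hy).trans ?_)
        gcongr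
        linarith
      have k3 : NV x ρ (P y - G y) ≤ C1 * (L * ρ) ^ m := by
        rw [NV_sub_comm]
        exact (NV_shift_le (x := y) hρ0.le (by rw [dist_comm y x]; linarith) _).trans
          (NV_jet_up ((jetV_trV _ _ _).sub (hP y hy)) hry (by linarith) (hGP y hy))
      have t1 := NV_tri (x := x) hρ0.le (G x) (P x) (G y)
      have t2 := NV_tri (x := x) hρ0.le (P x) (P y) (G y)
      have : C' * ρ ^ m = (2 * C1 + C0) * (L * ρ) ^ m := by rw [hC', mul_pow]; ring
      rw [this]
      linarith
  · intro x hx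
    have := hr x hx
    refine (hGP x hx).trans ?_
    gcongr
  · intro z hz Kz hKz hin
    have hz0 : dist z z ≤ κ * r z / 8 := by rw [dist_self]; have := hr z hz; positivity
    have e1 : ev z (G z) = ∑ a ∈ T z, ev1 z (θ z a) • ev z (F a z) := by
      rw [hG]; dsimp only
      rw [ev_trV hm, map_sum]
      simp_rw [ev_mul]
      symm
      apply Finset.sum_subset (hTA z)
      intro a ha haT
      rw [hθ]; dsimp only
      rw [part_zero A (fun a => φ a z) (i := a) (hTz z hz z hz0 a ha haT), map_zero, zero_smul]
    rw [e1]
    apply hKz.sum_mem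
    · intro a ha
      -- weights nonneg
      rw [hθ]; dsimp only
      rw [part, map_mul, map_prod]
      refine mul_nonneg ((hφ a (hTA z ha)).1.nonneg z) (Finset.prod_nonneg fun j hj => ?_)
      rw [map_sub, map_one]
      linarith [(hφ j (Finset.mem_filter.mp hj).1).1.le_one z]
    · rw [← map_sum, ← map_one (ev1 z), ← hθsum z hz]
      congr 1
      apply Finset.sum_subset (hTA z)
      intro a ha haT
      rw [hθ]; dsimp only
      rw [part_zero A (fun a => φ a z) (i := a) (hTz z hz z hz0 a ha haT)]
    · intro a ha
      have h1 := hTr z hz a ha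
      have ha' := (Finset.mem_filter.mp ha).2
      have h8 : c3 * r a = 8 * (κ * r a) := by rw [hκd]; ring
      have h7 : 0 < κ * r a := mul_pos hκ h1.2.2
      exact hin a (hAE (hTA z ha)) (by linarith)

end FP
end

section
namespace FP
open MvPolynomial
variable {n D : ℕ}

/-- Glaeser-type refinements -/
def Gam (m : ℕ) (E : Finset (En n)) (K : En n → Set (Fin D → ℝ)) (R : ℝ) :
    ℕ → En n → Set (VP n D)
  | 0, x => {P | JetV m P ∧ ev x P ∈ K x}
  | l + 1, x => {P | (JetV m P ∧ ev x P ∈ K x) ∧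
      ∀ y ∈ E, ∃ P' ∈ Gam m E K R l y, NV x (dist x y) (P - P') ≤ R * dist x y ^ m}

section
variable {m : ℕ} {E : Finset (En n)} {K : En n → Set (Fin D → ℝ)}

lemma Gam.base {R : ℝ} {l : ℕ} {x : En n} {P : VP n D} (h : P ∈ Gam m E K R l x) :
    JetV m P ∧ ev x P ∈ K x := by
  cases l with
  | zero => exact h
  | succ l => exact h.1

lemma Gam.succ_sub {R : ℝ} (l : ℕ) : ∀ {x : En n} {P : VP n D}, P ∈ Gam m E K R (l + 1) x →
    P ∈ Gam m E K R l x := by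
  induction l with
  | zero => intro x P h; exact h.1
  | succ l ih =>
    intro x P h
    refine ⟨h.1, fun y hy => ?_⟩
    obtain ⟨P', h1, h2⟩ := h.2 y hy
    exact ⟨P', ih h1, h2⟩

lemma Gam.lev {R : ℝ} {l l' : ℕ} (hl : l ≤ l') {x : En n} {P : VP n D}
    (h : P ∈ Gam m E K R l' x) : P ∈ Gam m E K R l x := by
  induction l', hl using Nat.le_induction with
  | base => exact h
  | succ k _ ih => exact ih (Gam.succ_sub k h)

lemma Gam.mono {R R' : ℝ} (hR : R ≤ R') (l : ℕ) : ∀ {x : En n} {P : VP n D},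
    P ∈ Gam m E K R l x → P ∈ Gam m E K R' l x := by
  induction l with
  | zero => intro x P h; exact h
  | succ l ih =>
    intro x P h
    refine ⟨h.1, fun y hy => ?_⟩
    obtain ⟨P', h1, h2⟩ := h.2 y hy
    exact ⟨P', ih h1, h2.trans (by gcongr)⟩

lemma Gam.convex {R : ℝ} (hK : ∀ x ∈ E, Convex ℝ (K x)) (l : ℕ) :
    ∀ x ∈ E, Convex ℝ (Gam m E K R l x) := by
  induction l with
  | zero =>
    intro x hx P hP Q hQ a b ha hb hab
    refine ⟨(hP.1.smul a).add (hQ.1.smul b), ?_⟩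
    rw [map_add, map_smul, map_smul]
    exact hK x hx hP.2 hQ.2 ha hb hab
  | succ l ih =>
    intro x hx P hP Q hQ a b ha hb hab
    refine ⟨⟨(hP.1.1.smul a).add (hQ.1.1.smul b), ?_⟩, ?_⟩
    · rw [map_add, map_smul, map_smul]
      exact hK x hx hP.1.2 hQ.1.2 ha hb hab
    · intro y hy
      obtain ⟨P', h1, h2⟩ := hP.2 y hy
      obtain ⟨Q', h3, h4⟩ := hQ.2 y hy
      refine ⟨a • P' + b • Q', ih y hy h1 h3 ha hb hab, ?_⟩
      have e : a • P + b • Q - (a • P' + b • Q') = a • (P - P') + b • (Q - Q') := by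
        rw [smul_sub, smul_sub]; abel
      rw [e]
      refine (NV_add_le dist_nonneg _ _).trans ?_
      rw [NV_smul, NV_smul, abs_of_nonneg ha, abs_of_nonneg hb]
      calc _ ≤ a * (R * dist x y ^ m) + b * (R * dist x y ^ m) := by gcongr
        _ = (a + b) * (R * dist x y ^ m) := by ring
        _ = _ := by rw [hab, one_mul]

/-- scalar field, differences controlled at small scale only -/
structure SF (m : ℕ) (s B : ℝ) (θ : En n → Poly n) : Prop where
  bd2 : ∀ z, N z (2 * s) (θ z) ≤ B
  diff : ∀ z w, dist z w ≤ s → N z (dist z w) (θ z - θ w) ≤ B * (dist z w / s) ^ m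
  nonneg : ∀ z, 0 ≤ ev1 z (θ z)
  le_one : ∀ z, ev1 z (θ z) ≤ 1

lemma SF.bd {s B : ℝ} {θ : En n → Poly n} (h : SF m s B θ) (hs : 0 < s) (z : En n) :
    N z s (θ z) ≤ B := (N_mono hs.le (by linarith) _).trans (h.bd2 z)

lemma NV_zero_scale {x : En n} {R : ℝ} (hR : 0 ≤ R) (P : VP n D) :
    NV x (dist x x) (P - P) ≤ R * dist x x ^ m := by
  rw [sub_self, NV_zero]; positivity

lemma closure_lem (m n D : ℕ) (hm : 1 ≤ m) (l : ℕ) : ∀ R B : ℝ, 0 ≤ R → 0 ≤ B → ∃ R', R ≤ R' ∧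
    ∀ (E : Finset (En n)) (K : En n → Set (Fin D → ℝ)), (∀ x ∈ E, Convex ℝ (K x)) →
    ∀ x ∈ E, ∀ (δ : ℝ) (θ : En n → Poly n) (Q1 Q2 : VP n D), 0 < δ → SF m δ B θ →
      Q1 ∈ Gam m E K R l x → Q2 ∈ Gam m E K R l x → NV x δ (Q1 - Q2) ≤ R * δ ^ m →
      trV m x (θ x • Q1 + (1 - θ x) • Q2) ∈ Gam m E K R' l x := by
  have base : ∀ (E : Finset (En n)) (K : En n → Set (Fin D → ℝ)), (∀ x ∈ E, Convex ℝ (K x)) →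
    ∀ x ∈ E, ∀ (δ B : ℝ) (θ : En n → Poly n) (Q1 Q2 : VP n D), SF m δ B θ →
      (JetV m Q1 ∧ ev x Q1 ∈ K x) → (JetV m Q2 ∧ ev x Q2 ∈ K x) →
      (JetV m (trV m x (θ x • Q1 + (1 - θ x) • Q2)) ∧
        ev x (trV m x (θ x • Q1 + (1 - θ x) • Q2)) ∈ K x) := by
    intro E K hK x hx δ B θ Q1 Q2 hθ h1 h2
    refine ⟨jetV_trV _ _ _, ?_⟩
    rw [ev_trV hm, map_add, ev_mul, ev_mul, map_sub, map_one]
    exact hK x hx h1.2 h2.2 (hθ.nonneg x) (by linarith [hθ.le_one x]) (by ring)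
  induction l with
  | zero =>
    intro R B hR hB
    refine ⟨R, le_rfl, ?_⟩
    intro E K hK x hx δ θ Q1 Q2 hδ hθ h1 h2 _
    exact base E K hK x hx δ B θ Q1 Q2 hθ h1 h2
  | succ l ih =>
    intro R B hR hB
    obtain ⟨R1, hR1, ih⟩ := ih (3 * 2 ^ m * R) B (by positivity) hB
    have h2m : (1:ℝ) ≤ 2 ^ m := one_le_pow₀ (by norm_num)
    have h4m : (1:ℝ) ≤ 4 ^ m := one_le_pow₀ (by norm_num)
    have hRR : R ≤ 3 * 2 ^ m * R := by nlinarith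
    set C : ℝ := 2 * ((1 + B) * (2 * R) * (2 + 4 ^ m)) with hC
    have hC0 : 0 ≤ C := by positivity
    set R' := R1 + C + 4 ^ m * (B * R) + R with hR'
    have hBR : 0 ≤ 4 ^ m * (B * R) := by positivity
    refine ⟨R', by linarith, ?_⟩
    intro E K hK x hx δ θ Q1 Q2 hδ hθ h1 h2 h12
    have hb := base E K hK x hx δ B θ Q1 Q2 hθ h1.1 h2.1
    refine ⟨hb, ?_⟩
    intro y hy
    by_cases hxy : y = x
    · subst hxy
      refine ⟨_, Gam.mono (show R1 ≤ R' by linarith) l (ih E K hK y hy δ θ Q1 Q2 hδ hθ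
        (Gam.mono hRR l (Gam.succ_sub l h1)) (Gam.mono hRR l (Gam.succ_sub l h2)) ?_), ?_⟩
      · exact h12.trans (by gcongr)
      · exact NV_zero_scale (by linarith) _
    obtain ⟨Q1', h1', d1⟩ := h1.2 y hy
    obtain ⟨Q2', h2', d2⟩ := h2.2 y hy
    have j1 := h1.1.1
    have j2 := h2.1.1
    have j1' := (Gam.base h1').1
    have j2' := (Gam.base h2').1
    set ρ := dist x y with hρ
    have hρ0 : 0 < ρ := dist_pos.mpr (Ne.symm hxy)
    by_cases hd : 4 * ρ ≤ δ
    · have u1 : NV x δ (Q1 - Q1') ≤ R * δ ^ m := NV_jet_up (j1.sub j1') hρ0 (by linarith) d1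
      have u2 : NV x δ (Q2 - Q2') ≤ R * δ ^ m := NV_jet_up (j2.sub j2') hρ0 (by linarith) d2
      have u12 : NV x δ (Q1' - Q2') ≤ 3 * R * δ ^ m := by
        have t1 := NV_tri (x := x) hδ.le Q1' Q1 Q2'
        have t2 := NV_tri (x := x) hδ.le Q1 Q2 Q2'
        rw [NV_sub_comm] at u1
        linarith
      refine ⟨_, Gam.mono (show R1 ≤ R' by linarith) l (ih E K hK y hy δ θ Q1' Q2' hδ hθ
        (Gam.mono hRR l h1') (Gam.mono hRR l h2') ?_), ?_⟩
      · have := NV_jet_shift (x := x) (y := y) (l := 2) (δ := δ) (δ' := δ) (j1'.sub j2') hδ.le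
          (by norm_num) hδ.le (by linarith)
        refine this.trans ?_
        calc 2 ^ m * NV x δ (Q1' - Q2') ≤ 2 ^ m * (3 * R * δ ^ m) := by gcongr
          _ = _ := by ring
      · have hθx : N x δ (θ x) ≤ B := hθ.bd hδ x
        have hθy : N x δ (θ y) ≤ B :=
          (N_shift_le (x := y) hδ.le (by rw [dist_comm]; linarith) _).trans (hθ.bd2 y)
        have hθd := hθ.diff x y (by linarith)
        rw [← hρ] at hθd
        have hρδ : 0 ≤ (ρ / δ) ^ m := by positivity
        have eρ : R * ρ ^ m = R * δ ^ m * (ρ / δ) ^ m := by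
          rw [mul_assoc, ← mul_pow, mul_div_cancel₀ _ hδ.ne']
        have hRδ : 0 ≤ R * δ ^ m := by positivity
        have hRδ' : 0 ≤ R * δ ^ m * (ρ / δ) ^ m := by positivity
        have hBρ : B * (ρ / δ) ^ m ≤ (1 + B) * (ρ / δ) ^ m := by gcongr; linarith
        have t1 := NV_tri (x := x) hδ.le Q1' Q1 Q2
        have u1' := u1
        rw [NV_sub_comm] at u1'
        have u2' := u2
        rw [NV_sub_comm] at u2'
        have n1 := N_sub_le (x := x) hδ.le 1 (θ x)
        have n2 := N_sub_le (x := x) hδ.le 1 (θ y)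
        rw [N_one] at n1 n2
        have n3 : N x ρ (1 - θ x - (1 - θ y)) = N x ρ (θ x - θ y) := by
          rw [N_sub_comm]; congr 1; ring
        have := (pair_glue (m := m) (Finset.univ : Finset (Fin 2)) (z := x) (z' := y) (s := δ)
          (B := 1 + B) (H := 2 * R * δ ^ m) hδ hd (by linarith) (by positivity)
          ![θ x, 1 - θ x] ![θ y, 1 - θ y] ![Q1, Q2] ![Q1', Q2'] Q2 j2 ?_ ?_ ?_ ?_ ?_ ?_ ?_ ?_).1
        · simp only [Fin.sum_univ_two, Matrix.cons_val_zero, Matrix.cons_val_one] at this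
          refine this.trans ?_
          simp only [Finset.card_univ, Fintype.card_fin]
          rw [← hρ]
          have e3 : R' * ρ ^ m = C * ρ ^ m + (R1 + 4 ^ m * (B * R) + R) * ρ ^ m := by rw [hR']; ring
          have : 0 ≤ (R1 + 4 ^ m * (B * R) + R) * ρ ^ m :=
            mul_nonneg (by linarith) (by positivity)
          have e4 : C * ρ ^ m = 2 * ((1 + B) * 2 * (2 + 4 ^ m)) * (R * ρ ^ m) := by rw [hC]; ring
          rw [e3, e4, eρ]
          push_cast
          linarith
        · intro i _; fin_cases i <;> simp <;> linarith
        · intro i _; fin_cases i <;> simp <;> linarith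
        · intro i _; fin_cases i <;> simp <;> rw [← hρ]
          · linarith
          · simp at n3; rw [n3]; linarith
        · intro i _; fin_cases i <;> simp <;> linarith
        · intro i _; fin_cases i <;> simp <;> linarith
        · intro i _; fin_cases i <;> simp <;> rw [← hρ] <;> linarith
        · simp [Fin.sum_univ_two]
        · simp [Fin.sum_univ_two]
    · push Not at hd
      refine ⟨Q2', Gam.mono (show R ≤ R' by linarith) l h2', ?_⟩
      have e : θ x • Q1 + (1 - θ x) • Q2 = Q2 + θ x • (Q1 - Q2) := by
        rw [sub_smul, one_smul, smul_sub]; abel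
      rw [e, map_add, trV_of_jet _ j2]
      set T := trV m x (θ x • (Q1 - Q2)) with hT
      have hTj : JetV m T := jetV_trV _ _ _
      have hTb : NV x δ T ≤ B * R * δ ^ m := by
        refine (NV_trV_le hδ.le _ _).trans ((NV_mul_le hδ.le _ _).trans ?_)
        rw [mul_assoc]
        exact mul_le_mul (hθ.bd hδ x) h12 (NV_nonneg hδ.le _) hB
      have hT4 : NV x ρ T ≤ B * R * (4 * ρ) ^ m :=
        (NV_mono hρ0.le (by linarith) _).trans (NV_jet_up hTj hδ hd.le hTb)
      have e2 : Q2 + T - Q2' = T + (Q2 - Q2') := by abel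
      rw [e2]
      refine (NV_add_le hρ0.le _ _).trans ?_
      have hρm : 0 ≤ ρ ^ m := by positivity
      have : R' * ρ ^ m = (R1 + C) * ρ ^ m + B * R * (4 * ρ) ^ m + R * ρ ^ m := by
        rw [hR', mul_pow]; ring
      rw [this]
      have : 0 ≤ (R1 + C) * ρ ^ m := mul_nonneg (by linarith) hρm
      linarith
end
end FP
end

section
namespace FP
open MvPolynomial
variable {n D : ℕ}

/-- scaled monomial -/
def mon (y : En n) (δ : ℝ) (γ : Fin n →₀ ℕ) : Poly n := dil y δ (monomial γ 1)

lemma N_mon_le {y z : En n} {δ ρ t : ℝ} (hδ : 0 < δ) (hρ : 0 ≤ ρ) (γ : Fin n →₀ ℕ)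
    (h : ρ + dist z y ≤ t * δ) : N z ρ (mon y δ γ) ≤ t ^ γ.degree := by
  refine (N_dil_le hδ hρ _ _ _).trans ?_
  refine (Nw_tau_le (by positivity) _ _).trans ?_
  rw [Nw_monomial, abs_one, one_mul]
  refine pow_le_pow_left₀ (by positivity) ?_ _
  rw [norm_smul, norm_inv, Real.norm_eq_abs, abs_of_pos hδ, ← dist_eq_norm, ← div_eq_inv_mul,
    ← add_div, div_le_iff₀ hδ]
  exact h

lemma mult_lem (m n D : ℕ) (hm : 1 ≤ m) (l : ℕ) (R : ℝ) (hR : 0 ≤ R) : ∃ R' c : ℝ, R ≤ R' ∧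
    0 < c ∧ c ≤ 1 ∧
    ∀ (E : Finset (En n)) (K : En n → Set (Fin D → ℝ)), (∀ x ∈ E, Convex ℝ (K x)) →
    ∀ y ∈ E, ∀ (δ : ℝ) (P u : VP n D) (γ : Fin n →₀ ℕ), 0 < δ → γ.degree ≤ m →
      P + u ∈ Gam m E K R l y → P - u ∈ Gam m E K R l y → NV y δ u ≤ R * δ ^ m →
      P + c • trV m y (mon y δ γ • u) ∈ Gam m E K R' l y ∧
      P - c • trV m y (mon y δ γ • u) ∈ Gam m E K R' l y := by
  obtain ⟨B0, hB0, hbump⟩ := exists_bump_scaled m n hm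
  set B1 : ℝ := 8 ^ m * B0 with hB1
  have h8 : (1:ℝ) ≤ 8 ^ m := one_le_pow₀ (by norm_num)
  have hB11 : 1 ≤ B1 := by rw [hB1]; nlinarith
  obtain ⟨R', hR', hcl⟩ := closure_lem m n D hm l (2 * R) B1 (by linarith) (by linarith)
  refine ⟨R', 1 / B1, by linarith, by positivity, by rw [div_le_one (by linarith)]; exact hB11, ?_⟩
  intro E K hK y hy δ P u γ hδ hγ h1 h2 hu
  obtain ⟨φ, hφ, hφ1, hφ0⟩ := hbump y δ hδ
  set c : ℝ := 1 / B1 with hc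
  have hc0 : 0 < c := by positivity
  have hcB : c * B1 = 1 := by rw [hc]; field_simp
  set ψ : En n → Poly n := fun z => φ z * mon y δ γ with hψ
  have hψb : ∀ z, N z (2 * δ) (ψ z) ≤ B1 := by
    intro z
    by_cases hz : 2 * δ ≤ dist z y
    · rw [hψ]; dsimp only; rw [hφ0 z hz, zero_mul, N_zero]; linarith
    · push Not at hz
      refine (N_mul_le (by linarith) _ _).trans ?_
      have a1 : N z (2 * δ) (φ z) ≤ 2 ^ m * B0 :=
        (N_jet_scale (hφ.jet z) hδ.le (by norm_num)).trans
          (mul_le_mul_of_nonneg_left (hφ.bd z) (by positivity))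
      have a2 : N z (2 * δ) (mon y δ γ) ≤ 4 ^ m :=
        (N_mon_le (t := 4) hδ (by linarith) γ (by linarith)).trans
          (pow_le_pow_right₀ (by norm_num) hγ)
      calc _ ≤ (2 ^ m * B0) * 4 ^ m := mul_le_mul a1 a2 (N_nonneg (by linarith) _) (by positivity)
        _ = B1 := by rw [hB1, show (8:ℝ) = 2 * 4 by norm_num, mul_pow]; ring
  have hψd : ∀ z w, dist z w ≤ δ → N z (dist z w) (ψ z - ψ w) ≤ B1 * (dist z w / δ) ^ m := by
    intro z w hzw
    have e : ψ z - ψ w = (φ z - φ w) * mon y δ γ := by rw [hψ]; ring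
    by_cases hz : 3 * δ ≤ dist z y
    · have : dist z y ≤ dist z w + dist w y := dist_triangle _ _ _
      rw [e, hφ0 z (by linarith), hφ0 w (by linarith), sub_self, zero_mul, N_zero]
      positivity
    · push Not at hz
      rw [e]
      refine (N_mul_le dist_nonneg _ _).trans ?_
      have a2 : N z (dist z w) (mon y δ γ) ≤ 4 ^ m :=
        (N_mon_le (t := 4) hδ dist_nonneg γ (by linarith)).trans
          (pow_le_pow_right₀ (by norm_num) hγ)
      calc _ ≤ (B0 * (dist z w / δ) ^ m) * 4 ^ m :=
            mul_le_mul (hφ.diff z w) a2 (N_nonneg dist_nonneg _) (by positivity)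
        _ = (4 ^ m * B0) * (dist z w / δ) ^ m := by ring
        _ ≤ B1 * (dist z w / δ) ^ m := by
            rw [hB1]; gcongr; norm_num
  set θ : En n → Poly n := fun z => C (1 / 2) + C (c / 2) * ψ z with hθ
  have hNC : ∀ (z : En n) (s a : ℝ) (p : Poly n), N z s (C a * p) = |a| * N z s p := by
    intro z s a p
    rw [← smul_eq_C_mul, N_smul]
  have hev : ∀ z, ev1 z (θ z) = 1 / 2 + c / 2 * ev1 z (ψ z) := by
    intro z
    rw [hθ]; dsimp only
    rw [map_add, ← smul_eq_C_mul, ev1_smul, ev1_apply z (C _), tau_C, coeff_zero_C]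
  have hevψ : ∀ z, |ev1 z (ψ z)| ≤ B1 := fun z =>
    (ev1_le_N (by linarith) _).trans (hψb z)
  have hevc : ∀ z, |c * ev1 z (ψ z)| ≤ 1 := by
    intro z
    rw [abs_mul, abs_of_pos hc0, ← hcB]
    exact mul_le_mul_of_nonneg_left (hevψ z) hc0.le
  have hSF : SF m δ B1 θ := by
    refine ⟨?_, ?_, ?_, ?_⟩
    · intro z
      refine (N_add_le (by linarith) _ _).trans ?_
      rw [hNC, abs_of_pos (by positivity)]
      have : N z (2 * δ) (C (1 / 2) : Poly n) = 1 / 2 := by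
        unfold N; rw [tau_C, Nw_C, abs_of_pos (by norm_num)]
      rw [this]
      have := mul_le_mul_of_nonneg_left (hψb z) (show 0 ≤ c / 2 by positivity)
      linarith
    · intro z w hzw
      have e : θ z - θ w = C (c / 2) * (ψ z - ψ w) := by rw [hθ]; ring
      rw [e, hNC, abs_of_pos (by positivity)]
      have c1 : c / 2 ≤ 1 := by
        have : c ≤ 1 := by rw [hc, div_le_one (by linarith)]; exact hB11
        linarith
      refine (mul_le_mul_of_nonneg_left (hψd z w hzw) (by positivity)).trans ?_
      have : 0 ≤ B1 * (dist z w / δ) ^ m := by positivity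
      nlinarith
    · intro z; rw [hev]; linarith [(abs_le.mp (hevc z)).1]
    · intro z; rw [hev]; linarith [(abs_le.mp (hevc z)).2]
  have jP : JetV m P := by
    have a := (Gam.base h1).1.add (Gam.base h2).1
    have := a.smul (1/2)
    have e : (1/2 : ℝ) • (P + u + (P - u)) = P := by
      rw [show P + u + (P - u) = (2:ℝ) • P by rw [two_smul]; abel, smul_smul]; norm_num
    rwa [e] at this
  have h2R : R ≤ 2 * R := by linarith
  have hd : NV y δ ((P + u) - (P - u)) ≤ 2 * R * δ ^ m := by
    rw [show (P + u) - (P - u) = (2:ℝ) • u by rw [two_smul]; abel, NV_smul, abs_two]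
    linarith
  have hyy : θ y = C (1 / 2) + C (c / 2) * mon y δ γ := by
    rw [hθ]; dsimp only; rw [hψ]; dsimp only; rw [hφ1 y (by rw [dist_self]; exact hδ.le), one_mul]
  have hC1 : (C (1/2) + C (1/2) : Poly n) = 1 := by rw [← C_add]; norm_num
  have hC2 : (C (c/2) + C (c/2) : Poly n) = C c := by rw [← C_add]; norm_num
  have hsm : ∀ Q : VP n D, c • Q = (C c : Poly n) • Q := by
    intro Q; ext1 j; simp [smul_eq_C_mul]
  have key1 : trV m y (θ y • (P + u) + (1 - θ y) • (P - u)) = P + c • trV m y (mon y δ γ • u) := by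
    conv_rhs => rw [← trV_of_jet y jP, ← map_smul, ← map_add]
    congr 1
    rw [hyy, hsm]
    ext1 j
    simp only [Pi.add_apply, Pi.smul_apply, Pi.sub_apply, smul_eq_mul]
    linear_combination (u j) * hC1 + (mon y δ γ * u j) * hC2
  have key2 : trV m y (θ y • (P - u) + (1 - θ y) • (P + u)) = P - c • trV m y (mon y δ γ • u) := by
    conv_rhs => rw [← trV_of_jet y jP, ← map_smul, ← map_sub]
    congr 1
    rw [hyy, hsm]
    ext1 j
    simp only [Pi.add_apply, Pi.smul_apply, Pi.sub_apply, smul_eq_mul]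
    linear_combination -(u j) * hC1 - (mon y δ γ * u j) * hC2
  constructor
  · rw [← key1]
    exact hcl E K hK y hy δ θ _ _ hδ hSF (Gam.mono h2R l h1) (Gam.mono h2R l h2) hd
  · rw [← key2]
    refine hcl E K hK y hy δ θ _ _ hδ hSF (Gam.mono h2R l h2) (Gam.mono h2R l h1) ?_
    rw [NV_sub_comm]; exact hd

/-- index set of coefficients -/
abbrev Idx (m n D : ℕ) := (Bm n m) × Fin D

/-- normalised coefficients at (x, δ) -/
def ch (m : ℕ) (x : En n) (δ : ℝ) : VP n D →ₗ[ℝ] (Idx m n D → ℝ) where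
  toFun P i := coeff i.1.1 (tau x (P i.2)) * (δ ^ i.1.1.degree / δ ^ m)
  map_add' P Q := by ext i; simp [add_mul]
  map_smul' c P := by ext i; simp [mul_assoc]

lemma ch_apply (m : ℕ) (x : En n) (δ : ℝ) (P : VP n D) (i : Idx m n D) :
    ch m x δ P i = coeff i.1.1 (tau x (P i.2)) * (δ ^ i.1.1.degree / δ ^ m) := rfl

def mkV (m : ℕ) (x : En n) (δ : ℝ) : (Idx m n D → ℝ) →ₗ[ℝ] VP n D where
  toFun c j := tau (-x) (∑ β : Bm n m, monomial β.1 (c (β, j) * (δ ^ m / δ ^ β.1.degree)))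
  map_add' c c' := by
    ext1 j
    simp only [Pi.add_apply, add_mul, ← map_add, ← Finset.sum_add_distrib]
  map_smul' a c := by
    ext1 j
    simp only [Pi.smul_apply, smul_eq_mul, mul_assoc, RingHom.id_apply]
    rw [← map_smul, Finset.smul_sum]
    simp only [smul_monomial, smul_eq_mul]

lemma tau_mkV (m : ℕ) (x : En n) (δ : ℝ) (c : Idx m n D → ℝ) (j : Fin D) :
    tau x (mkV m x δ c j) = ∑ β : Bm n m, monomial β.1 (c (β, j) * (δ ^ m / δ ^ β.1.degree)) := by
  show tau x (tau (-x) _) = _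
  rw [tau_tau, add_neg_cancel, tau_zero]

lemma jet_mkV (m : ℕ) (x : En n) (δ : ℝ) (c : Idx m n D → ℝ) : JetV m (mkV m x δ c) := by
  intro j
  apply Jet.of_tau (x := x)
  rw [tau_mkV]
  intro β hβ
  rw [coeff_sum]
  apply Finset.sum_eq_zero
  intro γ _
  rw [coeff_monomial, if_neg]
  rintro rfl
  have := mem_Bm.mp γ.2
  omega

lemma ch_mkV (m : ℕ) (x : En n) {δ : ℝ} (hδ : 0 < δ) (c : Idx m n D → ℝ) :
    ch m x δ (mkV m x δ c) = c := by
  ext ⟨β, j⟩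
  rw [ch_apply]
  dsimp only
  rw [tau_mkV, coeff_sum, Finset.sum_eq_single β]
  · rw [coeff_monomial, if_pos rfl]; field_simp
  · intro γ _ hγ
    rw [coeff_monomial, if_neg]
    exact fun h => hγ (Subtype.ext h)
  · simp

lemma ch_inj {m : ℕ} (x : En n) {δ : ℝ} (hδ : 0 < δ) {P Q : VP n D} (hP : JetV m P) (hQ : JetV m Q)
    (h : ch m x δ P = ch m x δ Q) : P = Q := by
  ext1 j
  have : tau x (P j) = tau x (Q j) := by
    ext β
    by_cases hβ : β.degree < m
    · have := congrFun h (⟨β, mem_Bm.mpr hβ⟩, j)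
      rw [ch_apply, ch_apply] at this
      exact mul_right_cancel₀ (by positivity) this
    · rw [(hP j).tau x β (by omega), (hQ j).tau x β (by omega)]
  have h2 := congrArg (tau (-x)) this
  rwa [tau_tau, tau_tau, neg_add_cancel, tau_zero, tau_zero] at h2

lemma mkV_ch {m : ℕ} (x : En n) {δ : ℝ} (hδ : 0 < δ) {P : VP n D} (hP : JetV m P) :
    mkV m x δ (ch m x δ P) = P :=
  ch_inj x hδ (jet_mkV _ _ _ _) hP (ch_mkV m x hδ _)

lemma NV_eq_ch {m : ℕ} (x : En n) {δ : ℝ} (hδ : 0 < δ) {P : VP n D} (hP : JetV m P) :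
    NV x δ P = δ ^ m * ∑ i, |ch m x δ P i| := by
  unfold NV N
  rw [Fintype.sum_prod_type_right, Finset.mul_sum]
  refine Finset.sum_congr rfl fun j _ => ?_
  rw [((hP j).tau x).Nw_eq, Finset.mul_sum, ← Finset.sum_coe_sort]
  refine Finset.sum_congr rfl fun β _ => ?_
  rw [ch_apply, abs_mul, abs_of_pos (show 0 < δ ^ β.1.degree / δ ^ m by positivity)]
  dsimp only
  field_simp

/-- shifting indices -/
def shv (m : ℕ) (γ : Fin n →₀ ℕ) (a : Idx m n D → ℝ) : Idx m n D → ℝ := fun i =>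
  if h : γ ≤ i.1.1 then a (⟨i.1.1 - γ, mem_Bm.mpr (lt_of_le_of_lt (by
    have : i.1.1 - γ + γ = i.1.1 := tsub_add_cancel_of_le h
    rw [← this]; simp) (mem_Bm.mp i.1.2))⟩, i.2) else 0

lemma tau_mon (y : En n) {δ : ℝ} (hδ : 0 < δ) (γ : Fin n →₀ ℕ) :
    tau y (mon y δ γ) = monomial γ ((1 / δ) ^ γ.degree) := by
  unfold mon
  rw [tau_dil y y hδ.ne', sub_self, smul_zero, tau_zero, dil, aeval_monomial]
  simp only [map_one, one_mul, PiLp.zero_apply, map_zero, sub_zero]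
  rw [Finsupp.prod, monomial_eq]
  simp only [mul_pow, Finset.prod_mul_distrib, ← map_pow, ← map_prod]
  rw [Finset.prod_pow_eq_pow_sum]
  rfl

lemma ch_mon (m : ℕ) (y : En n) {δ : ℝ} (hδ : 0 < δ) (γ : Fin n →₀ ℕ) (u : VP n D) :
    ch m y δ (trV m y (mon y δ γ • u)) = shv m γ (ch m y δ u) := by
  ext ⟨β, j⟩
  have hβ := mem_Bm.mp β.2
  rw [ch_apply]
  dsimp only
  rw [trV_apply, tau_tr, coeff_tr0, if_pos hβ, Pi.smul_apply, smul_eq_mul, map_mul, tau_mon y hδ,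
    coeff_monomial_mul', shv]
  dsimp only
  split_ifs with h
  · rw [ch_apply]; dsimp only
    have : β.1.degree = (β.1 - γ).degree + γ.degree := by
      rw [← map_add, tsub_add_cancel_of_le h]
    rw [this, pow_add, one_div, inv_pow]
    field_simp
  · simp

end FP
end

section
namespace FP
open MvPolynomial
variable {n D : ℕ}

/-- bounded Whitney field on `T` selecting from `K` -/
def FO (m : ℕ) (K : En n → Set (Fin D → ℝ)) (M : ℝ) (T : Finset (En n)) (P : En n → VP n D) : Prop :=
  Fld m ↑T P M ∧ ∀ z ∈ T, NV z 1 (P z) ≤ M ∧ ev z (P z) ∈ K z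

lemma Fld.mono_set {m : ℕ} {S T : Set (En n)} {P : En n → VP n D} {M : ℝ} (h : Fld m T P M)
    (hS : S ⊆ T) : Fld m S P M :=
  ⟨fun x hx => h.1 x (hS hx), fun x hx y hy => h.2 x (hS hx) y (hS hy)⟩

lemma Fld.comb {m : ℕ} {S : Set (En n)} {P Q : En n → VP n D} {M M' : ℝ} (h : Fld m S P M)
    (h' : Fld m S Q M') (a b : ℝ) : Fld m S (a • P + b • Q) (|a| * M + |b| * M') := by
  refine ⟨fun x hx => ((h.1 x hx).smul a).add ((h'.1 x hx).smul b), fun x hx y hy => ?_⟩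
  have e : (a • P + b • Q) x - (a • P + b • Q) y = a • (P x - P y) + b • (Q x - Q y) := by
    simp only [Pi.add_apply, Pi.smul_apply, smul_sub]; abel
  rw [e]
  refine (NV_add_le dist_nonneg _ _).trans ?_
  rw [NV_smul, NV_smul]
  have h1 := mul_le_mul_of_nonneg_left (h.2 x hx y hy) (abs_nonneg a)
  have h2 := mul_le_mul_of_nonneg_left (h'.2 x hx y hy) (abs_nonneg b)
  linarith

lemma FO.mono {m : ℕ} {K : En n → Set (Fin D → ℝ)} {M : ℝ} {S T : Finset (En n)}
    {P : En n → VP n D} (h : FO m K M T P) (hS : S ⊆ T) : FO m K M S P :=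
  ⟨h.1.mono_set (by exact_mod_cast hS), fun z hz => h.2 z (hS hz)⟩

lemma FO.convex {m : ℕ} {K : En n → Set (Fin D → ℝ)} {M : ℝ} {T : Finset (En n)}
    (hK : ∀ x ∈ T, Convex ℝ (K x)) : Convex ℝ {P | FO m K M T P} := by
  intro P hP Q hQ a b ha hb hab
  refine ⟨?_, fun z hz => ⟨?_, ?_⟩⟩
  · have := hP.1.comb hQ.1 a b
    rwa [abs_of_nonneg ha, abs_of_nonneg hb, ← add_mul, hab, one_mul] at this
  · rw [Pi.add_apply, Pi.smul_apply, Pi.smul_apply]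
    refine (NV_add_le zero_le_one _ _).trans ?_
    rw [NV_smul, NV_smul, abs_of_nonneg ha, abs_of_nonneg hb]
    have h1 := mul_le_mul_of_nonneg_left (hP.2 z hz).1 ha
    have h2 := mul_le_mul_of_nonneg_left (hQ.2 z hz).1 hb
    calc _ ≤ a * M + b * M := add_le_add h1 h2
      _ = M := by rw [← add_mul, hab, one_mul]
  · rw [Pi.add_apply, Pi.smul_apply, Pi.smul_apply, map_add, map_smul, map_smul]
    exact hK z hz (hP.2 z hz).2 (hQ.2 z hz).2 ha hb hab

lemma helly_step {m : ℕ} {K : En n → Set (Fin D → ℝ)} {M : ℝ} {E W : Finset (En n)}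
    (hK : ∀ x ∈ E, Convex ℝ (K x)) (hW : W ⊆ E) (k : ℕ) (Pc : Set (En n → VP n D))
    (hPc : Convex ℝ Pc) (y : En n) (hy : y ∈ E)
    (H : ∀ T ⊆ E, T.card ≤ (Fintype.card (Idx m n D) + 1) * k + 1 → ∃ P ∈ Pc, FO m K M (T ∪ W) P) :
    ∃ P', ∀ S ⊆ E, S.card ≤ k → ∃ P ∈ Pc, FO m K M (insert y (S ∪ W)) P ∧ P y = P' := by
  set F : Finset (En n) → Set (Idx m n D → ℝ) := fun S =>
    {c | ∃ P ∈ Pc, FO m K M (insert y (S ∪ W)) P ∧ P y = mkV m 0 1 c}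
  have hh := Convex.helly_theorem' (F := F) (s := E.powerset.filter fun S => S.card ≤ k) (𝕜 := ℝ) ?_ ?_
  · obtain ⟨c, hc⟩ := hh
    refine ⟨mkV m 0 1 c, fun S hS hk => ?_⟩
    have := Set.mem_iInter₂.mp hc S (by simp [hS, hk])
    exact this
  · intro S hS c hc c' hc' a b ha hb hab
    have hSE : S ⊆ E := by simp at hS; exact hS.1
    obtain ⟨P, hP, h1, h2⟩ := hc
    obtain ⟨Q, hQ, h3, h4⟩ := hc'
    refine ⟨a • P + b • Q, hPc hP hQ ha hb hab, FO.convex ?_ h1 h3 ha hb hab, ?_⟩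
    · intro x hx
      apply hK
      have : insert y (S ∪ W) ⊆ E := by
        intro z hz; simp at hz; rcases hz with rfl | h | h
        · exact hy
        · exact hSE h
        · exact hW h
      exact this hx
    · simp [h2, h4]
  · intro I hI hcard
    rw [Module.finrank_fintype_fun_eq_card] at hcard
    have hI' : ∀ S ∈ I, S ⊆ E ∧ S.card ≤ k := fun S hS => by simpa using hI hS
    obtain ⟨P, hP, hF⟩ := H (insert y (I.biUnion id)) (by
        intro z hz; simp at hz; rcases hz with rfl | ⟨S, hS, hz⟩
        · exact hy
        · exact (hI' S hS).1 hz) (by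
        refine (Finset.card_insert_le _ _).trans ?_
        have := Finset.card_biUnion_le_card_mul I id k (fun S hS => (hI' S hS).2)
        have h2 : I.card * k ≤ (Fintype.card (Idx m n D) + 1) * k := Nat.mul_le_mul_right _ hcard
        omega)
    refine ⟨ch m 0 1 (P y), ?_⟩
    rw [Set.mem_iInter₂]
    intro S hS
    refine ⟨P, hP, hF.mono ?_, ?_⟩
    · intro z hz
      simp at hz ⊢
      rcases hz with h | h | h
      · exact Or.inl h
      · exact Or.inr (Or.inl ⟨S, hS, h⟩)
      · exact Or.inr (Or.inr h)
    · rw [mkV_ch 0 one_pos (hF.1.1 y (by simp))]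

/-- Helly numbers -/
def kH (m n D : ℕ) : ℕ → ℕ
  | 0 => 0
  | l + 1 => (Fintype.card (Idx m n D) + 1) * kH m n D l + 1

lemma helly_gam_aux {m : ℕ} {K : En n → Set (Fin D → ℝ)} {M : ℝ} {E : Finset (En n)}
    (hK : ∀ x ∈ E, Convex ℝ (K x)) (l : ℕ) : ∀ x ∈ E, ∀ p,
    (∀ S ⊆ E, S.card ≤ kH m n D l → ∃ P, FO m K M (insert x S) P ∧ P x = p) →
    p ∈ Gam m E K M l x := by
  have base : ∀ l, ∀ x ∈ E, ∀ p,
    (∀ S ⊆ E, S.card ≤ kH m n D l → ∃ P, FO m K M (insert x S) P ∧ P x = p) →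
    JetV m p ∧ ev x p ∈ K x := by
    intro l x hx p H
    obtain ⟨P, hP, rfl⟩ := H ∅ (by simp) (by simp)
    exact ⟨hP.1.1 x (by simp), (hP.2 x (by simp)).2⟩
  induction l with
  | zero => exact base 0
  | succ l ih =>
    intro x hx p H
    refine ⟨base _ x hx p H, fun y hy => ?_⟩
    obtain ⟨P', hP'⟩ := helly_step (M := M) hK (W := {x}) (by simpa using hx) (kH m n D l)
      {P | P x = p} (by
        intro P hP Q hQ a b ha hb hab
        have h1 : P x = p := hP
        have h2 : Q x = p := hQ
        show a • P x + b • Q x = p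
        rw [h1, h2, ← add_smul, hab, one_smul]) y hy (by
        intro T hT hk
        obtain ⟨P, h1, h2⟩ := H T hT hk
        refine ⟨P, h2, h1.mono ?_⟩
        intro z hz; simp at hz ⊢; tauto)
    refine ⟨P', ih y hy P' ?_, ?_⟩
    · intro S hS hk
      obtain ⟨P, _, h1, h2⟩ := hP' S hS hk
      exact ⟨P, h1.mono (Finset.insert_subset_insert _ Finset.subset_union_left), h2⟩
    · obtain ⟨P, h0, h1, rfl⟩ := hP' ∅ (by simp) (by simp)
      have h0 : P x = p := h0
      rw [← h0]
      exact h1.1.2 x (by simp) y (by simp)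

lemma helly_gam (m n D : ℕ) (l : ℕ) : ∃ k : ℕ, ∀ (K : En n → Set (Fin D → ℝ)) (M : ℝ)
    (E : Finset (En n)), (∀ x ∈ E, Convex ℝ (K x)) →
    (∀ T ⊆ E, T.card ≤ k → ∃ P, FO m K M T P) →
    ∀ x ∈ E, ∃ P ∈ Gam m E K M l x, NV x 1 P ≤ M := by
  refine ⟨kH m n D (l + 1), fun K M E hK H x hx => ?_⟩
  obtain ⟨P', hP'⟩ := helly_step (M := M) hK (W := ∅) (by simp) (kH m n D l) Set.univ convex_univ x hx
    (by
      intro T hT hk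
      obtain ⟨P, h1⟩ := H T hT hk
      exact ⟨P, trivial, by simpa using h1⟩)
  refine ⟨P', helly_gam_aux hK l x hx P' ?_, ?_⟩
  · intro S hS hk
    obtain ⟨P, _, h1, h2⟩ := hP' S hS hk
    exact ⟨P, by simpa using h1, h2⟩
  · obtain ⟨P, _, h1, rfl⟩ := hP' ∅ (by simp) (by simp)
    exact (h1.2 x (by simp)).1

end FP
end

section
namespace FP
open MvPolynomial
variable {m n D : ℕ}

/-- up-closed sets of indices -/
def UpC (A : Finset (Idx m n D)) : Prop :=
  ∀ i ∈ A, ∀ k : Idx m n D, i.1.1 ≤ k.1.1 → i.2 = k.2 → k ∈ A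

/-- sort key -/
def key (i : Idx m n D) : Lex ((MonomialOrder.lex (σ := Fin n)).syn × Fin D) :=
  toLex ((MonomialOrder.lex (σ := Fin n)).toSyn i.1.1, i.2)

lemma key_inj : Function.Injective (key (m := m) (n := n) (D := D)) := by
  intro i k h
  have h2 : ((MonomialOrder.lex (σ := Fin n)).toSyn i.1.1, i.2) =
    ((MonomialOrder.lex (σ := Fin n)).toSyn k.1.1, k.2) := toLex.injective h
  rw [Prod.mk.injEq] at h2
  have h3 := (MonomialOrder.lex (σ := Fin n)).toSyn.injective h2.1
  exact Prod.ext (Subtype.ext h3) h2.2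

lemma key_lt {i k i' k' : Idx m n D} (γ : Fin n →₀ ℕ) (h : key i < key k)
    (hi : i'.1.1 + γ = i.1.1) (hk : k'.1.1 + γ = k.1.1) (hi2 : i'.2 = i.2) (hk2 : k'.2 = k.2) :
    key i' < key k' := by
  unfold key at *
  rw [Prod.Lex.lt_iff] at *
  simp only [ofLex_toLex] at *
  rw [← hi, ← hk, map_add, map_add, add_lt_add_iff_right, add_left_inj] at h
  rw [hi2, hk2]; exact h

lemma groebner (V : Submodule ℝ (Idx m n D → ℝ))
    (hV : ∀ v ∈ V, ∀ γ : Fin n →₀ ℕ, γ.degree ≤ m → shv m γ v ∈ V) :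
    ∃ A : Finset (Idx m n D), UpC A ∧ A.card = Module.finrank ℝ V ∧ ∃ v : Idx m n D → (Idx m n D → ℝ),
      ∀ α ∈ A, v α ∈ V ∧ ∀ β ∈ A, v α β = if α = β then 1 else 0 := by
  set A : Finset (Idx m n D) := Finset.univ.filter fun α => ∃ v ∈ V, v α = 1 ∧
    ∀ β, key β < key α → v β = 0 with hA
  have memA : ∀ {α}, α ∈ A ↔ ∃ v ∈ V, v α = 1 ∧ ∀ β, key β < key α → v β = 0 := by simp [hA]
  have up : UpC A := by
    intro i hi k h1 h2
    obtain ⟨v, hv, hvi, hv0⟩ := memA.mp hi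
    have hk := mem_Bm.mp k.1.2
    have hle : (k.1.1 - i.1.1) ≤ k.1.1 := tsub_le_self
    have hadd : k.1.1 - i.1.1 + i.1.1 = k.1.1 := tsub_add_cancel_of_le h1
    refine memA.mpr ⟨shv m (k.1.1 - i.1.1) v, hV v hv _ ?_, ?_, ?_⟩
    · have : k.1.1.degree = (k.1.1 - i.1.1).degree + i.1.1.degree := by rw [← map_add, hadd]
      omega
    · rw [shv, dif_pos hle, ← hvi]
      congr 1
      refine Prod.ext (Subtype.ext ?_) h2.symm
      exact tsub_tsub_cancel_of_le h1
    · intro β hβ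
      rw [shv]
      split_ifs with h
      · apply hv0
        refine key_lt (k.1.1 - i.1.1) hβ ?_ ?_ rfl h2
        · exact tsub_add_cancel_of_le h
        · rw [add_comm]; exact hadd
      · rfl
  choose! w hwV hw1 hw0 using fun α (h : α ∈ A) => memA.mp h
  -- independence
  have ind : LinearIndependent ℝ (fun α : A => (⟨w α, hwV α α.2⟩ : V)) := by
    rw [Fintype.linearIndependent_iff]
    intro c hc
    by_contra hne
    push Not at hne
    obtain ⟨i0, hi0⟩ := hne
    obtain ⟨i, hi, hmin⟩ := Finset.exists_min_image (Finset.univ.filter fun i : A => c i ≠ 0)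
      (fun i => key i.1) ⟨i0, by simpa using hi0⟩
    simp at hi
    have h1 := congrArg (fun v : V => v.1 i.1) hc
    simp only [Submodule.coe_sum, Submodule.coe_smul, Finset.sum_apply, Pi.smul_apply, smul_eq_mul,
      Submodule.coe_zero, Pi.zero_apply] at h1
    rw [Finset.sum_eq_single i] at h1
    · rw [hw1 i i.2, mul_one] at h1; exact hi h1
    · intro b _ hb
      by_cases hcb : c b = 0
      · simp [hcb]
      · have := hmin b (by simpa using hcb)
        have hlt : key i.1 < key b.1 := lt_of_le_of_ne this fun h => hb (Subtype.ext (key_inj h)).symm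
        rw [hw0 b b.2 _ hlt, mul_zero]
    · simp
  set ρ : V →ₗ[ℝ] (A → ℝ) := (LinearMap.funLeft ℝ ℝ (fun i : A => i.1)).comp V.subtype with hρ
  have inj : Function.Injective ρ := by
    rw [← LinearMap.ker_eq_bot, LinearMap.ker_eq_bot']
    intro v hv
    by_contra hne
    have : ∃ i, v.1 i ≠ 0 := by
      by_contra hh; push Not at hh
      exact hne (Subtype.ext (funext hh))
    obtain ⟨i0, hi0⟩ := this
    obtain ⟨i, hi, hmin⟩ := Finset.exists_min_image (Finset.univ.filter fun i => v.1 i ≠ 0)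
      (fun i => key i) ⟨i0, by simpa using hi0⟩
    simp at hi
    have hiA : i ∈ A := by
      refine memA.mpr ⟨(v.1 i)⁻¹ • v.1, V.smul_mem _ v.2, by simp [hi], fun β hβ => ?_⟩
      by_contra hc
      have : v.1 β ≠ 0 := by intro h; apply hc; simp [h]
      exact absurd (hmin β (by simpa using this)) (not_le.mpr hβ)
    have := congrFun hv ⟨i, hiA⟩
    exact hi this
  have c1 := ind.fintype_card_le_finrank
  have c2 := LinearMap.finrank_le_finrank_of_injective inj
  rw [Module.finrank_fintype_fun_eq_card] at c2
  have c3 : Module.finrank ℝ V = Module.finrank ℝ (A → ℝ) := by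
    rw [Module.finrank_fintype_fun_eq_card]; omega
  have surj : Function.Surjective ρ := (LinearMap.injective_iff_surjective_of_finrank_eq_finrank c3).mp inj
  refine ⟨A, up, ?_, ?_⟩
  · rw [Fintype.card_coe] at c1 c2; omega
  · choose s hs using surj
    refine ⟨fun α => if h : α ∈ A then (s (Pi.single ⟨α, h⟩ 1)).1 else 0, fun α hα => ?_⟩
    dsimp only
    rw [dif_pos hα]
    refine ⟨(s _).2, fun β hβ => ?_⟩
    have := congrFun (hs (Pi.single ⟨α, hα⟩ 1)) ⟨β, hβ⟩
    have h2 : (s (Pi.single ⟨α, hα⟩ 1)).1 β = (Pi.single ⟨α, hα⟩ 1 : A → ℝ) ⟨β, hβ⟩ := this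
    rw [h2, Pi.single_apply]
    simp [eq_comm]

end FP
end

section
namespace FP
open MvPolynomial Filter Topology
variable {m n D : ℕ}

/-- abstract family of fat directions -/
structure FatFam (g : ℝ → ℝ) (R0 : ℝ) (Φ : ℝ → Set (Idx m n D → ℝ)) : Prop where
  mono : ∀ R R', R0 ≤ R → R ≤ R' → Φ R ⊆ Φ R'
  zero : ∀ R, R0 ≤ R → 0 ∈ Φ R
  add : ∀ R, R0 ≤ R → ∀ u ∈ Φ R, ∀ v ∈ Φ R, u + v ∈ Φ (2 * R)
  smul : ∀ R, R0 ≤ R → ∀ u ∈ Φ R, ∀ t T : ℝ, 1 ≤ T → |t| ≤ T → t • u ∈ Φ (T * R)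
  shift : ∀ R, R0 ≤ R → ∀ u ∈ Φ R, ∑ i, |u i| ≤ R → ∀ γ : Fin n →₀ ℕ, γ.degree ≤ m → shv m γ u ∈ Φ (g R)

/-- reduced bounded systems -/
def Sys (Φ : ℝ → Set (Idx m n D → ℝ)) (R : ℝ) (A : Finset (Idx m n D)) : Prop :=
  ∃ a : Idx m n D → Idx m n D → ℝ, ∀ α ∈ A, a α ∈ Φ R ∧ (∀ β ∈ A, a α β = if α = β then 1 else 0) ∧
    ∑ β, |a α β| ≤ R

section
variable {g : ℝ → ℝ} {R0 : ℝ} {Φ : ℝ → Set (Idx m n D → ℝ)}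

lemma Sys.mono (hΦ : FatFam g R0 Φ) {R R' : ℝ} (h0 : R0 ≤ R) (h : R ≤ R') {A : Finset (Idx m n D)}
    (hS : Sys Φ R A) : Sys Φ R' A := by
  obtain ⟨a, ha⟩ := hS
  exact ⟨a, fun α hα => ⟨hΦ.mono R R' h0 h (ha α hα).1, (ha α hα).2.1, (ha α hα).2.2.trans h⟩⟩

lemma FatFam.sum (hΦ : FatFam g R0 Φ) (h1 : 1 ≤ R0) {R : ℝ} (h0 : R0 ≤ R) {ι : Type*} (s : Finset ι)
    (f : ι → Idx m n D → ℝ) (hf : ∀ i ∈ s, f i ∈ Φ R) : ∑ i ∈ s, f i ∈ Φ (2 ^ s.card * R) := by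
  induction s using Finset.induction_on with
  | empty => simpa using hΦ.zero R h0
  | insert i s his ih =>
    rw [Finset.sum_insert his, Finset.card_insert_of_notMem his, pow_succ, mul_comm _ (2:ℝ), mul_assoc]
    have h2 : R ≤ 2 ^ s.card * R := by
      have : (1:ℝ) ≤ 2 ^ s.card := one_le_pow₀ (by norm_num)
      nlinarith
    refine hΦ.add _ (h0.trans h2) _ ?_ _ ?_
    · exact hΦ.mono _ _ h0 h2 (hf i (by simp))
    · exact ih fun j hj => hf j (by simp [hj])

lemma FatFam.comb (hΦ : FatFam g R0 Φ) (h1 : 1 ≤ R0) {R : ℝ} (h0 : R0 ≤ R) {ι : Type*} (s : Finset ι)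
    (f : ι → Idx m n D → ℝ) (c : ι → ℝ) {T : ℝ} (hT : 1 ≤ T) (hc : ∀ i ∈ s, |c i| ≤ T)
    (hf : ∀ i ∈ s, f i ∈ Φ R) : ∑ i ∈ s, c i • f i ∈ Φ (2 ^ s.card * (T * R)) :=
  hΦ.sum h1 (by nlinarith) s _ fun i hi => hΦ.smul R h0 _ (hf i hi) _ _ hT (hc i hi)
end

lemma ulim {ι : Type*} [Fintype ι] (U : Ultrafilter ℕ) (f : ℕ → ι → ℝ) (R : ℝ)
    (h : ∀ k i, |f k i| ≤ R) : ∃ v, Tendsto f U (𝓝 v) := by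
  have hc : IsCompact (Set.pi Set.univ fun _ : ι => Set.Icc (-R) R) :=
    isCompact_univ_pi fun _ => isCompact_Icc
  obtain ⟨v, _, hv⟩ := hc.ultrafilter_le_nhds (U.map f) (by
    rw [Ultrafilter.coe_map, le_principal_iff, mem_map]
    refine Filter.Eventually.of_forall (p := fun k => f k ∈ _) fun k => ?_
    simp only [Set.mem_pi, Set.mem_univ, true_imp_iff]
    exact fun i => abs_le.mp (h k i))
  exact ⟨v, hv⟩

section
variable {g : ℝ → ℝ} {R0 : ℝ} {Φ : ℕ → ℝ → Set (Idx m n D → ℝ)}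

/-- limits of fat directions -/
def LimV (hΦ : ∀ k, FatFam g R0 (Φ k)) (h1 : 1 ≤ R0) (U : Ultrafilter ℕ) : Submodule ℝ (Idx m n D → ℝ) where
  carrier := {v | ∃ f : ℕ → Idx m n D → ℝ, Tendsto f U (𝓝 v) ∧ ∃ R, R0 ≤ R ∧ ∀ᶠ k in U, f k ∈ Φ k R}
  zero_mem' := ⟨fun _ => 0, tendsto_const_nhds, R0, le_rfl, Eventually.of_forall fun k => (hΦ k).zero R0 le_rfl⟩
  add_mem' := by
    rintro v w ⟨f, hf, R, hR, hfR⟩ ⟨f', hf', R', hR', hfR'⟩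
    refine ⟨fun k => f k + f' k, hf.add hf', 2 * max R R', ?_, ?_⟩
    · have := le_max_left R R'; linarith
    · filter_upwards [hfR, hfR'] with k h h'
      exact (hΦ k).add _ (hR.trans (le_max_left _ _)) _ ((hΦ k).mono _ _ hR (le_max_left _ _) h) _
        ((hΦ k).mono _ _ hR' (le_max_right _ _) h')
  smul_mem' := by
    rintro c v ⟨f, hf, R, hR, hfR⟩
    refine ⟨fun k => c • f k, hf.const_smul c, max 1 |c| * R, ?_, ?_⟩
    · have := le_max_left 1 |c|; nlinarith
    · filter_upwards [hfR] with k h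
      exact (hΦ k).smul _ hR _ h _ _ (le_max_left _ _) (le_max_right _ _)

lemma LimV_shift (hΦ : ∀ k, FatFam g R0 (Φ k)) (h1 : 1 ≤ R0) (hg : ∀ R, R ≤ g R) (U : Ultrafilter ℕ) :
    ∀ v ∈ LimV hΦ h1 U, ∀ γ : Fin n →₀ ℕ, γ.degree ≤ m → shv m γ v ∈ LimV hΦ h1 U := by
  rintro v ⟨f, hf, R, hR, hfR⟩ γ hγ
  have hcont : Continuous (shv m γ : (Idx m n D → ℝ) → _) := by
    refine continuous_pi fun i => ?_
    unfold shv
    split_ifs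
    · exact continuous_apply _
    · exact continuous_const
  have hs : Tendsto (fun k => ∑ i, |f k i|) U (𝓝 (∑ i, |v i|)) :=
    tendsto_finsetSum _ fun i _ => ((tendsto_pi_nhds.mp hf) i).abs
  have hs2 := hs.eventually (eventually_le_nhds (lt_add_one _))
  set R1 := max R (∑ i, |v i| + 1)
  refine ⟨fun k => shv m γ (f k), (hcont.tendsto v).comp hf, g R1, ?_, ?_⟩
  · exact hR.trans ((le_max_left _ _).trans (hg _))
  · filter_upwards [hfR, hs2] with k h h'
    exact (hΦ k).shift R1 (hR.trans (le_max_left _ _)) _ ((hΦ k).mono _ _ hR (le_max_left _ _) h)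
      (h'.trans (le_max_right _ _)) γ hγ

lemma lift_sys (hΦ : ∀ k, FatFam g R0 (Φ k)) (h1 : 1 ≤ R0) (U : Ultrafilter ℕ)
    (A : Finset (Idx m n D)) (v : Idx m n D → Idx m n D → ℝ)
    (hv : ∀ α ∈ A, ∀ β ∈ A, v α β = if α = β then 1 else 0)
    (f : Idx m n D → ℕ → Idx m n D → ℝ) (hf : ∀ α ∈ A, Tendsto (f α) U (𝓝 (v α))) (R : ℝ) (hR : R0 ≤ R)
    (hfR : ∀ α ∈ A, ∀ᶠ k in U, f α k ∈ Φ k R) : ∃ R', R0 ≤ R' ∧ ∀ᶠ k in U,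
      ∃ a : Idx m n D → Idx m n D → ℝ, ∀ α ∈ A, a α ∈ Φ k R' ∧
        (∀ β ∈ A, a α β = if α = β then 1 else 0) ∧ ∑ β, |a α β| ≤ R' ∧
        ∃ c : A → ℝ, a α = ∑ β, c β • f β.1 k := by
  set G : ℕ → Matrix A A ℝ := fun k => Matrix.of fun α β => f α.1 k β.1 with hG
  have hG1 : Tendsto G U (𝓝 1) := by
    refine tendsto_pi_nhds.mpr fun α => tendsto_pi_nhds.mpr fun β => ?_
    have := (tendsto_pi_nhds.mp (hf α α.2)) β
    rw [hv α α.2 β β.2] at this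
    rw [Matrix.one_apply]
    simp only [Subtype.ext_iff]
    exact this
  have hdet : Tendsto (fun k => (G k).det) U (𝓝 1) := by
    have := (Continuous.matrix_det (continuous_id (X := Matrix A A ℝ))).tendsto 1
    simp only [id, Matrix.det_one] at this
    exact this.comp hG1
  have hadj : Tendsto (fun k => (G k).adjugate) U (𝓝 1) := by
    have := (Continuous.matrix_adjugate (continuous_id (X := Matrix A A ℝ))).tendsto 1
    simp only [id, Matrix.adjugate_one] at this
    exact this.comp hG1
  have hinv : Tendsto (fun k => (G k)⁻¹) U (𝓝 1) := by
    have : Tendsto (fun k => (G k).det⁻¹ • (G k).adjugate) U (𝓝 ((1:ℝ)⁻¹ • 1)) :=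
      (hdet.inv₀ one_ne_zero).smul hadj
    simp only [inv_one, one_smul] at this
    refine this.congr fun k => ?_
    rw [Matrix.inv_def, Ring.inverse_eq_inv']
  have hb : ∀ᶠ k in U, ∀ α β, |(G k)⁻¹ α β| ≤ 2 := by
    rw [eventually_all]; intro α
    rw [eventually_all]; intro β
    have := ((tendsto_pi_nhds.mp ((tendsto_pi_nhds.mp hinv) α)) β).abs
    refine this.eventually (eventually_le_nhds ?_)
    rw [Matrix.one_apply]; split_ifs <;> norm_num
  have hne : ∀ᶠ k in U, (G k).det ≠ 0 := hdet.eventually_ne one_ne_zero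
  have hsum : ∀ᶠ k in U, ∀ α : A, ∑ i, |f α.1 k i| ≤ ∑ i, |v α.1 i| + 1 := by
    rw [eventually_all]; intro α
    have hs : Tendsto (fun k => ∑ i, |f α.1 k i|) U (𝓝 (∑ i, |v α.1 i|)) :=
      tendsto_finsetSum _ fun i _ => ((tendsto_pi_nhds.mp (hf α α.2)) i).abs
    exact hs.eventually (eventually_le_nhds (lt_add_one _))
  have hfR' : ∀ᶠ k in U, ∀ α : A, f α.1 k ∈ Φ k R := by
    rw [eventually_all]; exact fun α => hfR α α.2
  set R1 := 2 ^ (Finset.univ : Finset A).card * (2 * R)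
  set R2 := ∑ α : A, 2 * (∑ i, |v α.1 i| + 1)
  have h1' : (1:ℝ) ≤ 2 ^ (Finset.univ : Finset A).card := one_le_pow₀ (by norm_num)
  have hR01 : R0 ≤ R1 := by
    have : R0 ≤ 2 * R := by linarith
    show R0 ≤ 2 ^ _ * (2 * R)
    nlinarith
  refine ⟨max R1 R2, hR01.trans (le_max_left _ _), ?_⟩
  filter_upwards [hb, hne, hsum, hfR'] with k hb hne hsum hfR'
  set c : A → A → ℝ := fun α β => (G k)⁻¹ α β
  refine ⟨fun α => if h : α ∈ A then ∑ β, c ⟨α, h⟩ β • f β.1 k else 0, fun α hα => ?_⟩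
  dsimp only
  rw [dif_pos hα]
  refine ⟨?_, ?_, ?_, c ⟨α, hα⟩, rfl⟩
  · refine (hΦ k).mono _ _ hR01 (le_max_left _ _) ?_
    exact (hΦ k).comb h1 hR _ _ _ one_le_two (fun β _ => hb _ _) (fun β _ => hfR' β)
  · intro β hβ
    have : ((G k)⁻¹ * G k) ⟨α, hα⟩ ⟨β, hβ⟩ = (1 : Matrix A A ℝ) ⟨α, hα⟩ ⟨β, hβ⟩ := by
      rw [Matrix.nonsing_inv_mul _ (isUnit_iff_ne_zero.mpr hne)]
    rw [Matrix.mul_apply, Matrix.one_apply] at this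
    simpa [Finset.sum_apply, c, hG] using this
  · refine le_trans ?_ (le_max_right _ _)
    calc ∑ β, |(∑ γ, c ⟨α, hα⟩ γ • f γ.1 k) β| ≤ ∑ β, ∑ γ : A, 2 * |f γ.1 k β| := by
          refine Finset.sum_le_sum fun β _ => ?_
          rw [Finset.sum_apply]
          refine (Finset.abs_sum_le_sum_abs _ _).trans (Finset.sum_le_sum fun γ _ => ?_)
          rw [Pi.smul_apply, smul_eq_mul, abs_mul]
          exact mul_le_mul_of_nonneg_right (hb _ _) (abs_nonneg _)
      _ = ∑ γ : A, 2 * ∑ β, |f γ.1 k β| := by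
          rw [Finset.sum_comm]; simp only [Finset.mul_sum]
      _ ≤ R2 := Finset.sum_le_sum fun γ _ => by linarith [hsum γ]

lemma lim_large (hΦ : ∀ k, FatFam g R0 (Φ k)) (h1 : 1 ≤ R0) (hg : ∀ R, R ≤ g R) (U : Ultrafilter ℕ) :
    ∃ A : Finset (Idx m n D), UpC A ∧ A.card = Module.finrank ℝ (LimV hΦ h1 U) ∧
    (∃ v : Idx m n D → Idx m n D → ℝ, ∀ α ∈ A, v α ∈ LimV hΦ h1 U ∧ ∀ β ∈ A, v α β = if α = β then 1 else 0) ∧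
    ∃ R', R0 ≤ R' ∧ ∀ᶠ k in U, Sys (Φ k) R' A := by
  obtain ⟨A, hup, hcard, v, hv⟩ := groebner (LimV hΦ h1 U) (LimV_shift hΦ h1 hg U)
  refine ⟨A, hup, hcard, ⟨v, hv⟩, ?_⟩
  choose! f hf R hR hfR using fun α hα => (hv α hα).1
  set Rm := R0 + ∑ α ∈ A, (R α - R0)
  have hRm : ∀ α ∈ A, R α ≤ Rm := fun α hα => by
    have := Finset.single_le_sum (f := fun α => R α - R0) (fun β hβ => by linarith [hR β hβ]) hα
    linarith
  have hRm0 : R0 ≤ Rm := by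
    have := Finset.sum_nonneg (f := fun α => R α - R0) (s := A) (fun β hβ => by linarith [hR β hβ])
    linarith
  obtain ⟨R', hR', h⟩ := lift_sys hΦ h1 U A v (fun α hα => (hv α hα).2) f hf Rm hRm0 (fun α hα => by
    filter_upwards [hfR α hα] with k hk
    exact (hΦ k).mono _ _ (hR α hα) (hRm α hα) hk)
  refine ⟨R', hR', ?_⟩
  filter_upwards [h] with k hk
  obtain ⟨a, ha⟩ := hk
  exact ⟨a, fun α hα => ⟨(ha α hα).1, (ha α hα).2.1, (ha α hα).2.2.1⟩⟩
end
end FP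
end

section
namespace FP
open MvPolynomial Filter Topology
variable {m n D : ℕ}

lemma abs_le_of_sum {ι : Type*} [Fintype ι] {f : ι → ℝ} {R : ℝ} (h : ∑ i, |f i| ≤ R) (i : ι) : |f i| ≤ R :=
  (Finset.single_le_sum (f := fun i => |f i|) (fun _ _ => abs_nonneg _) (Finset.mem_univ i)).trans h

lemma eventually_ge_hyper (R : ℝ) : ∀ᶠ k : ℕ in (hyperfilter ℕ : Filter ℕ), R ≤ k := by
  have : ∀ᶠ k : ℕ in atTop, R ≤ k := tendsto_natCast_atTop_atTop.eventually_ge_atTop R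
  exact Nat.hyperfilter_le_atTop this

lemma RC_add (g : ℝ → ℝ) (hg : ∀ R, R ≤ g R) (R0 : ℝ) (h1 : 1 ≤ R0) (A : Finset (Idx m n D)) :
    ∃ R', R0 ≤ R' ∧ ∀ Φ : ℝ → Set (Idx m n D → ℝ), FatFam g R0 Φ → Sys Φ R0 A →
      ∀ w ∈ Φ R0, ∑ i, |w i| ≤ R0 → 1 ≤ ∑ i, |w i| → (∀ β ∈ A, w β = 0) →
      ∃ A', UpC A' ∧ A.card < A'.card ∧ Sys Φ R' A' := by
  by_contra hcon
  have H : ∀ k : ℕ, ∃ Φ : ℝ → Set (Idx m n D → ℝ), FatFam g R0 Φ ∧ Sys Φ R0 A ∧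
      ∃ w ∈ Φ R0, ∑ i, |w i| ≤ R0 ∧ 1 ≤ ∑ i, |w i| ∧ (∀ β ∈ A, w β = 0) ∧
      ∀ A', UpC A' → A.card < A'.card → ¬ Sys Φ (max R0 k) A' := by
    intro k
    by_contra hk
    apply hcon
    refine ⟨max R0 k, le_max_left _ _, fun Φ h1 h2 w h3 h4 h5 h6 => ?_⟩
    by_contra h7
    apply hk
    refine ⟨Φ, h1, h2, w, h3, h4, h5, h6, fun A' h8 h9 h10 => h7 ⟨A', h8, h9, h10⟩⟩
  choose Φ hΦ hS w hw hwR hw1 hw0 hno using H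
  choose a ha using hS
  set U := hyperfilter ℕ
  have hal : ∀ α : A, ∃ v, Tendsto (fun k => a k α) U (𝓝 v) := fun α =>
    ulim U _ R0 fun k i => abs_le_of_sum (ha k α α.2).2.2 i
  choose v hv using hal
  obtain ⟨w', hw'⟩ := ulim U w R0 fun k i => abs_le_of_sum (hwR k) i
  have hvV : ∀ α, v α ∈ LimV hΦ h1 U := fun α =>
    ⟨_, hv α, R0, le_rfl, Eventually.of_forall fun k => (ha k α α.2).1⟩
  have hwV : w' ∈ LimV hΦ h1 U := ⟨_, hw', R0, le_rfl, Eventually.of_forall hw⟩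
  have hvd : ∀ α β : A, v α β = if α = β then 1 else 0 := fun α β => by
    refine tendsto_nhds_unique ((tendsto_pi_nhds.mp (hv α)) β) ?_
    refine tendsto_const_nhds.congr fun k => ?_
    rw [(ha k α α.2).2.1 β β.2]; simp only [Subtype.ext_iff]
  have hwd : ∀ β : A, w' β = 0 := fun β => by
    refine tendsto_nhds_unique ((tendsto_pi_nhds.mp hw') β) ?_
    refine tendsto_const_nhds.congr fun k => ?_
    rw [hw0 k β β.2]
  have hwn : 1 ≤ ∑ i, |w' i| := by
    have hs : Tendsto (fun k => ∑ i, |w k i|) U (𝓝 (∑ i, |w' i|)) :=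
      tendsto_finsetSum _ fun i _ => ((tendsto_pi_nhds.mp hw') i).abs
    exact ge_of_tendsto hs (Eventually.of_forall hw1)
  have ind : LinearIndependent ℝ (fun o : Option A => (o.elim ⟨w', hwV⟩ fun α => ⟨v α, hvV α⟩ : LimV hΦ h1 U)) := by
    rw [Fintype.linearIndependent_iff]
    intro c hc
    have hc' := congrArg Subtype.val hc
    simp only [Fintype.sum_option, Option.elim, Submodule.coe_add, Submodule.coe_sum, Submodule.coe_smul,
      Submodule.coe_zero] at hc'
    have hz : ∀ β : A, c (some β) = 0 := by
      intro β
      have := congrFun hc' β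
      simp only [Pi.add_apply, Pi.smul_apply, Finset.sum_apply, hwd, hvd, smul_eq_mul, mul_zero, zero_add,
        Pi.zero_apply] at this
      simpa using this
    intro o
    cases o with
    | some β => exact hz β
    | none =>
      simp only [hz, zero_smul, Finset.sum_const_zero, add_zero] at hc'
      rcases smul_eq_zero.mp hc' with h | h
      · exact h
      · rw [h] at hwn; simp at hwn; exact absurd hwn (by norm_num)
  have hc := ind.fintype_card_le_finrank
  rw [Fintype.card_option, Fintype.card_coe] at hc
  obtain ⟨A', hup, hcard, _, R', hR', hev⟩ := lim_large hΦ h1 hg U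
  obtain ⟨k, hk1, hk2⟩ := (hev.and (eventually_ge_hyper R')).exists
  refine hno k A' hup (by omega) ?_
  exact Sys.mono (hΦ k) hR' (hk2.trans (le_max_right _ _)) hk1

lemma onb {ι : Type*} [Fintype ι] (L : Submodule ℝ (ι → ℝ)) {r : ℕ} (hr : Module.finrank ℝ L = r) :
    ∃ w : Fin r → ι → ℝ, (∀ k, w k ∈ L) ∧ ∀ k l, ∑ i, w k i * w l i = if k = l then 1 else 0 := by
  set e := (WithLp.linearEquiv 2 ℝ (ι → ℝ)).symm
  set L' : Submodule ℝ (EuclideanSpace ℝ ι) := L.map (e : (ι → ℝ) →ₗ[ℝ] EuclideanSpace ℝ ι) with hL'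
  have hr' : Module.finrank ℝ L' = r := by rw [hL', ← hr]; exact LinearEquiv.finrank_map_eq e L
  set b := (stdOrthonormalBasis ℝ L').reindex (finCongr hr')
  refine ⟨fun k => e.symm (b k).1, fun k => ?_, fun k l => ?_⟩
  · show e.symm (b k).1 ∈ L
    obtain ⟨x, hx, hx2⟩ := (b k).2
    rw [← hx2]; simpa using hx
  · have := orthonormal_iff_ite.mp b.orthonormal k l
    rw [← this, Submodule.coe_inner, PiLp.inner_apply]
    refine Finset.sum_congr rfl fun i _ => ?_
    simp only [RCLike.inner_apply, conj_trivial]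
    rw [mul_comm]; rfl

lemma det_bound (r : ℕ) (T : ℝ) : ∃ C : ℝ, 0 ≤ C ∧ ∀ {ι : Type} [Fintype ι] [DecidableEq ι] (M : Matrix ι ι ℝ),
    Fintype.card ι = r → (∀ i j, |M i j| ≤ T) → |M.det| ≤ C := by
  refine ⟨r.factorial • |T| ^ r, by positivity, fun M hr hM => ?_⟩
  have := Matrix.det_le (A := M) (abv := IsAbsoluteValue.toAbsoluteValue (abs : ℝ → ℝ)) (x := |T|)
    (fun i j => (hM i j).trans (le_abs_self T))
  rw [hr] at this
  exact this

lemma desc_det (A A' : Finset (Idx m n D)) (hcard : A'.card = A.card)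
    (hdeg : ∑ α ∈ A, α.1.1.degree ≤ ∑ α ∈ A', α.1.1.degree) (R1 : ℝ) (hR1 : 1 ≤ R1) :
    ∃ C : ℝ, 0 ≤ C ∧ ∀ (κ : ℝ) (a a' : Idx m n D → Idx m n D → ℝ), 0 < κ → κ ≤ 1 →
      (∀ α ∈ A, ∀ β ∈ A, a α β = if α = β then 1 else 0) →
      (∀ α ∈ A, ∀ β, |a α β| * κ ^ α.1.1.degree ≤ R1 * κ ^ β.1.1.degree) →
      (∀ α ∈ A', ∀ β ∈ A', a' α β = if α = β then 1 else 0) →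
      (∀ α ∈ A', ∀ β, |a' α β| ≤ R1) →
      (∀ α ∈ A', a' α = ∑ β : A, a' α β • a β) →
      ∀ α ∈ A, ∑ β, |a α β| ≤ C := by
  obtain ⟨C1, hC1, hdet⟩ := det_bound A.card R1
  set C2 := C1 * C1
  have hC2 : 0 ≤ C2 := mul_nonneg hC1 hC1
  refine ⟨∑ _β : Idx m n D, ∑ _k : A, C2 * R1, by positivity, ?_⟩
  intro κ a a' hκ hκ1 ha haκ ha' haR hL α hα
  obtain ⟨e⟩ : Nonempty (A ≃ A') := Fintype.card_eq.mp (by simp [hcard])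
  set MA : Matrix A A ℝ := Matrix.of fun α k => a α.1 (e k).1 with hMA
  set MB : Matrix A A ℝ := Matrix.of fun k α => a' (e k).1 α.1 with hMB
  have hBA : MB * MA = 1 := by
    ext k l
    rw [Matrix.mul_apply, Matrix.one_apply]
    have h2 := congrFun (hL (e k).1 (e k).2) (e l).1
    rw [ha' _ (e k).2 _ (e l).2, Finset.sum_apply] at h2
    simp only [hMA, hMB, Matrix.of_apply]
    simp only [Pi.smul_apply, smul_eq_mul, ← Subtype.ext_iff, e.injective.eq_iff] at h2
    exact h2.symm
  have hAB : MA * MB = 1 := mul_eq_one_comm.mp hBA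
  have hadj : MA = MA.det • MB.adjugate := by
    have h1 := Matrix.adjugate_mul MB
    have h2 : MB.adjugate = MB.det • MA := by
      calc MB.adjugate = MB.adjugate * (MB * MA) := by rw [hBA, mul_one]
        _ = _ := by rw [← mul_assoc, h1, Matrix.smul_mul, one_mul]
    have h3 : MA.det * MB.det = 1 := by rw [← Matrix.det_mul, hAB, Matrix.det_one]
    rw [h2, smul_smul, h3, one_smul]
  have hdA : |MA.det| ≤ C1 := by
    set w1 : A → ℝ := fun α => κ ^ α.1.1.1.degree
    set w2 : A → ℝ := fun k => (κ ^ (e k).1.1.1.degree)⁻¹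
    have hb := hdet (Matrix.of fun i j => w2 j * (Matrix.of (fun i j => w1 i * MA i j) i j)) (by simp) (by
      intro i j
      simp only [Matrix.of_apply, w1, w2, hMA]
      have := haκ i i.2 (e j)
      rw [abs_mul, abs_mul, abs_of_pos (by positivity), abs_of_pos (by positivity), inv_mul_le_iff₀ (by positivity)]
      linarith)
    rw [Matrix.det_mul_row, Matrix.det_mul_column] at hb
    have e1 : ∏ i, w1 i = κ ^ (∑ α ∈ A, α.1.1.degree) := by
      rw [Finset.prod_pow_eq_pow_sum, ← Finset.sum_coe_sort A]
    have e2 : ∏ i, w2 i = (κ ^ (∑ α ∈ A', α.1.1.degree))⁻¹ := by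
      rw [Finset.prod_inv_distrib, Finset.prod_pow_eq_pow_sum, ← Finset.sum_coe_sort A']
      congr 2
      exact Equiv.sum_comp e fun α : A' => α.1.1.1.degree
    have hge : 1 ≤ (∏ i, w2 i) * ∏ i, w1 i := by
      rw [e1, e2, le_inv_mul_iff₀ (by positivity), mul_one]
      exact pow_le_pow_of_le_one hκ.le hκ1 hdeg
    rw [← mul_assoc, abs_mul] at hb
    calc |MA.det| = 1 * |MA.det| := (one_mul _).symm
      _ ≤ |(∏ i, w2 i) * ∏ i, w1 i| * |MA.det| :=
        mul_le_mul_of_nonneg_right (hge.trans (le_abs_self _)) (abs_nonneg _)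
      _ ≤ C1 := hb
  have hent : ∀ i k, |MA i k| ≤ C2 := by
    intro i k
    rw [hadj, Matrix.smul_apply, smul_eq_mul, abs_mul]
    refine mul_le_mul hdA ?_ (abs_nonneg _) hC1
    rw [Matrix.adjugate_apply]
    refine hdet _ (by simp) fun p q => ?_
    rw [Matrix.updateRow_apply]
    split_ifs
    · rw [Pi.single_apply]; split_ifs <;> simp <;> linarith
    · exact haR _ (e p).2 _
  have hrep : ∀ β, a α β = ∑ k, MA ⟨α, hα⟩ k * a' (e k).1 β := by
    intro β
    have h2 : ∀ k, a' (e k).1 β = ∑ γ, MB k γ * a γ.1 β := by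
      intro k
      have := congrFun (hL (e k).1 (e k).2) β
      rw [Finset.sum_apply] at this
      exact this
    simp only [h2, Finset.mul_sum]
    rw [Finset.sum_comm]
    simp only [← mul_assoc, ← Finset.sum_mul]
    have h3 : ∀ γ, ∑ k, MA ⟨α, hα⟩ k * MB k γ = (1 : Matrix A A ℝ) ⟨α, hα⟩ γ := by
      intro γ; rw [← hAB, Matrix.mul_apply]
    simp only [h3, Matrix.one_apply, ite_mul, one_mul, zero_mul, Finset.sum_ite_eq, Finset.mem_univ, if_true]
  refine Finset.sum_le_sum fun β _ => ?_
  rw [hrep]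
  refine (Finset.abs_sum_le_sum_abs _ _).trans (Finset.sum_le_sum fun k _ => ?_)
  rw [abs_mul]
  exact mul_le_mul (hent _ _) (haR _ (e k).2 _) (abs_nonneg _) hC2

/-- progress measure -/
def Bet (A A' : Finset (Idx m n D)) : Prop :=
  A.card < A'.card ∨ (A'.card = A.card ∧ ∑ α ∈ A', α.1.1.degree < ∑ α ∈ A, α.1.1.degree)

set_option maxHeartbeats 1000000 in
lemma descend (g : ℝ → ℝ) (hg : ∀ R, R ≤ g R) (R0 : ℝ) (h1 : 1 ≤ R0) (A : Finset (Idx m n D)) :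
    ∃ R', R0 ≤ R' ∧ ∀ Φ : ℝ → Set (Idx m n D → ℝ), FatFam g R0 Φ →
      ∀ (κ : ℝ) (a : Idx m n D → Idx m n D → ℝ), 0 < κ → κ ≤ 1 →
      (∀ α ∈ A, a α ∈ Φ R0) →
      (∀ α ∈ A, ∀ β ∈ A, a α β = if α = β then 1 else 0) →
      (∀ α ∈ A, ∀ β, |a α β| * κ ^ α.1.1.degree ≤ R0 * κ ^ β.1.1.degree) →
      (∃ A', UpC A' ∧ Bet A A' ∧ Sys Φ R' A') ∨ Sys Φ R' A := by
  by_contra hcon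
  have H : ∀ k : ℕ, ∃ Φ : ℝ → Set (Idx m n D → ℝ), FatFam g R0 Φ ∧
      ∃ (κ : ℝ) (a : Idx m n D → Idx m n D → ℝ), 0 < κ ∧ κ ≤ 1 ∧
      (∀ α ∈ A, a α ∈ Φ R0) ∧
      (∀ α ∈ A, ∀ β ∈ A, a α β = if α = β then 1 else 0) ∧
      (∀ α ∈ A, ∀ β, |a α β| * κ ^ α.1.1.degree ≤ R0 * κ ^ β.1.1.degree) ∧
      (∀ A', UpC A' → Bet A A' → ¬ Sys Φ (max R0 k) A') ∧ ¬ Sys Φ (max R0 k) A := by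
    intro k
    by_contra hk
    apply hcon
    refine ⟨max R0 k, le_max_left _ _, fun Φ h1 κ a h2 h3 h4 h5 h6 => ?_⟩
    by_contra h7
    apply hk
    push Not at h7
    exact ⟨Φ, h1, κ, a, h2, h3, h4, h5, h6, h7.1, h7.2⟩
  choose Φ hΦ κ a hκ hκ1 haΦ had haκ hno1 hno2 using H
  set U := hyperfilter ℕ
  -- coordinates
  set L : ℕ → Submodule ℝ (Idx m n D → ℝ) := fun k => Submodule.span ℝ (Set.range fun α : A => a k α) with hL
  have coord : ∀ k, ∀ w ∈ L k, w = ∑ β : A, w β • a k β := by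
    intro k w hw
    obtain ⟨c, hc⟩ := (Submodule.mem_span_range_iff_exists_fun ℝ).mp hw
    have : ∀ β : A, w β = c β := by
      intro β
      rw [← hc, Finset.sum_apply]
      simp only [Pi.smul_apply, smul_eq_mul]
      rw [Finset.sum_eq_single β]
      · rw [had k β β.2 β β.2, if_pos rfl, mul_one]
      · intro b _ hb
        rw [had k b b.2 β β.2, if_neg (fun h => hb (Subtype.ext h)), mul_zero]
      · simp
    simp only [this]
    exact hc.symm
  have indk : ∀ k, LinearIndependent ℝ (fun α : A => a k α) := by
    intro k
    rw [Fintype.linearIndependent_iff]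
    intro c hc β
    have := congrFun hc β
    rw [Finset.sum_apply] at this
    simp only [Pi.smul_apply, smul_eq_mul] at this
    rw [Finset.sum_eq_single β] at this
    · rwa [had k β β.2 β β.2, if_pos rfl, mul_one] at this
    · intro b _ hb
      rw [had k b b.2 β β.2, if_neg (fun h => hb (Subtype.ext h)), mul_zero]
    · simp
  have hfr : ∀ k, Module.finrank ℝ (L k) = A.card := by
    intro k
    rw [hL]
    have := finrank_span_eq_card (indk k)
    rw [this, Fintype.card_coe]
  choose w hwL hwo using fun k => onb (L k) (hfr k)
  have hwb : ∀ k p i, |w k p i| ≤ 1 := by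
    intro k p i
    have h2 := hwo k p p
    rw [if_pos rfl] at h2
    have h3 := Finset.single_le_sum (f := fun i => w k p i * w k p i) (fun _ _ => mul_self_nonneg _)
      (Finset.mem_univ i)
    rw [h2] at h3
    exact abs_le_one_iff_mul_self_le_one.mpr h3
  set Rw := 2 ^ (Finset.univ : Finset A).card * (1 * R0) with hRw
  have hRw0 : R0 ≤ Rw := by
    have h1' : (1:ℝ) ≤ 2 ^ (Finset.univ : Finset A).card := one_le_pow₀ (by norm_num)
    rw [hRw, one_mul]
    nlinarith
  have hwΦ : ∀ k p, w k p ∈ Φ k Rw := by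
    intro k p
    rw [coord k _ (hwL k p)]
    exact (hΦ k).comb h1 le_rfl _ _ _ le_rfl (fun β _ => hwb k p β) fun β _ => haΦ k β β.2
  choose v hv using fun p => ulim U (fun k => w k p) 1 (fun k i => hwb k p i)
  have hvV : ∀ p, v p ∈ LimV hΦ h1 U := fun p =>
    ⟨_, hv p, Rw, hRw0, Eventually.of_forall fun k => hwΦ k p⟩
  have hvo : ∀ p q, ∑ i, v p i * v q i = if p = q then 1 else 0 := by
    intro p q
    have hs : Tendsto (fun k => ∑ i, w k p i * w k q i) U (𝓝 (∑ i, v p i * v q i)) :=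
      tendsto_finsetSum _ fun i _ => ((tendsto_pi_nhds.mp (hv p)) i).mul ((tendsto_pi_nhds.mp (hv q)) i)
    refine tendsto_nhds_unique hs (tendsto_const_nhds.congr fun k => (hwo k p q).symm)
  have ind : LinearIndependent ℝ (fun p => (⟨v p, hvV p⟩ : LimV hΦ h1 U)) := by
    rw [Fintype.linearIndependent_iff]
    intro c hc q
    have hc' := congrArg Subtype.val hc
    simp only [Submodule.coe_sum, Submodule.coe_smul, Submodule.coe_zero] at hc'
    have h2 : ∑ i, (∑ p, c p • v p) i * v q i = 0 := by rw [hc']; simp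
    simp only [Finset.sum_apply, Pi.smul_apply, smul_eq_mul, Finset.sum_mul] at h2
    rw [Finset.sum_comm] at h2
    simp only [mul_assoc, ← Finset.mul_sum, hvo] at h2
    simpa using h2
  have hc := ind.fintype_card_le_finrank
  rw [Fintype.card_fin] at hc
  obtain ⟨A', hup, hcard, ⟨u, hu⟩, R', hR', hev⟩ := lim_large hΦ h1 hg U
  have noBet : ¬ Bet A A' := by
    intro hB
    obtain ⟨k, hk1, hk2⟩ := (hev.and (eventually_ge_hyper R')).exists
    exact hno1 k A' hup hB (Sys.mono (hΦ k) hR' (hk2.trans (le_max_right _ _)) hk1)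
  unfold Bet at noBet
  push Not at noBet
  have hcA : A'.card = A.card := by have := noBet.1; omega
  have hdeg := noBet.2 hcA
  have hspan := ind.span_eq_top_of_card_eq_finrank' (by rw [Fintype.card_fin]; omega)
  have hcoef : ∀ α : A', ∃ c : Fin A.card → ℝ, u α = ∑ p, c p • v p := by
    intro α
    have : (⟨u α, (hu α α.2).1⟩ : LimV hΦ h1 U) ∈ Submodule.span ℝ (Set.range fun p => (⟨v p, hvV p⟩ : LimV hΦ h1 U)) := by
      rw [hspan]; trivial
    obtain ⟨c, hc⟩ := (Submodule.mem_span_range_iff_exists_fun ℝ).mp this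
    refine ⟨c, ?_⟩
    have hc' := congrArg Subtype.val hc
    simp only [Submodule.coe_sum, Submodule.coe_smul] at hc'
    exact hc'.symm
  choose c hc using hcoef
  set f : Idx m n D → ℕ → Idx m n D → ℝ := fun α k =>
    if h : α ∈ A' then ∑ p, c ⟨α, h⟩ p • w k p else 0 with hf
  set T : ℝ := 1 + ∑ α, ∑ p, |c α p| with hT
  have hT1 : 1 ≤ T := by rw [hT]; have : 0 ≤ ∑ α, ∑ p, |c α p| := by positivity
                         linarith
  have hcT : ∀ α p, |c α p| ≤ T := by
    intro α p
    have h2 := Finset.single_le_sum (f := fun p => |c α p|) (fun _ _ => abs_nonneg _) (Finset.mem_univ p)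
    have h3 := Finset.single_le_sum (f := fun α => ∑ p, |c α p|) (fun _ _ => by positivity) (Finset.mem_univ α)
    linarith
  set Rf := 2 ^ (Finset.univ : Finset (Fin A.card)).card * (T * Rw) with hRf
  have hRf0 : R0 ≤ Rf := by
    have h1' : (1:ℝ) ≤ 2 ^ (Finset.univ : Finset (Fin A.card)).card := one_le_pow₀ (by norm_num)
    have h2' : Rw ≤ T * Rw := by nlinarith
    rw [hRf]
    nlinarith
  obtain ⟨R1, hR1, hev1⟩ := lift_sys hΦ h1 U A' u (fun α hα => (hu α hα).2) f (by
    intro α hα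
    rw [hc ⟨α, hα⟩]
    simp only [hf, dif_pos hα]
    exact tendsto_finsetSum _ fun p _ => (hv p).const_smul _) Rf hRf0 (by
    intro α hα
    refine Eventually.of_forall fun k => ?_
    simp only [hf, dif_pos hα]
    exact (hΦ k).comb h1 hRw0 _ _ _ hT1 (fun p _ => hcT _ p) fun p _ => hwΦ k p)
  obtain ⟨C, hC, hdd⟩ := desc_det A A' hcA hdeg R1 (h1.trans hR1)
  obtain ⟨k, ⟨a', ha'⟩, hk2⟩ := (hev1.and (eventually_ge_hyper C)).exists
  apply hno2 k
  refine ⟨a k, fun α hα => ⟨(hΦ k).mono _ _ le_rfl (le_max_left _ _) (haΦ k α hα), had k α hα, ?_⟩⟩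
  refine le_trans ?_ (hk2.trans (le_max_right _ _))
  refine hdd (κ k) (a k) a' (hκ k) (hκ1 k) (had k) ?_ (fun α hα => (ha' α hα).2.1) ?_ ?_ α hα
  · intro α hα β
    refine (haκ k α hα β).trans (mul_le_mul_of_nonneg_right hR1 (pow_nonneg (hκ k).le _))
  · intro α hα β
    exact abs_le_of_sum (ha' α hα).2.2.1 β
  · intro α hα
    apply coord
    obtain ⟨c', hc'⟩ := (ha' α hα).2.2.2
    rw [hc']
    refine Submodule.sum_mem _ fun β _ => Submodule.smul_mem _ _ ?_
    simp only [hf, dif_pos β.2]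
    exact Submodule.sum_mem _ fun p _ => Submodule.smul_mem _ _ (hwL k p)

end FP
end

section
namespace FP
open MvPolynomial
variable {m n D : ℕ}

lemma seg_mem {V : Type*} [AddCommGroup V] [Module ℝ V] {S : Set V} (hS : Convex ℝ S) {Q u : V}
    (h1 : Q + u ∈ S) (h2 : Q - u ∈ S) {t : ℝ} (ht : |t| ≤ 1) : Q + t • u ∈ S := by
  obtain ⟨h3, h4⟩ := abs_le.mp ht
  have := hS h1 h2 (a := (1 + t) / 2) (b := (1 - t) / 2) (by linarith) (by linarith) (by ring)
  convert this using 1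
  module

/-- fat directions at `(y, δ)` around `P` -/
def PhiG (m : ℕ) (E : Finset (En n)) (K : En n → Set (Fin D → ℝ)) (l : ℕ) (y : En n) (δ : ℝ) (P : VP n D) :
    ℝ → Set (Idx m n D → ℝ) := fun R =>
  {a | P + (1 / R) • mkV m y δ a ∈ Gam m E K R l y ∧ P - (1 / R) • mkV m y δ a ∈ Gam m E K R l y}

lemma PhiG_mem {E : Finset (En n)} {K : En n → Set (Fin D → ℝ)} (hK : ∀ x ∈ E, Convex ℝ (K x)) {l : ℕ}
    {y : En n} (hy : y ∈ E) {δ : ℝ} {P : VP n D} {R R' c : ℝ} {a : Idx m n D → ℝ} (hR : 0 < R) (hR' : 0 < R')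
    (hRR : R ≤ R')
    (h1 : P + (1 / R) • mkV m y δ a ∈ Gam m E K R l y) (h2 : P - (1 / R) • mkV m y δ a ∈ Gam m E K R l y)
    (hc : |c| * R ≤ R') : c • a ∈ PhiG m E K l y δ P R' := by
  have hcv := Gam.convex (m := m) (R := R) hK l y hy
  have ht : |c * R / R'| ≤ 1 := by
    rw [abs_div, abs_mul, abs_of_pos hR, abs_of_pos hR', div_le_one hR']; exact hc
  have e : (1 / R') • mkV m y δ (c • a) = (c * R / R') • ((1 / R) • mkV m y δ a) := by
    rw [map_smul, smul_smul, smul_smul]; congr 1; field_simp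
  have ht' : |-(c * R / R')| ≤ 1 := by rwa [abs_neg]
  constructor
  · rw [e]; exact Gam.mono hRR l (seg_mem hcv h1 h2 ht)
  · rw [e, sub_eq_add_neg, ← neg_smul]; exact Gam.mono hRR l (seg_mem hcv h1 h2 ht')

lemma fat_gauge (m n D : ℕ) (hm : 1 ≤ m) (l : ℕ) : ∃ g : ℝ → ℝ, (∀ R, R ≤ g R) ∧
    ∀ (E : Finset (En n)) (K : En n → Set (Fin D → ℝ)), (∀ x ∈ E, Convex ℝ (K x)) → ∀ y ∈ E,
    ∀ (δ : ℝ) (P : VP n D) (R0 : ℝ), 0 < δ → 1 ≤ R0 → P ∈ Gam m E K R0 l y →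
      FatFam g R0 (PhiG m E K l y δ P) := by
  have H : ∀ R : ℝ, ∃ R' c : ℝ, 1 ≤ R → (R ≤ R' ∧ 0 < c ∧ c ≤ 1 ∧
    ∀ (E : Finset (En n)) (K : En n → Set (Fin D → ℝ)), (∀ x ∈ E, Convex ℝ (K x)) → ∀ y ∈ E,
    ∀ (δ : ℝ) (P u : VP n D) (γ : Fin n →₀ ℕ), 0 < δ → γ.degree ≤ m →
      P + u ∈ Gam m E K R l y → P - u ∈ Gam m E K R l y → NV y δ u ≤ R * δ ^ m →
      P + c • trV m y (mon y δ γ • u) ∈ Gam m E K R' l y ∧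
      P - c • trV m y (mon y δ γ • u) ∈ Gam m E K R' l y) := by
    intro R
    by_cases h : 1 ≤ R
    · obtain ⟨R', c, h1, h2⟩ := mult_lem m n D hm l R (by linarith)
      refine ⟨R', c, fun _ => ⟨h1, h2.1, h2.2.1, ?_⟩⟩
      exact h2.2.2
    · exact ⟨0, 0, fun h' => absurd h' h⟩
  choose G c hGc using H
  refine ⟨fun R => max R (max (G R) (R / c R)), fun R => le_max_left _ _, ?_⟩
  intro E K hK y hy δ P R0 hδ hR0 hP
  have pos : ∀ {R}, R0 ≤ R → 0 < R := fun h => by linarith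
  refine ⟨?_, ?_, ?_, ?_, ?_⟩
  · intro R R' h0 h a ha
    have := PhiG_mem hK hy (c := 1) (pos h0) (pos (h0.trans h)) h ha.1 ha.2 (by simpa using h)
    rwa [one_smul] at this
  · intro R h0
    have := Gam.mono h0 l hP
    constructor <;> simpa using this
  · intro R h0 u hu v hv
    have hcv := Gam.convex (m := m) (R := R) hK l y hy
    have hR := pos h0
    have e : ∀ Q : VP n D, (1 / (2 * R)) • Q = (1/2 : ℝ) • ((1 / R) • Q) := by
      intro Q; rw [smul_smul]; congr 1; field_simp
    constructor
    · have := hcv hu.1 hv.1 (a := 1/2) (b := 1/2) (by norm_num) (by norm_num) (by norm_num)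
      refine Gam.mono (by linarith : R ≤ 2 * R) l ?_
      rw [e, map_add]
      convert this using 1
      module
    · have := hcv hu.2 hv.2 (a := 1/2) (b := 1/2) (by norm_num) (by norm_num) (by norm_num)
      refine Gam.mono (by linarith : R ≤ 2 * R) l ?_
      rw [e, map_add]
      convert this using 1
      module
  · intro R h0 u hu t T hT ht
    have hR := pos h0
    exact PhiG_mem hK hy hR (by positivity) (by nlinarith) hu.1 hu.2 (mul_le_mul_of_nonneg_right ht hR.le)
  · intro R h0 u hu hsum γ hγ
    have hR := pos h0
    obtain ⟨h1, h2, h3, h4⟩ := hGc R (hR0.trans h0)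
    have hNV : NV y δ ((1 / R) • mkV m y δ u) ≤ R * δ ^ m := by
      rw [NV_smul, NV_eq_ch y hδ (jet_mkV _ _ _ _), ch_mkV m y hδ, abs_of_pos (by positivity)]
      have hd : 0 < δ ^ m := by positivity
      have : 1 / R * (δ ^ m * ∑ i, |u i|) ≤ 1 / R * (δ ^ m * R) := by gcongr
      refine this.trans ?_
      have e : 1 / R * (δ ^ m * R) = δ ^ m := by field_simp
      rw [e]
      have : 1 ≤ R := hR0.trans h0
      nlinarith
    obtain ⟨h5, h6⟩ := h4 E K hK y hy δ P _ γ hδ hγ hu.1 hu.2 hNV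
    have e : trV m y (mon y δ γ • ((1 / R) • mkV m y δ u)) = (1 / R) • mkV m y δ (shv m γ u) := by
      rw [smul_comm, map_smul]
      congr 1
      apply ch_inj y hδ (jetV_trV _ _ _) (jet_mkV _ _ _ _)
      rw [ch_mon m y hδ, ch_mkV m y hδ, ch_mkV m y hδ]
    rw [e, smul_smul] at h5 h6
    set R' := max R (max (G R) (R / c R)) with hR'
    have hRR' : R ≤ R' := le_max_left _ _
    have hGR' : G R ≤ R' := (le_max_left _ _).trans (le_max_right _ _)
    have hcR' : R / c R ≤ R' := (le_max_right _ _).trans (le_max_right _ _)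
    have hp' : 0 < R' := hR.trans_le hRR'
    have hcv := Gam.convex (m := m) (R := R') hK l y hy
    have ht : |R / (c R * R')| ≤ 1 := by
      rw [abs_of_pos (by positivity), div_le_one (by positivity)]
      rw [div_le_iff₀ h2] at hcR'; linarith
    have ht' : |-(R / (c R * R'))| ≤ 1 := by rwa [abs_neg]
    have e2 : (1 / R') • mkV m y δ (shv m γ u) = (R / (c R * R')) • ((c R * (1 / R)) • mkV m y δ (shv m γ u)) := by
      rw [smul_smul]; congr 1; field_simp
    have h5' := Gam.mono hGR' l h5
    have h6' := Gam.mono hGR' l h6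
    show P + (1 / R') • mkV m y δ (shv m γ u) ∈ _ ∧ P - (1 / R') • mkV m y δ (shv m γ u) ∈ _
    constructor
    · rw [e2]; exact seg_mem hcv h5' h6' ht
    · rw [e2, sub_eq_add_neg, ← neg_smul]; exact seg_mem hcv h5' h6' ht'

/-- large systems -/
def Lrg (E : Finset (En n)) (K : En n → Set (Fin D → ℝ)) (A : Finset (Idx m n D)) (x : En n) (δ R : ℝ)
    (P : VP n D) (l : ℕ) : Prop :=
  P ∈ Gam m E K R l x ∧ Sys (PhiG m E K l x δ P) R A

lemma lrg_descend (hm : 1 ≤ m) (l : ℕ) (A : Finset (Idx m n D)) (R0 : ℝ) (h1 : 1 ≤ R0) :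
    ∃ R', R0 ≤ R' ∧ ∀ (E : Finset (En n)) (K : En n → Set (Fin D → ℝ)), (∀ x ∈ E, Convex ℝ (K x)) →
    ∀ y ∈ E, ∀ (δ0 δ : ℝ) (P : VP n D), 0 < δ → δ ≤ δ0 → Lrg E K A y δ0 R0 P l →
      (∃ A', UpC A' ∧ Bet A A' ∧ Lrg E K A' y δ R' P l) ∨ Lrg E K A y δ R' P l := by
  obtain ⟨g, hg, hfat⟩ := fat_gauge m n D hm l
  obtain ⟨R', hR', hd⟩ := descend (m := m) (n := n) (D := D) g hg R0 h1 A
  refine ⟨R', hR', ?_⟩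
  rintro E K hK y hy δ0 δ P hδ hδδ ⟨hP, a, ha⟩
  have hδ0 : 0 < δ0 := hδ.trans_le hδδ
  set κ := δ / δ0 with hκ
  have hκ0 : 0 < κ := by positivity
  have hκ1 : κ ≤ 1 := by rw [hκ, div_le_one hδ0]; exact hδδ
  have hPR := Gam.mono hR' l hP
  have key := hd (PhiG m E K l y δ P) (hfat E K hK y hy δ P R0 hδ h1 hP) κ
    (fun α β => κ ^ β.1.1.degree / κ ^ α.1.1.degree * a α β) hκ0 hκ1 ?_ ?_ ?_
  · rcases key with ⟨A', h2, h3, h4⟩ | h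
    · exact Or.inl ⟨A', h2, h3, hPR, h4⟩
    · exact Or.inr ⟨hPR, h⟩
  · intro α hα
    obtain ⟨hf, _, _⟩ := ha α hα
    have hdeg : α.1.1.degree ≤ m := (mem_Bm.mp α.1.2).le
    have e : mkV m y δ (fun β => κ ^ β.1.1.degree / κ ^ α.1.1.degree * a α β) =
        (κ ^ (m - α.1.1.degree)) • mkV m y δ0 (a α) := by
      apply ch_inj y hδ (jet_mkV _ _ _ _) ((jet_mkV _ _ _ _).smul _)
      rw [ch_mkV m y hδ, map_smul]
      ext β
      have h3 := congrFun (ch_mkV m y hδ0 (a α)) β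
      rw [ch_apply] at h3
      rw [Pi.smul_apply, ch_apply, ← h3, smul_eq_mul, pow_sub₀ _ hκ0.ne' hdeg, hκ, div_pow, div_pow, div_pow]
      field_simp
    have hcv := Gam.convex (m := m) (R := R0) hK l y hy
    have hle : |κ ^ (m - α.1.1.degree)| ≤ 1 := by
      rw [abs_of_pos (by positivity)]; exact pow_le_one₀ hκ0.le hκ1
    have hle' : |-κ ^ (m - α.1.1.degree)| ≤ 1 := by rwa [abs_neg]
    constructor
    · rw [e, smul_comm]; exact seg_mem hcv hf.1 hf.2 hle
    · rw [e, smul_comm, sub_eq_add_neg, ← neg_smul]; exact seg_mem hcv hf.1 hf.2 hle'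
  · intro α hα β hβ
    rw [(ha α hα).2.1 β hβ]
    split_ifs with h
    · subst h; field_simp
    · rw [mul_zero]
  · intro α hα β
    have h3 := abs_le_of_sum (ha α hα).2.2 β
    rw [abs_mul, abs_of_pos (by positivity : 0 < κ ^ β.1.1.degree / κ ^ α.1.1.degree)]
    calc _ = |a α β| * κ ^ β.1.1.degree := by field_simp
      _ ≤ _ := mul_le_mul_of_nonneg_right h3 (by positivity)

lemma lrg_RC (hm : 1 ≤ m) (l : ℕ) (A : Finset (Idx m n D)) (R0 : ℝ) (h1 : 1 ≤ R0) :
    ∃ R', R0 ≤ R' ∧ ∀ (E : Finset (En n)) (K : En n → Set (Fin D → ℝ)), (∀ x ∈ E, Convex ℝ (K x)) →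
    ∀ y ∈ E, ∀ (δ : ℝ) (P w : VP n D), 0 < δ → Lrg E K A y δ R0 P l → JetV m w →
      P + (1 / R0) • w ∈ Gam m E K R0 l y → P - (1 / R0) • w ∈ Gam m E K R0 l y →
      NV y δ w ≤ R0 * δ ^ m → δ ^ m ≤ NV y δ w → (∀ β ∈ A, ch m y δ w β = 0) →
      ∃ A', UpC A' ∧ Bet A A' ∧ Lrg E K A' y δ R' P l := by
  obtain ⟨g, hg, hfat⟩ := fat_gauge m n D hm l
  obtain ⟨R', hR', hd⟩ := RC_add (m := m) (n := n) (D := D) g hg R0 h1 A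
  refine ⟨R', hR', ?_⟩
  intro E K hK y hy δ P w hδ hL hw h2 h3 h4 h5 h6
  have hδm : 0 < δ ^ m := by positivity
  rw [NV_eq_ch y hδ hw] at h4 h5
  have e := mkV_ch y hδ hw
  obtain ⟨A', h7, h8, h9⟩ := hd (PhiG m E K l y δ P) (hfat E K hK y hy δ P R0 hδ h1 hL.1) hL.2 (ch m y δ w)
    ⟨by rw [e]; exact h2, by rw [e]; exact h3⟩ (by nlinarith) (by nlinarith) h6
  exact ⟨A', h7, Or.inl h8, Gam.mono hR' l hL.1, h9⟩

end FP
end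

section
namespace FP
open MvPolynomial
variable {m n D : ℕ}

lemma mat_inv (ι : Type*) [Fintype ι] [DecidableEq ι] : ∃ ε : ℝ, 0 < ε ∧ ∀ G : Matrix ι ι ℝ,
    (∀ i j, |G i j - (1 : Matrix ι ι ℝ) i j| ≤ ε) → ∃ H : Matrix ι ι ℝ, H * G = 1 ∧ ∀ i j, |H i j| ≤ 2 := by
  have hdet : ContinuousAt (fun G : Matrix ι ι ℝ => G.det) 1 := (continuous_id.matrix_det).continuousAt
  have hinv : ContinuousAt (fun G : Matrix ι ι ℝ => G⁻¹) 1 := by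
    simp only [Matrix.inv_def, Ring.inverse_eq_inv']
    refine ContinuousAt.smul (hdet.inv₀ (by simp)) (continuous_id.matrix_adjugate).continuousAt
  have h1 : ∀ᶠ G : Matrix ι ι ℝ in nhds 1, G.det ≠ 0 := hdet.eventually_ne (by simp)
  have h2 : ∀ᶠ G : Matrix ι ι ℝ in nhds 1, ∀ i j, |G⁻¹ i j| < 2 := by
    rw [Filter.eventually_all]; intro i
    rw [Filter.eventually_all]; intro j
    have : ContinuousAt (fun G : Matrix ι ι ℝ => |G⁻¹ i j|) 1 :=
      ContinuousAt.comp (g := fun G : Matrix ι ι ℝ => |G i j|) (continuous_id.matrix_elem i j).abs.continuousAt hinv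
    refine this.eventually_lt_const ?_
    show |(1 : Matrix ι ι ℝ)⁻¹ i j| < 2
    rw [inv_one, Matrix.one_apply]; split_ifs <;> norm_num
  have h3 := h1.and h2
  have h4 : ∀ᶠ G : ι → ι → ℝ in nhds (fun i j => (1 : Matrix ι ι ℝ) i j : ι → ι → ℝ), (Matrix.det (Matrix.of G) ≠ 0 ∧ ∀ i j, |(Matrix.of G)⁻¹ i j| < 2) := h3
  rw [Metric.eventually_nhds_iff] at h4
  obtain ⟨ε, hε, h5⟩ := h4
  refine ⟨ε / 2, by positivity, fun G hG => ?_⟩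
  have h6 : dist (fun i j => G i j : ι → ι → ℝ) (fun i j => (1 : Matrix ι ι ℝ) i j : ι → ι → ℝ) < ε := by
    rw [dist_pi_lt_iff hε]; intro i
    rw [dist_pi_lt_iff hε]; intro j
    rw [Real.dist_eq]
    exact (hG i j).trans_lt (by linarith)
  obtain ⟨h7, h8⟩ := h5 h6
  refine ⟨G⁻¹, Matrix.nonsing_inv_mul G (isUnit_iff_ne_zero.mpr h7), fun i j => (h8 i j).le⟩

lemma ball_mem {V ι : Type*} [AddCommGroup V] [Module ℝ V] {S : Set V} (hS : Convex ℝ S) (A : Finset ι)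
    {p0 : V} (h0 : p0 ∈ S) (p q : ι → V) (hp : ∀ i ∈ A, p i ∈ S) (hq : ∀ i ∈ A, q i ∈ S) (t : ι → ℝ)
    (ht : ∀ i ∈ A, |t i| ≤ 1) :
    (1 / (2 * (A.card : ℝ) + 1)) • (p0 + ∑ i ∈ A, ((p i + q i) + t i • (p i - q i))) ∈ S := by
  induction A using Finset.induction_on with
  | empty => simpa using h0
  | insert a A ha ih =>
    have ih := ih (fun i hi => hp i (Finset.mem_insert_of_mem hi)) (fun i hi => hq i (Finset.mem_insert_of_mem hi))
      (fun i hi => ht i (Finset.mem_insert_of_mem hi))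
    obtain ⟨h3, h4⟩ := abs_le.mp (ht a (Finset.mem_insert_self _ _))
    have hm := hS (hp a (Finset.mem_insert_self _ _)) (hq a (Finset.mem_insert_self _ _))
      (a := (1 + t a) / 2) (b := (1 - t a) / 2) (by linarith) (by linarith) (by ring)
    have := hS ih hm (a := (2 * (A.card : ℝ) + 1) / (2 * (A.card : ℝ) + 3)) (b := 2 / (2 * (A.card : ℝ) + 3))
      (by positivity) (by positivity) (by field_simp; ring)
    convert this using 1
    rw [Finset.sum_insert ha, Finset.card_insert_of_notMem ha, smul_smul]
    have e1 : (2 * (A.card : ℝ) + 1) / (2 * (A.card : ℝ) + 3) * (1 / (2 * (A.card : ℝ) + 1)) =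
      1 / (2 * (A.card : ℝ) + 3) := by field_simp
    have e2 : 1 / (2 * ((A.card + 1 : ℕ) : ℝ) + 1) = 1 / (2 * (A.card : ℝ) + 3) := by
      push_cast; congr 1; ring
    rw [e1, e2]
    have e3 : 2 / (2 * (A.card : ℝ) + 3) = 2 * (1 / (2 * (A.card : ℝ) + 3)) := by ring
    rw [e3]
    module

/-- directions around a point -/
lemma dir_mem {V ι : Type*} [AddCommGroup V] [Module ℝ V] {S : Set V} (hS : Convex ℝ S) [Fintype ι]
    {P : V} (h0 : P ∈ S) (w : ι → V) (hp : ∀ i, P + w i ∈ S) (hq : ∀ i, P - w i ∈ S) (t : ι → ℝ)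
    (ht : ∀ i, |t i| * (2 * (Fintype.card ι : ℝ) + 1) ≤ 2) :
    P + ∑ i, t i • w i ∈ S := by
  have hk : (0:ℝ) < 2 * (Fintype.card ι : ℝ) + 1 := by positivity
  have := ball_mem hS Finset.univ h0 (fun i => P + w i) (fun i => P - w i) (fun i _ => hp i) (fun i _ => hq i)
    (fun i => t i * ((2 * (Fintype.card ι : ℝ) + 1) / 2)) (fun i _ => by
      rw [abs_mul, abs_of_pos (by positivity : 0 < (2 * (Fintype.card ι : ℝ) + 1) / 2)]; linarith [ht i])
  convert this using 1
  have e : ∀ i, ((P + w i) + (P - w i)) + (t i * ((2 * (Fintype.card ι : ℝ) + 1) / 2)) • ((P + w i) - (P - w i)) =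
     (2:ℝ) • P + ((2 * (Fintype.card ι : ℝ) + 1)) • (t i • w i) := fun i => by module
  simp only [e, Finset.sum_add_distrib, ← Finset.smul_sum, Finset.sum_const, Finset.card_univ,
    ← Nat.cast_smul_eq_nsmul ℝ]
  rw [smul_add, smul_add, smul_smul, smul_smul, smul_smul, one_div_mul_cancel hk.ne', one_smul, ← add_assoc,
    ← add_smul]
  congr 1
  rw [show 1 / (2 * (Fintype.card ι : ℝ) + 1) + 1 / (2 * (Fintype.card ι : ℝ) + 1) * 2 * Fintype.card ι = 1 by field_simp; ring, one_smul]

/-- vanishing `A`-coefficients -/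
def WA (A : Finset (Idx m n D)) (Q : VP n D) : Prop := ∀ β ∈ A, ∀ (x : En n) (δ : ℝ), 0 < δ → ch m x δ Q β = 0

lemma WA.of {A : Finset (Idx m n D)} (hA : UpC A) {Q : VP n D} (hQ : JetV m Q) {x : En n} {δ : ℝ} (hδ : 0 < δ)
    (h : ∀ β ∈ A, ch m x δ Q β = 0) : WA A Q := by
  intro β hβ y δ' _
  rw [ch_apply]
  have e : tau y (Q β.2) = tau (y - x) (tau x (Q β.2)) := by rw [tau_tau]; congr 2; abel
  rw [e, coeff_tau_eq_zero, zero_mul]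
  intro α hα
  by_cases hd : α.degree < m
  · have := h (⟨α, mem_Bm.mpr hd⟩, β.2) (hA β hβ _ hα rfl)
    rw [ch_apply] at this
    exact (mul_eq_zero.mp this).resolve_right (by positivity)
  · exact (hQ β.2).tau x α (by omega)

lemma WA.zero (A : Finset (Idx m n D)) : WA A 0 := fun β _ x δ _ => by rw [map_zero]; rfl
lemma WA.add {A : Finset (Idx m n D)} {P Q : VP n D} (hP : WA A P) (hQ : WA A Q) : WA A (P + Q) :=
  fun β hβ x δ hδ => by rw [map_add, Pi.add_apply, hP β hβ x δ hδ, hQ β hβ x δ hδ, add_zero]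
lemma WA.smul {A : Finset (Idx m n D)} {P : VP n D} (c : ℝ) (hP : WA A P) : WA A (c • P) :=
  fun β hβ x δ hδ => by rw [map_smul, Pi.smul_apply, hP β hβ x δ hδ, smul_zero]
lemma WA.sub {A : Finset (Idx m n D)} {P Q : VP n D} (hP : WA A P) (hQ : WA A Q) : WA A (P - Q) :=
  fun β hβ x δ hδ => by rw [map_sub, Pi.sub_apply, hP β hβ x δ hδ, hQ β hβ x δ hδ, sub_zero]

lemma Lrg.out {E : Finset (En n)} {K : En n → Set (Fin D → ℝ)} {A : Finset (Idx m n D)} {x : En n} {δ R : ℝ}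
    {P : VP n D} {l : ℕ} (hδ : 0 < δ) (h : Lrg E K A x δ R P l) : ∃ u : A → VP n D, ∀ α, JetV m (u α) ∧
      P + (1 / R) • u α ∈ Gam m E K R l x ∧ P - (1 / R) • u α ∈ Gam m E K R l x ∧
      (∀ β : A, ch m x δ (u α) β = (1 : Matrix A A ℝ) α β) ∧ NV x δ (u α) ≤ R * δ ^ m := by
  obtain ⟨_, a, ha⟩ := h
  refine ⟨fun α => mkV m x δ (a α), fun α => ⟨jet_mkV _ _ _ _, (ha α α.2).1.1, (ha α α.2).1.2, ?_, ?_⟩⟩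
  · intro β
    rw [ch_mkV m x hδ, (ha α α.2).2.1 β β.2, Matrix.one_apply]
    simp only [Subtype.ext_iff]
  · rw [NV_eq_ch x hδ (jet_mkV _ _ _ _), ch_mkV m x hδ, mul_comm]
    exact mul_le_mul_of_nonneg_right (ha α α.2).2.2 (by positivity)

lemma Lrg.intro {E : Finset (En n)} {K : En n → Set (Fin D → ℝ)} {A : Finset (Idx m n D)} {x : En n} {δ R : ℝ}
    {P : VP n D} {l : ℕ} (hδ : 0 < δ) (hP : P ∈ Gam m E K R l x) (u : A → VP n D) (h : ∀ α, JetV m (u α) ∧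
      P + (1 / R) • u α ∈ Gam m E K R l x ∧ P - (1 / R) • u α ∈ Gam m E K R l x ∧
      (∀ β : A, ch m x δ (u α) β = (1 : Matrix A A ℝ) α β) ∧ NV x δ (u α) ≤ R * δ ^ m) :
    Lrg E K A x δ R P l := by
  refine ⟨hP, fun α => if hα : α ∈ A then ch m x δ (u ⟨α, hα⟩) else 0, fun α hα => ?_⟩
  obtain ⟨h1, h2, h3, h4, h5⟩ := h ⟨α, hα⟩
  dsimp only
  rw [dif_pos hα]
  refine ⟨⟨by rw [mkV_ch x hδ h1]; exact h2, by rw [mkV_ch x hδ h1]; exact h3⟩, ?_, ?_⟩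
  · intro β hβ
    have := h4 ⟨β, hβ⟩
    rw [this, Matrix.one_apply]; simp only [Subtype.mk.injEq]
  · rw [NV_eq_ch x hδ h1, mul_comm] at h5
    exact le_of_mul_le_mul_right h5 (by positivity)

lemma ch_le {x : En n} {δ : ℝ} (hδ : 0 < δ) {P : VP n D} (hP : JetV m P) (β : Idx m n D) {c : ℝ}
    (h : NV x δ P ≤ c * δ ^ m) : |ch m x δ P β| ≤ c := by
  rw [NV_eq_ch x hδ hP, mul_comm] at h
  exact abs_le_of_sum (le_of_mul_le_mul_right h (by positivity)) β

/-- coefficients change little under a small shift of base point -/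
lemma ch_shift {x y : En n} {δ c : ℝ} (hδ : 0 < δ) (hc : 0 ≤ c) (hc1 : c ≤ 1) (hxy : dist x y ≤ c * δ)
    {P : VP n D} (hP : JetV m P) {B : ℝ} (hB : NV x δ P ≤ B * δ ^ m) (β : Idx m n D) :
    |ch m y δ P β - ch m x δ P β| ≤ 2 ^ m * c * B := by
  have hδm : 0 < δ ^ m := by positivity
  set p := tau x (P β.2) with hp
  have hpj : Jet m p := (hP β.2).tau x
  have e : tau y (P β.2) = tau (y - x) p := by rw [hp, tau_tau]; congr 2; abel
  have h1 := Nw_tau_sub_le hδ.le (y - x) p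
  have hn : ‖y - x‖ ≤ c * δ := by rw [← dist_eq_norm, dist_comm]; exact hxy
  have h2 : Nw (δ + ‖y - x‖) p ≤ (1 + c) ^ m * Nw δ p := by
    refine (Nw_mono (by positivity) (show δ + ‖y - x‖ ≤ (1 + c) * δ by linarith) p).trans ?_
    exact Jet.scale' hpj hδ.le (by linarith)
  have hN0 : 0 ≤ Nw δ p := Nw_nonneg hδ.le _
  have hNB : Nw δ p ≤ B * δ ^ m := by
    refine le_trans ?_ hB
    exact Finset.single_le_sum (f := fun j => N x δ (P j)) (fun j _ => Nw_nonneg hδ.le _) (Finset.mem_univ β.2)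
  have h3 : (1 + c) ^ m - 1 ≤ 2 ^ m * c := by
    have : (1 + c) ^ m ≤ 1 + (2 ^ m - 1) * c := by
      clear * - hc hc1
      induction m with
      | zero => simp
      | succ k ih =>
        have h2 : (1:ℝ) ≤ 2 ^ k := one_le_pow₀ (by norm_num)
        rw [pow_succ, pow_succ]
        calc (1 + c) ^ k * (1 + c) ≤ (1 + (2 ^ k - 1) * c) * (1 + c) := mul_le_mul_of_nonneg_right ih (by linarith)
          _ ≤ _ := by nlinarith [mul_nonneg (mul_nonneg (sub_nonneg.mpr h2) hc) (sub_nonneg.mpr hc1)]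
    nlinarith
  have h4 : |coeff β.1.1 (tau (y - x) p - p)| * δ ^ β.1.1.degree ≤ Nw δ (tau (y - x) p - p) := coeff_le_Nw hδ.le _ _
  rw [ch_apply, ch_apply, ← sub_mul, e, ← coeff_sub, abs_mul, abs_of_pos (by positivity : 0 < δ ^ β.1.1.degree / δ ^ m),
    ← mul_div_assoc, div_le_iff₀ hδm]
  have h5 : Nw (δ + ‖y - x‖) p - Nw δ p ≤ 2 ^ m * c * Nw δ p := by nlinarith
  have h6 : 2 ^ m * c * Nw δ p ≤ 2 ^ m * c * (B * δ ^ m) := mul_le_mul_of_nonneg_left hNB (by positivity)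
  linarith

lemma transport (hm : 1 ≤ m) {E : Finset (En n)} {K : En n → Set (Fin D → ℝ)} {R : ℝ} (hR : 0 ≤ R) {l : ℕ} {x y : En n}
    (hy : y ∈ E) {P : VP n D} (hP : P ∈ Gam m E K R (l + 1) x) {δ c : ℝ} (hδ : 0 < δ) (hc : 0 < c) (hc1 : c ≤ 1)
    (hxy : dist x y ≤ c * δ) : ∃ P' ∈ Gam m E K R l y, NV x δ (P - P') ≤ R * c * δ ^ m := by
  rcases eq_or_ne x y with rfl | hne
  · refine ⟨P, Gam.succ_sub l hP, ?_⟩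
    rw [sub_self, NV_zero]; positivity
  · obtain ⟨P', h1, h2⟩ := hP.2 y hy
    refine ⟨P', h1, ?_⟩
    have hj : JetV m (P - P') := hP.1.1.sub (Gam.base h1).1
    have h3 := NV_jet_up hj (dist_pos.mpr hne) hxy h2
    have h4 := NV_jet_scale1 (x := x) (δ := c * δ) (l := 1 / c) hj (by positivity) (by rw [le_div_iff₀ hc]; linarith)
    rw [show 1 / c * (c * δ) = δ by field_simp] at h4
    refine h4.trans ((mul_le_mul_of_nonneg_left h3 (by positivity)).trans (le_of_eq ?_))
    obtain ⟨k, rfl⟩ : ∃ k, m = k + 1 := ⟨m - 1, by omega⟩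
    rw [Nat.add_sub_cancel, mul_pow, div_pow, one_pow, pow_succ c]
    field_simp

end FP
end

section
namespace FP
open MvPolynomial
variable {m n D : ℕ}

lemma Lrg.jet {E : Finset (En n)} {K : En n → Set (Fin D → ℝ)} {A : Finset (Idx m n D)} {x : En n} {δ R : ℝ}
    {P : VP n D} {l : ℕ} (h : Lrg E K A x δ R P l) : JetV m P := (Gam.base h.1).1

set_option maxHeartbeats 2000000 in
lemma step1 (hm : 1 ≤ m) (l : ℕ) (A : Finset (Idx m n D)) (hA : UpC A) (R : ℝ) (hR : 1 ≤ R) :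
    ∃ R1 c : ℝ, R ≤ R1 ∧ 0 < c ∧ c ≤ 1 ∧ ∀ (E : Finset (En n)) (K : En n → Set (Fin D → ℝ)),
    (∀ x ∈ E, Convex ℝ (K x)) → ∀ (x0 : En n) (δ : ℝ) (P0 : VP n D), 0 < δ → Lrg E K A x0 δ R P0 (l + 1) →
    ∀ y ∈ E, dist x0 y ≤ c * δ → ∃ P, Lrg E K A y δ R1 P l ∧ WA A (P - P0) ∧ NV x0 δ (P - P0) ≤ R1 * δ ^ m := by
  obtain ⟨ε, hε, hmat⟩ := mat_inv A
  set r : ℝ := (A.card : ℝ) with hr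
  have hr0 : 0 ≤ r := by positivity
  set k : ℝ := 2 * r + 1 with hk
  have hk1 : 1 ≤ k := by linarith
  set T : ℝ := 2 ^ m with hT
  have hT1 : 1 ≤ T := one_le_pow₀ (by norm_num)
  set q : ℝ := 1 + 2 * T * R ^ 2 / ε + 4 * r * T * R ^ 2 * k with hq
  have hq1 : 1 ≤ q := by
    have : 0 ≤ 2 * T * R ^ 2 / ε + 4 * r * T * R ^ 2 * k := by positivity
    linarith
  set c : ℝ := 1 / q with hc
  have hc0 : 0 < c := by positivity
  have hc1 : c ≤ 1 := by rw [hc, div_le_one (by positivity)]; exact hq1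
  have hcq : c * q = 1 := by rw [hc]; field_simp
  have hcε : 2 * T * R ^ 2 * c ≤ ε := by
    have : 2 * T * R ^ 2 / ε ≤ q := by
      have : 0 ≤ 4 * r * T * R ^ 2 * k := by positivity
      linarith
    rw [div_le_iff₀ hε] at this
    calc 2 * T * R ^ 2 * c ≤ q * ε * c := mul_le_mul_of_nonneg_right this hc0.le
      _ = ε * (c * q) := by ring
      _ = ε := by rw [hcq, mul_one]
  have hct : 4 * r * T * R ^ 2 * k * c ≤ 1 := by
    have : 4 * r * T * R ^ 2 * k ≤ q := by
      have : 0 ≤ 2 * T * R ^ 2 / ε := by positivity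
      linarith
    calc 4 * r * T * R ^ 2 * k * c ≤ q * c := mul_le_mul_of_nonneg_right this hc0.le
      _ = 1 := by rw [mul_comm, hcq]
  set R1 : ℝ := 2 * k * R + r * (4 * T * R ^ 2) + R with hR1
  have hR1' : R ≤ R1 := by
    have : 0 ≤ 2 * k * R + r * (4 * T * R ^ 2) := by positivity
    linarith
  refine ⟨R1, c, hR1', hc0, hc1, ?_⟩
  intro E K hK x0 δ P0 hδ hL y hy hxy
  have hδm : 0 < δ ^ m := by positivity
  obtain ⟨u, hu⟩ := hL.out hδ
  have htr : ∀ P ∈ Gam m E K R (l + 1) x0, ∃ P' ∈ Gam m E K R l y, NV x0 δ (P - P') ≤ R * c * δ ^ m :=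
    fun P hP => transport hm (by linarith) hy hP hδ hc0 hc1 hxy
  obtain ⟨p0, hp0, hp0'⟩ := htr P0 hL.1
  choose p hp hp' using fun α => htr _ (hu α).2.1
  choose s hs hs' using fun α => htr _ (hu α).2.2.1
  have hcv := Gam.convex (m := m) (R := R) hK l y hy
  have jp0 := (Gam.base hp0).1
  have jp : ∀ α, JetV m (p α) := fun α => (Gam.base (hp α)).1
  have js : ∀ α, JetV m (s α) := fun α => (Gam.base (hs α)).1
  set v : A → VP n D := fun α => (R / 2) • (p α - s α) with hv
  have jv : ∀ α, JetV m (v α) := fun α => ((jp α).sub (js α)).smul _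
  have hvu : ∀ α, NV x0 δ (v α - u α) ≤ R ^ 2 * c * δ ^ m := by
    intro α
    have e : v α - u α = (R / 2) • ((P0 - (1 / R) • u α - s α) - (P0 + (1 / R) • u α - p α)) := by
      have : u α = (R * (1 / R)) • u α := by rw [mul_one_div_cancel (by positivity), one_smul]
      rw [hv]
      conv_lhs => rw [this]
      module
    rw [e, NV_smul, abs_of_pos (by positivity : 0 < R / 2)]
    have := (NV_sub_le (x := x0) hδ.le (P0 - (1 / R) • u α - s α) (P0 + (1 / R) • u α - p α)).trans
      (add_le_add (hs' α) (hp' α))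
    calc _ ≤ R / 2 * (R * c * δ ^ m + R * c * δ ^ m) := mul_le_mul_of_nonneg_left this (by positivity)
      _ = _ := by ring
  have hvN : ∀ α, NV x0 δ (v α) ≤ 2 * R ^ 2 * δ ^ m := by
    intro α
    have e : v α = (v α - u α) + u α := by abel
    rw [e]
    refine (NV_add_le hδ.le _ _).trans ((add_le_add (hvu α) (hu α).2.2.2.2).trans ?_)
    have h1 : R ^ 2 * c ≤ R ^ 2 * 1 := mul_le_mul_of_nonneg_left hc1 (by positivity)
    have h2 : R ≤ R ^ 2 := by nlinarith
    rw [← add_mul]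
    exact mul_le_mul_of_nonneg_right (by linarith) hδm.le
  have hsh : ∀ Q : VP n D, JetV m Q → NV y δ Q ≤ T * NV x0 δ Q := by
    intro Q hQ
    refine NV_jet_shift (l := 2) hQ hδ.le (by norm_num) hδ.le ?_
    have : c * δ ≤ 1 * δ := mul_le_mul_of_nonneg_right hc1 hδ.le
    linarith
  have hG : ∀ α β : A, |ch m y δ (v α) β - (1 : Matrix A A ℝ) α β| ≤ ε := by
    intro α β
    have e : ch m y δ (v α) β - (1 : Matrix A A ℝ) α β =
      ch m y δ (v α - u α) β + (ch m y δ (u α) β - ch m x0 δ (u α) β) := by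
      rw [(hu α).2.2.2.1 β, map_sub, Pi.sub_apply]; ring
    rw [e]
    have h1 : |ch m y δ (v α - u α) β| ≤ T * (R ^ 2 * c) := by
      refine ch_le hδ ((jv α).sub (hu α).1) β ((hsh _ ((jv α).sub (hu α).1)).trans ?_)
      calc _ ≤ T * (R ^ 2 * c * δ ^ m) := mul_le_mul_of_nonneg_left (hvu α) (by positivity)
        _ = _ := by ring
    have h2 := ch_shift hδ hc0.le hc1 hxy (hu α).1 (hu α).2.2.2.2 β
    have h3 : R ≤ R ^ 2 := by nlinarith
    have h4 : T * c * R ≤ T * c * R ^ 2 := mul_le_mul_of_nonneg_left h3 (by positivity)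
    refine (abs_add_le _ _).trans ((add_le_add h1 h2).trans ?_)
    calc T * (R ^ 2 * c) + T * c * R ≤ T * (R ^ 2 * c) + T * c * R ^ 2 := by linarith
      _ = 2 * T * R ^ 2 * c := by ring
      _ ≤ ε := hcε
  obtain ⟨H, hHG, hH⟩ := hmat (Matrix.of fun α β : A => ch m y δ (v α) β) hG
  have hHG' : ∀ γ β : A, ∑ α, H γ α * ch m y δ (v α) β = (1 : Matrix A A ℝ) γ β := by
    intro γ β
    rw [← hHG, Matrix.mul_apply]; rfl
  -- the family of points
  set Pc : VP n D := (1 / k) • (p0 + ∑ α : A, (p α + s α)) with hPc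
  have hcard : (Finset.univ : Finset A).card = A.card := by rw [Finset.card_univ, Fintype.card_coe]
  have hmem : ∀ b : A → ℝ, (∀ α, |b α| * (k * R) ≤ 2) → Pc + ∑ α, b α • v α ∈ Gam m E K R l y := by
    intro b hb
    have := ball_mem hcv Finset.univ hp0 p s (fun α _ => hp α) (fun α _ => hs α) (fun α => b α * (k * R / 2))
      (fun α _ => by rw [abs_mul, abs_of_pos (by positivity : 0 < k * R / 2)]; linarith [hb α])
    rw [hcard] at this
    convert this using 1
    rw [Finset.sum_add_distrib, ← add_assoc, smul_add (1 / (2 * (A.card : ℝ) + 1))]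
    congr 1
    rw [Finset.smul_sum]
    refine Finset.sum_congr rfl fun α _ => ?_
    rw [hv, smul_smul, smul_smul]
    congr 1
    have : k ≠ 0 := by positivity
    rw [hk] at this ⊢
    rw [hr] at this ⊢
    field_simp
  have hPcN : NV x0 δ (Pc - P0) ≤ R * c * δ ^ m := by
    have e : Pc - P0 = (1 / k) • ((p0 - P0) + ∑ α : A, ((p α - (P0 + (1 / R) • u α)) + (s α - (P0 - (1 / R) • u α)))) := by
      have e1 : ∀ α : A, (p α - (P0 + (1 / R) • u α)) + (s α - (P0 - (1 / R) • u α)) = (p α + s α) - (2:ℝ) • P0 :=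
        fun α => by module
      simp only [e1, Finset.sum_sub_distrib, Finset.sum_const, hcard, ← Nat.cast_smul_eq_nsmul ℝ]
      have e2 : P0 = ((1 / k) * k) • P0 := by rw [one_div_mul_cancel (by positivity), one_smul]
      conv_lhs => rw [e2, hPc]
      rw [← hr, hk]
      module
    rw [e, NV_smul, abs_of_pos (by positivity : 0 < 1 / k)]
    have h1 : NV x0 δ ((p0 - P0) + ∑ α : A, ((p α - (P0 + (1 / R) • u α)) + (s α - (P0 - (1 / R) • u α)))) ≤
        R * c * δ ^ m + ∑ α : A, (R * c * δ ^ m + R * c * δ ^ m) := by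
      refine (NV_add_le hδ.le _ _).trans (add_le_add (by rw [NV_sub_comm]; exact hp0') ?_)
      refine (NV_sum_le hδ.le _ _).trans (Finset.sum_le_sum fun α _ => ?_)
      refine (NV_add_le hδ.le _ _).trans (add_le_add (by rw [NV_sub_comm]; exact hp' α) (by rw [NV_sub_comm]; exact hs' α))
    rw [Finset.sum_const, hcard, nsmul_eq_mul] at h1
    calc _ ≤ 1 / k * (R * c * δ ^ m + A.card * (R * c * δ ^ m + R * c * δ ^ m)) := mul_le_mul_of_nonneg_left h1 (by positivity)
      _ = (1 / k * k) * (R * c * δ ^ m) := by rw [← hr, hk]; ring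
      _ = _ := by rw [one_div_mul_cancel (by positivity), one_mul]
  have jPc : JetV m Pc := (jp0.add (JetV.sum _ _ fun α _ => (jp α).add (js α))).smul _
  have jd : JetV m (Pc - P0) := jPc.sub hL.jet
  have he : ∀ β : A, |ch m y δ (Pc - P0) β| ≤ T * (R * c) := by
    intro β
    refine ch_le hδ jd β ((hsh _ jd).trans ?_)
    calc _ ≤ T * (R * c * δ ^ m) := mul_le_mul_of_nonneg_left hPcN (by positivity)
      _ = _ := by ring
  set b : A → ℝ := fun α => -∑ γ : A, ch m y δ (Pc - P0) γ * H γ α with hb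
  have hbB : ∀ α, |b α| ≤ r * (2 * T * R * c) := by
    intro α
    rw [hb]; dsimp only
    rw [abs_neg]
    refine (Finset.abs_sum_le_sum_abs _ _).trans ?_
    calc _ ≤ ∑ γ : A, (2 * T * R * c) := by
          refine Finset.sum_le_sum fun γ _ => ?_
          rw [abs_mul]
          calc _ ≤ (T * (R * c)) * 2 := mul_le_mul (he γ) (hH γ α) (abs_nonneg _) (by positivity)
            _ = _ := by ring
      _ = _ := by rw [Finset.sum_const, hcard, nsmul_eq_mul]
  have hbk : ∀ α, |b α| * (k * R) ≤ 1 := by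
    intro α
    calc _ ≤ r * (2 * T * R * c) * (k * R) := mul_le_mul_of_nonneg_right (hbB α) (by positivity)
      _ = (4 * r * T * R ^ 2 * k * c) / 2 := by ring
      _ ≤ _ := by linarith
  have hb1 : ∀ α, |b α| ≤ 1 := by
    intro α
    have h1 : 1 ≤ k * R := by nlinarith
    have := hbk α
    have h2 : |b α| * 1 ≤ |b α| * (k * R) := mul_le_mul_of_nonneg_left h1 (abs_nonneg _)
    linarith
  set Py : VP n D := Pc + ∑ α, b α • v α with hPy
  have hPym : Py ∈ Gam m E K R l y := hmem b fun α => by linarith [hbk α]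
  have jPy := (Gam.base hPym).1
  refine ⟨Py, ?_, ?_, ?_⟩
  · refine Lrg.intro hδ (Gam.mono hR1' l hPym) (fun γ => ∑ α, H γ α • v α) fun γ => ?_
    have hsmall : ∀ σ : ℝ, |σ| ≤ 1 → Py + (σ * (1 / R1)) • ∑ α, H γ α • v α ∈ Gam m E K R1 l y := by
      intro σ hσ
      refine Gam.mono hR1' l ?_
      have := hmem (fun α => b α + σ * (1 / R1) * H γ α) fun α => ?_
      · convert this using 1
        simp only [add_smul, Finset.sum_add_distrib, ← smul_smul, Finset.smul_sum]
        rw [hPy, add_assoc]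
      · have h1 : |σ * (1 / R1) * H γ α| ≤ 1 * (1 / R1) * 2 := by
          rw [abs_mul, abs_mul, abs_of_pos (by positivity : 0 < 1 / R1)]
          exact mul_le_mul (mul_le_mul_of_nonneg_right hσ (by positivity)) (hH γ α) (abs_nonneg _) (by positivity)
        have h2 : 1 * (1 / R1) * 2 * (k * R) ≤ 1 := by
          have h3 : 2 * k * R ≤ R1 := by
            have : 0 ≤ r * (4 * T * R ^ 2) + R := by positivity
            linarith
          have h4 : 0 < R1 := by positivity
          rw [show 1 * (1 / R1) * 2 * (k * R) = (2 * k * R) / R1 by ring, div_le_one h4]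
          exact h3
        have h5 : |b α + σ * (1 / R1) * H γ α| * (k * R) ≤ (|b α| + 1 * (1 / R1) * 2) * (k * R) :=
          mul_le_mul_of_nonneg_right ((abs_add_le _ _).trans (by linarith)) (by positivity)
        have := hbk α
        rw [add_mul] at h5
        linarith
    refine ⟨JetV.sum _ _ fun α _ => (jv α).smul _, ?_, ?_, ?_, ?_⟩
    · have := hsmall 1 (by norm_num)
      rwa [one_mul] at this
    · have := hsmall (-1) (by norm_num)
      rwa [neg_one_mul, neg_smul, ← sub_eq_add_neg] at this
    · intro β
      rw [map_sum, Finset.sum_apply, ← hHG' γ β]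
      refine Finset.sum_congr rfl fun α _ => ?_
      rw [map_smul, Pi.smul_apply, smul_eq_mul]
    · refine (NV_sum_le hδ.le _ _).trans ?_
      calc _ ≤ ∑ α : A, (4 * T * R ^ 2 * δ ^ m) := by
            refine Finset.sum_le_sum fun α _ => ?_
            rw [NV_smul]
            calc _ ≤ 2 * (T * (2 * R ^ 2 * δ ^ m)) := mul_le_mul (hH γ α)
                  ((hsh _ (jv α)).trans (mul_le_mul_of_nonneg_left (hvN α) (by positivity))) (NV_nonneg hδ.le _) (by norm_num)
              _ = _ := by ring
        _ = r * (4 * T * R ^ 2) * δ ^ m := by rw [Finset.sum_const, hcard, nsmul_eq_mul]; ring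
        _ ≤ _ := mul_le_mul_of_nonneg_right (by
            have : 0 ≤ 2 * k * R + R := by positivity
            linarith) hδm.le
  · refine WA.of hA (jPy.sub hL.jet) hδ (x := y) fun β hβ => ?_
    have e : Py - P0 = (Pc - P0) + ∑ α, b α • v α := by rw [hPy]; abel
    rw [e, map_add, map_sum, Pi.add_apply, Finset.sum_apply]
    have e2 : ∀ α, ch m y δ (b α • v α) β = b α * ch m y δ (v α) β := fun α => by
      rw [map_smul, Pi.smul_apply, smul_eq_mul]
    rw [Finset.sum_congr rfl fun α _ => e2 α]
    simp only [hb, neg_mul, Finset.sum_neg_distrib, Finset.sum_mul]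
    rw [Finset.sum_comm]
    have e3 : ∀ γ : A, ∑ α : A, ch m y δ (Pc - P0) γ * H γ α * ch m y δ (v α) β =
        ch m y δ (Pc - P0) γ * (1 : Matrix A A ℝ) γ ⟨β, hβ⟩ := fun γ => by
      rw [← hHG' γ ⟨β, hβ⟩, Finset.mul_sum]
      refine Finset.sum_congr rfl fun α _ => by ring
    simp only [e3, Matrix.one_apply, mul_ite, mul_one, mul_zero, Finset.sum_ite_eq', Finset.mem_univ, if_true]
    ring
  · have e : Py - P0 = (Pc - P0) + ∑ α, b α • v α := by rw [hPy]; abel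
    rw [e]
    refine (NV_add_le hδ.le _ _).trans ?_
    have h1 : NV x0 δ (∑ α, b α • v α) ≤ r * (2 * R ^ 2 * δ ^ m) := by
      refine (NV_sum_le hδ.le _ _).trans ?_
      calc _ ≤ ∑ α : A, (2 * R ^ 2 * δ ^ m) := by
            refine Finset.sum_le_sum fun α _ => ?_
            rw [NV_smul]
            calc _ ≤ 1 * (2 * R ^ 2 * δ ^ m) := mul_le_mul (hb1 α) (hvN α) (NV_nonneg hδ.le _) (by norm_num)
              _ = _ := one_mul _
        _ = _ := by rw [Finset.sum_const, hcard, nsmul_eq_mul]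
    have h2 : R * c ≤ R * 1 := mul_le_mul_of_nonneg_left hc1 (by linarith)
    have h3 : r * (2 * R ^ 2) ≤ r * (4 * T * R ^ 2) := mul_le_mul_of_nonneg_left (by nlinarith [sq_nonneg R]) hr0
    calc _ ≤ R * c * δ ^ m + r * (2 * R ^ 2 * δ ^ m) := add_le_add hPcN h1
      _ = (R * c + r * (2 * R ^ 2)) * δ ^ m := by ring
      _ ≤ _ := mul_le_mul_of_nonneg_right (by
            have : 0 ≤ 2 * k * R := by positivity
            linarith) hδm.le

end FP
end

section
namespace FP
open MvPolynomial
variable {m n D : ℕ}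

lemma Bet.trans {A B C : Finset (Idx m n D)} (h1 : Bet A B) (h2 : Bet B C) : Bet A C := by
  unfold Bet at *
  omega

lemma Gam.shrink {E : Finset (En n)} {K : En n → Set (Fin D → ℝ)} (hK : ∀ x ∈ E, Convex ℝ (K x)) {x : En n} (hx : x ∈ E)
    {R R' : ℝ} (hR : 0 < R) (hRR : R ≤ R') {l : ℕ} {P u : VP n D} (h1 : P + (1 / R) • u ∈ Gam m E K R l x)
    (h2 : P - (1 / R) • u ∈ Gam m E K R l x) : P + (1 / R') • u ∈ Gam m E K R' l x ∧ P - (1 / R') • u ∈ Gam m E K R' l x := by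
  have hcv := Gam.convex (m := m) (R := R) hK l x hx
  have hR' : 0 < R' := by linarith
  have ht : |R / R'| ≤ 1 := by rw [abs_of_pos (by positivity), div_le_one hR']; exact hRR
  have e : (1 / R') • u = (R / R') • ((1 / R) • u) := by rw [smul_smul]; congr 1; field_simp
  constructor
  · rw [e]; exact Gam.mono hRR l (seg_mem hcv h1 h2 ht)
  · rw [e, sub_eq_add_neg, ← neg_smul]; exact Gam.mono hRR l (seg_mem hcv h1 h2 (by rwa [abs_neg]))

lemma Lrg.mono {E : Finset (En n)} {K : En n → Set (Fin D → ℝ)} (hK : ∀ x ∈ E, Convex ℝ (K x)) {x : En n} (hx : x ∈ E)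
    {A : Finset (Idx m n D)} {δ R R' : ℝ} (hδ : 0 < δ) (hR : 0 < R) (hRR : R ≤ R') {l : ℕ} {P : VP n D}
    (h : Lrg E K A x δ R P l) : Lrg E K A x δ R' P l := by
  obtain ⟨u, hu⟩ := h.out hδ
  refine Lrg.intro hδ (Gam.mono hRR l h.1) u fun α => ?_
  obtain ⟨h1, h2, h3, h4, h5⟩ := hu α
  obtain ⟨h6, h7⟩ := Gam.shrink hK hx hR hRR h2 h3
  exact ⟨h1, h6, h7, h4, h5.trans (mul_le_mul_of_nonneg_right hRR (by positivity))⟩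

lemma Lrg.lev {E : Finset (En n)} {K : En n → Set (Fin D → ℝ)} {x : En n}
    {A : Finset (Idx m n D)} {δ R : ℝ} (hδ : 0 < δ) {l l' : ℕ} (hl : l ≤ l') {P : VP n D}
    (h : Lrg E K A x δ R P l') : Lrg E K A x δ R P l := by
  obtain ⟨u, hu⟩ := h.out hδ
  refine Lrg.intro hδ (Gam.lev hl h.1) u fun α => ?_
  obtain ⟨h1, h2, h3, h4, h5⟩ := hu α
  exact ⟨h1, Gam.lev hl h2, Gam.lev hl h3, h4, h5⟩

lemma lemS (hm : 1 ≤ m) (L : ℕ) (A : Finset (Idx m n D)) (R2 Ra : ℝ) (hR2 : 1 ≤ R2) (hRa : R2 ≤ Ra) :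
    ∃ R3, 1 ≤ R3 ∧ ∀ (E : Finset (En n)) (K : En n → Set (Fin D → ℝ)), (∀ x ∈ E, Convex ℝ (K x)) →
    ∀ y ∈ E, ∀ (δ : ℝ) (P P1 P2 : VP n D), 0 < δ → Lrg E K A y δ R2 P L → P1 ∈ Gam m E K Ra L y → P2 ∈ Gam m E K Ra L y →
      WA A (P2 - P1) → δ ^ m < NV y δ (P1 - P2) → ∃ A' w, UpC A' ∧ Bet A A' ∧ WA A w ∧ NV y δ w = δ ^ m ∧
        Lrg E K A' y δ R3 ((1/2 : ℝ) • (P + P1) + (1/4 : ℝ) • w) L := by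
  obtain ⟨R', hR', hRC⟩ := lrg_RC (n := n) (D := D) hm L A (2 * Ra + 4) (by linarith)
  refine ⟨R', by linarith, ?_⟩
  intro E K hK y hy δ P P1 P2 hδ hL h1 h2 hW hN
  have hδm : 0 < δ ^ m := by positivity
  set s := NV y δ (P1 - P2) with hs
  set t := δ ^ m / s with ht
  have hs0 : 0 < s := hδm.trans hN
  have ht0 : 0 < t := by positivity
  have ht1 : t ≤ 1 := by rw [ht, div_le_one hs0]; exact hN.le
  set w := t • (P2 - P1) with hw
  have hNw : NV y δ w = δ ^ m := by
    rw [hw, NV_smul, abs_of_pos ht0, NV_sub_comm, ← hs, ht]; field_simp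
  set Rb := 2 * Ra + 4 with hRb
  have hcv := Gam.convex (m := m) (R := Ra) hK L y hy
  have hRab : Ra ≤ Rb := by linarith
  have hRb0 : 0 < Rb := by linarith
  have hseg : ∀ σ : ℝ, 0 ≤ σ → σ ≤ 1 → P1 + σ • w ∈ Gam m E K Ra L y := by
    intro σ h0 h3
    have := hcv h1 h2 (a := 1 - σ * t) (b := σ * t) (by nlinarith) (by positivity) (by ring)
    convert this using 1
    rw [hw]; module
  set P' := (1/2 : ℝ) • (P + P1) + (1/4 : ℝ) • w with hP'
  have hmix : ∀ (Q : VP n D), Q ∈ Gam m E K Ra L y → ∀ σ : ℝ, |σ| ≤ 1/4 →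
      (1/2 : ℝ) • Q + (1/2 : ℝ) • P1 + (1/4 + σ) • w ∈ Gam m E K Rb L y := by
    intro Q hQ σ hσ
    obtain ⟨h3, h4⟩ := abs_le.mp hσ
    refine Gam.mono hRab L ?_
    have := hcv hQ (hseg (1/2 + 2 * σ) (by linarith) (by linarith)) (a := 1/2) (b := 1/2) (by norm_num) (by norm_num) (by norm_num)
    convert this using 1
    module
  have hPa := Gam.mono hRa L hL.1
  have hP'm : P' ∈ Gam m E K Rb L y := by
    have := hmix P hPa 0 (by norm_num)
    convert this using 1
    rw [hP']; module
  obtain ⟨u, hu⟩ := hL.out hδ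
  have hL' : Lrg E K A y δ Rb P' L := by
    refine Lrg.intro hδ hP'm u fun α => ?_
    obtain ⟨h3, h4, h5, h6, h7⟩ := hu α
    obtain ⟨h8, h9⟩ := Gam.shrink hK hy (by linarith) hRa h4 h5
    have hRa0 : 0 < Ra := by linarith
    have ht : |2 * Ra / Rb| ≤ 1 := by rw [abs_of_pos (by positivity), div_le_one hRb0]; linarith
    have e : (1 / Rb) • u α = (1/2 : ℝ) • ((2 * Ra / Rb) • ((1 / Ra) • u α)) := by
      have : Ra ≠ 0 := by linarith
      rw [smul_smul, smul_smul]; congr 1; field_simp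
    have h10 := hmix _ (seg_mem hcv h8 h9 ht) 0 (by norm_num)
    have h11 := hmix _ (seg_mem hcv h8 h9 (t := -(2 * Ra / Rb)) (by rwa [abs_neg])) 0 (by norm_num)
    refine ⟨h3, ?_, ?_, h6, h7.trans (mul_le_mul_of_nonneg_right (by linarith) (by positivity))⟩
    · convert h10 using 1
      rw [e, hP']; module
    · convert h11 using 1
      rw [e, hP']; module
  have jw : JetV m w := ((Gam.base h2).1.sub (Gam.base h1).1).smul t
  have hq : |1 / Rb| ≤ 1/4 := by
    rw [abs_of_pos (by positivity), div_le_div_iff₀ hRb0 (by norm_num)]; linarith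
  have a1 : P' + (1 / Rb) • w ∈ Gam m E K Rb L y := by
    convert hmix P hPa (1 / Rb) hq using 1
    rw [hP']; module
  have a2 : P' - (1 / Rb) • w ∈ Gam m E K Rb L y := by
    convert hmix P hPa (-(1 / Rb)) (by rwa [abs_neg]) using 1
    rw [hP']; module
  have a3 : NV y δ w ≤ Rb * δ ^ m := by rw [hNw]; nlinarith
  obtain ⟨A', h3, h4, h5⟩ := hRC E K hK y hy δ P' w hδ hL' jw a1 a2 a3 hNw.ge
    (fun β hβ => (hW.smul t) β hβ y δ hδ)
  exact ⟨A', w, h3, h4, hW.smul t, hNw, h5⟩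

/-- progress at `(y, δ)` -/
def Prog (E : Finset (En n)) (K : En n → Set (Fin D → ℝ)) (A : Finset (Idx m n D)) (L : ℕ) (R3 : ℝ) (P0 : VP n D)
    (δ0 : ℝ) (y : En n) (δ : ℝ) : Prop :=
  ∃ δb A' P, δ ≤ δb ∧ δb ≤ δ0 ∧ UpC A' ∧ Bet A A' ∧ WA A (P - P0) ∧ Lrg E K A' y δb R3 P L

lemma Prog.anti {E : Finset (En n)} {K : En n → Set (Fin D → ℝ)} {A : Finset (Idx m n D)} {L : ℕ} {R3 : ℝ} {P0 : VP n D}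
    {δ0 : ℝ} {y : En n} {δ δ' : ℝ} (h : Prog E K A L R3 P0 δ0 y δ) (hd : δ' ≤ δ) : Prog E K A L R3 P0 δ0 y δ' := by
  obtain ⟨δb, A', P, h1, h2⟩ := h
  exact ⟨δb, A', P, hd.trans h1, h2⟩

set_option maxHeartbeats 2000000 in
lemma ml_local (hm : 1 ≤ m) (L : ℕ) (A : Finset (Idx m n D)) (hAu : UpC A) (R1 : ℝ) (hR1 : 1 ≤ R1) : ∃ R3 R4 C5 : ℝ, 1 ≤ R4 ∧ 0 ≤ C5 ∧
    ∀ (E : Finset (En n)) (K : En n → Set (Fin D → ℝ)), (∀ x ∈ E, Convex ℝ (K x)) → ∀ (δ0 : ℝ) (P0 : VP n D), JetV m P0 → ∀ y ∈ E,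
    ∀ Py : VP n D, Lrg E K A y δ0 R1 Py (L + 1) → WA A (Py - P0) → ∀ δ, 0 < δ → δ ≤ δ0 →
      (Prog E K A L R3 P0 δ0 y δ → ∃ A' P, UpC A' ∧ Bet A A' ∧ Lrg E K A' y δ R4 P L ∧ NV y δ (P - Py) ≤ R4 * δ ^ m) ∧
      (¬ Prog E K A L R3 P0 δ0 y δ → ∀ z ∈ E, dist z y ≤ 2 * δ → ∀ Pz, Pz ∈ Gam m E K R1 (L + 1) z → WA A (Pz - P0) →
        NV y δ (Pz - Py) ≤ C5 * δ ^ m) := by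
  obtain ⟨R2, hR2, hdesc⟩ := lrg_descend (n := n) (D := D) hm L A R1 hR1
  have hR21 : 1 ≤ R2 := hR1.trans hR2
  obtain ⟨R3', hR3', hS⟩ := lemS (n := n) (D := D) hm L A R2 R2 hR21 le_rfl
  set R3 := R2 + R3' with hR3
  have hR23 : R2 ≤ R3 := by linarith
  have hR31 : 1 ≤ R3 := by linarith
  obtain ⟨R4', hR4', hS'⟩ := lemS (n := n) (D := D) hm L A R2 R3 hR21 hR23
  choose R5 hR5 hdesc' using fun A' => lrg_descend (n := n) (D := D) hm L A' R3 hR31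
  have hR5sum : ∀ A', R5 A' ≤ ∑ B, R5 B := fun A' =>
    Finset.single_le_sum (f := R5) (fun B _ => by linarith [hR5 B]) (Finset.mem_univ A')
  set R4 := R2 + R4' + ∑ B, R5 B with hR4
  have hs0 : 0 ≤ ∑ B, R5 B := Finset.sum_nonneg fun B _ => by linarith [hR5 B]
  set B : ℝ := 4 ^ m * R1 with hB
  have hB0 : 0 ≤ B := by positivity
  set r : ℝ := (A.card : ℝ) with hr
  set τ : ℝ := 1 / (2 + B * R2 * (2 * r + 1)) with hτ
  have hτ0 : 0 < τ := by positivity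
  have hτq : τ * (2 + B * R2 * (2 * r + 1)) = 1 := by
    rw [hτ]; exact one_div_mul_cancel (by positivity)
  have hτp : 0 ≤ τ * (B * R2 * (2 * r + 1)) := by positivity
  have hτ2 : τ ≤ 1/2 := by linarith
  have hτB : τ * (B * R2 * (2 * r + 1)) ≤ 1 := by linarith
  refine ⟨R3, R4, 3 / τ + 4 ^ m * R1, by linarith, by positivity, ?_⟩
  intro E K hK δ0 P0 jP0 y hy Py hL hW δ hδ hδδ
  have hδm : 0 < δ ^ m := by positivity
  have hδ0 : 0 < δ0 := hδ.trans_le hδδ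
  have hLL : Lrg E K A y δ0 R1 Py L := hL.lev hδ0 (Nat.le_succ L)
  constructor
  · rintro ⟨δb, A', P, h1, h2, h3, h4, h5, h6⟩
    rcases hdesc E K hK y hy δ0 δ Py hδ hδδ hLL with ⟨B', hB1, hB2, hB3⟩ | hA
    · refine ⟨B', Py, hB1, hB2, hB3.mono hK hy hδ (by linarith) (by linarith), ?_⟩
      rw [sub_self, NV_zero]; positivity
    by_cases hN : δ ^ m < NV y δ (Py - P)
    · obtain ⟨A2, w, h7, h8, h9, h10, h11⟩ := hS' E K hK y hy δ Py Py P hδ hA (Gam.mono hR23 L hA.1) h6.1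
        (by have := h5.sub hW; rwa [sub_sub_sub_cancel_right] at this) hN
      refine ⟨A2, _, h7, h8, h11.mono hK hy hδ (by linarith) (by linarith), ?_⟩
      have e : (1/2 : ℝ) • (Py + Py) + (1/4 : ℝ) • w - Py = (1/4 : ℝ) • w := by module
      rw [e, NV_smul, h10, abs_of_pos (by norm_num)]
      exact mul_le_mul_of_nonneg_right (by linarith) hδm.le
    · have hb0 : 0 < δb := hδ.trans_le h1
      have hn : NV y δ (P - Py) ≤ R4 * δ ^ m := by
        rw [NV_sub_comm]
        refine (not_lt.mp hN).trans ?_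
        have : 1 * δ ^ m ≤ R4 * δ ^ m := mul_le_mul_of_nonneg_right (by linarith) hδm.le
        linarith
      have h5A := hR5sum A'
      have h5B := hR5 A'
      rcases hdesc' A' E K hK y hy δb δ P hδ h1 h6 with ⟨B', hB1, hB2, hB3⟩ | hA3
      · exact ⟨B', P, hB1, h4.trans hB2, hB3.mono hK hy hδ (by linarith) (by linarith), hn⟩
      · exact ⟨A', P, h3, h4, hA3.mono hK hy hδ (by linarith) (by linarith), hn⟩
  · intro hnp z hz hzy Pz hPz hWz
    have hA : Lrg E K A y δ R2 Py L := by
      rcases hdesc E K hK y hy δ0 δ Py hδ hδδ hLL with ⟨B', hB1, hB2, hB3⟩ | hA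
      · exact absurd ⟨δ, B', Py, le_rfl, hδδ, hB1, hB2, hW, hB3.mono hK hy hδ (by linarith) (by linarith)⟩ hnp
      · exact hA
    have hclose : ∀ P1 ∈ Gam m E K R2 L y, WA A (P1 - P0) → NV y δ (P1 - Py) ≤ δ ^ m := by
      intro P1 hP1 hW1
      by_contra hN
      obtain ⟨A2, w, h7, h8, h9, h10, h11⟩ := hS E K hK y hy δ Py P1 Py hδ hA hP1 hA.1
        (by have := hW.sub hW1; rwa [sub_sub_sub_cancel_right] at this) (not_le.mp hN)
      refine hnp ⟨δ, A2, _, le_rfl, hδδ, h7, h8, ?_, h11.mono hK hy hδ (by linarith) (by linarith)⟩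
      have := ((hW.add hW1).smul (1/2)).add (h9.smul (1/4))
      convert this using 1
      module
    obtain ⟨Q, hQ, hQN⟩ := transport hm (by linarith) hy hPz (δ := 2 * δ) (by positivity) one_pos le_rfl (by linarith)
    have jQ := (Gam.base hQ).1
    have jz := (Gam.base hPz).1
    have hQN' : NV y δ (Pz - Q) ≤ 4 ^ m * R1 * δ ^ m := by
      have := NV_jet_shift (x := z) (y := y) (δ := 2 * δ) (δ' := δ) (l := 2) (jz.sub jQ) (by positivity) (by norm_num) hδ.le (by linarith)
      refine this.trans ((mul_le_mul_of_nonneg_left hQN (by positivity)).trans (le_of_eq ?_))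
      rw [mul_pow, show (4:ℝ) = 2 * 2 by norm_num, mul_pow]; ring
    obtain ⟨u, hu⟩ := hA.out hδ
    have hq : ∀ β : A, |ch m y δ (Q - P0) β| ≤ B := by
      intro β
      have e : ch m y δ (Q - P0) β = ch m y δ (Q - Pz) β := by
        have := hWz β β.2 y δ hδ
        have e2 : Q - P0 = (Q - Pz) + (Pz - P0) := by abel
        rw [e2, map_add, Pi.add_apply, this, add_zero]
      rw [e]
      refine ch_le hδ (jQ.sub jz) β ?_
      rw [NV_sub_comm]; exact hQN'
    set b : A → ℝ := fun α => -(τ * ch m y δ (Q - P0) α / (1 - τ)) with hb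
    have h1τ : 1/2 ≤ 1 - τ := by linarith
    have hbB : ∀ α, |b α| ≤ 2 * τ * B := by
      intro α
      rw [hb]; dsimp only
      rw [abs_neg, abs_div, abs_mul, abs_of_pos hτ0, abs_of_pos (by linarith : 0 < 1 - τ), div_le_iff₀ (by linarith)]
      have h1 : τ * |ch m y δ (Q - P0) α| ≤ τ * B := mul_le_mul_of_nonneg_left (hq α) hτ0.le
      have h2 : 2 * τ * B * (1/2) ≤ 2 * τ * B * (1 - τ) := mul_le_mul_of_nonneg_left h1τ (by positivity)
      linarith
    have hcv := Gam.convex (m := m) (R := R2) hK L y hy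
    have hd : Py + ∑ α, b α • u α ∈ Gam m E K R2 L y := by
      have := dir_mem hcv hA.1 (fun α => (1 / R2) • u α) (fun α => (hu α).2.1) (fun α => (hu α).2.2.1) (fun α => b α * R2) ?_
      · convert this using 2
        refine Finset.sum_congr rfl fun α _ => ?_
        rw [smul_smul, mul_assoc, mul_one_div_cancel (by positivity), mul_one]
      · intro α
        rw [Fintype.card_coe, abs_mul, abs_of_pos (by positivity : 0 < R2)]
        calc _ ≤ 2 * τ * B * R2 * (2 * (A.card : ℝ) + 1) := mul_le_mul_of_nonneg_right
              (mul_le_mul_of_nonneg_right (hbB α) (by positivity)) (by positivity)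
          _ = 2 * (τ * (B * R2 * (2 * r + 1))) := by rw [hr]; ring
          _ ≤ 2 := by linarith
    set Pt := (1 - τ) • (Py + ∑ α, b α • u α) + τ • Q with hPt
    have hPtm : Pt ∈ Gam m E K R2 L y := hcv hd (Gam.mono hR2 L hQ) (by linarith) hτ0.le (by ring)
    have jsum : JetV m (∑ α, b α • u α) := JetV.sum _ _ fun α _ => (hu α).1.smul _
    have hNs : NV y δ (∑ α, b α • u α) ≤ 2 * δ ^ m := by
      refine (NV_sum_le hδ.le _ _).trans ?_
      calc _ ≤ ∑ α : A, (2 * τ * B * (R2 * δ ^ m)) := by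
            refine Finset.sum_le_sum fun α _ => ?_
            rw [NV_smul]
            exact mul_le_mul (hbB α) (hu α).2.2.2.2 (NV_nonneg hδ.le _) (by positivity)
        _ = 2 * (τ * (B * R2 * r)) * δ ^ m := by
            rw [Finset.sum_const, Finset.card_univ, Fintype.card_coe, nsmul_eq_mul, ← hr]; ring
        _ ≤ 2 * δ ^ m := by
            refine mul_le_mul_of_nonneg_right ?_ hδm.le
            have : τ * (B * R2 * r) ≤ τ * (B * R2 * (2 * r + 1)) := by
              refine mul_le_mul_of_nonneg_left (mul_le_mul_of_nonneg_left ?_ (by positivity)) hτ0.le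
              have : 0 ≤ r := by positivity
              linarith
            linarith
    have hchs : ∀ β : A, ch m y δ (∑ α, b α • u α) β = b β := by
      intro β
      rw [map_sum, Finset.sum_apply]
      have : ∀ α : A, ch m y δ (b α • u α) β = b α * (1 : Matrix A A ℝ) α β := fun α => by
        rw [map_smul, Pi.smul_apply, smul_eq_mul, (hu α).2.2.2.1 β]
      simp only [this, Matrix.one_apply, mul_ite, mul_one, mul_zero, Finset.sum_ite_eq', Finset.mem_univ, if_true]
    have hWt : ∀ β ∈ A, ch m y δ (Pt - P0) β = 0 := by
      intro β hβ
      have e : Pt - P0 = (1 - τ) • (Py - P0) + (1 - τ) • (∑ α, b α • u α) + τ • (Q - P0) := by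
        rw [hPt]; module
      have h1 := hW β hβ y δ hδ
      have h2 := hchs ⟨β, hβ⟩
      rw [e, map_add, map_add, map_smul, map_smul, map_smul]
      simp only [Pi.add_apply, Pi.smul_apply, smul_eq_mul]
      rw [h1, h2, hb]
      have : 1 - τ ≠ 0 := by linarith
      dsimp only
      field_simp
      ring
    have h1 := hclose Pt hPtm (WA.of hAu ((Gam.base hPtm).1.sub jP0) hδ hWt)
    have e : Q - Py = (1 / τ) • ((Pt - Py) - (1 - τ) • ∑ α, b α • u α) := by
      have : Q - Py = (1 / τ * τ) • (Q - Py) := by rw [one_div_mul_cancel hτ0.ne', one_smul]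
      rw [this, hPt]; module
    have h2 : NV y δ (Q - Py) ≤ 3 / τ * δ ^ m := by
      rw [e, NV_smul, abs_of_pos (by positivity : 0 < 1 / τ)]
      have h3 := NV_sub_le (x := y) hδ.le (Pt - Py) ((1 - τ) • ∑ α, b α • u α)
      rw [NV_smul, abs_of_pos (by linarith : 0 < 1 - τ)] at h3
      have h4 : (1 - τ) * NV y δ (∑ α, b α • u α) ≤ 1 * NV y δ (∑ α, b α • u α) :=
        mul_le_mul_of_nonneg_right (by linarith) (NV_nonneg hδ.le _)
      calc _ ≤ 1 / τ * (3 * δ ^ m) := mul_le_mul_of_nonneg_left (by linarith) (by positivity)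
        _ = _ := by ring
    have h5 := NV_tri (x := y) hδ.le Pz Q Py
    calc _ ≤ 4 ^ m * R1 * δ ^ m + 3 / τ * δ ^ m := h5.trans (add_le_add hQN' h2)
      _ = _ := by ring

end FP
end

section
namespace FP
open MvPolynomial
variable {m n D : ℕ}

/-- main lemma for a given index set -/
def MLp (A : Finset (Idx m n D)) (l : ℕ) : Prop := ∀ R : ℝ, 1 ≤ R → ∃ C c : ℝ, 0 ≤ C ∧ 0 < c ∧ c ≤ 1 ∧
    ∀ (E : Finset (En n)) (K : En n → Set (Fin D → ℝ)), (∀ x ∈ E, Convex ℝ (K x)) → ∀ x0 ∈ E, ∀ (δ0 : ℝ) (P0 : VP n D),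
    0 < δ0 → Lrg E K A x0 δ0 R P0 l → ∃ F : En n → VP n D, Fld m {z | z ∈ E ∧ dist x0 z < c * δ0} F C ∧
      ∀ z ∈ E, dist x0 z < c * δ0 → ev z (F z) ∈ K z ∧ NV x0 δ0 (F z - P0) ≤ C * δ0 ^ m

lemma MLp.lev {A : Finset (Idx m n D)} {l l' : ℕ} (hl : l ≤ l') (h : MLp A l) : MLp A l' := by
  intro R hR
  obtain ⟨C, c, h1, h2, h3, h4⟩ := h R hR
  exact ⟨C, c, h1, h2, h3, fun E K hK x0 hx0 δ0 P0 hδ hL => h4 E K hK x0 hx0 δ0 P0 hδ (hL.lev hδ hl)⟩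

/-- radius function -/
lemma radius (E : Finset (En n)) (Pr : En n → ℝ → Prop) (hPr : ∀ y δ δ', Pr y δ → δ' ≤ δ → Pr y δ') (M : ℝ) (hM : 0 < M) :
    ∃ ρ : En n → ℝ, (∀ x, 0 < ρ x ∧ ρ x ≤ M) ∧ (∀ x ∈ E, ∀ y ∈ E, |ρ x - ρ y| ≤ dist x y) ∧
      (∀ x ∈ E, ∀ δ, 0 < δ → δ < ρ x → ((∀ y ∈ E, dist y x ≤ δ → Pr y δ) ∨ (∀ y ∈ E, dist y x ≤ δ → y = x))) ∧
      (∀ x ∈ E, ∀ δ, ρ x < δ → δ ≤ M → ∃ y ∈ E, dist y x ≤ δ ∧ ¬ Pr y δ) := by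
  set OK : En n → ℝ → Prop := fun x δ => (∀ y ∈ E, dist y x ≤ δ → Pr y δ) ∨ (∀ y ∈ E, dist y x ≤ δ → y = x) with hOK
  have down : ∀ x δ δ', OK x δ → δ' ≤ δ → OK x δ' := by
    rintro x δ δ' (h | h) hd
    · exact Or.inl fun y hy hyx => hPr _ _ _ (h y hy (hyx.trans hd)) hd
    · exact Or.inr fun y hy hyx => h y hy (hyx.trans hd)
  have shift : ∀ x δ, OK x δ → ∀ y ∈ E, dist x y ≤ δ → OK y (δ - dist x y) := by
    rintro x δ h y hy hxy
    rcases h with h | h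
    · refine Or.inl fun z hz hzy => hPr _ _ _ (h z hz ?_) (by linarith [dist_nonneg (x := x) (y := y)])
      have := dist_triangle z y x
      rw [dist_comm y x] at this; linarith
    · refine Or.inr fun z hz hzy => ?_
      have h1 : z = x := h z hz (by have := dist_triangle z y x; rw [dist_comm y x] at this; linarith)
      have h2 : y = x := h y hy (by rwa [dist_comm])
      rw [h1, h2]
  set S : En n → Set ℝ := fun x => {δ | 0 < δ ∧ δ ≤ M ∧ OK x δ} with hS
  have hne : ∀ x, (S x).Nonempty := by
    intro x
    obtain ⟨ε, hε, h⟩ : ∃ ε > 0, ∀ y ∈ E, dist y x ≤ ε → y = x := by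
      have hfin : (((E.erase x : Finset (En n)) : Set (En n))).Finite := Finset.finite_toSet _
      have hx : x ∈ ((((E.erase x : Finset (En n)) : Set (En n))))ᶜ := by simp
      obtain ⟨ε, hε, h⟩ := Metric.isOpen_iff.mp hfin.isClosed.isOpen_compl x hx
      refine ⟨ε / 2, by positivity, fun y hy hyx => ?_⟩
      by_contra hne
      exact h (show y ∈ Metric.ball x ε from by rw [Metric.mem_ball]; linarith) (by simp [hy, hne])
    refine ⟨min ε M, lt_min hε hM, min_le_right _ _, Or.inr fun y hy hyx => h y hy (hyx.trans (min_le_left _ _))⟩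
  have hbdd : ∀ x, BddAbove (S x) := fun x => ⟨M, fun δ hδ => hδ.2.1⟩
  have lip : ∀ x ∈ E, ∀ y ∈ E, sSup (S x) ≤ sSup (S y) + dist x y := by
    intro x hx y hy
    refine csSup_le (hne x) fun δ hδ => ?_
    by_cases h : δ ≤ dist x y
    · obtain ⟨δ', hδ'⟩ := hne y
      have := le_csSup (hbdd y) hδ'
      linarith [hδ'.1]
    · push Not at h
      have : δ - dist x y ∈ S y := ⟨by linarith, by linarith [hδ.2.1, dist_nonneg (x := x) (y := y)], shift x δ hδ.2.2 y hy h.le⟩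
      linarith [le_csSup (hbdd y) this]
  refine ⟨fun x => sSup (S x), fun x => ⟨?_, csSup_le (hne x) fun δ hδ => hδ.2.1⟩, ?_, ?_, ?_⟩
  · obtain ⟨δ', hδ'⟩ := hne x
    exact hδ'.1.trans_le (le_csSup (hbdd x) hδ')
  · intro x hx y hy
    have h1 := lip x hx y hy
    have h2 := lip y hy x hx
    rw [dist_comm y x] at h2
    rw [abs_le]; constructor <;> linarith
  · intro x hx δ hδ hlt
    obtain ⟨δ', h1, h2⟩ := exists_lt_of_lt_csSup (hne x) hlt
    exact down x δ' δ h1.2.2 h2.le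
  · intro x hx δ hlt hM'
    by_contra hno
    push Not at hno
    obtain ⟨δ', hδ'⟩ := hne x
    have h3 := le_csSup (hbdd x) hδ'
    have : δ ∈ S x := ⟨by linarith [hδ'.1], hM', Or.inl hno⟩
    exact absurd (le_csSup (hbdd x) this) (not_le.mpr hlt)

end FP
end

section
namespace FP
open MvPolynomial
variable {m n D : ℕ}

lemma ml_IH (A : Finset (Idx m n D)) (L : ℕ) (hIH : ∀ A', UpC A' → Bet A A' → MLp A' L) (R : ℝ) (hR : 1 ≤ R) :
    ∃ C c : ℝ, 0 ≤ C ∧ 0 < c ∧ c ≤ 1 ∧ ∀ A', UpC A' → Bet A A' →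
    ∀ (E : Finset (En n)) (K : En n → Set (Fin D → ℝ)), (∀ x ∈ E, Convex ℝ (K x)) → ∀ x0 ∈ E, ∀ (δ0 : ℝ) (P0 : VP n D),
    0 < δ0 → Lrg E K A' x0 δ0 R P0 L → ∃ F : En n → VP n D, Fld m {z | z ∈ E ∧ dist x0 z < c * δ0} F C ∧
      ∀ z ∈ E, dist x0 z < c * δ0 → ev z (F z) ∈ K z ∧ NV x0 δ0 (F z - P0) ≤ C * δ0 ^ m := by
  have H : ∀ A' : Finset (Idx m n D), ∃ C c : ℝ, 0 ≤ C ∧ 0 < c ∧ c ≤ 1 ∧ (UpC A' → Bet A A' →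
    ∀ (E : Finset (En n)) (K : En n → Set (Fin D → ℝ)), (∀ x ∈ E, Convex ℝ (K x)) → ∀ x0 ∈ E, ∀ (δ0 : ℝ) (P0 : VP n D),
    0 < δ0 → Lrg E K A' x0 δ0 R P0 L → ∃ F : En n → VP n D, Fld m {z | z ∈ E ∧ dist x0 z < c * δ0} F C ∧
      ∀ z ∈ E, dist x0 z < c * δ0 → ev z (F z) ∈ K z ∧ NV x0 δ0 (F z - P0) ≤ C * δ0 ^ m) := by
    intro A'
    by_cases h : UpC A' ∧ Bet A A'
    · obtain ⟨C, c, h1, h2, h3, h4⟩ := hIH A' h.1 h.2 R hR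
      exact ⟨C, c, h1, h2, h3, fun _ _ => h4⟩
    · exact ⟨0, 1, le_rfl, one_pos, le_rfl, fun a b => absurd ⟨a, b⟩ h⟩
  choose C c h1 h2 h3 h4 using H
  obtain ⟨A0, hA0⟩ := Finite.exists_min c
  refine ⟨∑ B, C B, c A0, Finset.sum_nonneg fun B _ => h1 B, h2 A0, h3 A0, ?_⟩
  intro A' hu hb E K hK x0 hx0 δ0 P0 hδ hL
  obtain ⟨F, hF, hF2⟩ := h4 A' hu hb E K hK x0 hx0 δ0 P0 hδ hL
  have hC : C A' ≤ ∑ B, C B := Finset.single_le_sum (f := C) (fun B _ => h1 B) (Finset.mem_univ A')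
  have hc : c A0 * δ0 ≤ c A' * δ0 := mul_le_mul_of_nonneg_right (hA0 A') hδ.le
  refine ⟨F, ⟨fun x hx => hF.1 x ⟨hx.1, hx.2.trans_le hc⟩, fun x hx y hy => ?_⟩, fun z hz hzd => ?_⟩
  · exact (hF.2 x ⟨hx.1, hx.2.trans_le hc⟩ y ⟨hy.1, hy.2.trans_le hc⟩).trans
      (mul_le_mul_of_nonneg_right hC (pow_nonneg dist_nonneg _))
  · obtain ⟨a, b⟩ := hF2 z hz (hzd.trans_le hc)
    exact ⟨a, b.trans (mul_le_mul_of_nonneg_right hC (pow_nonneg hδ.le _))⟩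

set_option maxHeartbeats 2000000 in
lemma ml_step (hm : 1 ≤ m) (A : Finset (Idx m n D)) (hA : UpC A) (L : ℕ) (hIH : ∀ A', UpC A' → Bet A A' → MLp A' L) :
    MLp A (L + 2) := by
  intro R hR
  obtain ⟨R1, c1, hRR1, hc1, hc11, hst⟩ := step1 (n := n) (D := D) hm (L + 1) A hA R hR
  have hR1 : 1 ≤ R1 := hR.trans hRR1
  obtain ⟨R3, R4, C5, hR4, hC5, hloc⟩ := ml_local (n := n) (D := D) hm L A hA R1 hR1
  obtain ⟨CI, cI, hCI, hcI, hcI1, hI⟩ := ml_IH A L hIH R4 hR4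
  set c2 := c1 / 4 with hc2
  have hc20 : 0 < c2 := by positivity
  have hc21 : c2 ≤ 1 / 4 := by rw [hc2]; linarith
  set W := 2 * R1 * (1 + 2 / c2) ^ m with hW
  have hW0 : 0 ≤ W := by positivity
  set C0 := (CI + R4) + 2 ^ m * (2 * C5) * 2 ^ m + W with hC0d
  have hC0 : 0 ≤ C0 := by positivity
  obtain ⟨C', hC', hglue⟩ := glue m n D hm C0 cI hC0 hcI hcI1
  refine ⟨2 ^ m * C' + R1, c2, by positivity, hc20, by linarith, ?_⟩
  intro E K hK x0 hx0 δ0 P0 hδ0 hL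
  have hP0 : JetV m P0 := hL.jet
  have H1 : ∀ y : En n, ∃ P, y ∈ E → dist x0 y ≤ c1 * δ0 →
      Lrg E K A y δ0 R1 P (L + 1) ∧ WA A (P - P0) ∧ NV x0 δ0 (P - P0) ≤ R1 * δ0 ^ m := by
    intro y
    by_cases h : y ∈ E ∧ dist x0 y ≤ c1 * δ0
    · obtain ⟨P, hP⟩ := hst E K hK x0 δ0 P0 hδ0 hL y h.1 h.2
      exact ⟨P, fun _ _ => hP⟩
    · exact ⟨0, fun a b => absurd ⟨a, b⟩ h⟩
  choose PP hPP using H1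
  set E' := E.filter (fun z => dist x0 z < c2 * δ0) with hE'
  have hE'1 : ∀ z ∈ E', z ∈ E ∧ dist x0 z < c2 * δ0 := fun z hz => by simpa [hE'] using hz
  have hc2c1 : c2 * δ0 + c2 * δ0 ≤ c1 * δ0 := by
    have : c2 * δ0 = c1 * δ0 / 4 := by rw [hc2]; ring
    have := mul_pos hc1 hδ0
    linarith
  have hcpos : 0 < c2 * δ0 := mul_pos hc20 hδ0
  have hcle : c2 * δ0 ≤ δ0 / 4 := by
    have := mul_le_mul_of_nonneg_right hc21 hδ0.le
    linarith
  have hPPE : ∀ z ∈ E', Lrg E K A z δ0 R1 (PP z) (L + 1) ∧ WA A (PP z - P0) ∧ NV x0 δ0 (PP z - P0) ≤ R1 * δ0 ^ m :=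
    fun z hz => hPP z (hE'1 z hz).1 (by have := (hE'1 z hz).2; linarith)
  obtain ⟨ρ, hρ, hρlip, hρ1, hρ2⟩ := radius E (fun y δ => Prog E K A L R3 P0 δ0 y δ)
    (fun y δ δ' h hd => h.anti hd) (c2 * δ0) hcpos
  set r : En n → ℝ := fun x => ρ x / 2 with hr
  have hr0 : ∀ x, 0 < r x := fun x => half_pos (hρ x).1
  have hrM : ∀ x, r x ≤ c2 * δ0 / 2 := fun x => by have := (hρ x).2; simp only [hr]; linarith
  -- local fields
  have HF : ∀ a : En n, ∃ F : En n → VP n D, a ∈ E' → Fld m {z | z ∈ E' ∧ dist a z < cI * r a} F (CI + R4) ∧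
      ∀ z ∈ E', dist a z < cI * r a → ev z (F z) ∈ K z ∧ NV a (r a) (F z - PP a) ≤ (CI + R4) * r a ^ m := by
    intro a
    by_cases ha : a ∈ E'
    swap
    · exact ⟨0, fun h => absurd h ha⟩
    have haE := (hE'1 a ha).1
    obtain ⟨hLa, hWa, -⟩ := hPPE a ha
    have hra := hr0 a
    have hcr : cI * r a ≤ r a := by
      have := mul_le_mul_of_nonneg_right hcI1 hra.le
      linarith
    rcases hρ1 a haE (r a) hra (by have := (hρ a).1; simp only [hr]; linarith) with h | h
    · have hp := h a haE (by rw [dist_self]; exact hra.le)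
      obtain ⟨A', P, hu, hb, hLP, hNP⟩ := (hloc E K hK δ0 P0 hP0 a haE (PP a) hLa hWa (r a) hra
        (by have := hrM a; linarith)).1 hp
      obtain ⟨F, hF, hF2⟩ := hI A' hu hb E K hK a haE (r a) P hra hLP
      refine ⟨F, fun _ => ⟨⟨fun x hx => hF.1 x ⟨(hE'1 x hx.1).1, hx.2⟩, fun x hx y hy => ?_⟩, fun z hz hzd => ?_⟩⟩
      · exact (hF.2 x ⟨(hE'1 x hx.1).1, hx.2⟩ y ⟨(hE'1 y hy.1).1, hy.2⟩).trans
          (mul_le_mul_of_nonneg_right (by linarith) (pow_nonneg dist_nonneg _))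
      · obtain ⟨e1, e2⟩ := hF2 z (hE'1 z hz).1 hzd
        refine ⟨e1, ?_⟩
        have := NV_tri (x := a) hra.le (F z) P (PP a)
        linarith
    · have hsing : ∀ z ∈ E', dist a z < cI * r a → z = a := fun z hz hzd =>
        h z (hE'1 z hz).1 (by rw [dist_comm]; linarith)
      have hn : ∀ z ∈ E', dist a z < cI * r a → NV a (r a) (PP a - PP a) ≤ (CI + R4) * r a ^ m := fun z hz hzd => by
        rw [sub_self, NV_zero]; positivity
      refine ⟨fun _ => PP a, fun _ => ⟨⟨fun x hx => hLa.jet, fun x hx y hy => ?_⟩, fun z hz hzd => ⟨?_, hn z hz hzd⟩⟩⟩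
      · rw [sub_self, NV_zero]; positivity
      · rw [hsing z hz hzd]; exact (Gam.base hLa.1).2
  choose F hF using HF
  have hCIC0 : CI + R4 ≤ C0 := by
    have : 0 ≤ (2:ℝ) ^ m * (2 * C5) * 2 ^ m := by positivity
    linarith
  have hcompat : ∀ x ∈ E', ∀ y ∈ E', NV x (dist x y + r x) (PP x - PP y) ≤ C0 * (dist x y + r x) ^ m := by
    intro x hx y hy
    by_cases hxy : x = y
    · subst hxy
      rw [sub_self, NV_zero]
      have := hr0 x
      have : 0 ≤ dist x x + r x := by rw [dist_self]; linarith
      positivity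
    have hd : 0 < dist x y := dist_pos.mpr hxy
    obtain ⟨hLx, hWx, hNx⟩ := hPPE x hx
    obtain ⟨hLy, hWy, hNy⟩ := hPPE y hy
    have hxE := hE'1 x hx
    have hyE := hE'1 y hy
    have hrx := hr0 x
    set s := dist x y + r x with hs
    have hs0 : 0 < s := by positivity
    have hsm : 0 < s ^ m := by positivity
    have hjet : JetV m (PP x - PP y) := hLx.jet.sub hLy.jet
    by_cases hδ : 2 * s ≤ c2 * δ0
    · obtain ⟨y0, hy0, hy0d, hnp⟩ := hρ2 x hxE.1 (2 * s) (by simp only [hs, hr]; linarith) hδ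
      have hd0 : dist x0 y0 ≤ c1 * δ0 := by
        have := dist_triangle x0 x y0
        rw [dist_comm x y0] at this
        linarith [hxE.2]
      obtain ⟨hL0, hW0', -⟩ := hPP y0 hy0 hd0
      have hb := (hloc E K hK δ0 P0 hP0 y0 hy0 (PP y0) hL0 hW0' (2 * s) (by linarith) (by linarith)).2 hnp
      have b1 := hb x hxE.1 (by rw [dist_comm]; linarith) (PP x) hLx.1 hWx
      have b2 := hb y hyE.1 (by
        have := dist_triangle y x y0
        rw [dist_comm y x, dist_comm x y0] at this
        linarith) (PP y) hLy.1 hWy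
      have b3 := NV_tri (x := y0) (show 0 ≤ 2 * s by linarith) (PP x) (PP y0) (PP y)
      rw [NV_sub_comm (PP y0) (PP y)] at b3
      have b4 : NV x s (PP x - PP y) ≤ 2 ^ m * NV y0 (2 * s) (PP x - PP y) :=
        NV_jet_shift hjet (l := 2) (by linarith) (by norm_num) hs0.le (by linarith)
      have b5 : NV y0 (2 * s) (PP x - PP y) ≤ 2 * C5 * (2 * s) ^ m := by linarith
      have b6 : (2:ℝ) ^ m * NV y0 (2 * s) (PP x - PP y) ≤ 2 ^ m * (2 * C5 * (2 * s) ^ m) :=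
        mul_le_mul_of_nonneg_left b5 (by positivity)
      have b7 : (2:ℝ) ^ m * (2 * C5 * (2 * s) ^ m) = 2 ^ m * (2 * C5) * 2 ^ m * s ^ m := by rw [mul_pow]; ring
      have b8 : 2 ^ m * (2 * C5) * 2 ^ m * s ^ m ≤ C0 * s ^ m :=
        mul_le_mul_of_nonneg_right (by linarith) hsm.le
      linarith
    · push Not at hδ
      have b3 := NV_tri (x := x0) hδ0.le (PP x) P0 (PP y)
      rw [NV_sub_comm P0 (PP y)] at b3
      have b5 : NV x0 δ0 (PP x - PP y) ≤ 2 * R1 * δ0 ^ m := by linarith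
      have h2c : 0 < 2 / c2 := by positivity
      have hs2 : δ0 ≤ 2 / c2 * s := by
        rw [div_mul_eq_mul_div, le_div_iff₀ hc20]; linarith
      have h2s : 2 / c2 * s = 2 / c2 * s := rfl
      have hone : 1 ≤ 2 / c2 := by rw [le_div_iff₀ hc20]; linarith
      set t := (1 + 2 / c2) * s with ht
      have hte : t = s + 2 / c2 * s := by rw [ht]; ring
      have b6 := NV_jet_up hjet hδ0 (show δ0 ≤ t by linarith) b5
      have b7 : NV x s (PP x - PP y) ≤ NV x0 t (PP x - PP y) :=
        NV_shift_le hs0.le (by linarith [hxE.2]) _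
      have b8 : 2 * R1 * t ^ m = W * s ^ m := by rw [ht, mul_pow, hW]; ring
      have b9 : W * s ^ m ≤ C0 * s ^ m := by
        refine mul_le_mul_of_nonneg_right ?_ hsm.le
        have : 0 ≤ (2:ℝ) ^ m * (2 * C5) * 2 ^ m := by positivity
        linarith
      linarith
  obtain ⟨G, hG1, hG2, hG3⟩ := hglue E' r PP F (fun x _ => hr0 x)
    (fun x hx y hy => by
      have := hρlip x (hE'1 x hx).1 y (hE'1 y hy).1
      have e : r x - r y = (ρ x - ρ y) / 2 := by simp only [hr]; ring
      rw [e, abs_div, abs_two]; linarith)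
    (fun x hx => (hPPE x hx).1.jet)
    (fun a ha => ⟨(hF a ha).1.1, fun x hx y hy => ((hF a ha).1.2 x hx y hy).trans
      (mul_le_mul_of_nonneg_right hCIC0 (pow_nonneg dist_nonneg _))⟩)
    (fun a ha z hz hzd => ((hF a ha).2 z hz hzd).2.trans
      (mul_le_mul_of_nonneg_right hCIC0 (pow_nonneg (hr0 a).le _)))
    hcompat
  have hmem : ∀ z, z ∈ E → dist x0 z < c2 * δ0 → z ∈ E' := fun z h1 h2 => by simp [hE', h1, h2]
  have hp2 : (1:ℝ) ≤ 2 ^ m := one_le_pow₀ (by norm_num)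
  have hCC : C' ≤ 2 ^ m * C' + R1 := by
    have := mul_le_mul_of_nonneg_right hp2 hC'
    linarith
  refine ⟨G, ⟨fun x hx => hG1.1 x (hmem x hx.1 hx.2), fun x hx y hy => ?_⟩, fun z hz hzd => ⟨?_, ?_⟩⟩
  · exact (hG1.2 x (hmem x hx.1 hx.2) y (hmem y hy.1 hy.2)).trans
      (mul_le_mul_of_nonneg_right hCC (pow_nonneg dist_nonneg _))
  · exact hG3 z (hmem z hz hzd) (K z) (hK z hz) fun a ha had => ((hF a ha).2 z (hmem z hz hzd) had).1
  · have hz' := hmem z hz hzd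
    have hj : JetV m (G z - PP z) := (hG1.1 z hz').sub (hPPE z hz').1.jet
    have b1 := NV_jet_up hj (hr0 z) (show r z ≤ 2 * δ0 by have := hrM z; linarith) (hG2 z hz')
    have b2 : NV x0 δ0 (G z - PP z) ≤ NV z (2 * δ0) (G z - PP z) :=
      NV_shift_le hδ0.le (by rw [dist_comm]; linarith) _
    have b3 := NV_tri (x := x0) hδ0.le (G z) (PP z) P0
    have b4 := (hPPE z hz').2.2
    have b5 : C' * (2 * δ0) ^ m = 2 ^ m * C' * δ0 ^ m := by rw [mul_pow]; ring
    rw [add_mul]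
    linarith

lemma ML (hm : 1 ≤ m) (A : Finset (Idx m n D)) (hA : UpC A) : ∃ l, MLp A l := by
  set N := Fintype.card (Idx m n D) with hN
  have key : ∀ p : ℕ ×ₗ ℕ, ∀ A : Finset (Idx m n D), toLex (N - A.card, ∑ α ∈ A, α.1.1.degree) = p → UpC A →
      ∃ l, MLp A l := by
    intro p
    induction p using WellFoundedLT.induction with
    | ind p ih =>
      intro A hp hA
      have H : ∀ A' : Finset (Idx m n D), ∃ l, UpC A' → Bet A A' → MLp A' l := by
        intro A'
        by_cases h : UpC A' ∧ Bet A A'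
        · obtain ⟨l, hl⟩ := ih (toLex (N - A'.card, ∑ α ∈ A', α.1.1.degree)) (by
            rw [← hp, Prod.Lex.toLex_lt_toLex]
            have h1 : A'.card ≤ N := Finset.card_le_univ A'
            have h2 : A.card ≤ N := Finset.card_le_univ A
            rcases h.2 with h3 | h3
            · left; dsimp only; omega
            · right; exact ⟨by dsimp only; omega, h3.2⟩) A' rfl h.1
          exact ⟨l, fun _ _ => hl⟩
        · exact ⟨0, fun a b => absurd ⟨a, b⟩ h⟩
      choose l hl using H
      exact ⟨(∑ B, l B) + 2, ml_step hm A hA _ fun A' hu hb => (hl A' hu hb).lev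
        (Finset.single_le_sum (f := l) (fun _ _ => Nat.zero_le _) (Finset.mem_univ A'))⟩
  exact key _ A rfl hA

end FP
end

set_option linter.unusedSectionVars false
section
namespace FP

section Node
variable {K : Type*} [Field K] [LinearOrder K] [IsStrictOrderedRing K]

/-- finite elements -/
def FinE (a : K) : Prop := ∃ k : ℕ, |a| ≤ k
/-- infinitesimal elements -/
def InfE (a : K) : Prop := ∀ k : ℕ, |a| * k ≤ 1

lemma FinE.add {a b : K} (ha : FinE a) (hb : FinE b) : FinE (a + b) := by
  obtain ⟨k, hk⟩ := ha
  obtain ⟨l, hl⟩ := hb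
  exact ⟨k + l, by push_cast; exact (abs_add_le _ _).trans (add_le_add hk hl)⟩
lemma FinE.mul {a b : K} (ha : FinE a) (hb : FinE b) : FinE (a * b) := by
  obtain ⟨k, hk⟩ := ha
  obtain ⟨l, hl⟩ := hb
  exact ⟨k * l, by push_cast; rw [abs_mul]; exact mul_le_mul hk hl (abs_nonneg _) (Nat.cast_nonneg _)⟩
lemma FinE.of_le_one {a : K} (h : |a| ≤ 1) : FinE a := ⟨1, by simpa using h⟩
lemma FinE.one : FinE (1 : K) := FinE.of_le_one (by simp)
lemma InfE.zero : InfE (0 : K) := fun k => by simp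
lemma InfE.neg {a : K} (h : InfE a) : InfE (-a) := fun k => by rw [abs_neg]; exact h k
lemma InfE.fin {a : K} (h : InfE a) : FinE a := ⟨1, by simpa using h 1⟩
lemma InfE.add {a b : K} (ha : InfE a) (hb : InfE b) : InfE (a + b) := fun k => by
  have h1 := ha (2 * k)
  have h2 := hb (2 * k)
  push_cast at h1 h2
  have h3 := mul_le_mul_of_nonneg_right (abs_add_le a b) (Nat.cast_nonneg (α := K) k)
  have e1 : |a| * (2 * (k:K)) = 2 * (|a| * k) := by ring
  have e2 : |b| * (2 * (k:K)) = 2 * (|b| * k) := by ring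
  rw [add_mul] at h3
  linarith
lemma InfE.sub {a b : K} (ha : InfE a) (hb : InfE b) : InfE (a - b) := by
  rw [sub_eq_add_neg]; exact ha.add hb.neg
lemma FinE.mul_inf {a b : K} (ha : FinE a) (hb : InfE b) : InfE (a * b) := fun k => by
  obtain ⟨l, hl⟩ := ha
  have h1 := hb (l * k)
  push_cast at h1
  rw [abs_mul]
  have h2 : |a| * (|b| * k) ≤ l * (|b| * k) := mul_le_mul_of_nonneg_right hl (by positivity)
  calc |a| * |b| * k = |a| * (|b| * k) := by ring
    _ ≤ l * (|b| * k) := h2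
    _ = |b| * (l * k) := by ring
    _ ≤ 1 := h1
lemma InfE.mul_fin {a b : K} (ha : InfE a) (hb : FinE b) : InfE (a * b) := by
  rw [mul_comm]; exact hb.mul_inf ha
lemma InfE.of_le {a b : K} (hb : InfE b) (h : |a| ≤ |b|) : InfE a := fun k =>
  (mul_le_mul_of_nonneg_right h (Nat.cast_nonneg k)).trans (hb k)
lemma InfE.sum {ι : Type*} (s : Finset ι) (f : ι → K) (h : ∀ i ∈ s, InfE (f i)) : InfE (∑ i ∈ s, f i) := by
  induction s using Finset.induction_on with
  | empty => simpa using InfE.zero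
  | insert a s ha ih =>
    rw [Finset.sum_insert ha]
    exact (h a (Finset.mem_insert_self _ _)).add (ih fun i hi => h i (Finset.mem_insert_of_mem hi))
lemma FinE.inv {a : K} (h : ¬ InfE a) : FinE a⁻¹ := by
  unfold InfE at h
  push Not at h
  obtain ⟨k, hk⟩ := h
  have ha : 0 < |a| := by
    rcases (abs_nonneg a).lt_or_eq with h | h
    · exact h
    · rw [← h] at hk; simp at hk; linarith
  refine ⟨k, ?_⟩
  rw [abs_inv, inv_le_iff_one_le_mul₀ ha]
  rw [mul_comm] at hk; exact hk.le
lemma not_inf_one : ¬ InfE (1 : K) := fun h => by have := h 2; norm_num at this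
lemma InfE.ne_zero {a : K} (h : ¬ InfE a) : a ≠ 0 := fun h' => h (h' ▸ InfE.zero)

/-- modules over the finite elements -/
structure OMod {E : Type*} [AddCommGroup E] [Module K E] (p : E → Prop) : Prop where
  zero : p 0
  add : ∀ {a b}, p a → p b → p (a + b)
  smul : ∀ {c : K} {a}, FinE c → p a → p (c • a)

lemma OMod.sum {E : Type*} [AddCommGroup E] [Module K E] {p : E → Prop} (hp : OMod (K := K) p) {ι : Type*}
    (s : Finset ι) (f : ι → E) (h : ∀ i ∈ s, p (f i)) : p (∑ i ∈ s, f i) := by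
  induction s using Finset.induction_on with
  | empty => simpa using hp.zero
  | insert a s ha ih =>
    rw [Finset.sum_insert ha]
    exact hp.add (h a (Finset.mem_insert_self _ _)) (ih fun i hi => h i (Finset.mem_insert_of_mem hi))
lemma OMod.neg {E : Type*} [AddCommGroup E] [Module K E] {p : E → Prop} (hp : OMod (K := K) p) {a : E} (h : p a) :
    p (-a) := by
  have := hp.smul (c := -1) (FinE.of_le_one (by simp)) h
  simpa using this
lemma OMod.sub {E : Type*} [AddCommGroup E] [Module K E] {p : E → Prop} (hp : OMod (K := K) p) {a b : E} (h : p a) (h' : p b) :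
    p (a - b) := by
  rw [sub_eq_add_neg]; exact hp.add h (hp.neg h')

variable {U : Type*} [AddCommGroup U] [Module K U] [FiniteDimensional K U] {ι : Type*}

/-- inductive invariant -/
def Good (η : (ι → K) →ₗ[K] U) (S : Finset ι) (M : (ι → K) → Prop) (Λ : U → Prop) : Prop :=
  ∃ (V : Submodule K U) (B : Finset ι) (s : ι → ι → K), B ⊆ S ∧ B.Nonempty ∧ S.card ≤ B.card * 2 ^ Module.finrank K V ∧
    (∀ b ∈ B, M (s b)) ∧ (∀ b ∈ B, ∀ b' ∈ B, InfE (s b b' - if b = b' then 1 else 0)) ∧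
    ∀ f ∈ V, Λ f → ∃ σ, M σ ∧ (∀ b ∈ B, InfE (σ b)) ∧ η σ = f

lemma Good.anti {η : (ι → K) →ₗ[K] U} {S : Finset ι} {M : (ι → K) → Prop} {Λ Λ' : U → Prop} (h : Good η S M Λ)
    (hΛ : ∀ f, Λ' f → Λ f) : Good η S M Λ' := by
  obtain ⟨V, B, s, h1, h2, h3, h4, h5, h6⟩ := h
  exact ⟨V, B, s, h1, h2, h3, h4, h5, fun f hf hf' => h6 f hf (hΛ f hf')⟩

set_option maxHeartbeats 1000000 in
lemma node_core (η : (ι → K) →ₗ[K] U) (S : Finset ι) (M MM : (ι → K) → Prop) (Λ Λ0 : U → Prop)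
    (hMM : OMod (K := K) MM) (hL : OMod (K := K) Λ) (hL0 : OMod (K := K) Λ0) (hLL : ∀ f, Λ f → Λ0 f)
    (hη : ∀ s, MM s → Λ0 (η s)) (hcomb : ∀ s, MM s → Λ (η s) → M s) (hone : M (fun x => if x ∈ S then 1 else 0))
    (V : Submodule K U) (B : Finset ι) (s : ι → ι → K) (hBS : B ⊆ S) (hBne : B.Nonempty)
    (hcard : S.card ≤ B.card * 2 ^ Module.finrank K V) (hs : ∀ b ∈ B, MM (s b))
    (hs1 : ∀ b ∈ B, ∀ b' ∈ B, InfE (s b b' - if b = b' then 1 else 0))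
    (hV : ∀ f ∈ V, Λ0 f → ∃ σ, MM σ ∧ (∀ b ∈ B, InfE (σ b)) ∧ η σ = f) : Good η S M Λ := by
  set e : ι → U := fun b => η (s b) with he
  have he0 : ∀ b ∈ B, Λ0 (e b) := fun b hb => hη _ (hs b hb)
  have hsfin : ∀ b ∈ B, ∀ b' ∈ B, FinE (s b b') := by
    intro b hb b' hb'
    have h1 := (hs1 b hb b' hb').fin
    have h2 : FinE (if b = b' then (1:K) else 0) := by
      split_ifs
      · exact FinE.one
      · exact FinE.of_le_one (by simp)
    have := h1.add h2
    simpa using this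
  set Q : Finset ι → Prop := fun T => ∀ a : ι → K, (∀ b ∈ B, FinE (a b)) → (∀ b ∈ B, b ∉ T → InfE (a b)) →
    (∃ g ∈ V, Λ (∑ b ∈ B, a b • e b - g)) → ∀ t ∈ T, InfE (a t) with hQ
  obtain ⟨T, hTm, hTmax⟩ := Finset.exists_max_image (B.powerset.filter Q) Finset.card
    ⟨∅, by simp [hQ]⟩
  rw [Finset.mem_filter, Finset.mem_powerset] at hTm
  obtain ⟨hTB, hQT⟩ := hTm
  -- coefficients
  have hco : ∀ c : ι → K, (∃ g ∈ V, Λ (∑ t ∈ T, c t • e t - g)) → ∀ t ∈ T, InfE (c t) := by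
    rintro c ⟨g, hg, hΛ⟩ t ht
    by_contra hcon
    obtain ⟨t0, ht0, hmax⟩ := Finset.exists_max_image T (fun t => |c t|) ⟨t, ht⟩
    have hn : ¬ InfE (c t0) := fun h => hcon (h.of_le (hmax t ht))
    have hne := InfE.ne_zero hn
    have hinv := FinE.inv hn
    set a : ι → K := fun b => if b ∈ T then (c t0)⁻¹ * c b else 0 with ha
    have hsum : ∑ b ∈ B, a b • e b - (c t0)⁻¹ • g = (c t0)⁻¹ • (∑ t ∈ T, c t • e t - g) := by
      rw [smul_sub, Finset.smul_sum]
      congr 1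
      rw [← Finset.sum_subset hTB]
      · refine Finset.sum_congr rfl fun b hb => ?_
        simp only [ha, if_pos hb, mul_smul]
      · intro b _ hb
        simp only [ha, if_neg hb, zero_smul]
    have := hQT a (fun b hb => by
        by_cases hbT : b ∈ T
        · simp only [ha, if_pos hbT]
          refine FinE.of_le_one ?_
          rw [abs_mul, abs_inv, inv_mul_le_iff₀ (abs_pos.mpr hne), mul_one]
          exact hmax b hbT
        · simp only [ha, if_neg hbT]; exact FinE.of_le_one (by simp))
      (fun b hb hbT => by simp only [ha, if_neg hbT]; exact InfE.zero)
      ⟨(c t0)⁻¹ • g, V.smul_mem _ hg, by rw [hsum]; exact hL.smul hinv hΛ⟩ t0 ht0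
    simp only [ha, if_pos ht0, inv_mul_cancel₀ hne] at this
    exact not_inf_one this
  -- enlarged space
  set W : Finset ι → Submodule K U := fun T' => V ⊔ Submodule.span K (Set.image e (T' : Set ι)) with hW
  have hWmem : ∀ T' f, f ∈ W T' → ∃ g ∈ V, ∃ c : ι → K, f = g + ∑ t ∈ T', c t • e t := by
    intro T' f hf
    obtain ⟨g, hg, f', hf', rfl⟩ := Submodule.mem_sup.mp hf
    obtain ⟨c, hc⟩ := (Submodule.mem_span_image_finset_iff_exists_fun' K).mp hf'
    exact ⟨g, hg, c, by rw [hc]⟩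
  have hext : ∀ T' ⊆ T, ∀ c : ι → K, ∑ t ∈ T', c t • e t = ∑ t ∈ T, (if t ∈ T' then c t else 0) • e t := by
    intro T' hT' c
    rw [← Finset.sum_subset hT']
    · exact Finset.sum_congr rfl fun t ht => by rw [if_pos ht]
    · intro t _ ht; rw [if_neg ht, zero_smul]
  have hrank : ∀ T' ⊆ T, Module.finrank K V + T'.card ≤ Module.finrank K (W T') := by
    intro T'
    induction T' using Finset.induction_on with
    | empty =>
      intro _
      have : W ∅ = V := by simp [hW]
      rw [this]; simp
    | insert t T' ht ih =>
      intro hT'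
      have hT'' : T' ⊆ T := fun x hx => hT' (Finset.mem_insert_of_mem hx)
      have h1 := ih hT''
      have hlt : W T' < W (insert t T') := by
        refine lt_of_le_of_ne (sup_le_sup_left (Submodule.span_mono (Set.image_mono (by simp))) _) ?_
        intro heq
        have hm : e t ∈ W T' := by
          rw [heq]
          exact (le_sup_right : _ ≤ V ⊔ _) (Submodule.subset_span ⟨t, by simp, rfl⟩)
        obtain ⟨g, hg, c, hc⟩ := hWmem _ _ hm
        set c' : ι → K := fun x => if x = t then 1 else - c x with hc'
        have := hco (fun x => if x ∈ insert t T' then c' x else 0) ⟨g, hg, by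
          rw [← hext (insert t T') hT' c', Finset.sum_insert ht]
          have : ∑ x ∈ T', c' x • e x = - ∑ x ∈ T', c x • e x := by
            rw [← Finset.sum_neg_distrib]
            refine Finset.sum_congr rfl fun x hx => ?_
            have : x ≠ t := fun h => ht (h ▸ hx)
            simp [hc', this]
          rw [this, hc]
          simp only [hc', if_true, one_smul]
          convert hL.zero using 1
          abel⟩ t (hT' (by simp))
        simp [hc'] at this
        exact not_inf_one this
      have h2 := Submodule.finrank_lt_finrank_of_lt hlt
      rw [Finset.card_insert_of_notMem ht]
      omega
  have hWprop : ∀ T' ⊆ T, ∀ f ∈ W T', Λ f → ∃ σ, M σ ∧ (∀ b ∈ B, InfE (σ b)) ∧ η σ = f := by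
    intro T' hT' f hf hΛ
    obtain ⟨g, hg, c, hc⟩ := hWmem _ _ hf
    set c' : ι → K := fun t => if t ∈ T' then c t else 0 with hc'
    have hf' : f = g + ∑ t ∈ T, c' t • e t := by rw [hc, hext T' hT' c]
    have hci := hco c' ⟨-g, V.neg_mem hg, by rw [sub_neg_eq_add, add_comm, ← hf']; exact hΛ⟩
    have hg' : g = f - ∑ t ∈ T, c' t • e t := by rw [hf']; abel
    obtain ⟨σ1, hσ1, hσ2, hσ3⟩ := hV g hg (by
      rw [hg']
      exact hL0.sub (hLL _ hΛ) (hL0.sum _ _ fun t ht => hL0.smul (hci t ht).fin (he0 t (hTB ht))))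
    have hησ : η (σ1 + ∑ t ∈ T, c' t • s t) = f := by
      rw [map_add, hσ3, map_sum, hf']
      simp only [map_smul, he]
    refine ⟨σ1 + ∑ t ∈ T, c' t • s t, hcomb _ (hMM.add hσ1 (hMM.sum _ _ fun t ht => hMM.smul (hci t ht).fin (hs t (hTB ht))))
      (by rw [hησ]; exact hΛ), fun b hb => ?_, hησ⟩
    simp only [Pi.add_apply, Finset.sum_apply, Pi.smul_apply, smul_eq_mul]
    exact (hσ2 b hb).add (InfE.sum _ _ fun t ht => (hci t ht).mul_fin (hsfin t (hTB ht) b hb))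
  by_cases hT : T = B
  · obtain ⟨b0, hb0⟩ := hBne
    have hsub : B.erase b0 ⊆ T := by rw [hT]; exact Finset.erase_subset _ _
    refine ⟨W (B.erase b0), {b0}, fun _ => fun x => if x ∈ S then 1 else 0, by simpa using hBS hb0, by simp, ?_, fun _ _ => hone, ?_, ?_⟩
    · have h1 := hrank _ hsub
      rw [Finset.card_erase_of_mem hb0] at h1
      have hpos : 0 < B.card := Finset.card_pos.mpr ⟨b0, hb0⟩
      have h2 : B.card ≤ 2 ^ (B.card - 1) := by
        have := (B.card - 1).lt_two_pow_self
        omega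
      calc S.card ≤ B.card * 2 ^ Module.finrank K V := hcard
        _ ≤ 2 ^ (B.card - 1) * 2 ^ Module.finrank K V := Nat.mul_le_mul_right _ h2
        _ = 2 ^ (Module.finrank K V + (B.card - 1)) := by rw [← pow_add, add_comm]
        _ ≤ 2 ^ Module.finrank K (W (B.erase b0)) := Nat.pow_le_pow_right (by norm_num) h1
        _ = _ := by simp
    · intro b hb b' hb'
      rw [Finset.mem_singleton] at hb hb'
      subst hb; subst hb'
      simp [hBS hb0, InfE.zero]
    · intro f hf hΛ
      obtain ⟨σ, h1, h2, h3⟩ := hWprop _ hsub f hf hΛ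
      exact ⟨σ, h1, fun b hb => by rw [Finset.mem_singleton] at hb; subst hb; exact h2 _ hb0, h3⟩
  · have hex : ∀ b : ι, ∃ s' : ι → K, b ∈ B \ T → M s' ∧ ∀ b' ∈ B \ T, InfE (s' b' - if b = b' then 1 else 0) := by
      intro b
      by_cases hb : b ∈ B \ T
      swap
      · exact ⟨0, fun h => absurd h hb⟩
      have hbB : b ∈ B := (Finset.mem_sdiff.mp hb).1
      have hbT : b ∉ T := (Finset.mem_sdiff.mp hb).2
      have hnQ : ¬ Q (insert b T) := by
        intro h
        have := hTmax (insert b T) (by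
          rw [Finset.mem_filter, Finset.mem_powerset]
          exact ⟨Finset.insert_subset hbB hTB, h⟩)
        rw [Finset.card_insert_of_notMem hbT] at this
        omega
      simp only [hQ] at hnQ
      push Not at hnQ
      obtain ⟨a, ha1, ha2, ⟨g, hg, hΛ⟩, t, ht, hat⟩ := hnQ
      have hab : ¬ InfE (a b) := by
        intro h
        have h1 := hQT a ha1 (fun b' hb' hb'T => by
          by_cases hbb : b' = b
          · rw [hbb]; exact h
          · exact ha2 b' hb' (by simp [hbb, hb'T])) ⟨g, hg, hΛ⟩
        rcases Finset.mem_insert.mp ht with h2 | h2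
        · exact hat (h2 ▸ h)
        · exact hat (h1 t h2)
      have hne := InfE.ne_zero hab
      have hinv := FinE.inv hab
      obtain ⟨σ1, hσ1, hσ2, hσ3⟩ := hV g hg (by
        have : g = ∑ b ∈ B, a b • e b - (∑ b ∈ B, a b • e b - g) := by abel
        rw [this]
        exact hL0.sub (hL0.sum _ _ fun t ht => hL0.smul (ha1 t ht) (he0 t ht)) (hLL _ hΛ))
      refine ⟨(a b)⁻¹ • (∑ c ∈ B, a c • s c - σ1), fun _ => ⟨hcomb _ (hMM.smul hinv
        (hMM.sub (hMM.sum _ _ fun c hc => hMM.smul (ha1 c hc) (hs c hc)) hσ1)) ?_, fun b' hb' => ?_⟩⟩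
      · rw [map_smul]
        refine hL.smul hinv ?_
        rw [map_sub, hσ3, map_sum]
        simpa only [map_smul] using hΛ
      · have hb'B : b' ∈ B := (Finset.mem_sdiff.mp hb').1
        have hb'T : b' ∉ T := (Finset.mem_sdiff.mp hb').2
        simp only [Pi.smul_apply, Pi.sub_apply, Finset.sum_apply, smul_eq_mul]
        have e1 : ∑ c ∈ B, a c * s c b' = ∑ c ∈ B, a c * (s c b' - if c = b' then 1 else 0) + a b' := by
          simp only [mul_sub, Finset.sum_sub_distrib]
          simp [Finset.sum_ite_eq', hb'B]
        have e2 : (a b)⁻¹ * (∑ c ∈ B, a c * s c b' - σ1 b') - (if b = b' then 1 else 0) =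
            (a b)⁻¹ * (∑ c ∈ B, a c * (s c b' - if c = b' then 1 else 0) + (a b' - if b = b' then a b else 0) - σ1 b') := by
          rw [e1]
          split_ifs with h
          · field_simp; ring
          · ring
        rw [e2]
        refine hinv.mul_inf (((InfE.sum _ _ fun c hc => (ha1 c hc).mul_inf (hs1 c hc b' hb'B)).add ?_).sub (hσ2 b' hb'B))
        split_ifs with h
        · rw [h, sub_self]; exact InfE.zero
        · rw [sub_zero]; exact ha2 b' hb'B (by simp [Ne.symm h, hb'T])
    choose s' hs' using hex
    have hss : T ⊂ B := Finset.ssubset_iff_subset_ne.mpr ⟨hTB, hT⟩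
    refine ⟨W T, B \ T, s', fun x hx => hBS (Finset.mem_sdiff.mp hx).1, Finset.sdiff_nonempty.mpr (fun h => hT (hTB.antisymm h)), ?_,
      fun b hb => (hs' b hb).1, fun b hb => (hs' b hb).2, fun f hf hΛ => ?_⟩
    · have h1 := hrank T le_rfl
      have hc := Finset.card_sdiff_add_card_eq_card hTB
      have hpos : 0 < (B \ T).card := Finset.card_pos.mpr (Finset.sdiff_nonempty.mpr (fun h => hT (hTB.antisymm h)))
      have h2 : B.card ≤ (B \ T).card * 2 ^ T.card := by
        have h3 : T.card + 1 ≤ 2 ^ T.card := T.card.lt_two_pow_self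
        have h4 := Nat.mul_le_mul_left (B \ T).card h3
        have h5 : T.card ≤ (B \ T).card * T.card := Nat.le_mul_of_pos_left _ hpos
        rw [mul_add, mul_one] at h4
        omega
      calc S.card ≤ B.card * 2 ^ Module.finrank K V := hcard
        _ ≤ ((B \ T).card * 2 ^ T.card) * 2 ^ Module.finrank K V := Nat.mul_le_mul_right _ h2
        _ = (B \ T).card * 2 ^ (Module.finrank K V + T.card) := by rw [mul_assoc, ← pow_add, add_comm T.card]
        _ ≤ _ := Nat.mul_le_mul_left _ (Nat.pow_le_pow_right (by norm_num) h1)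
    · obtain ⟨σ, h1, h2, h3⟩ := hWprop T le_rfl f hf hΛ
      exact ⟨σ, h1, fun b hb => h2 b (Finset.mem_sdiff.mp hb).1, h3⟩

lemma node_aux (η : (ι → K) →ₗ[K] U) (S S1 S2 : Finset ι) (hS : S = S1 ∪ S2) (hdis : Disjoint S1 S2)
    (M M1 M2 : (ι → K) → Prop) (Λ Λ0 : U → Prop)
    (hM1 : OMod (K := K) M1) (hM2 : OMod (K := K) M2) (hL : OMod (K := K) Λ) (hL0 : OMod (K := K) Λ0) (hLL : ∀ f, Λ f → Λ0 f)
    (hη1 : ∀ s, M1 s → Λ0 (η s)) (hη2 : ∀ s, M2 s → Λ0 (η s)) (hs1 : ∀ s, M1 s → ∀ x, x ∉ S1 → s x = 0)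
    (hs2 : ∀ s, M2 s → ∀ x, x ∉ S2 → s x = 0)
    (hcomb : ∀ u v, M1 u → M2 v → Λ (η (u + v)) → M (u + v)) (hone : M (fun x => if x ∈ S then 1 else 0))
    (V1 : Submodule K U) (B1 : Finset ι) (s1 : ι → ι → K) (h11 : B1 ⊆ S1) (h12 : B1.Nonempty)
    (h13 : S1.card ≤ B1.card * 2 ^ Module.finrank K V1)
    (h14 : ∀ b ∈ B1, M1 (s1 b)) (h15 : ∀ b ∈ B1, ∀ b' ∈ B1, InfE (s1 b b' - if b = b' then 1 else 0))
    (h16 : ∀ f ∈ V1, Λ0 f → ∃ σ, M1 σ ∧ (∀ b ∈ B1, InfE (σ b)) ∧ η σ = f)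
    (V2 : Submodule K U) (B2 : Finset ι) (s2 : ι → ι → K) (h21 : B2 ⊆ S2)
    (h23 : S2.card ≤ B2.card * 2 ^ Module.finrank K V2)
    (h24 : ∀ b ∈ B2, M2 (s2 b)) (h25 : ∀ b ∈ B2, ∀ b' ∈ B2, InfE (s2 b b' - if b = b' then 1 else 0))
    (hle : Module.finrank K V2 ≤ Module.finrank K V1) : Good η S M Λ := by
  have hn1 : ∀ b ∈ B1, b ∉ S2 := fun b hb h => Finset.disjoint_left.mp hdis (h11 hb) h
  have hn2 : ∀ b ∈ B2, b ∉ S1 := fun b hb h => Finset.disjoint_left.mp hdis h (h21 hb)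
  have hn2' : ∀ b ∈ B2, b ∉ B1 := fun b hb h => hn2 b hb (h11 h)
  refine node_core η S M (fun s => ∃ u v, M1 u ∧ M2 v ∧ s = u + v) Λ Λ0 ⟨⟨0, 0, hM1.zero, hM2.zero, by simp⟩, ?_, ?_⟩ hL hL0 hLL
    ?_ ?_ hone V1 (B1 ∪ B2) (fun b => if b ∈ B1 then s1 b else s2 b) ?_ (h12.mono Finset.subset_union_left) ?_ ?_ ?_ ?_
  · rintro _ _ ⟨u, v, hu, hv, rfl⟩ ⟨u', v', hu', hv', rfl⟩
    exact ⟨u + u', v + v', hM1.add hu hu', hM2.add hv hv', by abel⟩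
  · rintro c _ hc ⟨u, v, hu, hv, rfl⟩
    exact ⟨c • u, c • v, hM1.smul hc hu, hM2.smul hc hv, smul_add _ _ _⟩
  · rintro _ ⟨u, v, hu, hv, rfl⟩
    rw [map_add]; exact hL0.add (hη1 u hu) (hη2 v hv)
  · rintro _ ⟨u, v, hu, hv, rfl⟩ h
    exact hcomb u v hu hv h
  · rw [hS]; exact Finset.union_subset_union h11 h21
  · rw [hS, Finset.card_union_of_disjoint hdis, Finset.card_union_of_disjoint (Finset.disjoint_of_subset_left h11 (Finset.disjoint_of_subset_right h21 hdis)), add_mul]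
    exact add_le_add h13 (h23.trans (Nat.mul_le_mul_left _ (Nat.pow_le_pow_right (by norm_num) hle)))
  · intro b hb
    by_cases h : b ∈ B1
    · rw [if_pos h]; exact ⟨s1 b, 0, h14 b h, hM2.zero, by simp⟩
    · rw [if_neg h]
      exact ⟨0, s2 b, hM1.zero, h24 b ((Finset.mem_union.mp hb).resolve_left h), by simp⟩
  · intro b hb b' hb'
    rcases Finset.mem_union.mp hb with h | h <;> rcases Finset.mem_union.mp hb' with h' | h'
    · rw [if_pos h]; exact h15 b h b' h'
    · rw [if_pos h, hs1 _ (h14 b h) b' (hn2 b' h'), if_neg (fun hh : b = b' => hn2' b' h' (hh ▸ h)), sub_zero]; exact InfE.zero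
    · rw [if_neg (hn2' b h), hs2 _ (h24 b h) b' (hn1 b' h'), if_neg (fun hh : b = b' => hn2' b h (hh ▸ h')), sub_zero]; exact InfE.zero
    · rw [if_neg (hn2' b h)]; exact h25 b h b' h'
  · intro f hf hΛ
    obtain ⟨σ, e1, e2, e3⟩ := h16 f hf hΛ
    refine ⟨σ, ⟨σ, 0, e1, hM2.zero, by simp⟩, fun b hb => ?_, e3⟩
    rcases Finset.mem_union.mp hb with h | h
    · exact e2 b h
    · rw [hs1 _ e1 b (hn2 b h)]; exact InfE.zero

lemma node (η : (ι → K) →ₗ[K] U) (S S1 S2 : Finset ι) (hS : S = S1 ∪ S2) (hdis : Disjoint S1 S2)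
    (M M1 M2 : (ι → K) → Prop) (Λ Λ0 : U → Prop)
    (hM1 : OMod (K := K) M1) (hM2 : OMod (K := K) M2) (hL : OMod (K := K) Λ) (hL0 : OMod (K := K) Λ0) (hLL : ∀ f, Λ f → Λ0 f)
    (hη1 : ∀ s, M1 s → Λ0 (η s)) (hη2 : ∀ s, M2 s → Λ0 (η s)) (hs1 : ∀ s, M1 s → ∀ x, x ∉ S1 → s x = 0)
    (hs2 : ∀ s, M2 s → ∀ x, x ∉ S2 → s x = 0)
    (hcomb : ∀ u v, M1 u → M2 v → Λ (η (u + v)) → M (u + v)) (hone : M (fun x => if x ∈ S then 1 else 0))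
    (hG1 : Good η S1 M1 Λ0) (hG2 : Good η S2 M2 Λ0) : Good η S M Λ := by
  obtain ⟨V1, B1, s1, h11, h12, h13, h14, h15, h16⟩ := hG1
  obtain ⟨V2, B2, s2, h21, h22, h23, h24, h25, h26⟩ := hG2
  rcases le_total (Module.finrank K V2) (Module.finrank K V1) with h | h
  · exact node_aux η S S1 S2 hS hdis M M1 M2 Λ Λ0 hM1 hM2 hL hL0 hLL hη1 hη2 hs1 hs2 hcomb hone
      V1 B1 s1 h11 h12 h13 h14 h15 h16 V2 B2 s2 h21 h23 h24 h25 h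
  · exact node_aux η S S2 S1 (by rw [hS, Finset.union_comm]) hdis.symm M M2 M1 Λ Λ0 hM2 hM1 hL hL0 hLL hη2 hη1 hs2 hs1
      (fun u v hu hv h => by rw [add_comm] at h ⊢; exact hcomb v u hv hu h) hone
      V2 B2 s2 h21 h22 h23 h24 h25 h26 V1 B1 s1 h11 h13 h14 h15 h

lemma good_leaf (η : (ι → K) →ₗ[K] U) (x : ι) (M : (ι → K) → Prop) (hM0 : M 0) (Λ : U → Prop)
    (hone : M (fun y => if y ∈ ({x} : Finset ι) then 1 else 0)) : Good η {x} M Λ := by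
  refine ⟨⊥, {x}, fun _ => fun y => if y ∈ ({x} : Finset ι) then 1 else 0, le_rfl, by simp, by simp, fun _ _ => hone, ?_, ?_⟩
  · intro b hb b' hb'
    rw [Finset.mem_singleton] at hb hb'
    subst hb; subst hb'
    simp [InfE.zero]
  · intro f hf _
    rw [Submodule.mem_bot] at hf
    exact ⟨0, hM0, fun _ _ => InfE.zero, by rw [hf, map_zero]⟩

end Node
end FP
end

section
namespace FP
open MvPolynomial
variable {m n D : ℕ} {ι : Type}

/-- pairing of functionals with jets -/
def pr (f : Idx m n D → ℝ) (P : VP n D) : ℝ := ∑ i, f i * ch m 0 1 P i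

lemma pr_sub (f : Idx m n D → ℝ) (P Q : VP n D) : pr f (P - Q) = pr f P - pr f Q := by
  simp [pr, mul_sub, Finset.sum_sub_distrib]
lemma pr_smul (f : Idx m n D → ℝ) (c : ℝ) (P : VP n D) : pr f (c • P) = c * pr f P := by
  simp only [pr, map_smul, Pi.smul_apply, smul_eq_mul, Finset.mul_sum]
  exact Finset.sum_congr rfl fun i _ => by ring
lemma pr_add (f : Idx m n D → ℝ) (P Q : VP n D) : pr f (P + Q) = pr f P + pr f Q := by
  simp [pr, mul_add, Finset.sum_add_distrib]
lemma pr_zero (f : Idx m n D → ℝ) : pr f (0 : VP n D) = 0 := by simp [pr]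
lemma pr_comb {κ : Type*} (S : Finset κ) (s : κ → ℝ) (ξ : κ → Idx m n D → ℝ) (P : VP n D) :
    pr (fun i => ∑ v ∈ S, s v * ξ v i) P = ∑ v ∈ S, s v * pr (ξ v) P := by
  simp only [pr, Finset.sum_mul, Finset.mul_sum]
  rw [Finset.sum_comm]
  exact Finset.sum_congr rfl fun v _ => Finset.sum_congr rfl fun i _ => by ring

/-- admissible fields -/
def Ad (m : ℕ) (S : Finset ι) (x : ι → En n) (δ c : ℝ) (P : ι → VP n D) : Prop :=
  (∀ v ∈ S, JetV m (P v) ∧ NV (x v) δ (P v) ≤ c * δ ^ m) ∧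
  ∀ v ∈ S, ∀ w ∈ S, NV (x v) (dist (x v) (x w)) (P v - P w) ≤ c * dist (x v) (x w) ^ m

/-- dual bound -/
def Du (S : Finset ι) (x : ι → En n) (ξ : ι → Idx m n D → ℝ) (δ : ℝ) (s : ι → ℝ) (B : ℝ) : Prop :=
  ∀ P : ι → VP n D, Ad m S x δ 1 P → |∑ v ∈ S, s v * pr (ξ v) (P v)| ≤ B

/-- bound of a functional -/
def La (S : Finset ι) (x : ι → En n) (δ : ℝ) (f : Idx m n D → ℝ) (B : ℝ) : Prop :=
  ∀ P : VP n D, JetV m P → (∀ v ∈ S, NV (x v) δ P ≤ δ ^ m) → |pr f P| ≤ B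

lemma Du.scale {S : Finset ι} {x : ι → En n} {ξ : ι → Idx m n D → ℝ} {δ : ℝ} {s : ι → ℝ} {B c : ℝ} (h : Du S x ξ δ s B)
    (hc : 0 < c) {P : ι → VP n D} (hP : Ad m S x δ c P) : |∑ v ∈ S, s v * pr (ξ v) (P v)| ≤ c * B := by
  have h1 := h (fun v => c⁻¹ • P v) ⟨fun v hv => ⟨(hP.1 v hv).1.smul _, by
      rw [NV_smul, abs_of_pos (inv_pos.mpr hc), inv_mul_le_iff₀ hc, one_mul]; exact (hP.1 v hv).2⟩,
    fun v hv w hw => by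
      rw [← smul_sub, NV_smul, abs_of_pos (inv_pos.mpr hc), inv_mul_le_iff₀ hc, one_mul]; exact hP.2 v hv w hw⟩
  have e : ∑ v ∈ S, s v * pr (ξ v) (c⁻¹ • P v) = c⁻¹ * ∑ v ∈ S, s v * pr (ξ v) (P v) := by
    rw [Finset.mul_sum]
    exact Finset.sum_congr rfl fun v _ => by rw [pr_smul]; ring
  rw [e, abs_mul, abs_of_pos (inv_pos.mpr hc), inv_mul_le_iff₀ hc] at h1
  exact h1

lemma La.scale {S : Finset ι} {x : ι → En n} {f : Idx m n D → ℝ} {δ : ℝ} {B c : ℝ} (h : La S x δ f B)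
    (hc : 0 < c) {P : VP n D} (hj : JetV m P) (hP : ∀ v ∈ S, NV (x v) δ P ≤ c * δ ^ m) : |pr f P| ≤ c * B := by
  have h1 := h (c⁻¹ • P) (hj.smul _) fun v hv => by
      rw [NV_smul, abs_of_pos (inv_pos.mpr hc), inv_mul_le_iff₀ hc]; exact hP v hv
  rw [pr_smul, abs_mul, abs_of_pos (inv_pos.mpr hc), inv_mul_le_iff₀ hc] at h1
  exact h1

lemma La.down {S : Finset ι} {x : ι → En n} {f : Idx m n D → ℝ} {δ δ' B : ℝ} (h : La S x δ f B) (hδ' : 0 < δ') (hd : δ' ≤ δ) :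
    La S x δ' f B := fun P hP hN => h P hP fun v hv => by
  have := NV_jet_up (c := 1) hP hδ' hd (by rw [one_mul]; exact hN v hv)
  rwa [one_mul] at this

lemma La.sub {S S1 : Finset ι} {x : ι → En n} {f : Idx m n D → ℝ} {δ B : ℝ} (h : La S x δ f B) (hδ : 0 < δ)
    (h1 : S1 ⊆ S) (hne : S1.Nonempty) (hdi : ∀ v ∈ S, ∀ w ∈ S, dist (x v) (x w) ≤ δ) : La S1 x δ f (2 ^ m * B) := by
  intro P hP hN
  obtain ⟨v, hv⟩ := hne
  refine h.scale (by positivity) hP fun w hw => ?_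
  have := NV_jet_shift hP (l := 2) (x := x v) (y := x w) hδ.le (by norm_num) hδ.le (by have := hdi v (h1 hv) w hw; linarith)
  exact this.trans (mul_le_mul_of_nonneg_left (hN v hv) (by positivity))

lemma Du.toLa {S S1 : Finset ι} {x : ι → En n} {ξ : ι → Idx m n D → ℝ} {δ : ℝ} {s : ι → ℝ} {B : ℝ} (hm : 1 ≤ m) (h : Du S1 x ξ δ s B)
    (h1 : S1 ⊆ S) : La S x δ (fun i => ∑ v ∈ S1, s v * ξ v i) B := by
  intro P hP hN
  rw [pr_comb]
  exact h (fun _ => P) ⟨fun v hv => ⟨hP, by rw [one_mul]; exact hN v (h1 hv)⟩, fun v hv w hw => by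
    rw [sub_self, NV_zero]; positivity⟩

lemma Du.comb {S S1 S2 : Finset ι} {x : ι → En n} {ξ : ι → Idx m n D → ℝ} {δ δ' : ℝ} {s : ι → ℝ} {B1 B2 B3 : ℝ} (hm : 1 ≤ m) (hinj : Function.Injective x)
    (hS : S = S1 ∪ S2) (hdis : Disjoint S1 S2) (hne : S.Nonempty) (hdi : ∀ v ∈ S, ∀ w ∈ S, dist (x v) (x w) ≤ δ')
    (hδ' : 0 < δ') (hd : δ' ≤ δ)
    (h1 : Du S1 x ξ δ' s B1) (h2 : Du S2 x ξ δ' s B2) (h3 : La S x δ (fun i => ∑ v ∈ S, s v * ξ v i) B3) :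
    Du S x ξ δ s (B1 + B2 + 2 ^ m * B3) := by
  intro P hP
  obtain ⟨a, ha⟩ := hne
  have hδ : 0 < δ := hδ'.trans_le hd
  have hsub : ∀ v ∈ S, JetV m (P v - P a) ∧ NV (x v) δ' (P v - P a) ≤ 1 * δ' ^ m := by
    intro v hv
    refine ⟨(hP.1 v hv).1.sub (hP.1 a ha).1, ?_⟩
    by_cases hva : v = a
    · rw [hva, sub_self, NV_zero]; positivity
    · exact NV_jet_up ((hP.1 v hv).1.sub (hP.1 a ha).1) (dist_pos.mpr (hinj.ne hva)) (hdi v hv a ha) (hP.2 v hv a ha)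
  have hAd : ∀ T ⊆ S, Ad m T x δ' 1 (fun v => P v - P a) := fun T hT =>
    ⟨fun v hv => hsub v (hT hv), fun v hv w hw => by
      rw [sub_sub_sub_cancel_right]; exact hP.2 v (hT hv) w (hT hw)⟩
  have b1 := h1 _ (hAd S1 (by rw [hS]; exact Finset.subset_union_left))
  have b2 := h2 _ (hAd S2 (by rw [hS]; exact Finset.subset_union_right))
  have b3 := h3.scale (c := 2 ^ m) (by positivity) (hP.1 a ha).1 fun v hv => by
    have := NV_jet_shift (hP.1 a ha).1 (l := 2) (x := x a) (y := x v) hδ.le (by norm_num) hδ.le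
      (by have := hdi a ha v hv; linarith)
    refine this.trans (mul_le_mul_of_nonneg_left ?_ (by positivity))
    have := (hP.1 a ha).2
    rwa [one_mul] at this
  rw [pr_comb] at b3
  have e : ∑ v ∈ S, s v * pr (ξ v) (P v) = ∑ v ∈ S1, s v * pr (ξ v) (P v - P a) + ∑ v ∈ S2, s v * pr (ξ v) (P v - P a)
      + ∑ v ∈ S, s v * pr (ξ v) (P a) := by
    rw [← Finset.sum_union hdis, ← hS, ← Finset.sum_add_distrib]
    exact Finset.sum_congr rfl fun v _ => by rw [pr_sub]; ring
  rw [e]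
  have t1 := abs_add_le (∑ v ∈ S1, s v * pr (ξ v) (P v - P a) + ∑ v ∈ S2, s v * pr (ξ v) (P v - P a)) (∑ v ∈ S, s v * pr (ξ v) (P a))
  have t2 := abs_add_le (∑ v ∈ S1, s v * pr (ξ v) (P v - P a)) (∑ v ∈ S2, s v * pr (ξ v) (P v - P a))
  linarith

/-- restriction of the constant multiplier to a separated piece -/
lemma Du.split {S S1 : Finset ι} {x : ι → En n} {ξ : ι → Idx m n D → ℝ} {δ δ' : ℝ} {s : ι → ℝ} {B L : ℝ} (hm : 1 ≤ m)
    (h1 : S1 ⊆ S) (hdi : ∀ v ∈ S, ∀ w ∈ S, dist (x v) (x w) ≤ δ') (hδ' : 0 < δ') (hd : δ' ≤ δ) (hL : 1 ≤ L)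
    (hsep : ∀ v ∈ S1, ∀ w ∈ S, w ∉ S1 → δ' ≤ L * dist (x v) (x w))
    (h : Du S x ξ δ s B) : Du S1 x ξ δ' s ((2 * L) ^ m * B) := by
  intro P hP
  have hL0 : 0 < L := by linarith
  set Q : ι → VP n D := fun v => if v ∈ S1 then P v else 0 with hQ
  have hδ : 0 < δ := hδ'.trans_le hd
  have hc1 : 1 ≤ (2 * L) ^ m := one_le_pow₀ (by linarith)
  have hc0 : (0:ℝ) < (2 * L) ^ m := by positivity
  have cross : ∀ v ∈ S1, ∀ w ∈ S, w ∉ S1 → ∀ z, (z = v ∨ z = w) →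
      NV (x z) (dist (x v) (x w)) (P v) ≤ (2 * L) ^ m * dist (x v) (x w) ^ m := by
    intro v hv w hw hw1 z hz
    have hd1 := hsep v hv w hw hw1
    have hd2 := hdi v (h1 hv) w hw
    have hdn : 0 ≤ dist (x v) (x w) := dist_nonneg
    have hzd : dist (x v) (x z) ≤ dist (x v) (x w) := by
      rcases hz with rfl | rfl
      · rw [dist_self]; exact hdn
      · exact le_rfl
    have b := (hP.1 v hv).2
    rw [one_mul] at b
    have b1 : NV (x z) (dist (x v) (x w)) (P v) ≤ 2 ^ m * NV (x v) (dist (x v) (x w)) (P v) :=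
      NV_jet_shift (hP.1 v hv).1 (l := 2) hdn (by norm_num) hdn (by linarith)
    have b2 : NV (x v) (dist (x v) (x w)) (P v) ≤ NV (x v) δ' (P v) := NV_mono hdn hd2 _
    have b3 : δ' ^ m ≤ (L * dist (x v) (x w)) ^ m := pow_le_pow_left₀ hδ'.le hd1 _
    have b4 : (2:ℝ) ^ m * NV (x v) (dist (x v) (x w)) (P v) ≤ 2 ^ m * (L * dist (x v) (x w)) ^ m :=
      mul_le_mul_of_nonneg_left (b2.trans (b.trans b3)) (by positivity)
    refine b1.trans (b4.trans (le_of_eq ?_))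
    rw [mul_pow, mul_pow, mul_assoc]
  have hAd : Ad m S x δ ((2 * L) ^ m) Q := by
    constructor
    · intro v hv
      by_cases hv1 : v ∈ S1
      · simp only [hQ, if_pos hv1]
        obtain ⟨p1, p2⟩ := hP.1 v hv1
        refine ⟨p1, (NV_jet_up p1 hδ' hd p2).trans (mul_le_mul_of_nonneg_right hc1 (by positivity))⟩
      · simp only [hQ, if_neg hv1]
        exact ⟨JetV.zero, by rw [NV_zero]; positivity⟩
    · intro v hv w hw
      by_cases hv1 : v ∈ S1 <;> by_cases hw1 : w ∈ S1
      · simp only [hQ, if_pos hv1, if_pos hw1]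
        exact (hP.2 v hv1 w hw1).trans (mul_le_mul_of_nonneg_right hc1 (by positivity))
      · simp only [hQ, if_pos hv1, if_neg hw1, sub_zero]
        exact cross v hv1 w hw hw1 v (Or.inl rfl)
      · simp only [hQ, if_neg hv1, if_pos hw1, zero_sub, NV_neg]
        rw [dist_comm]
        exact cross w hw1 v hv hv1 v (Or.inr rfl)
      · simp only [hQ, if_neg hv1, if_neg hw1, sub_zero, NV_zero]
        positivity
  have := h.scale hc0 hAd
  have e : ∑ v ∈ S, s v * pr (ξ v) (Q v) = ∑ v ∈ S1, s v * pr (ξ v) (P v) := by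
    rw [← Finset.sum_subset h1]
    · exact Finset.sum_congr rfl fun v hv => by simp only [hQ, if_pos hv]
    · intro v _ hv
      simp only [hQ, if_neg hv, pr_zero, mul_zero]
  rwa [e] at this

/-- splitting of a finite set at its diameter -/
lemma exists_split (S : Finset ι) (x : ι → En n) (hinj : Function.Injective x) (h2 : 2 ≤ S.card) :
    ∃ (δ : ℝ) (S1 : Finset ι), 0 < δ ∧ (∀ v ∈ S, ∀ w ∈ S, dist (x v) (x w) ≤ δ) ∧ (∃ v ∈ S, ∃ w ∈ S, dist (x v) (x w) = δ) ∧ S1 ⊆ S ∧ S1.Nonempty ∧ (S \ S1).Nonempty ∧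
      ∀ v ∈ S1, ∀ w ∈ S \ S1, δ ≤ S.card * dist (x v) (x w) := by
  obtain ⟨p, hp, hmax⟩ := Finset.exists_max_image (S ×ˢ S) (fun p => dist (x p.1) (x p.2)) (by
    have : S.Nonempty := Finset.card_pos.mp (by omega)
    exact this.product this)
  obtain ⟨a, b⟩ := p
  rw [Finset.mem_product] at hp
  obtain ⟨ha, hb⟩ := hp
  dsimp only at ha hb hmax
  set δ := dist (x a) (x b) with hδ
  set N := S.card with hN
  have hdi : ∀ v ∈ S, ∀ w ∈ S, dist (x v) (x w) ≤ δ := fun v hv w hw => hmax (v, w) (Finset.mem_product.mpr ⟨hv, hw⟩)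
  have hpos : 0 < δ := by
    obtain ⟨v, hv, w, hw, hvw⟩ := Finset.one_lt_card.mp (show 1 < S.card by omega)
    exact (dist_pos.mpr (hinj.ne hvw)).trans_le (hdi v hv w hw)
  have hN0 : (0:ℝ) < N := by have : 0 < N := by omega
                             exact_mod_cast this
  set f : ι → ℕ := fun v => ⌈dist (x a) (x v) * N / δ⌉₊ - 1 with hf
  obtain ⟨j, hj, hjn⟩ := Finset.exists_mem_notMem_of_card_lt_card (s := (S.erase a).image f) (t := Finset.range N) (by
    rw [Finset.card_range]
    refine Finset.card_image_le.trans_lt ?_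
    rw [Finset.card_erase_of_mem ha]; omega)
  rw [Finset.mem_range] at hj
  have key : ∀ v ∈ S, (j:ℝ) < dist (x a) (x v) * N / δ → (j:ℝ) + 1 < dist (x a) (x v) * N / δ := by
    intro v hv h
    by_contra hcon
    push Not at hcon
    apply hjn
    refine Finset.mem_image.mpr ⟨v, Finset.mem_erase.mpr ⟨?_, hv⟩, ?_⟩
    · rintro rfl
      rw [dist_self, zero_mul, zero_div] at h
      have : (0:ℝ) ≤ j := Nat.cast_nonneg _
      linarith
    · have h1 : j < ⌈dist (x a) (x v) * N / δ⌉₊ := Nat.lt_ceil.mpr h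
      have h3 : ⌈dist (x a) (x v) * N / δ⌉₊ ≤ j + 1 := Nat.ceil_le.mpr (by push_cast; exact hcon)
      simp only [hf]; omega
  refine ⟨δ, S.filter (fun v => dist (x a) (x v) * N / δ ≤ j), hpos, hdi, ⟨a, ha, b, hb, rfl⟩, Finset.filter_subset _ _, ⟨a, ?_⟩, ⟨b, ?_⟩, ?_⟩
  · rw [Finset.mem_filter]; exact ⟨ha, by rw [dist_self, zero_mul, zero_div]; positivity⟩
  · rw [Finset.mem_sdiff, Finset.mem_filter]
    refine ⟨hb, fun h => ?_⟩
    have h1 := h.2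
    rw [← hδ, mul_div_assoc, mul_comm, div_mul_cancel₀ _ hpos.ne'] at h1
    have : (j:ℝ) < N := by exact_mod_cast hj
    linarith
  · intro v hv w hw
    rw [Finset.mem_filter] at hv
    rw [Finset.mem_sdiff, Finset.mem_filter] at hw
    have hw2 : (j:ℝ) < dist (x a) (x w) * N / δ := by
      by_contra hc; push Not at hc; exact hw.2 ⟨hw.1, hc⟩
    have h1 := key w hw.1 hw2
    have h3 := hv.2
    rw [lt_div_iff₀ hpos] at h1
    rw [div_le_iff₀ hpos] at h3
    have h4 := mul_le_mul_of_nonneg_right (dist_triangle (x a) (x v) (x w)) hN0.le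
    rw [add_mul] at h1 h4
    linarith
end FP
end

section
namespace FP
open MvPolynomial
variable {m n D : ℕ} {ι : Type}

/-- ultrafilter on the naturals -/
abbrev UF : Filter ℕ := ((Filter.hyperfilter ℕ : Ultrafilter ℕ) : Filter ℕ)
/-- hyperreal field -/
abbrev HK : Type := Filter.Germ ((Filter.hyperfilter ℕ : Ultrafilter ℕ) : Filter ℕ) ℝ

/-- the germ of a sequence -/
def gm (f : ℕ → ℝ) : HK := (f : Filter.Germ ((Filter.hyperfilter ℕ : Ultrafilter ℕ) : Filter ℕ) ℝ)

lemma gm_surj (a : HK) : ∃ f, a = gm f := by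
  induction a using Filter.Germ.inductionOn with
  | h f => exact ⟨f, rfl⟩
lemma gm_eq {f g : ℕ → ℝ} : gm f = gm g ↔ ∀ᶠ k in UF, f k = g k := Filter.Germ.coe_eq
lemma gm_le {f g : ℕ → ℝ} : gm f ≤ gm g ↔ ∀ᶠ k in UF, f k ≤ g k := Filter.Germ.coe_le
lemma gm_add (f g : ℕ → ℝ) : gm (fun k => f k + g k) = gm f + gm g := rfl
lemma gm_mul (f g : ℕ → ℝ) : gm (fun k => f k * g k) = gm f * gm g := rfl
lemma gm_sub (f g : ℕ → ℝ) : gm (fun k => f k - g k) = gm f - gm g := rfl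
lemma gm_zero : gm (fun _ => 0) = 0 := rfl
lemma gm_one : gm (fun _ => 1) = 1 := rfl
lemma gm_nat (j : ℕ) : gm (fun _ => (j:ℝ)) = (j : HK) := rfl
lemma gm_abs (f : ℕ → ℝ) : gm (fun k => |f k|) = |gm f| := by
  unfold gm
  rw [Filter.Germ.abs_def]; rfl
lemma gm_sum {κ : Type*} (S : Finset κ) (f : κ → ℕ → ℝ) : gm (fun k => ∑ v ∈ S, f v k) = ∑ v ∈ S, gm (f v) := by
  induction S using Finset.induction_on with
  | empty => simp only [Finset.sum_empty]; exact gm_zero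
  | insert a S ha ih =>
    simp only [Finset.sum_insert ha]
    rw [gm_add, ih]
lemma gm_fin {f : ℕ → ℝ} (h : FinE (gm f)) : ∃ j : ℕ, ∀ᶠ k in UF, |f k| ≤ j := by
  obtain ⟨j, hj⟩ := h
  exact ⟨j, by rw [← gm_abs, ← gm_nat, gm_le] at hj; exact hj⟩

variable [Fintype ι]

/-- multiplier module -/
def Mg (S : Finset ι) (x : ℕ → ι → En n) (ξ : ℕ → ι → Idx m n D → ℝ) (δ : ℕ → ℝ) (s : ι → HK) : Prop :=
  (∀ v, v ∉ S → s v = 0) ∧ ∃ sk : ι → ℕ → ℝ, (∀ v, s v = gm (sk v)) ∧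
    ∃ C : ℝ, ∀ᶠ k in UF, Du S (x k) (ξ k) (δ k) (fun v => sk v k) C
/-- functional module -/
def Lg (S : Finset ι) (x : ℕ → ι → En n) (δ : ℕ → ℝ) (f : Idx m n D → HK) : Prop :=
  ∃ fk : Idx m n D → ℕ → ℝ, (∀ i, f i = gm (fk i)) ∧
    ∃ C : ℝ, ∀ᶠ k in UF, La S (x k) (δ k) (fun i => fk i k) C
/-- total functional -/
def et (ξ : ℕ → ι → Idx m n D → ℝ) : (ι → HK) →ₗ[HK] (Idx m n D → HK) where
  toFun s := fun i => ∑ v, s v * gm (fun k => ξ k v i)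
  map_add' s t := by
    funext i; simp only [Pi.add_apply, add_mul, Finset.sum_add_distrib]
  map_smul' c s := by
    funext i; simp only [Pi.smul_apply, smul_eq_mul, Finset.mul_sum, RingHom.id_apply, mul_assoc]

lemma et_gm (ξ : ℕ → ι → Idx m n D → ℝ) (s : ι → HK) (sk : ι → ℕ → ℝ) (h : ∀ v, s v = gm (sk v)) (i : Idx m n D) :
    et ξ s i = gm (fun k => ∑ v, sk v k * ξ k v i) := by
  rw [gm_sum]
  exact Finset.sum_congr rfl fun v _ => by rw [h v, gm_mul]

lemma Du.congr {S : Finset ι} {x : ι → En n} {ξ : ι → Idx m n D → ℝ} {δ : ℝ} {s t : ι → ℝ} {B : ℝ}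
    (h : Du S x ξ δ s B) (hst : ∀ v ∈ S, s v = t v) : Du S x ξ δ t B := by
  intro P hP
  have e : ∑ v ∈ S, t v * pr (ξ v) (P v) = ∑ v ∈ S, s v * pr (ξ v) (P v) :=
    Finset.sum_congr rfl fun v hv => by rw [hst v hv]
  rw [e]
  exact h P hP
lemma Du.add {S : Finset ι} {x : ι → En n} {ξ : ι → Idx m n D → ℝ} {δ : ℝ} {s t : ι → ℝ} {B C : ℝ}
    (h : Du S x ξ δ s B) (h' : Du S x ξ δ t C) : Du S x ξ δ (fun v => s v + t v) (B + C) := by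
  intro P hP
  have e : ∑ v ∈ S, (s v + t v) * pr (ξ v) (P v) = ∑ v ∈ S, s v * pr (ξ v) (P v) + ∑ v ∈ S, t v * pr (ξ v) (P v) := by
    rw [← Finset.sum_add_distrib]; exact Finset.sum_congr rfl fun v _ => by ring
  rw [e]
  exact (abs_add_le _ _).trans (add_le_add (h P hP) (h' P hP))
lemma Du.smul {S : Finset ι} {x : ι → En n} {ξ : ι → Idx m n D → ℝ} {δ : ℝ} {s : ι → ℝ} {B c j : ℝ}
    (h : Du S x ξ δ s B) (hc : |c| ≤ j) : Du S x ξ δ (fun v => c * s v) (j * B) := by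
  intro P hP
  have e : ∑ v ∈ S, (c * s v) * pr (ξ v) (P v) = c * ∑ v ∈ S, s v * pr (ξ v) (P v) := by
    rw [Finset.mul_sum]; exact Finset.sum_congr rfl fun v _ => by ring
  rw [e, abs_mul]
  exact mul_le_mul hc (h P hP) (abs_nonneg _) ((abs_nonneg _).trans hc)
lemma La.congr {S : Finset ι} {x : ι → En n} {δ : ℝ} {f g : Idx m n D → ℝ} {B : ℝ}
    (h : La S x δ f B) (hst : ∀ i, f i = g i) : La S x δ g B := by
  rwa [← funext hst]

lemma OMod_Mg (S : Finset ι) (x : ℕ → ι → En n) (ξ : ℕ → ι → Idx m n D → ℝ) (δ : ℕ → ℝ) : OMod (K := HK) (Mg S x ξ δ) where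
  zero := ⟨fun _ _ => rfl, fun _ _ => 0, fun _ => gm_zero.symm, 0, Filter.Eventually.of_forall fun k P _ => by simp⟩
  add := by
    rintro s t ⟨h1, sk, h2, C, h3⟩ ⟨g1, tk, g2, C', g3⟩
    refine ⟨fun v hv => by rw [Pi.add_apply, h1 v hv, g1 v hv, add_zero], fun v k => sk v k + tk v k, fun v => ?_, C + C', ?_⟩
    · rw [Pi.add_apply, h2, g2]; rfl
    · filter_upwards [h3, g3] with k a b
      exact a.add b
  smul := by
    rintro c s hc ⟨h1, sk, h2, C, h3⟩
    obtain ⟨ck, rfl⟩ := gm_surj c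
    obtain ⟨j, hj⟩ := gm_fin hc
    refine ⟨fun v hv => by rw [Pi.smul_apply, h1 v hv, smul_zero], fun v k => ck k * sk v k, fun v => ?_, j * C, ?_⟩
    · rw [Pi.smul_apply, h2]; rfl
    · filter_upwards [h3, hj] with k a b
      exact a.smul b

lemma OMod_Lg (S : Finset ι) (x : ℕ → ι → En n) (δ : ℕ → ℝ) : OMod (K := HK) (Lg (m := m) (D := D) S x δ) where
  zero := ⟨fun _ _ => 0, fun _ => gm_zero.symm, 0, Filter.Eventually.of_forall fun k P _ _ => by simp [pr]⟩
  add := by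
    rintro s t ⟨sk, h2, C, h3⟩ ⟨tk, g2, C', g3⟩
    refine ⟨fun v k => sk v k + tk v k, fun v => ?_, C + C', ?_⟩
    · rw [Pi.add_apply, h2, g2]; rfl
    · filter_upwards [h3, g3] with k a b P hP hN
      have e : pr (fun i => sk i k + tk i k) P = pr (fun i => sk i k) P + pr (fun i => tk i k) P := by
        simp only [pr, add_mul, Finset.sum_add_distrib]
      rw [e]
      exact (abs_add_le _ _).trans (add_le_add (a P hP hN) (b P hP hN))
  smul := by
    rintro c s hc ⟨sk, h2, C, h3⟩
    obtain ⟨ck, rfl⟩ := gm_surj c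
    obtain ⟨j, hj⟩ := gm_fin hc
    refine ⟨fun v k => ck k * sk v k, fun v => ?_, j * C, ?_⟩
    · rw [Pi.smul_apply, h2]; rfl
    · filter_upwards [h3, hj] with k a b P hP hN
      have e : pr (fun i => ck k * sk i k) P = ck k * pr (fun i => sk i k) P := by
        simp only [pr, Finset.mul_sum, mul_assoc]
      rw [e, abs_mul]
      exact mul_le_mul b (a P hP hN) (abs_nonneg _) ((abs_nonneg _).trans b)

lemma sum_supp {S : Finset ι} {s : ι → ℝ} (h : ∀ v, v ∉ S → s v = 0) (g : ι → ℝ) : ∑ v, s v * g v = ∑ v ∈ S, s v * g v := by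
  symm
  exact Finset.sum_subset (Finset.subset_univ _) fun v _ hv => by rw [h v hv, zero_mul]

lemma supp_ev {S : Finset ι} {s : ι → HK} {sk : ι → ℕ → ℝ} (h1 : ∀ v, v ∉ S → s v = 0) (h2 : ∀ v, s v = gm (sk v)) :
    ∀ᶠ k in UF, ∀ v, v ∉ S → sk v k = 0 := by
  rw [Filter.eventually_all]
  intro v
  by_cases hv : v ∈ S
  · exact Filter.Eventually.of_forall fun k h => absurd hv h
  · have := h1 v hv
    rw [h2, ← gm_zero, gm_eq] at this
    filter_upwards [this] with k hk _ using hk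

lemma Lg_et {S S1 : Finset ι} {x : ℕ → ι → En n} {ξ : ℕ → ι → Idx m n D → ℝ} {δ : ℕ → ℝ} (hm : 1 ≤ m) (h1 : S1 ⊆ S)
    {s : ι → HK} (h : Mg S1 x ξ δ s) : Lg S x δ (et ξ s) := by
  obtain ⟨h1', sk, h2, C, h3⟩ := h
  refine ⟨fun i k => ∑ v, sk v k * ξ k v i, et_gm ξ s sk h2, C, ?_⟩
  filter_upwards [h3, supp_ev h1' h2] with k a b
  refine (a.toLa hm h1).congr fun i => ?_
  exact (sum_supp (s := fun v => sk v k) b (fun v => ξ k v i)).symm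

lemma Mg_comb {S S1 S2 : Finset ι} {x : ℕ → ι → En n} {ξ : ℕ → ι → Idx m n D → ℝ} {δ δ' : ℕ → ℝ} (hm : 1 ≤ m) (hinj : ∀ k, Function.Injective (x k))
    (hS : S = S1 ∪ S2) (hdis : Disjoint S1 S2) (hne : S.Nonempty) (hdi : ∀ k, ∀ v ∈ S, ∀ w ∈ S, dist (x k v) (x k w) ≤ δ' k)
    (hδ' : ∀ k, 0 < δ' k) (hd : ∀ k, δ' k ≤ δ k) {u v : ι → HK} (hu : Mg S1 x ξ δ' u) (hv : Mg S2 x ξ δ' v)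
    (hL : Lg S x δ (et ξ (u + v))) : Mg S x ξ δ (u + v) := by
  obtain ⟨u1, uk, u2, C1, u3⟩ := hu
  obtain ⟨v1, vk, v2, C2, v3⟩ := hv
  obtain ⟨fk, f1, C3, f2⟩ := hL
  have hr : ∀ w, (u + v) w = gm (fun k => uk w k + vk w k) := fun w => by
    rw [Pi.add_apply, u2, v2]; rfl
  refine ⟨fun w hw => ?_, fun w k => uk w k + vk w k, hr, C1 + C2 + 2 ^ m * C3, ?_⟩
  · rw [hS, Finset.mem_union] at hw
    push Not at hw
    rw [Pi.add_apply, u1 w hw.1, v1 w hw.2, add_zero]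
  · have hf : ∀ᶠ k in UF, ∀ i, fk i k = ∑ w, (uk w k + vk w k) * ξ k w i := by
      rw [Filter.eventually_all]
      intro i
      have := f1 i
      rw [et_gm ξ _ _ hr, gm_eq] at this
      filter_upwards [this] with k hk using hk.symm
    filter_upwards [u3, v3, f2, hf, supp_ev u1 u2, supp_ev v1 v2] with k a b c d e f
    refine Du.comb hm (hinj k) hS hdis hne (hdi k) (hδ' k) (hd k) (a.congr fun w hw => ?_) (b.congr fun w hw => ?_) (c.congr fun i => ?_)
    · rw [f w (Finset.disjoint_left.mp hdis hw), add_zero]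
    · rw [e w (Finset.disjoint_right.mp hdis hw), zero_add]
    · rw [d]
      refine sum_supp (s := fun w => uk w k + vk w k) (fun w hw => ?_) _
      rw [hS, Finset.mem_union] at hw
      push Not at hw
      show uk w k + vk w k = 0
      rw [e w hw.1, f w hw.2, add_zero]

lemma one_gm (S : Finset ι) : ∀ v, (fun y => if y ∈ S then (1:HK) else 0) v = gm ((fun (y:ι) (_:ℕ) => if y ∈ S then (1:ℝ) else 0) v) := by
  intro v
  by_cases h : v ∈ S
  · simp only [if_pos h]; exact gm_one.symm
  · simp only [if_neg h]; exact gm_zero.symm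

lemma Mg_one {S : Finset ι} {x : ℕ → ι → En n} {ξ : ℕ → ι → Idx m n D → ℝ} {δ : ℕ → ℝ} :
    Mg S x ξ δ (fun y => if y ∈ S then 1 else 0) ↔ ∃ C : ℝ, ∀ᶠ k in UF, Du S (x k) (ξ k) (δ k) (fun _ => 1) C := by
  constructor
  · rintro ⟨h1, sk, h2, C, h3⟩
    refine ⟨C, ?_⟩
    have : ∀ᶠ k in UF, ∀ v, v ∈ S → sk v k = 1 := by
      rw [Filter.eventually_all]
      intro v
      have := h2 v
      rw [one_gm S v, gm_eq] at this
      filter_upwards [this] with k hk hv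
      rw [← hk, if_pos hv]
    filter_upwards [h3, this] with k a b
    exact a.congr b
  · rintro ⟨C, h⟩
    refine ⟨fun v hv => if_neg hv, fun y _ => if y ∈ S then 1 else 0, one_gm S, C, ?_⟩
    filter_upwards [h] with k a
    exact a.congr fun v hv => by rw [if_pos hv]

lemma Good_all (hm : 1 ≤ m) (x : ℕ → ι → En n) (hinj : ∀ k, Function.Injective (x k)) (ξ : ℕ → ι → Idx m n D → ℝ) (N : ℕ) :
    ∀ (S : Finset ι) (δ : ℕ → ℝ), S.card ≤ N → S.Nonempty → (∀ k, 0 < δ k) → (∀ k, ∀ v ∈ S, ∀ w ∈ S, dist (x k v) (x k w) ≤ δ k) →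
    Mg S x ξ δ (fun y => if y ∈ S then 1 else 0) → Good (et ξ) S (Mg S x ξ δ) (Lg S x δ) := by
  induction N with
  | zero =>
    intro S δ hN hne
    have := hne.card_pos
    omega
  | succ N ih =>
    intro S δ hN hne hδ hdi hone
    by_cases h1 : S.card ≤ 1
    · obtain ⟨v, rfl⟩ := Finset.card_eq_one.mp (le_antisymm h1 hne.card_pos)
      exact good_leaf (et ξ) v _ (OMod_Mg _ _ _ _).zero _ hone
    have h2 : 2 ≤ S.card := by omega
    choose δ' T hδ' hdi' hatt hTS hTne hTc hsep using fun k => exists_split S (x k) (hinj k) h2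
    have hd : ∀ k, δ' k ≤ δ k := fun k => by
      obtain ⟨v, hv, w, hw, e⟩ := hatt k
      rw [← e]; exact hdi k v hv w hw
    -- the split is eventually constant
    obtain ⟨S1, hS1⟩ : ∃ S1 : Finset ι, ∀ᶠ k in UF, T k = S1 := by
      by_contra hcon
      have : ∀ᶠ k in UF, ∀ S1 : Finset ι, T k ≠ S1 := by
        rw [Filter.eventually_all]
        intro S1
        exact (Ultrafilter.eventually_not).mpr (not_exists.mp hcon S1)
      obtain ⟨k, hk⟩ := this.exists
      exact hk _ rfl
    obtain ⟨k0, hk0⟩ := hS1.exists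
    have hs1 : S1 ⊆ S := hk0 ▸ hTS k0
    have hs1ne : S1.Nonempty := hk0 ▸ hTne k0
    have hs2ne : (S \ S1).Nonempty := hk0 ▸ hTc k0
    have hU : S = S1 ∪ (S \ S1) := (Finset.union_sdiff_of_subset hs1).symm
    have hdis : Disjoint S1 (S \ S1) := Finset.disjoint_sdiff
    have hcd : (S \ S1).card + S1.card = S.card := Finset.card_sdiff_add_card_eq_card hs1
    have c1 := hs1ne.card_pos
    have c2 := hs2ne.card_pos
    have hL : (1:ℝ) ≤ S.card := by exact_mod_cast (show 1 ≤ S.card by omega)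
    obtain ⟨C, hC⟩ := Mg_one.mp hone
    have o1 : Mg S1 x ξ δ' (fun y => if y ∈ S1 then 1 else 0) := by
      refine Mg_one.mpr ⟨(2 * S.card) ^ m * C, ?_⟩
      filter_upwards [hC, hS1] with k a b
      refine Du.split hm hs1 (hdi' k) (hδ' k) (hd k) hL (fun v hv w hw hw1 => ?_) a
      exact hsep k v (by rw [b]; exact hv) w (by rw [b]; exact Finset.mem_sdiff.mpr ⟨hw, hw1⟩)
    have o2 : Mg (S \ S1) x ξ δ' (fun y => if y ∈ S \ S1 then 1 else 0) := by
      refine Mg_one.mpr ⟨(2 * S.card) ^ m * C, ?_⟩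
      filter_upwards [hC, hS1] with k a b
      refine Du.split hm Finset.sdiff_subset (hdi' k) (hδ' k) (hd k) hL (fun v hv w hw hw1 => ?_) a
      rw [dist_comm]
      refine hsep k w ?_ v (by rw [b]; exact hv)
      rw [b]
      by_contra hcon
      exact hw1 (Finset.mem_sdiff.mpr ⟨hw, hcon⟩)
    have lsub : ∀ S' ⊆ S, S'.Nonempty → ∀ f, Lg S x δ' f → Lg (m := m) (D := D) S' x δ' f := by
      rintro S' hS' hne' f ⟨fk, f1, C, f2⟩
      refine ⟨fk, f1, 2 ^ m * C, ?_⟩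
      filter_upwards [f2] with k a
      exact a.sub (hδ' k) hS' hne' (hdi' k)
    have G1 := (ih S1 δ' (by omega) hs1ne hδ' (fun k v hv w hw => hdi' k v (hs1 hv) w (hs1 hw)) o1).anti (lsub S1 hs1 hs1ne)
    have G2 := (ih (S \ S1) δ' (by omega) hs2ne hδ' (fun k v hv w hw => hdi' k v (Finset.sdiff_subset hv) w (Finset.sdiff_subset hw)) o2).anti
      (lsub (S \ S1) Finset.sdiff_subset hs2ne)
    refine node (et ξ) S S1 (S \ S1) hU hdis (Mg S x ξ δ) (Mg S1 x ξ δ') (Mg (S \ S1) x ξ δ') (Lg S x δ) (Lg S x δ')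
      (OMod_Mg _ _ _ _) (OMod_Mg _ _ _ _) (OMod_Lg _ _ _) (OMod_Lg _ _ _) ?_ (fun s hs => Lg_et hm hs1 hs)
      (fun s hs => Lg_et hm Finset.sdiff_subset hs) (fun s hs => hs.1) (fun s hs => hs.1) ?_ hone G1 G2
    · rintro f ⟨fk, f1, C, f2⟩
      refine ⟨fk, f1, C, ?_⟩
      filter_upwards [f2] with k a
      exact a.down (hδ' k) (hd k)
    · intro u v hu hv hl
      exact Mg_comb hm hinj hU hdis hne hdi' hδ' hd hu hv hl

/-- the linear lemma -/
theorem linear_lemma (m n D : ℕ) (hm : 1 ≤ m) (ι : Type) [Fintype ι] (hcard : 2 ^ Fintype.card (Idx m n D) < Fintype.card ι) :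
    ∃ C : ℝ, 0 ≤ C ∧ ∀ (x : ι → En n) (ξ : ι → Idx m n D → ℝ), Function.Injective x → (∀ v w, dist (x v) (x w) ≤ 1) →
      Du Finset.univ x ξ 1 (fun _ => 1) 1 → ∃ (s : ι → ℝ) (b b' : ι), s b = 1 ∧ s b' = 0 ∧ Du Finset.univ x ξ 1 s C := by
  by_contra hcon
  push Not at hcon
  choose x ξ hinj hdi hone hno using fun k : ℕ => hcon k (Nat.cast_nonneg k)
  have hne : (Finset.univ : Finset ι).Nonempty := by
    rw [← Finset.card_pos, Finset.card_univ]; exact lt_of_le_of_lt (Nat.zero_le _) hcard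
  obtain ⟨V, B, s, hB, hBne, hc, hs, hs1, -⟩ := Good_all hm x hinj ξ (Fintype.card ι) Finset.univ (fun _ => 1) le_rfl hne
    (fun _ => one_pos) (fun k v _ w _ => hdi k v w) (Mg_one.mpr ⟨1, Filter.Eventually.of_forall hone⟩)
  have hV : Module.finrank HK V ≤ Fintype.card (Idx m n D) := by
    have := Submodule.finrank_le V
    rwa [Module.finrank_fintype_fun_eq_card] at this
  have hB2 : 1 < B.card := by
    by_contra h
    have h1 : B.card ≤ 1 := by omega
    have h2 : 2 ^ Module.finrank HK V ≤ 2 ^ Fintype.card (Idx m n D) := Nat.pow_le_pow_right (by norm_num) hV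
    have h3 := Nat.mul_le_mul h1 h2
    rw [Finset.card_univ] at hc
    omega
  obtain ⟨b, hb, b', hb', hbb⟩ := Finset.one_lt_card.mp hB2
  obtain ⟨-, sk, h2, C, h3⟩ := hs b hb
  have i1 := hs1 b hb b hb
  have i2 := hs1 b hb b' hb'
  rw [if_pos rfl, h2] at i1
  rw [if_neg hbb, sub_zero, h2] at i2
  have j1 := i1 4
  have j2 := i2 4
  rw [← gm_one, ← gm_sub, ← gm_abs, ← gm_nat, ← gm_mul, gm_le] at j1
  rw [← gm_one, ← gm_abs, ← gm_nat, ← gm_mul, gm_le] at j2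
  have hbig : ∀ᶠ k : ℕ in UF, 2 * (C + 1) ≤ (k:ℝ) := by
    have : ∀ᶠ k : ℕ in Filter.atTop, 2 * (C + 1) ≤ (k:ℝ) := tendsto_natCast_atTop_atTop.eventually_ge_atTop _
    exact Nat.hyperfilter_le_atTop this
  obtain ⟨k, hk1, hk2, hk3, hk4⟩ := (j1.and (j2.and (h3.and hbig))).exists
  push_cast at hk1 hk2
  have a1 : |sk b k - 1| ≤ 1 / 4 := by linarith
  have a2 : |sk b' k| ≤ 1 / 4 := by linarith
  rw [abs_le] at a1 a2
  set d := sk b k - sk b' k with hd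
  have hd2 : 1 / 2 ≤ d := by rw [hd]; linarith
  have hd0 : 0 < d := by linarith
  have hdinv : |d⁻¹| ≤ 2 := by
    rw [abs_of_pos (inv_pos.mpr hd0)]
    rw [inv_le_comm₀ hd0 (by norm_num)]; linarith
  have hD := (hk3.add ((hone k).smul (c := - sk b' k) (j := 1) (by rw [abs_neg, abs_le]; constructor <;> linarith))).smul hdinv
  refine hno k _ b b' ?_ ?_ (fun P hP => (hD P hP).trans ?_)
  · show d⁻¹ * (sk b k + -sk b' k * 1) = 1
    rw [mul_one, ← sub_eq_add_neg]; exact inv_mul_cancel₀ hd0.ne'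
  · simp
  · linarith
end FP
end

section
namespace FP
open MvPolynomial
variable {m n D : ℕ} {ι : Type} [Fintype ι]

lemma Ad_ext (x : ι → En n) (hdi : ∀ v w, dist (x v) (x w) ≤ 1) (hinj : Function.Injective x) {M : ℝ} (hM : 0 < M) (v : ι) (hc : ∃ w, w ≠ v)
    (P : ι → VP n D) (hP : Ad m (Finset.univ.erase v) x 1 M P) :
    ∃ P', Ad m Finset.univ x 1 (2 ^ m * M) P' ∧ ∀ w, w ≠ v → P' w = P w := by
  obtain ⟨w1, hw1⟩ := hc
  obtain ⟨w0, hw0, hmin⟩ := Finset.exists_min_image (Finset.univ.erase v) (fun w => dist (x v) (x w)) ⟨w1, by simp [hw1]⟩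
  have hw0v : w0 ≠ v := Finset.ne_of_mem_erase hw0
  have me : ∀ w, w ≠ v → w ∈ Finset.univ.erase v := fun w hw => Finset.mem_erase.mpr ⟨hw, Finset.mem_univ _⟩
  have h1 : (1:ℝ) ≤ 2 ^ m := one_le_pow₀ (by norm_num)
  have hle : M ≤ 2 ^ m * M := by
    have := mul_le_mul_of_nonneg_right h1 hM.le
    rwa [one_mul] at this
  have key : ∀ w, w ≠ v → NV (x v) (dist (x v) (x w)) (P w0 - P w) ≤ 2 ^ m * M * dist (x v) (x w) ^ m ∧
      NV (x w) (dist (x v) (x w)) (P w - P w0) ≤ 2 ^ m * M * dist (x v) (x w) ^ m := by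
    intro w hw
    set d := dist (x v) (x w) with hd
    have hd0 : 0 < d := dist_pos.mpr (hinj.ne hw.symm)
    by_cases hww : w = w0
    · rw [hww, sub_self, NV_zero, NV_zero]
      exact ⟨by positivity, by positivity⟩
    have hdw : dist (x v) (x w0) ≤ d := hmin w (me w hw)
    have hd2 : dist (x w) (x w0) ≤ 2 * d := by
      have := dist_triangle (x w) (x v) (x w0)
      rw [dist_comm (x w) (x v)] at this
      linarith
    have hj : JetV m (P w - P w0) := (hP.1 w (me w hw)).1.sub (hP.1 w0 hw0).1
    have e : 2 ^ m * M * d ^ m = M * (2 * d) ^ m := by rw [mul_pow]; ring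
    rw [e]
    constructor
    · have a1 := NV_jet_up (t := 2 * d) ((hP.1 w0 hw0).1.sub (hP.1 w (me w hw)).1) (dist_pos.mpr (hinj.ne (Ne.symm hww)))
        (by rw [dist_comm]; exact hd2) (hP.2 w0 hw0 w (me w hw))
      refine le_trans (NV_shift_le hd0.le ?_ _) a1
      rw [dist_comm]; linarith
    · have a1 := NV_jet_up hj (dist_pos.mpr (hinj.ne hww)) hd2 (hP.2 w (me w hw) w0 hw0)
      exact (NV_mono hd0.le (by linarith) _).trans a1
  refine ⟨fun w => if w = v then P w0 else P w, ⟨fun w _ => ?_, fun w _ w' _ => ?_⟩, fun w hw => by simp only [if_neg hw]⟩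
  · by_cases hw : w = v
    · subst hw
      simp only [if_true]
      refine ⟨(hP.1 w0 hw0).1, ?_⟩
      have := NV_jet_shift (hP.1 w0 hw0).1 (l := 2) (x := x w0) (y := x w) (δ := 1) (δ' := 1) zero_le_one (by norm_num) zero_le_one
        (by have := hdi w0 w; linarith)
      refine this.trans ?_
      rw [mul_assoc]
      exact mul_le_mul_of_nonneg_left (hP.1 w0 hw0).2 (by positivity)
    · simp only [if_neg hw]
      refine ⟨(hP.1 w (me w hw)).1, (hP.1 w (me w hw)).2.trans ?_⟩
      rw [one_pow, mul_one, mul_one]; exact hle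
  · by_cases hw : w = v <;> by_cases hw' : w' = v
    · simp only [if_pos hw, if_pos hw', sub_self, NV_zero]; positivity
    · simp only [if_pos hw, if_neg hw']
      rw [hw]; exact (key w' hw').1
    · simp only [if_neg hw, if_pos hw']
      rw [hw', dist_comm]; exact (key w hw).2
    · simp only [if_neg hw, if_neg hw']
      exact (hP.2 w (me w hw) w' (me w' hw')).trans (mul_le_mul_of_nonneg_right hle (by positivity))

lemma cont_NV (y : En n) {δ : ℝ} (hδ : 0 < δ) (L : (ι → Idx m n D → ℝ) →ₗ[ℝ] VP n D) (hL : ∀ c, JetV m (L c)) :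
    Continuous fun c => NV y δ (L c) := by
  have e : (fun c => NV y δ (L c)) = fun c => δ ^ m * ∑ i, |((ch m y δ).comp L) c i| := by
    funext c; rw [NV_eq_ch y hδ (hL c)]; rfl
  rw [e]
  have hc : Continuous ((ch m y δ).comp L) := LinearMap.continuous_of_finiteDimensional _
  refine continuous_const.mul (continuous_finsetSum _ fun i _ => ?_)
  exact ((continuous_apply i).comp hc).abs

lemma lin_expand (f : (ι → Idx m n D → ℝ) →ₗ[ℝ] ℝ) (c : ι → Idx m n D → ℝ) :
    f c = ∑ v, ∑ i, f (Pi.single v (Pi.single i 1)) * c v i := by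
  have e : c = ∑ v, ∑ i, c v i • (Pi.single v (Pi.single i (1:ℝ)) : ι → Idx m n D → ℝ) := by
    funext v i
    simp only [Finset.sum_apply, Pi.smul_apply, smul_eq_mul]
    rw [Finset.sum_eq_single v, Finset.sum_eq_single i]
    · simp
    · intro j _ hj; simp [Pi.single_eq_of_ne (Ne.symm hj)]
    · intro h; exact absurd (Finset.mem_univ _) h
    · intro w _ hw
      refine Finset.sum_eq_zero fun j _ => ?_
      rw [Pi.single_eq_of_ne (Ne.symm hw)]; simp
    · intro h; exact absurd (Finset.mem_univ _) h
  conv_lhs => rw [e]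
  simp only [map_sum, map_smul, smul_eq_mul]
  exact Finset.sum_congr rfl fun v _ => Finset.sum_congr rfl fun i _ => mul_comm _ _

/-- Hahn-Banach separation -/
lemma separate (x : ι → En n) (hinj : Function.Injective x) (hdi : ∀ v w, dist (x v) (x w) ≤ 1) (K : ι → Set (Fin D → ℝ)) (hK : ∀ v, Convex ℝ (K v))
    (ρ : ℝ) (hρ : 0 < ρ) (hno : ¬ ∃ P, Ad m Finset.univ x 1 ρ P ∧ ∀ v, ev (x v) (P v) ∈ K v) :
    ∃ ξ : ι → Idx m n D → ℝ, Du Finset.univ x ξ 1 (fun _ => 1) 1 ∧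
      ∀ Q : ι → VP n D, (∀ v, JetV m (Q v)) → (∀ v, ev (x v) (Q v) ∈ K v) → ρ / 2 ≤ ∑ v, pr (ξ v) (Q v) := by
  set Φ : ι → (ι → Idx m n D → ℝ) →ₗ[ℝ] VP n D := fun v => (mkV m 0 1).comp (LinearMap.proj v) with hΦ
  have hj : ∀ v c, JetV m (Φ v c) := fun v c => jet_mkV _ _ _ _
  have hΦP : ∀ P : ι → VP n D, (∀ v, JetV m (P v)) → ∀ v, Φ v (fun w => ch m 0 1 (P w)) = P v := fun P hP v =>
    mkV_ch 0 one_pos (hP v)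
  set Bo : Set (ι → Idx m n D → ℝ) := {c | (∀ v, NV (x v) 1 (Φ v c) < ρ) ∧
    ∀ v w, v ≠ w → NV (x v) (dist (x v) (x w)) ((Φ v - Φ w) c) < ρ * dist (x v) (x w) ^ m} with hBo
  set A : Set (ι → Idx m n D → ℝ) := {c | ∀ v, ev (x v) (Φ v c) ∈ K v} with hA
  have conv1 : ∀ (y : En n) (δ : ℝ) (hδ : 0 ≤ δ) (L : (ι → Idx m n D → ℝ) →ₗ[ℝ] VP n D) (r : ℝ) (c d : ι → Idx m n D → ℝ) (a b : ℝ),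
      0 ≤ a → 0 ≤ b → a + b = 1 → NV y δ (L c) < r → NV y δ (L d) < r → NV y δ (L (a • c + b • d)) < r := by
    intro y δ hδ L r c d a b ha hb hab h1 h2
    rw [map_add, map_smul, map_smul]
    refine (NV_add_le hδ _ _).trans_lt ?_
    rw [NV_smul, NV_smul, abs_of_nonneg ha, abs_of_nonneg hb]
    have := (convex_Iio r) (Set.mem_Iio.mpr h1) (Set.mem_Iio.mpr h2) ha hb hab
    exact this
  have hBc : Convex ℝ Bo := by
    intro c hc d hd a b ha hb hab
    exact ⟨fun v => conv1 _ _ zero_le_one _ _ c d a b ha hb hab (hc.1 v) (hd.1 v),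
      fun v w hvw => conv1 _ _ dist_nonneg _ _ c d a b ha hb hab (hc.2 v w hvw) (hd.2 v w hvw)⟩
  have hBop : IsOpen Bo := by
    have e : Bo = (⋂ v, {c | NV (x v) 1 (Φ v c) < ρ}) ∩ ⋂ v, ⋂ w, {c | v ≠ w → NV (x v) (dist (x v) (x w)) ((Φ v - Φ w) c) < ρ * dist (x v) (x w) ^ m} := by
      ext c; simp [hBo]
    rw [e]
    refine (isOpen_iInter_of_finite fun v => ?_).inter (isOpen_iInter_of_finite fun v => isOpen_iInter_of_finite fun w => ?_)
    · exact isOpen_lt (cont_NV _ one_pos _ (hj v)) continuous_const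
    · by_cases hvw : v = w
      · simp [hvw]
      · simp only [ne_eq, hvw, not_false_eq_true, true_imp_iff]
        exact isOpen_lt (cont_NV _ (dist_pos.mpr (hinj.ne hvw)) (Φ v - Φ w) (fun c => (hj v c).sub (hj w c))) continuous_const
  have hAc : Convex ℝ A := by
    intro c hc d hd a b ha hb hab v
    rw [map_add, map_smul, map_smul, map_add, map_smul, map_smul]
    exact hK v (hc v) (hd v) ha hb hab
  have hdis : Disjoint Bo A := by
    rw [Set.disjoint_left]
    intro c hc hcA
    refine hno ⟨fun v => Φ v c, ⟨fun v _ => ⟨hj v c, by rw [one_pow, mul_one]; exact (hc.1 v).le⟩, fun v _ w _ => ?_⟩, hcA⟩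
    by_cases hvw : v = w
    · rw [hvw, sub_self, NV_zero]; positivity
    · exact (hc.2 v w hvw).le
  obtain ⟨f, u, hf1, hf2⟩ := geometric_hahn_banach_open hBc hBop hAc hdis
  have h0 : (0 : ι → Idx m n D → ℝ) ∈ Bo := by
    refine ⟨fun v => by rw [map_zero, NV_zero]; exact hρ, fun v w hvw => ?_⟩
    rw [map_zero, NV_zero]
    have := dist_pos.mpr (hinj.ne hvw)
    positivity
  have hu : 0 < u := by have := hf1 _ h0; rwa [map_zero] at this
  have hexp : ∀ P : ι → VP n D, ∑ v, pr (fun i => ρ / (2 * u) * f (Pi.single v (Pi.single i 1))) (P v) = ρ / (2 * u) * f (fun v => ch m 0 1 (P v)) := by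
    intro P
    have := lin_expand f.toLinearMap (fun v => ch m 0 1 (P v))
    simp only [ContinuousLinearMap.coe_coe] at this
    rw [this, Finset.mul_sum]
    refine Finset.sum_congr rfl fun v _ => ?_
    rw [pr, Finset.mul_sum]
    exact Finset.sum_congr rfl fun i _ => by ring
  refine ⟨fun v i => ρ / (2 * u) * f (Pi.single v (Pi.single i 1)), ?_, ?_⟩
  · intro P hP
    have e : ∑ v, (1:ℝ) * pr (fun i => ρ / (2 * u) * f (Pi.single v (Pi.single i 1))) (P v) = ρ / (2 * u) * f (fun v => ch m 0 1 (P v)) := by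
      simp only [one_mul]; exact hexp P
    rw [e]
    have hm1 : ∀ t : ℝ, |t| = ρ / 2 → t * f (fun v => ch m 0 1 (P v)) < u := by
      intro t ht
      rw [← smul_eq_mul, ← map_smul]
      apply hf1
      have hr : ∀ v, Φ v (t • fun v => ch m 0 1 (P v)) = t • P v := fun v => by
        rw [map_smul, hΦP P (fun v => (hP.1 v (Finset.mem_univ _)).1)]
      refine ⟨fun v => ?_, fun v w hvw => ?_⟩
      · rw [hr, NV_smul, ht]
        have h1 := (hP.1 v (Finset.mem_univ _)).2
        rw [one_pow, mul_one] at h1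
        have := mul_le_mul_of_nonneg_left h1 (show 0 ≤ ρ / 2 by linarith)
        linarith
      · rw [LinearMap.sub_apply, hr, hr, ← smul_sub, NV_smul, ht]
        have h1 := hP.2 v (Finset.mem_univ _) w (Finset.mem_univ _)
        have h2 : 0 < dist (x v) (x w) ^ m := pow_pos (dist_pos.mpr (hinj.ne hvw)) _
        have := mul_le_mul_of_nonneg_left h1 (show 0 ≤ ρ / 2 by linarith)
        have h3 : 0 < ρ * dist (x v) (x w) ^ m := mul_pos hρ h2
        have e3 : ρ / 2 * (1 * dist (x v) (x w) ^ m) = (ρ * dist (x v) (x w) ^ m) / 2 := by ring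
        linarith
    have a1 := hm1 (ρ / 2) (abs_of_pos (by linarith))
    have a2 := hm1 (-(ρ / 2)) (by rw [abs_neg, abs_of_pos (by linarith)])
    have e2 : ρ / (2 * u) * f (fun v => ch m 0 1 (P v)) = (ρ / 2 * f (fun v => ch m 0 1 (P v))) / u := by
      field_simp
    rw [e2, abs_div, abs_of_pos hu, div_le_one hu, abs_le]
    constructor <;> linarith
  · intro Q hQ hQK
    rw [hexp Q]
    have h1 := hf2 (fun v => ch m 0 1 (Q v)) (fun v => by rw [hΦP Q hQ]; exact hQK v)
    have h2 := mul_le_mul_of_nonneg_left h1 (show 0 ≤ ρ / (2 * u) by positivity)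
    have e2 : ρ / (2 * u) * u = ρ / 2 := by field_simp
    linarith
end FP
end

section
namespace FP
open MvPolynomial
variable {m n D : ℕ}

theorem sharp_step (m n D : ℕ) (hm : 1 ≤ m) (ι : Type) [Fintype ι] (hcard : 2 ^ Fintype.card (Idx m n D) < Fintype.card ι) :
    ∃ C : ℝ, 1 ≤ C ∧ ∀ (x : ι → En n), Function.Injective x → (∀ v w, dist (x v) (x w) ≤ 1) →
      ∀ K : ι → Set (Fin D → ℝ), (∀ v, Convex ℝ (K v)) → ∀ M : ℝ, 0 < M →
      (∀ v, ∃ P, Ad m (Finset.univ.erase v) x 1 M P ∧ ∀ w, w ≠ v → ev (x w) (P w) ∈ K w) →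
      ∃ P, Ad m Finset.univ x 1 (C * M) P ∧ ∀ v, ev (x v) (P v) ∈ K v := by
  obtain ⟨C, hC, H⟩ := linear_lemma m n D hm ι hcard
  have h2m : (1:ℝ) ≤ 2 ^ m := one_le_pow₀ (by norm_num)
  refine ⟨2 * (2 ^ m * (1 + 2 * C)) + 1, by
    have : 0 ≤ (2:ℝ) ^ m * (1 + 2 * C) := by positivity
    linarith, fun x hinj hdi K hK M hM hP => ?_⟩
  by_contra hno
  set ρ := (2 * (2 ^ m * (1 + 2 * C)) + 1) * M with hρ
  have hρ0 : 0 < ρ := by positivity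
  obtain ⟨ξ, hξ1, hξ2⟩ := separate x hinj hdi K hK ρ hρ0 hno
  obtain ⟨s, b, b', hb, hb', hs⟩ := H x ξ hinj hdi hξ1
  obtain ⟨x1, -, hx1⟩ := Finset.exists_min_image Finset.univ s ⟨b, Finset.mem_univ _⟩
  obtain ⟨x2, -, hx2⟩ := Finset.exists_max_image Finset.univ s ⟨b, Finset.mem_univ _⟩
  have s1 : s x1 ≤ 0 := hb' ▸ hx1 b' (Finset.mem_univ _)
  have s2 : 1 ≤ s x2 := hb ▸ hx2 b (Finset.mem_univ _)
  have hne : x1 ≠ x2 := fun h => by rw [h] at s1; linarith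
  obtain ⟨P1, p1, q1⟩ := hP x1
  obtain ⟨P2, p2, q2⟩ := hP x2
  obtain ⟨R1, r1, t1⟩ := Ad_ext x hdi hinj hM x1 ⟨x2, hne.symm⟩ P1 p1
  obtain ⟨R2, r2, t2⟩ := Ad_ext x hdi hinj hM x2 ⟨x1, hne⟩ P2 p2
  set T := s x2 - s x1 with hT
  have hT1 : 1 ≤ T := by rw [hT]; linarith
  have hT0 : 0 < T := by linarith
  set a : ι → ℝ := fun v => (s v - s x1) / T with ha
  have ha0 : ∀ v, 0 ≤ a v := fun v => div_nonneg (by linarith [hx1 v (Finset.mem_univ _)]) hT0.le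
  have ha1 : ∀ v, a v ≤ 1 := fun v => by
    simp only [ha]; rw [div_le_one hT0, hT]; linarith [hx2 v (Finset.mem_univ _)]
  set Q : ι → VP n D := fun v => a v • R1 v + (1 - a v) • R2 v with hQ
  have hQK : ∀ v, ev (x v) (Q v) ∈ K v := by
    intro v
    by_cases h1 : v = x1
    · have e : a v = 0 := by simp only [ha, h1, sub_self, zero_div]
      have e2 : Q v = R2 v := by simp only [hQ, e, zero_smul, zero_add, sub_zero, one_smul]
      have hv2 : v ≠ x2 := by rw [h1]; exact hne
      rw [e2, t2 v hv2]; exact q2 v hv2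
    by_cases h2 : v = x2
    · have e : a v = 1 := by simp only [ha, h2]; exact div_self hT0.ne'
      have e2 : Q v = R1 v := by simp only [hQ, e, sub_self, zero_smul, add_zero, one_smul]
      rw [e2, t1 v h1]; exact q1 v h1
    · simp only [hQ]
      rw [map_add, map_smul, map_smul, t1 v h1, t2 v h2]
      exact hK v (q1 v h1) (q2 v h2) (ha0 v) (by linarith [ha1 v]) (by ring)
  have hQj : ∀ v, JetV m (Q v) := fun v =>
    ((r1.1 v (Finset.mem_univ _)).1.smul _).add ((r2.1 v (Finset.mem_univ _)).1.smul _)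
  have hlow := hξ2 Q hQj hQK
  have hc0 : 0 < 2 ^ m * M := by positivity
  have b1 := abs_le.mp (hξ1.scale hc0 r1)
  have b2 := abs_le.mp (hξ1.scale hc0 r2)
  have b3 := abs_le.mp (hs.scale hc0 r1)
  have b4 := abs_le.mp (hs.scale hc0 r2)
  simp only [one_mul, mul_one] at b1 b2
  have hsum : T * ∑ v, pr (ξ v) (Q v) = (- s x1) * ∑ v, pr (ξ v) (R1 v) + ∑ v, s v * pr (ξ v) (R1 v)
      + s x2 * ∑ v, pr (ξ v) (R2 v) - ∑ v, s v * pr (ξ v) (R2 v) := by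
    simp only [Finset.mul_sum]
    rw [← Finset.sum_add_distrib, ← Finset.sum_add_distrib, ← Finset.sum_sub_distrib]
    refine Finset.sum_congr rfl fun v _ => ?_
    simp only [hQ, ha]
    rw [pr_add, pr_smul, pr_smul]
    have e1 : T * ((s v - s x1) / T) = s v - s x1 := mul_div_cancel₀ _ hT0.ne'
    calc _ = (T * ((s v - s x1) / T)) * pr (ξ v) (R1 v) + (T - T * ((s v - s x1) / T)) * pr (ξ v) (R2 v) := by ring
      _ = _ := by rw [e1, hT]; ring
  have c1 : (- s x1) * ∑ v, pr (ξ v) (R1 v) ≤ (- s x1) * (2 ^ m * M) := mul_le_mul_of_nonneg_left b1.2 (by linarith)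
  have c2 : s x2 * ∑ v, pr (ξ v) (R2 v) ≤ s x2 * (2 ^ m * M) := mul_le_mul_of_nonneg_left b2.2 (by linarith)
  have c3 : T * ∑ v, pr (ξ v) (Q v) ≤ T * (2 ^ m * M) + 2 * (2 ^ m * M * C) := by
    rw [hsum, hT, sub_mul]; linarith [b3.2, b4.1]
  have c4 : 2 * (2 ^ m * M * C) ≤ T * (2 * (2 ^ m * M * C)) := by
    have : 0 ≤ 2 * (2 ^ m * M * C) := by positivity
    have := mul_le_mul_of_nonneg_right hT1 this
    linarith
  have c5 : T * ∑ v, pr (ξ v) (Q v) ≤ T * (2 ^ m * M + 2 * (2 ^ m * M * C)) := by rw [mul_add]; linarith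
  have c6 := le_of_mul_le_mul_left c5 hT0
  have c7 : ρ / 2 = 2 ^ m * M + 2 * (2 ^ m * M * C) + M / 2 := by rw [hρ]; ring
  linarith

lemma FO.mono_M {K : En n → Set (Fin D → ℝ)} {M M' : ℝ} {T : Finset (En n)} {P : En n → VP n D} (h : FO m K M T P) (hM : M ≤ M') :
    FO m K M' T P :=
  ⟨⟨h.1.1, fun x hx y hy => (h.1.2 x hx y hy).trans (mul_le_mul_of_nonneg_right hM (by positivity))⟩,
    fun z hz => ⟨(h.2 z hz).1.trans hM, (h.2 z hz).2⟩⟩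

theorem sharp_all (m n D : ℕ) (hm : 1 ≤ m) (N : ℕ) : ∃ C : ℝ, 1 ≤ C ∧ ∀ (K : En n → Set (Fin D → ℝ)) (M : ℝ) (E : Finset (En n)), 0 < M →
    (∀ x ∈ E, Convex ℝ (K x)) → (∀ x ∈ E, ∀ y ∈ E, dist x y ≤ 1) →
    (∀ T ⊆ E, T.card ≤ 2 ^ Fintype.card (Idx m n D) → ∃ P, FO m K M T P) →
    ∀ T ⊆ E, T.card ≤ N → ∃ P, FO m K (C * M) T P := by
  induction N with
  | zero =>
    refine ⟨1, le_rfl, fun K M E hM hK hE H T hT hc => ?_⟩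
    rw [one_mul]
    exact H T hT (hc.trans (Nat.zero_le _))
  | succ N ih =>
    obtain ⟨C1, hC1, H1⟩ := ih
    by_cases hN : 2 ^ Fintype.card (Idx m n D) < N + 1
    · obtain ⟨C2, hC2, H2⟩ := sharp_step m n D hm (Fin (N + 1)) (by rwa [Fintype.card_fin])
      refine ⟨C2 * C1, by nlinarith, fun K M E hM hK hE H T hT hc => ?_⟩
      have hC1M : 0 < C1 * M := by positivity
      by_cases hlt : T.card ≤ N
      · obtain ⟨P, hP⟩ := H1 K M E hM hK hE H T hT hlt
        refine ⟨P, hP.mono_M ?_⟩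
        rw [mul_assoc]
        have := mul_le_mul_of_nonneg_right hC2 hC1M.le
        linarith
      have hcard : T.card = N + 1 := by omega
      set e := T.equivFinOfCardEq hcard with he
      set x : Fin (N + 1) → En n := fun v => (e.symm v).1 with hx
      have hxT : ∀ v, x v ∈ T := fun v => (e.symm v).2
      have hinj : Function.Injective x := fun v w h => e.symm.injective (Subtype.ext h)
      obtain ⟨P, hP, hPK⟩ := H2 x hinj (fun v w => hE _ (hT (hxT v)) _ (hT (hxT w))) (fun v => K (x v)) (fun v => hK _ (hT (hxT v)))
        (C1 * M) hC1M (fun v => by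
          obtain ⟨P, hP⟩ := H1 K M E hM hK hE H (T.erase (x v)) ((Finset.erase_subset _ _).trans hT)
            (by rw [Finset.card_erase_of_mem (hxT v)]; omega)
          have hmem : ∀ w, w ≠ v → x w ∈ T.erase (x v) := fun w hw => Finset.mem_erase.mpr ⟨hinj.ne hw, hxT w⟩
          refine ⟨fun w => P (x w), ⟨fun w hw => ⟨?_, ?_⟩, fun w hw w' hw' => ?_⟩, fun w hw => (hP.2 _ (hmem w hw)).2⟩
          · exact hP.1.1 _ (hmem w (by simpa using hw))
          · rw [one_pow, mul_one]; exact (hP.2 _ (hmem w (by simpa using hw))).1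
          · exact hP.1.2 _ (hmem w (by simpa using hw)) _ (hmem w' (by simpa using hw')))
      set G : En n → VP n D := fun z => if h : z ∈ T then P (e ⟨z, h⟩) else 0 with hG
      have hGe : ∀ z (h : z ∈ T), G z = P (e ⟨z, h⟩) := fun z h => by simp only [hG]; rw [dif_pos h]
      have hxe : ∀ z (h : z ∈ T), x (e ⟨z, h⟩) = z := fun z h => by simp only [hx, Equiv.symm_apply_apply]
      refine ⟨G, ⟨fun z hz => ?_, fun z hz w hw => ?_⟩, fun z hz => ⟨?_, ?_⟩⟩
      · have hz' : z ∈ T := hz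
        rw [hGe z hz']; exact (hP.1 _ (Finset.mem_univ _)).1
      · have hz' : z ∈ T := hz
        have hw' : w ∈ T := hw
        have := hP.2 (e ⟨z, hz'⟩) (Finset.mem_univ _) (e ⟨w, hw'⟩) (Finset.mem_univ _)
        rw [hxe, hxe] at this
        rw [hGe z hz', hGe w hw', mul_assoc C2 C1 M]; exact this
      · have := (hP.1 (e ⟨z, hz⟩) (Finset.mem_univ _)).2
        rw [hxe, one_pow, mul_one] at this
        rw [hGe z hz, mul_assoc]; exact this
      · have := hPK (e ⟨z, hz⟩)
        rw [hxe] at this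
        rw [hGe z hz]; exact this
    · refine ⟨1, le_rfl, fun K M E hM hK hE H T hT hc => ?_⟩
      rw [one_mul]
      exact H T hT (by omega)

end FP
end

section
namespace FP
open MvPolynomial
variable {m n D : ℕ}

lemma card_Bm (n m : ℕ) : (Bm (n + 1) m).card = Nat.choose (n + m) (n + 1) := by
  induction m with
  | zero =>
    rw [Nat.choose_eq_zero_of_lt (by omega), Finset.card_eq_zero]
    ext β; simp
  | succ m ih =>
    have e : Bm (n + 1) (m + 1) = Bm (n + 1) m ∪ Finset.finsuppAntidiag Finset.univ m := by
      ext β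
      rw [Finset.mem_union, mem_Bm, mem_Bm, Finset.mem_finsuppAntidiag, Finsupp.degree_eq_sum]
      simp only [Finset.subset_univ, and_true]
      generalize Finset.univ.sum ⇑β = s
      omega
    have hd : Disjoint (Bm (n + 1) m) (Finset.finsuppAntidiag Finset.univ m) := by
      rw [Finset.disjoint_left]
      intro β h1 h2
      rw [mem_Bm, Finsupp.degree_eq_sum] at h1
      rw [Finset.mem_finsuppAntidiag] at h2
      have h3 := h2.1
      change Finset.univ.sum ⇑β < m at h1
      rw [h3] at h1
      exact lt_irrefl _ h1
    rw [e, Finset.card_union_of_disjoint hd, ih, Finset.card_finsuppAntidiag_nat_eq_choose, Finset.card_univ, Fintype.card_fin]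
    have e2 : n + 1 + m - 1 = n + m := by omega
    rw [e2, ← Nat.choose_symm_add (a := n) (b := m), ← add_assoc, Nat.choose_succ_succ' (n + m) n, add_comm]

lemma card_Idx (m n D : ℕ) (hn : 1 ≤ n) : Fintype.card (Idx m n D) = D * Nat.choose (n + m - 1) n := by
  obtain ⟨k, rfl⟩ : ∃ k, n = k + 1 := ⟨n - 1, by omega⟩
  rw [Fintype.card_prod, Fintype.card_coe, Fintype.card_fin, card_Bm, mul_comm]
  congr 2
  omega

theorem finite_case (m n D : ℕ) (hm : 1 ≤ m) (M : ℝ) (hM : 1 ≤ M) : ∃ C : ℝ, 0 ≤ C ∧ ∀ (E : Finset (En n)) (K : En n → Set (Fin D → ℝ)),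
    (∀ x ∈ E, Convex ℝ (K x)) → (∀ T ⊆ E, T.card ≤ 2 ^ Fintype.card (Idx m n D) → ∃ P, FO m K M T P) →
    ∃ G, FO m K C E G := by
  obtain ⟨l, hl⟩ := ML (m := m) (n := n) (D := D) hm ∅ (fun i hi => absurd hi (Finset.notMem_empty _))
  obtain ⟨k, hk⟩ := helly_gam m n D l
  obtain ⟨C1, hC1, H1⟩ := sharp_all m n D hm k
  have hR : 1 ≤ C1 * M := by
    have := mul_le_mul hC1 hM zero_le_one (by linarith)
    linarith
  set R := C1 * M with hRd
  obtain ⟨C2, c, hC2, hc, hc1, H2⟩ := hl R hR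
  have hc3 : 0 < min c (1 / 2) := lt_min hc (by norm_num)
  obtain ⟨C3, hC3, H3⟩ := glue m n D hm (C2 + R) (min c (1 / 2)) (by linarith) hc3 ((min_le_left _ _).trans hc1)
  refine ⟨C3, hC3, fun E K hK H => ?_⟩
  have loc : ∀ a ∈ E, ∃ F : En n → VP n D, Fld m {z | z ∈ E ∧ dist a z < min c (1 / 2) * 1} F (C2 + R) ∧
      ∀ z ∈ E, dist a z < min c (1 / 2) * 1 → ev z (F z) ∈ K z ∧ NV a 1 (F z - 0) ≤ (C2 + R) * 1 ^ m := by
    intro a ha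
    set E0 := E.filter (fun z => dist a z ≤ 1 / 2) with hE0
    have hsub : E0 ⊆ E := Finset.filter_subset _ _
    have haE0 : a ∈ E0 := by rw [hE0, Finset.mem_filter, dist_self]; exact ⟨ha, by norm_num⟩
    have hdiam : ∀ x ∈ E0, ∀ y ∈ E0, dist x y ≤ 1 := by
      intro x hx y hy
      rw [hE0, Finset.mem_filter] at hx hy
      have := dist_triangle_left x y a
      linarith [hx.2, hy.2]
    have hsh := H1 K M E0 (by linarith) (fun x hx => hK x (hsub hx)) hdiam (fun T hT => H T (hT.trans hsub))
    obtain ⟨P0, hP0, hP0N⟩ := hk K R E0 (fun x hx => hK x (hsub hx)) hsh a haE0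
    obtain ⟨F, hF1, hF2⟩ := H2 E0 K (fun x hx => hK x (hsub hx)) a haE0 1 P0 one_pos
      ⟨hP0, fun _ _ => 0, fun α hα => absurd hα (Finset.notMem_empty _)⟩
    have hin : ∀ z ∈ E, dist a z < min c (1 / 2) * 1 → z ∈ E0 ∧ dist a z < c * 1 := by
      intro z hz hd
      rw [mul_one] at hd ⊢
      refine ⟨?_, hd.trans_le (min_le_left _ _)⟩
      rw [hE0, Finset.mem_filter]
      exact ⟨hz, (hd.trans_le (min_le_right _ _)).le⟩
    refine ⟨F, ⟨fun z hz => hF1.1 z (hin z hz.1 hz.2), fun z hz w hw => ?_⟩, fun z hz hd => ?_⟩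
    · refine (hF1.2 z (hin z hz.1 hz.2) w (hin w hw.1 hw.2)).trans ?_
      exact mul_le_mul_of_nonneg_right (by linarith) (by positivity)
    · obtain ⟨z1, z2⟩ := hin z hz hd
      obtain ⟨q1, q2⟩ := hF2 z z1 z2
      refine ⟨q1, ?_⟩
      rw [one_pow, mul_one] at q2 ⊢
      have e : F z - 0 = (F z - P0) + P0 := by abel
      rw [e]
      exact (NV_add_le zero_le_one _ _).trans (add_le_add q2 hP0N)
  have loc' : ∀ a, ∃ F : En n → VP n D, a ∈ E → Fld m {z | z ∈ E ∧ dist a z < min c (1 / 2) * 1} F (C2 + R) ∧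
      ∀ z ∈ E, dist a z < min c (1 / 2) * 1 → ev z (F z) ∈ K z ∧ NV a 1 (F z - 0) ≤ (C2 + R) * 1 ^ m := by
    intro a
    by_cases ha : a ∈ E
    · obtain ⟨F, hF⟩ := loc a ha
      exact ⟨F, fun _ => hF⟩
    · exact ⟨fun _ => 0, fun h => absurd h ha⟩
  choose F hF using loc'
  obtain ⟨G, g1, g2, g3⟩ := H3 E (fun _ => 1) (fun _ => 0) F (fun _ _ => one_pos) (fun x _ y _ => by
      rw [sub_self, abs_zero]; positivity) (fun _ _ => JetV.zero) (fun a ha => (hF a ha).1)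
    (fun a ha z hz hd => ((hF a ha).2 z hz hd).2) (fun x _ y _ => by rw [sub_self, NV_zero]; positivity)
  refine ⟨G, g1, fun z hz => ⟨?_, g3 z hz (K z) (hK z hz) fun a ha hd => ((hF a ha).2 z hz hd).1⟩⟩
  have := g2 z hz
  rwa [sub_zero, one_pow, mul_one] at this

theorem compact_case (m n D : ℕ) (hm : 1 ≤ m) (C : ℝ) (K : En n → Set (Fin D → ℝ)) (hK : ∀ x, IsClosed (K x))
    (H : ∀ T : Finset (En n), ∃ P, FO m K C T P) :
    ∃ P : En n → VP n D, Fld m Set.univ P C ∧ (∀ x, NV x 1 (P x) ≤ C) ∧ ∀ x, ev x (P x) ∈ K x := by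
  set Q : Set (En n → Idx m n D → ℝ) := Set.pi Set.univ fun _ => Set.pi Set.univ fun _ => Set.Icc (-C) C with hQ
  have hQc : IsCompact Q := isCompact_univ_pi fun _ => isCompact_univ_pi fun _ => isCompact_Icc
  set p : (En n → Idx m n D → ℝ) → En n → VP n D := fun c x => mkV m x 1 (c x) with hp
  set Z : Finset (En n) → Set (En n → Idx m n D → ℝ) := fun T => {c | FO m K C T (p c)} with hZ
  have hsum : ∀ c x, NV x 1 (p c x) = ∑ i, |c x i| := fun c x => by
    rw [NV_eq_ch x one_pos (jet_mkV _ _ _ _), ch_mkV m x one_pos, one_pow, one_mul]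
  have hcl : ∀ T, IsClosed (Z T) := by
    intro T
    have e : Z T = (⋂ x ∈ T, ⋂ y ∈ T, {c | NV x (dist x y) (p c x - p c y) ≤ C * dist x y ^ m}) ∩
        ⋂ x ∈ T, ({c | ∑ i, |c x i| ≤ C} ∩ {c | ev x (p c x) ∈ K x}) := by
      ext c
      simp only [hZ, FO, Fld, Set.mem_setOf_eq, Set.mem_inter_iff, Set.mem_iInter, hsum]
      constructor
      · rintro ⟨⟨-, h1⟩, h2⟩
        exact ⟨fun x hx y hy => h1 x hx y hy, h2⟩
      · rintro ⟨h1, h2⟩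
        exact ⟨⟨fun x _ => jet_mkV _ _ _ _, fun x hx y hy => h1 x hx y hy⟩, h2⟩
    rw [e]
    refine IsClosed.inter (isClosed_biInter fun x hx => isClosed_biInter fun y hy => ?_)
      (isClosed_biInter fun x hx => IsClosed.inter ?_ ?_)
    · by_cases hxy : x = y
      · subst hxy
        simp only [sub_self]
        exact isClosed_le continuous_const continuous_const
      · have hd := dist_pos.mpr hxy
        have e2 : (fun c => NV x (dist x y) (p c x - p c y)) = fun c => dist x y ^ m * ∑ i,
            |((ch m x (dist x y)).comp (mkV m x 1)) (c x) i - ((ch m x (dist x y)).comp (mkV m y 1)) (c y) i| := by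
          funext c
          rw [NV_eq_ch x hd ((jet_mkV _ _ _ _).sub (jet_mkV _ _ _ _)), map_sub]
          rfl
        refine isClosed_le ?_ continuous_const
        rw [e2]
        have c1 : Continuous ((ch (D := D) m x (dist x y)).comp (mkV m x 1)) := LinearMap.continuous_of_finiteDimensional _
        have c2 : Continuous ((ch (D := D) m x (dist x y)).comp (mkV m y 1)) := LinearMap.continuous_of_finiteDimensional _
        refine continuous_const.mul (continuous_finsetSum _ fun i _ => ?_)
        exact (((continuous_apply i).comp (c1.comp (continuous_apply x))).sub
          ((continuous_apply i).comp (c2.comp (continuous_apply y)))).abs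
    · refine isClosed_le (continuous_finsetSum _ fun i _ => ?_) continuous_const
      exact ((continuous_apply i).comp (continuous_apply x)).abs
    · have c1 : Continuous ((ev (D := D) x).comp (mkV m x 1)) := LinearMap.continuous_of_finiteDimensional _
      exact (hK x).preimage (c1.comp (continuous_apply x))
  obtain ⟨c, -, hc⟩ := hQc.inter_iInter_nonempty Z hcl fun u => by
    obtain ⟨P, hP⟩ := H (u.sup id)
    have hP' : ∀ x ∈ u.sup id, p (fun x => if x ∈ u.sup id then ch m x 1 (P x) else 0) x = P x := fun x hx => by
      simp only [hp, if_pos hx]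
      exact mkV_ch x one_pos (hP.1.1 x hx)
    refine ⟨fun x => if x ∈ u.sup id then ch m x 1 (P x) else 0, ?_, ?_⟩
    · intro x _ i _
      show (if x ∈ u.sup id then ch m x 1 (P x) else 0) i ∈ Set.Icc (-C) C
      rw [Set.mem_Icc, ← abs_le]
      by_cases hx : x ∈ u.sup id
      · rw [if_pos hx]
        have h1 := (hP.2 x hx).1
        rw [NV_eq_ch x one_pos (hP.1.1 x hx), one_pow, one_mul] at h1
        exact (Finset.single_le_sum (f := fun i => |ch m x 1 (P x) i|) (fun _ _ => abs_nonneg _) (Finset.mem_univ i)).trans h1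
      · rw [if_neg hx, Pi.zero_apply, abs_zero]
        obtain ⟨P', hP'⟩ := H {x}
        have := NV_nonneg (x := x) (δ := 1) zero_le_one (P' x)
        exact this.trans (hP'.2 x (Finset.mem_singleton_self _)).1
    · rw [Set.mem_iInter₂]
      intro T hT
      have hTs : T ⊆ u.sup id := Finset.le_sup (f := id) hT
      refine ⟨⟨fun x hx => jet_mkV _ _ _ _, fun x hx y hy => ?_⟩, fun x hx => ?_⟩
      · rw [hP' x (hTs hx), hP' y (hTs hy)]
        exact hP.1.2 x (hTs hx) y (hTs hy)
      · rw [hP' x (hTs hx)]; exact hP.2 x (hTs hx)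
  rw [Set.mem_iInter] at hc
  have hx1 : ∀ x y : En n, x ∈ ({x, y} : Finset (En n)) := fun x y => by simp
  have hx2 : ∀ x y : En n, y ∈ ({x, y} : Finset (En n)) := fun x y => by simp
  refine ⟨p c, ⟨fun x _ => jet_mkV _ _ _ _, fun x _ y _ => ?_⟩, fun x => ?_, fun x => ?_⟩
  · have h : FO m K C {x, y} (p c) := hc {x, y}
    exact h.1.2 x (hx1 x y) y (hx2 x y)
  · have h : FO m K C {x, x} (p c) := hc {x, x}
    exact (h.2 x (hx1 x x)).1
  · have h : FO m K C {x, x} (p c) := hc {x, x}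
    exact (h.2 x (hx1 x x)).2

theorem main (m n D : ℕ) (hm : 1 ≤ m) (hn : 1 ≤ n) :
    ∃ Csharp : ℝ, 0 < Csharp ∧
      ∀ E : Set (En n), ∀ K : En n → Set (Fin D → ℝ),
        (∀ x ∈ E, Convex ℝ (K x) ∧ IsClosed (K x)) →
        (∀ S : Finset (En n), ↑S ⊆ E → S.card ≤ 2 ^ (D * Nat.choose (n + m - 1) n) →
          ∃ F : En n → Fin D → ℝ, ContDiff ℝ (m - 1 : ℕ) F ∧ Cm11LE m F 1 ∧
            ∀ x ∈ S, F x ∈ K x) →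
        ∃ F : En n → Fin D → ℝ, ContDiff ℝ (m - 1 : ℕ) F ∧ Cm11LE m F Csharp ∧
          ∀ x ∈ E, F x ∈ K x := by
  obtain ⟨C1, hC1, H1⟩ := fun_to_field m n D hm
  obtain ⟨C2, hC2, H2⟩ := finite_case m n D hm C1 hC1
  obtain ⟨C3, hC3, H3⟩ := field_to_fun m n D hm
  refine ⟨C3 * (C2 + 1), by positivity, fun E K hK H => ?_⟩
  set K' : En n → Set (Fin D → ℝ) := fun x => if x ∈ E then K x else Set.univ with hK'
  have hKin : ∀ x ∈ E, K' x = K x := fun x hx => by simp only [hK', if_pos hx]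
  have hKout : ∀ x, x ∉ E → K' x = Set.univ := fun x hx => by simp only [hK', if_neg hx]
  have hconv : ∀ x, Convex ℝ (K' x) := fun x => by
    by_cases hx : x ∈ E
    · rw [hKin x hx]; exact (hK x hx).1
    · rw [hKout x hx]; exact convex_univ
  have hclo : ∀ x, IsClosed (K' x) := fun x => by
    by_cases hx : x ∈ E
    · rw [hKin x hx]; exact (hK x hx).2
    · rw [hKout x hx]; exact isClosed_univ
  have hfin : ∀ T : Finset (En n), ∃ P, FO m K' (C2 + 1) T P := by
    intro T
    obtain ⟨G, hG⟩ := H2 T K' (fun x _ => hconv x) (fun S _ hS => by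
      rw [card_Idx m n D hn] at hS
      obtain ⟨F, f1, f2, f3⟩ := H (S.filter (· ∈ E)) (by intro x hx; simp at hx; exact hx.2)
        ((Finset.card_filter_le _ _).trans hS)
      obtain ⟨P, p1, p2, p3⟩ := H1 F 1 zero_le_one f1 f2
      rw [mul_one] at p1 p2
      refine ⟨P, p1.mono_set (Set.subset_univ _), fun z hz => ⟨p2 z, ?_⟩⟩
      rw [p3]
      by_cases hzE : z ∈ E
      · rw [hKin z hzE]; exact f3 z (Finset.mem_filter.mpr ⟨hz, hzE⟩)
      · rw [hKout z hzE]; trivial)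
    exact ⟨G, hG.mono_M (by linarith)⟩
  obtain ⟨P, p1, p2, p3⟩ := compact_case m n D hm (C2 + 1) K' hclo hfin
  obtain ⟨q1, q2⟩ := H3 P (C2 + 1) (by linarith) p1 p2
  exact ⟨fun x => ev x (P x), q1, q2, fun x hx => by
    have := p3 x
    rwa [hKin x hx] at this⟩
end FP
end

/-- **Finiteness principle for `C^{m-1,1}` selection** with finiteness number
`k♯ = 2^(D·binom(n+m-1,n))`, for arbitrary sets `E` and closed convex sets `K x`. -/
theorem cm11_selection_finiteness_principle
    (m n D : ℕ) (hm : 1 ≤ m) (hn : 1 ≤ n) (hD : 1 ≤ D) :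
    ∃ Csharp : ℝ, 0 < Csharp ∧
      ∀ E : Set (En n), ∀ K : En n → Set (Fin D → ℝ),
        (∀ x ∈ E, Convex ℝ (K x) ∧ IsClosed (K x)) →
        (∀ S : Finset (En n), ↑S ⊆ E → S.card ≤ 2 ^ (D * Nat.choose (n + m - 1) n) →
          ∃ F : En n → Fin D → ℝ, ContDiff ℝ (m - 1 : ℕ) F ∧ Cm11LE m F 1 ∧
            ∀ x ∈ S, F x ∈ K x) →
        ∃ F : En n → Fin D → ℝ, ContDiff ℝ (m - 1 : ℕ) F ∧ Cm11LE m F Csharp ∧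
          ∀ x ∈ E, F x ∈ K x := by
  exact FP.main m n D hm hn
end
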